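/- Let p ≥ 5 be a prime number and let m be a positive integer all of whose prime divisors are primes ≥ 5, with gcd(p, m) = 1. Then the set {n ∈ ℕ : B_{p,m}(n) ≡ 0 (mod p)} has arithmetic density 1; that is, lim_{X→∞} #{n ≤ X : p divides B_{p,m}(n)} / X = 1. -/

import Mathlib

/-- The number of `t`-regular partitions of `n`, i.e. partitions of `n`
none of whose parts is divisible by `t`. -/
noncomputable def regularPartitionCount (t n : ℕ) : ℕ :=
  Nat.card {π : n.Partition // ∀ x ∈ π.parts, ¬ t ∣ x}

/-- `B u v n` is the number of `(u,v)`-regular bipartitions of `n`: pairs `(α, β)` of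
partitions with `|α| + |β| = n`, `α` being `u`-regular and `β` being `v`-regular. -/
noncomputable def B (u v n : ℕ) : ℕ :=
  ∑ i ∈ Finset.range (n + 1), regularPartitionCount u i * regularPartitionCount v (n - i)

section

open NumberField Filter Topology IsDedekindDomain

section IdealZeta
variable (K : Type*) [Field K] [NumberField K]

/-- The Dedekind zeta function at a real argument, as a sum over nonzero ideals. -/
noncomputable def realZeta (s : ℝ) : ℝ :=
  ∑' I : {I : Ideal (𝓞 K) // I ≠ ⊥}, (Ideal.absNorm I.1 : ℝ) ^ (-s)

theorem LSeriesSummable_idealCount {s : ℝ} (hs : 1 < s) :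
    LSeriesSummable (fun n ↦ ((Nat.card {I : Ideal (𝓞 K) // Ideal.absNorm I = n} : ℕ) : ℂ)) s := by
  refine LSeriesSummable_of_sum_norm_bigO_and_nonneg
    (f := fun n ↦ ((Nat.card {I : Ideal (𝓞 K) // Ideal.absNorm I = n} : ℕ) : ℝ)) (r := 1)
    ?_ (fun _ ↦ Nat.cast_nonneg _) zero_le_one (by simpa using hs)
  have h := ((Ideal.tendsto_norm_le_div_atTop₀ K).comp tendsto_natCast_atTop_atTop).isBigO_one ℝ
  have h2 : (fun n : ℕ ↦ ∑ k ∈ Finset.Icc 1 n,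
      ((Nat.card {I : Ideal (𝓞 K) // Ideal.absNorm I = k} : ℕ) : ℝ))
      =ᶠ[atTop] fun n : ℕ ↦ ((fun s : ℝ ↦ (Nat.card {I : nonZeroDivisors (Ideal (𝓞 K)) //
        (Ideal.absNorm (I : Ideal (𝓞 K)) : ℝ) ≤ s} : ℝ) / s) ∘ Nat.cast) n * (n : ℝ) ^ (1 : ℝ) := by
    filter_upwards [eventually_gt_atTop 0] with n hn
    have hn' : (n : ℝ) ≠ 0 := by positivity
    simp only [Function.comp_apply, Real.rpow_one]
    rw [div_mul_cancel₀ _ hn']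
    simp only [Nat.cast_le, ← Nat.cast_sum]
    congr 1
    rw [← add_left_inj 1, ← Ideal.card_norm_le_eq_card_norm_le_add_one,
      show Finset.Icc 1 n = Finset.Ioc 0 n from Finset.Icc_succ_left_eq_Ioc _ _,
      show 1 = Nat.card {I : Ideal (𝓞 K) // Ideal.absNorm I = 0} by
        simp [Ideal.absNorm_eq_zero_iff],
      Finset.sum_Ioc_add_eq_sum_Icc (n.zero_le),
      ← Finset.card_preimage_eq_sum_card_image_eq (fun k _ ↦ Ideal.finite_setOfPred_absNorm_eq k)]
    simp [Set.coe_eq_subtype]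
  refine Asymptotics.IsBigO.congr' ?_ h2.symm EventuallyEq.rfl
  simpa using h.mul (Asymptotics.isBigO_refl (fun n : ℕ ↦ (n : ℝ) ^ (1 : ℝ)) atTop)

theorem hasSum_realZeta {s : ℝ} (hs : 1 < s) :
    HasSum (fun I : {I : Ideal (𝓞 K) // I ≠ ⊥} ↦ (Ideal.absNorm I.1 : ℝ) ^ (-s))
      (dedekindZeta K s).re := by
  set f : {I : Ideal (𝓞 K) // I ≠ ⊥} → ℝ := fun I ↦ (Ideal.absNorm I.1 : ℝ) ^ (-s) with hf
  let π : {I : Ideal (𝓞 K) // I ≠ ⊥} → ℕ := fun I ↦ Ideal.absNorm I.1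
  have hfin (n : ℕ) : Finite {I : {I : Ideal (𝓞 K) // I ≠ ⊥} // π I = n} := by
    have := (Ideal.finite_setOfPred_absNorm_eq (S := 𝓞 K) n).to_subtype
    exact Finite.of_injective
      (fun I ↦ (⟨I.1.1, I.2⟩ : {I : Ideal (𝓞 K) | Ideal.absNorm I = n}))
      (fun I J h ↦ Subtype.ext (Subtype.ext (by simpa using h)))
  have hterm (n : ℕ) :
      LSeries.term (fun n ↦ ((Nat.card {I : Ideal (𝓞 K) // Ideal.absNorm I = n} : ℕ) : ℂ)) s n
      = ((∑' I : {I : {I : Ideal (𝓞 K) // I ≠ ⊥} // π I = n}, f I.1 : ℝ) : ℂ) := by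
    rcases eq_or_ne n 0 with rfl | hn
    · rw [LSeries.term_zero]
      have : IsEmpty {I : {I : Ideal (𝓞 K) // I ≠ ⊥} // π I = 0} :=
        ⟨fun I ↦ I.1.2 (Ideal.absNorm_eq_zero_iff.mp I.2)⟩
      simp
    · rw [LSeries.term_of_ne_zero hn]
      have h1 : ∀ I : {I : {I : Ideal (𝓞 K) // I ≠ ⊥} // π I = n}, f I.1 = (n : ℝ) ^ (-s) := by
        intro I
        simp only [hf]
        congr 2
        exact I.2
      rw [tsum_congr h1, tsum_const, nsmul_eq_mul]
      have h2 : Nat.card {I : Ideal (𝓞 K) // Ideal.absNorm I = n}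
          = Nat.card {I : {I : Ideal (𝓞 K) // I ≠ ⊥} // π I = n} := by
        refine Nat.card_congr ⟨fun I ↦ ⟨⟨I.1, ?_⟩, I.2⟩, fun I ↦ ⟨I.1.1, I.2⟩, fun _ ↦ rfl,
          fun _ ↦ rfl⟩
        intro h
        apply hn
        rw [← I.2, h, Ideal.absNorm_bot]
      rw [h2]
      push_cast
      rw [Complex.ofReal_cpow (by positivity), div_eq_mul_inv, Complex.ofReal_neg, Complex.cpow_neg]
      simp
  have hL := LSeriesSummable_idealCount K hs
  have hL' : Summable fun n ↦ ∑' I : {I : {I : Ideal (𝓞 K) // I ≠ ⊥} // π I = n}, f I.1 := by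
    have : Summable fun n ↦
        ((∑' I : {I : {I : Ideal (𝓞 K) // I ≠ ⊥} // π I = n}, f I.1 : ℝ) : ℂ) := by
      simp only [← hterm]
      exact hL
    exact_mod_cast this
  have hsig : Summable fun x : Σ n, {I : {I : Ideal (𝓞 K) // I ≠ ⊥} // π I = n} ↦ f x.2.1 := by
    rw [summable_sigma_of_nonneg (fun _ ↦ by positivity)]
    exact ⟨fun n ↦ Summable.of_finite, hL'⟩
  have hsum : Summable f := (Equiv.sigmaFiberEquiv π).summable_iff.mp hsig
  have hval : ∑' I, f I = ∑' n, ∑' I : {I : {I : Ideal (𝓞 K) // I ≠ ⊥} // π I = n}, f I.1 := by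
    rw [← (Equiv.sigmaFiberEquiv π).tsum_eq f]
    exact hsig.tsum_sigma
  have h3 : dedekindZeta K s = ((∑' I, f I : ℝ) : ℂ) := by
    rw [hval, dedekindZeta, LSeries, Complex.ofReal_tsum]
    exact tsum_congr hterm
  rw [h3, Complex.ofReal_re]
  exact hsum.hasSum

theorem summable_realZeta {s : ℝ} (hs : 1 < s) :
    Summable (fun I : {I : Ideal (𝓞 K) // I ≠ ⊥} ↦ (Ideal.absNorm I.1 : ℝ) ^ (-s)) :=
  (hasSum_realZeta K hs).summable

theorem tendsto_sub_one_mul_realZeta :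
    Tendsto (fun s : ℝ ↦ (s - 1) * realZeta K s) (𝓝[>] 1) (𝓝 (dedekindZeta_residue K)) := by
  have h := (Complex.continuous_re.tendsto _).comp (tendsto_sub_one_mul_dedekindZeta_nhdsGT K)
  refine (h.congr' ?_)
  filter_upwards [self_mem_nhdsWithin] with s hs
  rw [realZeta, (hasSum_realZeta K hs).tsum_eq]
  simp only [Function.comp_apply]
  rw [show ((s : ℂ) - 1) = ((s - 1 : ℝ) : ℂ) by push_cast; ring, Complex.re_ofReal_mul]

end IdealZeta

end

section

open NumberField Filter Topology IsDedekindDomain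

section Euler
variable (K : Type*) [Field K] [NumberField K]

theorem exists_squarefree_mul_sq (I : Ideal (𝓞 K)) (hI : I ≠ ⊥) :
    ∃ (T : Finset (HeightOneSpectrum (𝓞 K))) (M : Ideal (𝓞 K)), M ≠ ⊥ ∧
      I = (∏ P ∈ T, P.asIdeal) * M ^ 2 := by
  classical
  induction I using UniqueFactorizationMonoid.induction_on_prime with
  | h₁ => exact absurd rfl hI
  | h₂ I hu => exact ⟨∅, ⊤, top_ne_bot, by
      rw [Ideal.isUnit_iff.mp hu]; simp [← Ideal.one_eq_top]⟩
  | h₃ I P hI0 hP ih =>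
    obtain ⟨T, M, hM, rfl⟩ := ih hI0
    let Q : HeightOneSpectrum (𝓞 K) := ⟨P, Ideal.isPrime_of_prime hP, hP.ne_zero⟩
    by_cases hQ : Q ∈ T
    · refine ⟨T.erase Q, P * M, mul_ne_zero hP.ne_zero hM, ?_⟩
      rw [← Finset.mul_prod_erase T _ hQ]
      change P * (P * _ * _) = _
      ring
    · refine ⟨insert Q T, M, hM, ?_⟩
      rw [Finset.prod_insert hQ]
      change _ = P * _ * _
      ring

theorem realZeta_nonneg (s : ℝ) : 0 ≤ realZeta K s := tsum_nonneg fun _ ↦ by positivity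

theorem summable_primes {s : ℝ} (hs : 1 < s) :
    Summable fun P : HeightOneSpectrum (𝓞 K) ↦ (Ideal.absNorm P.asIdeal : ℝ) ^ (-s) := by
  have hi : Function.Injective (fun P : HeightOneSpectrum (𝓞 K) ↦
      (⟨P.asIdeal, P.ne_bot⟩ : {I : Ideal (𝓞 K) // I ≠ ⊥})) := by
    intro P Q h
    rw [Subtype.mk.injEq] at h
    exact HeightOneSpectrum.ext h
  have := (summable_realZeta K hs).comp_injective hi
  simp only [Function.comp_def] at this
  exact this

theorem realZeta_le {s : ℝ} (hs : 1 < s) :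
    realZeta K s ≤ Real.exp (∑' P : HeightOneSpectrum (𝓞 K), (Ideal.absNorm P.asIdeal : ℝ) ^ (-s))
      * realZeta K (2 * s) := by
  classical
  choose T M hM hI using fun I : {I : Ideal (𝓞 K) // I ≠ ⊥} ↦ exists_squarefree_mul_sq K I.1 I.2
  let x : HeightOneSpectrum (𝓞 K) → ℝ := fun P ↦ (Ideal.absNorm P.asIdeal : ℝ) ^ (-s)
  let i : {I : Ideal (𝓞 K) // I ≠ ⊥} →
      Finset (HeightOneSpectrum (𝓞 K)) × {I : Ideal (𝓞 K) // I ≠ ⊥} := fun I ↦ (T I, ⟨M I, hM I⟩)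
  have hi : Function.Injective i := by
    intro I J h
    simp only [i, Prod.mk.injEq, Subtype.mk.injEq] at h
    exact Subtype.ext (by rw [hI I, hI J, h.1, h.2])
  have hx0 : ∀ P, 0 ≤ x P := fun P ↦ by positivity
  have hxs : Summable x := summable_primes K hs
  have hT := summable_finsetProd_of_summable_nonneg hx0 hxs
  have hZ := summable_realZeta K (s := 2 * s) (by linarith)
  have hprod := hT.mul_of_nonneg hZ (fun t ↦ Finset.prod_nonneg fun i _ ↦ hx0 i)
    (fun _ ↦ by positivity)
  have hterm : ∀ I : {I : Ideal (𝓞 K) // I ≠ ⊥}, (Ideal.absNorm I.1 : ℝ) ^ (-s) =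
      (∏ P ∈ (i I).1, x P) * (Ideal.absNorm (i I).2.1 : ℝ) ^ (-(2 * s)) := by
    intro I
    conv_lhs => rw [hI I]
    simp only [i, x, map_mul, map_prod, map_pow, Nat.cast_mul, Nat.cast_prod, Nat.cast_pow]
    rw [Real.mul_rpow (by positivity) (by positivity),
      Real.finsetProd_rpow _ _ (fun _ _ ↦ by positivity)]
    congr 1
    rw [← Real.rpow_natCast, ← Real.rpow_mul (by positivity)]
    congr 1
    push_cast
    ring
  calc realZeta K s = ∑' I, ((∏ P ∈ (i I).1, x P) * (Ideal.absNorm (i I).2.1 : ℝ) ^ (-(2 * s))) :=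
        tsum_congr hterm
    _ ≤ ∑' y : Finset (HeightOneSpectrum (𝓞 K)) × {I : Ideal (𝓞 K) // I ≠ ⊥},
          (∏ P ∈ y.1, x P) * (Ideal.absNorm y.2.1 : ℝ) ^ (-(2 * s)) := by
        refine Summable.tsum_le_tsum_of_inj i hi ?_ (fun _ ↦ le_rfl) (hprod.comp_injective hi) hprod
        intro c _
        exact mul_nonneg (Finset.prod_nonneg fun i _ ↦ hx0 i) (by positivity)
    _ = (∑' t : Finset (HeightOneSpectrum (𝓞 K)), ∏ P ∈ t, x P) * realZeta K (2 * s) := by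
        rw [realZeta, hT.tsum_mul_tsum hZ hprod]
    _ ≤ _ := by
        refine mul_le_mul_of_nonneg_right ?_ (realZeta_nonneg K _)
        refine Real.tsum_le_of_sum_le (fun t ↦ Finset.prod_nonneg fun i _ ↦ hx0 i) fun S ↦ ?_
        calc ∑ s ∈ S, ∏ i ∈ s, x i
            ≤ ∑ s ∈ (S.biUnion id).powerset, ∏ i ∈ s, x i :=
              Finset.sum_le_sum_of_subset_of_nonneg (fun s hs ↦ Finset.mem_powerset.mpr
                (Finset.subset_biUnion_of_mem id hs))
                (fun s _ _ ↦ Finset.prod_nonneg fun i _ ↦ hx0 i)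
          _ = ∏ i ∈ S.biUnion id, (1 + x i) := (Finset.prod_one_add _).symm
          _ ≤ Real.exp (∑ i ∈ S.biUnion id, x i) := Real.prod_one_add_le_exp_sum _ hx0
          _ ≤ Real.exp (∑' i, x i) :=
              Real.exp_le_exp.mpr (hxs.sum_le_tsum _ fun _ _ ↦ hx0 _)

theorem prod_one_add_le_realZeta {s : ℝ} (hs : 1 < s) (S : Finset (HeightOneSpectrum (𝓞 K))) :
    ∏ P ∈ S, (1 + (Ideal.absNorm P.asIdeal : ℝ) ^ (-s)) ≤ realZeta K s := by
  classical
  rw [Finset.prod_one_add]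
  let i : S.powerset → {I : Ideal (𝓞 K) // I ≠ ⊥} := fun T ↦
    ⟨∏ P ∈ T.1, P.asIdeal, Finset.prod_ne_zero_iff.mpr fun P _ ↦ P.ne_bot⟩
  have key : ∀ T U : Finset (HeightOneSpectrum (𝓞 K)),
      ∏ P ∈ T, P.asIdeal = ∏ P ∈ U, P.asIdeal → T ⊆ U := by
    intro T U h P hP
    have h1 : P.asIdeal ∣ ∏ Q ∈ U, Q.asIdeal := h ▸ Finset.dvd_prod_of_mem _ hP
    obtain ⟨Q, hQ, hd⟩ := (Prime.dvd_finsetProd_iff P.prime _).mp h1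
    have : P = Q := HeightOneSpectrum.ext (by
      rw [Ideal.dvd_iff_le] at hd
      exact (Q.isMaximal.eq_of_le P.isPrime.ne_top hd).symm)
    exact this ▸ hQ
  have hi : Function.Injective i := by
    intro T U h
    have h' : ∏ P ∈ T.1, P.asIdeal = ∏ P ∈ U.1, P.asIdeal := by simpa [i] using h
    exact Subtype.ext ((key _ _ h').antisymm (key _ _ h'.symm))
  rw [← Finset.sum_coe_sort, ← tsum_fintype (L := .unconditional _)]
  refine Summable.tsum_le_tsum_of_inj i hi (fun _ _ ↦ by positivity) (fun T ↦ ?_) Summable.of_finite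
    (summable_realZeta K hs)
  simp only [i, map_prod, Nat.cast_prod]
  rw [Real.finsetProd_rpow _ _ (fun _ _ ↦ by positivity)]

/-- The rational prime below a prime ideal. -/
noncomputable def primeBelow (P : HeightOneSpectrum (𝓞 K)) : ℕ :=
  Ideal.absNorm (P.asIdeal.under ℤ)

omit [NumberField K] in
theorem primeBelow_prime (P : HeightOneSpectrum (𝓞 K)) : (primeBelow K P).Prime := by
  have := P.isPrime
  have : NeZero P.asIdeal := ⟨P.ne_bot⟩
  exact Nat.absNorm_under_prime _

theorem absNorm_eq_primeBelow_pow (P : HeightOneSpectrum (𝓞 K)) :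
    ∃ f, f ≠ 0 ∧ Ideal.absNorm P.asIdeal = primeBelow K P ^ f := by
  have h1 := primeBelow_prime K P
  have h2 : primeBelow K P ∣ Ideal.absNorm P.asIdeal := by
    exact Int.absNorm_under_dvd_absNorm _
  have hlo : P.asIdeal.LiesOver (Ideal.span {(primeBelow K P : ℤ)}) := by
    constructor
    exact Int.ideal_span_absNorm_eq_self _
  refine ⟨_, ?_, Ideal.absNorm_eq_pow_inertiaDeg (p := (primeBelow K P : ℤ)) P.asIdeal
    (Nat.prime_iff_prime_int.mp h1)⟩
  intro h0
  have := Ideal.absNorm_eq_pow_inertiaDeg (p := (primeBelow K P : ℤ)) P.asIdeal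
    (Nat.prime_iff_prime_int.mp h1)
  rw [h0, pow_zero] at this
  rw [this] at h2
  exact h1.one_lt.ne' (Nat.dvd_one.mp h2)

theorem card_primeBelow_le (ℓ : ℕ) (S : Finset (HeightOneSpectrum (𝓞 K)))
    (hS : ∀ P ∈ S, primeBelow K P = ℓ) : S.card ≤ Module.finrank ℚ K := by
  classical
  rcases S.eq_empty_or_nonempty with rfl | ⟨P0, hP0⟩
  · simp
  have hℓ : ℓ.Prime := hS P0 hP0 ▸ primeBelow_prime K P0
  have hdvd : ∏ P ∈ S, P.asIdeal ∣ Ideal.span {(ℓ : 𝓞 K)} := by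
    refine Finset.prod_dvd_of_coprime (fun P _ Q _ hPQ ↦ ?_) fun P hP ↦ ?_
    · simp only [Function.onFun]
      rw [Ideal.isCoprime_iff_sup_eq]
      exact P.isMaximal.coprime_of_ne Q.isMaximal fun h ↦ hPQ (HeightOneSpectrum.ext h)
    · rw [Ideal.dvd_iff_le, Ideal.span_singleton_le_iff_mem, ← Int.cast_natCast,
        Int.cast_mem_ideal_iff]
      rw [← hS P hP]
      rfl
  have h1 := map_dvd Ideal.absNorm hdvd
  rw [map_prod, Ideal.absNorm_span_natCast, RingOfIntegers.rank] at h1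
  have h3 : ℓ ^ S.card ≤ ∏ P ∈ S, Ideal.absNorm P.asIdeal := by
    rw [← Finset.prod_const]
    refine Finset.prod_le_prod' fun P hP ↦ ?_
    obtain ⟨f, hf, h⟩ := absNorm_eq_primeBelow_pow K P
    rw [h, hS P hP]
    exact Nat.le_self_pow hf _
  exact (Nat.pow_le_pow_iff_right hℓ.one_lt).mp
    (h3.trans (Nat.le_of_dvd (pow_pos hℓ.pos _) h1))
end Euler

end

section

open NumberField Filter Topology IsDedekindDomain QuadraticAlgebra

section GaussExt
variable (K : Type*) [Field K] [NumberField K]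

/-- The extension `K(i)`. -/
abbrev GaussExt := QuadraticAlgebra K (-1) 0

variable [Fact (∀ r : K, r ^ 2 ≠ -1 + 0 * r)]

instance : CharZero (GaussExt K) :=
    charZero_of_injective_algebraMap (algebraMap K (GaussExt K)).injective

instance : NumberField (GaussExt K) where
  to_finiteDimensional := Module.Finite.trans K _

variable {K}

omit [NumberField K] [Fact (∀ (r : K), r ^ 2 ≠ -1 + 0 * r)] in
theorem coe_two_ringOfIntegers : ((2 : 𝓞 K) : K) = 2 := map_ofNat (algebraMap (𝓞 K) K) 2

theorem exists_two_mul_re (a : 𝓞 (GaussExt K)) : ∃ r : 𝓞 K, (r : K) = 2 * (a : GaussExt K).re := by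
  have h1 : IsIntegral ℤ (a : GaussExt K) := a.2
  have h2 : IsIntegral ℤ (star (a : GaussExt K)) :=
    h1.map (starRingEnd (GaussExt K)).toIntAlgHom
  have h3 := h1.add h2
  have h4 : (a : GaussExt K) + star (a : GaussExt K) =
      algebraMap K (GaussExt K) (2 * (a : GaussExt K).re) := by
    ext <;> simp [two_mul]
  rw [h4, isIntegral_algebraMap_iff (algebraMap K (GaussExt K)).injective] at h3
  exact ⟨⟨_, h3⟩, rfl⟩

/-- The element `i` in the ring of integers. -/
noncomputable def gaussI : 𝓞 (GaussExt K) :=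
  ⟨⟨0, 1⟩, by
    refine ⟨Polynomial.X ^ 2 + 1, by monicity!, ?_⟩
    simp only [Polynomial.eval₂_add, Polynomial.eval₂_pow, Polynomial.eval₂_X, Polynomial.eval₂_one]
    ext <;> simp [sq]⟩

theorem exists_two_mul_im (a : 𝓞 (GaussExt K)) : ∃ r : 𝓞 K, (r : K) = 2 * (a : GaussExt K).im := by
  obtain ⟨r, hr⟩ := exists_two_mul_re (gaussI * a)
  refine ⟨-r, ?_⟩
  rw [show ((-r : 𝓞 K) : K) = -(r : K) from rfl, hr]
  have : ((gaussI * a : 𝓞 (GaussExt K)) : GaussExt K).re = - (a : GaussExt K).im := by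
    change ((⟨0, 1⟩ : GaussExt K) * (a : GaussExt K)).re = _
    simp
  rw [this]; ring

noncomputable def reTwo (a : 𝓞 (GaussExt K)) : 𝓞 K := (exists_two_mul_re a).choose
noncomputable def imTwo (a : 𝓞 (GaussExt K)) : 𝓞 K := (exists_two_mul_im a).choose
theorem reTwo_spec (a : 𝓞 (GaussExt K)) : (reTwo a : K) = 2 * (a : GaussExt K).re :=
  (exists_two_mul_re a).choose_spec
theorem imTwo_spec (a : 𝓞 (GaussExt K)) : (imTwo a : K) = 2 * (a : GaussExt K).im :=
  (exists_two_mul_im a).choose_spec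

theorem reTwo_mul (a b : 𝓞 (GaussExt K)) :
    2 * reTwo (a * b) = reTwo a * reTwo b - imTwo a * imTwo b := by
  apply RingOfIntegers.ext
  simp only [map_mul, map_sub, reTwo_spec, imTwo_spec, QuadraticAlgebra.re_mul, map_ofNat]
  ring

theorem imTwo_mul (a b : 𝓞 (GaussExt K)) :
    2 * imTwo (a * b) = reTwo a * imTwo b + imTwo a * reTwo b := by
  apply RingOfIntegers.ext
  simp only [map_mul, map_add, reTwo_spec, imTwo_spec, QuadraticAlgebra.im_mul, map_ofNat]
  ring

/-- The homomorphism `u + iv ↦ χ(u) + jχ(v)`. -/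
noncomputable def gaussHom {F : Type*} [Field F] (χ : 𝓞 K →+* F) (j : F) (hj : j * j = -1)
    (h2 : (2 : F) ≠ 0) : 𝓞 (GaussExt K) →+* F where
  toFun a := (χ (reTwo a) + j * χ (imTwo a)) / 2
  map_one' := by
    have h1 : reTwo (1 : 𝓞 (GaussExt K)) = 2 := by
      apply RingOfIntegers.ext; simp [reTwo_spec, coe_two_ringOfIntegers]
    have h3 : imTwo (1 : 𝓞 (GaussExt K)) = 0 := by
      apply RingOfIntegers.ext; simp [imTwo_spec]
    rw [h1, h3]; simp only [map_ofNat, map_zero]; field_simp; ring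
  map_mul' a b := by
    have h1 := congrArg χ (reTwo_mul a b)
    have h3 := congrArg χ (imTwo_mul a b)
    simp only [map_mul, map_sub, map_add, map_ofNat] at h1 h3
    field_simp
    linear_combination 1 * h1 + j * h3 - χ (imTwo a) * χ (imTwo b) * hj
  map_zero' := by
    have h1 : reTwo (0 : 𝓞 (GaussExt K)) = 0 := by
      apply RingOfIntegers.ext; simp [reTwo_spec]
    have h3 : imTwo (0 : 𝓞 (GaussExt K)) = 0 := by
      apply RingOfIntegers.ext; simp [imTwo_spec]
    rw [h1, h3]; simp
  map_add' a b := by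
    have h1 : reTwo (a + b) = reTwo a + reTwo b := by
      apply RingOfIntegers.ext; simp [reTwo_spec]; ring
    have h3 : imTwo (a + b) = imTwo a + imTwo b := by
      apply RingOfIntegers.ext; simp [imTwo_spec]; ring
    rw [h1, h3]; simp only [map_add]; ring

theorem gaussHom_algebraMap {F : Type*} [Field F] (χ : 𝓞 K →+* F) (j : F) (hj : j * j = -1)
    (h2 : (2 : F) ≠ 0) (c : 𝓞 K) :
    gaussHom χ j hj h2 (algebraMap (𝓞 K) (𝓞 (GaussExt K)) c) = χ c := by
  have h0 : ((algebraMap (𝓞 K) (𝓞 (GaussExt K)) c : 𝓞 (GaussExt K)) : GaussExt K)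
      = algebraMap K (GaussExt K) c := rfl
  have h1 : reTwo (algebraMap (𝓞 K) (𝓞 (GaussExt K)) c) = 2 * c := by
    apply RingOfIntegers.ext; simp [reTwo_spec, h0, coe_two_ringOfIntegers]
  have h3 : imTwo (algebraMap (𝓞 K) (𝓞 (GaussExt K)) c) = 0 := by
    apply RingOfIntegers.ext; simp [imTwo_spec, h0]
  simp only [gaussHom, RingHom.coe_mk, MonoidHom.coe_mk, OneHom.coe_mk, h1, h3]
  simp only [map_mul, map_ofNat, map_zero]
  field_simp
  ring

theorem gaussHom_I {F : Type*} [Field F] (χ : 𝓞 K →+* F) (j : F) (hj : j * j = -1)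
    (h2 : (2 : F) ≠ 0) : gaussHom χ j hj h2 gaussI = j := by
  have h0 : ((gaussI : 𝓞 (GaussExt K)) : GaussExt K) = ⟨0, 1⟩ := rfl
  have h1 : reTwo (gaussI : 𝓞 (GaussExt K)) = 0 := by
    apply RingOfIntegers.ext; simp [reTwo_spec, h0]
  have h3 : imTwo (gaussI : 𝓞 (GaussExt K)) = 2 := by
    apply RingOfIntegers.ext; simp [imTwo_spec, h0, coe_two_ringOfIntegers]
  simp only [gaussHom, RingHom.coe_mk, MonoidHom.coe_mk, OneHom.coe_mk, h1, h3]
  simp only [map_ofNat, map_zero]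
  field_simp
  ring

/-- A surjection from the ring of integers to a finite field gives a prime. -/
theorem exists_prime_of_hom (L : Type*) [Field L] [NumberField L] {F : Type*} [Field F] [Finite F]
    (ψ : 𝓞 L →+* F) (hψ : Function.Surjective ψ) :
    ∃ Q : HeightOneSpectrum (𝓞 L), Q.asIdeal = RingHom.ker ψ ∧ Ideal.absNorm Q.asIdeal =
      Nat.card F := by
  have h : Ideal.absNorm (RingHom.ker ψ) = Nat.card F := by
    rw [Ideal.absNorm_apply, Submodule.cardQuot_apply]
    exact Nat.card_congr (RingHom.quotientKerEquivOfSurjective hψ).toEquiv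
  refine ⟨⟨RingHom.ker ψ, RingHom.ker_isPrime ψ, ?_⟩, rfl, h⟩
  intro h0
  rw [h0, Ideal.absNorm_bot] at h
  exact Nat.card_pos.ne h

theorem exists_two_primes_of_hom {F : Type*} [Field F] [Finite F] (h4 : Nat.card F % 4 = 1)
    (χ : 𝓞 K →+* F) (hχ : Function.Surjective χ) :
    ∃ Q : Bool → HeightOneSpectrum (𝓞 (GaussExt K)), Function.Injective Q ∧
      ∀ b, Ideal.absNorm (Q b).asIdeal = Nat.card F ∧
        (Q b).asIdeal.comap (algebraMap (𝓞 K) (𝓞 (GaussExt K))) = RingHom.ker χ := by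
  classical
  let : Fintype F := Fintype.ofFinite _
  rw [Nat.card_eq_fintype_card] at h4 ⊢
  obtain ⟨j, hj⟩ := (FiniteField.isSquare_neg_one_iff (F := F)).mpr (by omega)
  have h2 : (2 : F) ≠ 0 := by
    apply Ring.two_ne_zero
    intro h
    have := (FiniteField.even_card_iff_char_two (F := F)).mp h
    omega
  let e : Bool → F := fun b ↦ if b then j else -j
  have he : ∀ b, e b * e b = -1 := by
    intro b; cases b <;> simp [e, hj]
  have hj0 : j ≠ 0 := by
    rintro rfl; simp at hj
  let ψ : Bool → (𝓞 (GaussExt K) →+* F) := fun b ↦ gaussHom χ (e b) (he b) h2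
  have hψ : ∀ b, Function.Surjective (ψ b) := by
    intro b y
    obtain ⟨c, rfl⟩ := hχ y
    exact ⟨algebraMap _ _ c, gaussHom_algebraMap χ _ _ _ c⟩
  choose Q hQ hQn using fun b ↦ exists_prime_of_hom (GaussExt K) (ψ b) (hψ b)
  refine ⟨Q, ?_, fun b ↦ ⟨(hQn b).trans Nat.card_eq_fintype_card, ?_⟩⟩
  · have key : Q true ≠ Q false := by
      intro h
      obtain ⟨c, hc⟩ := hχ j
      have h1 : gaussI - algebraMap (𝓞 K) (𝓞 (GaussExt K)) c ∈ (Q true).asIdeal := by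
        rw [hQ, RingHom.mem_ker, map_sub]
        simp only [ψ, gaussHom_I, gaussHom_algebraMap, e, hc]
        simp
      rw [h, hQ, RingHom.mem_ker, map_sub] at h1
      simp only [ψ, gaussHom_I, gaussHom_algebraMap, e, hc] at h1
      have : (2 : F) * j = 0 := by
        have : -j - j = 0 := by simpa using h1
        linear_combination -this
      exact (mul_ne_zero h2 hj0) this
    intro b c h
    cases b <;> cases c <;> first | rfl | exact absurd h key | exact absurd h.symm key
  · ext c
    rw [Ideal.mem_comap, hQ, RingHom.mem_ker, RingHom.mem_ker]
    simp only [ψ, gaussHom_algebraMap]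

theorem exists_two_primes_above (P : HeightOneSpectrum (𝓞 K))
    (h4 : Ideal.absNorm P.asIdeal % 4 = 1) :
    ∃ Q : Bool → HeightOneSpectrum (𝓞 (GaussExt K)), Function.Injective Q ∧
      ∀ b, Ideal.absNorm (Q b).asIdeal = Ideal.absNorm P.asIdeal ∧
        (Q b).asIdeal.comap (algebraMap (𝓞 K) (𝓞 (GaussExt K))) = P.asIdeal := by
  have := P.isMaximal
  let := Ideal.Quotient.field P.asIdeal
  have hcard : Nat.card (𝓞 K ⧸ P.asIdeal) = Ideal.absNorm P.asIdeal := by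
    rw [Ideal.absNorm_apply, Submodule.cardQuot_apply]
  have hfin : Finite (𝓞 K ⧸ P.asIdeal) := by
    apply Nat.finite_of_card_ne_zero; omega
  obtain ⟨Q, h1, h2⟩ := exists_two_primes_of_hom (K := K) (F := 𝓞 K ⧸ P.asIdeal) (by omega)
    (Ideal.Quotient.mk P.asIdeal) Ideal.Quotient.mk_surjective
  refine ⟨Q, h1, fun b ↦ ⟨(h2 b).1.trans hcard, (h2 b).2.trans Ideal.mk_ker⟩⟩

end GaussExt

end

section

open NumberField Filter Topology IsDedekindDomain QuadraticAlgebra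

section DegreeOne
variable (K : Type*) [Field K] [NumberField K]

theorem summable_comp_of_card_fiber_le {X : Type*} (π : X → ℕ) (d : ℕ)
    (hπ : ∀ (ℓ : ℕ) (S : Finset X), (∀ P ∈ S, π P = ℓ) → S.card ≤ d) (g : ℕ → ℝ)
    (hg0 : ∀ n, 0 ≤ g n) (hg : Summable g) : Summable (g ∘ π) := by
  classical
  refine summable_of_sum_le (c := d * ∑' n, g n) (fun x ↦ hg0 _) fun S ↦ ?_
  simp only [Function.comp_apply]
  rw [← Finset.sum_fiberwise_of_maps_to (t := S.image π) (g := π)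
    (fun x hx ↦ Finset.mem_image_of_mem _ hx)]
  calc _ ≤ ∑ n ∈ S.image π, d * g n := by
        refine Finset.sum_le_sum fun n _ ↦ ?_
        rw [Finset.sum_congr rfl (g := fun _ ↦ g n) (by
          intro x hx; rw [(Finset.mem_filter.mp hx).2]), Finset.sum_const, nsmul_eq_mul]
        refine mul_le_mul_of_nonneg_right ?_ (hg0 n)
        exact_mod_cast hπ n _ fun P hP ↦ (Finset.mem_filter.mp hP).2
    _ ≤ _ := by
        rw [← Finset.mul_sum]
        exact mul_le_mul_of_nonneg_left (hg.sum_le_tsum _ fun _ _ ↦ hg0 _) (by positivity)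

theorem one_le_absNorm {I : Ideal (𝓞 K)} (hI : I ≠ ⊥) : (1 : ℝ) ≤ Ideal.absNorm I := by
  have : Ideal.absNorm I ≠ 0 := fun h ↦ hI (Ideal.absNorm_eq_zero_iff.mp h)
  exact_mod_cast Nat.one_le_iff_ne_zero.mpr this

theorem summable_primes_ne_one_mod_four
    (h : Summable fun ℓ : {ℓ : ℕ // ℓ.Prime ∧ ℓ % 4 = 3 ∧
      ∃ P : HeightOneSpectrum (𝓞 K), Ideal.absNorm P.asIdeal = ℓ} ↦ (1 / (ℓ : ℕ) : ℝ)) :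
    Summable fun P : {P : HeightOneSpectrum (𝓞 K) // Ideal.absNorm P.asIdeal % 4 ≠ 1} ↦
      (Ideal.absNorm P.1.asIdeal : ℝ)⁻¹ := by
  classical
  set U : Set ℕ := {ℓ : ℕ | ℓ.Prime ∧ ℓ % 4 = 3 ∧
      ∃ P : HeightOneSpectrum (𝓞 K), Ideal.absNorm P.asIdeal = ℓ} with hU
  let g : ℕ → ℝ := fun n ↦ U.indicator (fun n : ℕ ↦ (1 / n : ℝ)) n + 1 / (n : ℝ) ^ 2
    + ({2} : Set ℕ).indicator (fun n : ℕ ↦ (1 / n : ℝ)) n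
  have hg : Summable g := by
    refine (Summable.add ?_ ?_).add ?_
    · exact (summable_subtype_iff_indicator (s := U) (f := fun n : ℕ ↦ (1 / n : ℝ))).mp h
    · exact Real.summable_one_div_nat_pow.mpr (by norm_num)
    · refine summable_of_hasFiniteSupport ((Set.finite_singleton 2).subset ?_)
      exact Set.support_indicator_subset
  have i1 : ∀ (V : Set ℕ) n, 0 ≤ V.indicator (fun n : ℕ ↦ (1 / n : ℝ)) n := fun V n ↦
    Set.indicator_nonneg (fun _ _ ↦ by positivity) _
  have hg0 : ∀ n, 0 ≤ g n := fun n ↦ by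
    have := i1 U n; have := i1 {2} n; positivity
  have h1 := (summable_comp_of_card_fiber_le (primeBelow K) _ (card_primeBelow_le K) g hg0 hg)
  refine Summable.of_nonneg_of_le (fun _ ↦ by positivity) ?_ (h1.subtype _)
  rintro ⟨P, hP⟩
  simp only [Function.comp_apply, g]
  obtain ⟨f, hf0, hf⟩ := absNorm_eq_primeBelow_pow K P
  set ℓ := primeBelow K P with hℓ
  have hpr : ℓ.Prime := primeBelow_prime K P
  have := i1 U ℓ; have := i1 {2} ℓ
  rcases eq_or_ne f 1 with rfl | hf1
  · rw [pow_one] at hf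
    rcases hpr.eq_two_or_odd with h2 | h2
    · have : ({2} : Set ℕ).indicator (fun n : ℕ ↦ (1 / n : ℝ)) ℓ = 1 / ℓ := by
        rw [Set.indicator_of_mem]; exact h2
      rw [this, hf, ← one_div]
      have : (0 : ℝ) ≤ 1 / (ℓ : ℝ) ^ 2 := by positivity
      linarith
    · have : U.indicator (fun n : ℕ ↦ (1 / n : ℝ)) ℓ = 1 / ℓ := by
        rw [Set.indicator_of_mem]; exact ⟨hpr, by omega, P, hf⟩
      rw [this, hf, ← one_div]
      have : (0 : ℝ) ≤ 1 / (ℓ : ℝ) ^ 2 := by positivity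
      linarith
  · have h3 : (Ideal.absNorm P.asIdeal : ℝ)⁻¹ ≤ 1 / (ℓ : ℝ) ^ 2 := by
      rw [hf, one_div]
      have hl : (1 : ℝ) ≤ ℓ := by exact_mod_cast hpr.one_lt.le
      push_cast
      apply inv_anti₀ (by positivity)
      exact pow_le_pow_right₀ hl (by omega)
    linarith

theorem exp_sub_sq_le {x : ℝ} (hx : 0 ≤ x) : Real.exp (x - x ^ 2) ≤ 1 + x := by
  have h := Real.add_one_le_exp (-(x - x ^ 2))
  have h2 : Real.exp (x - x ^ 2) * Real.exp (-(x - x ^ 2)) = 1 := by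
    rw [← Real.exp_add]; simp
  have h0 := Real.exp_pos (x - x ^ 2)
  have h3 : 0 ≤ x ^ 3 := by positivity
  have h4 : Real.exp (x - x ^ 2) * (-(x - x ^ 2) + 1) ≤ 1 := by
    exact (mul_le_mul_of_nonneg_left h h0.le).trans_eq h2
  have h5 : 0 < -(x - x ^ 2) + 1 := by nlinarith
  by_contra! hcon
  nlinarith

theorem exp_two_mul_tsum_le [Fact (∀ r : K, r ^ 2 ≠ -1 + 0 * r)] {s : ℝ} (hs : 1 < s) :
    Real.exp (2 * ∑' P : {P : HeightOneSpectrum (𝓞 K) // Ideal.absNorm P.asIdeal % 4 = 1},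
      (Ideal.absNorm P.1.asIdeal : ℝ) ^ (-s)) ≤
    Real.exp (2 * ∑' P : HeightOneSpectrum (𝓞 K), (Ideal.absNorm P.asIdeal : ℝ) ^ (-(2 : ℝ))) *
      realZeta (GaussExt K) s := by
  classical
  set x : HeightOneSpectrum (𝓞 K) → ℝ := fun P ↦ (Ideal.absNorm P.asIdeal : ℝ) ^ (-s) with hx
  set C := ∑' P : HeightOneSpectrum (𝓞 K), (Ideal.absNorm P.asIdeal : ℝ) ^ (-(2 : ℝ)) with hC
  set Z := realZeta (GaussExt K) s
  have hx0 : ∀ P, 0 ≤ x P := fun P ↦ by positivity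
  have hfin : ∀ S : Finset {P : HeightOneSpectrum (𝓞 K) // Ideal.absNorm P.asIdeal % 4 = 1},
      Real.exp (2 * ∑ P ∈ S, x P.1) ≤ Real.exp (2 * C) * Z := by
    intro S
    choose Q hQi hQ using fun P : {P : HeightOneSpectrum (𝓞 K) // Ideal.absNorm P.asIdeal % 4 = 1} ↦
      exists_two_primes_above P.1 P.2
    let T := (S ×ˢ (Finset.univ : Finset Bool)).image fun y ↦ Q y.1 y.2
    have hinj : Function.Injective
        fun y : {P : HeightOneSpectrum (𝓞 K) // Ideal.absNorm P.asIdeal % 4 = 1} × Bool ↦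
            Q y.1 y.2 := by
      rintro ⟨P, b⟩ ⟨P', b'⟩ h
      simp only at h
      have h1 := (hQ P b).2
      rw [h, (hQ P' b').2] at h1
      have : P' = P := Subtype.ext (HeightOneSpectrum.ext h1)
      subst this
      exact Prod.ext rfl (hQi _ h)
    have h1 := prod_one_add_le_realZeta (GaussExt K) hs T
    rw [Finset.prod_image hinj.injOn, Finset.prod_product] at h1
    have h2 : ∏ P ∈ S, Real.exp (x P.1 - x P.1 ^ 2) ^ 2 ≤ Z := by
      refine le_trans (Finset.prod_le_prod (fun _ _ ↦ by positivity) fun P hP ↦ ?_) h1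
      simp only [(hQ P _).1, Fintype.prod_bool, ← sq]
      exact pow_le_pow_left₀ (by positivity) (exp_sub_sq_le (hx0 _)) 2
    have h3 : ∏ P ∈ S, Real.exp (x P.1 - x P.1 ^ 2) ^ 2
        = Real.exp (2 * ∑ P ∈ S, x P.1) * Real.exp (-(2 * ∑ P ∈ S, x P.1 ^ 2)) := by
      rw [Finset.prod_pow, ← Real.exp_sum, ← Real.exp_add, ← Real.exp_nat_mul,
          Finset.sum_sub_distrib]
      congr 1; push_cast; ring
    have h4 : ∑ P ∈ S, x P.1 ^ 2 ≤ C := by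
      have hle : ∀ P : HeightOneSpectrum (𝓞 K), x P ^ 2 ≤
          (Ideal.absNorm P.asIdeal : ℝ) ^ (-(2 : ℝ)) := by
        intro P
        have h1 : (1 : ℝ) ≤ Ideal.absNorm P.asIdeal := one_le_absNorm K P.ne_bot
        simp only [hx]
        rw [← Real.rpow_natCast, ← Real.rpow_mul (by positivity)]
        apply Real.rpow_le_rpow_of_exponent_le h1
        push_cast; linarith
      calc ∑ P ∈ S, x P.1 ^ 2 ≤ ∑ P ∈ S, (Ideal.absNorm P.1.asIdeal : ℝ) ^ (-(2 : ℝ)) :=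
            Finset.sum_le_sum fun P _ ↦ hle _
        _ ≤ ∑' P : {P : HeightOneSpectrum (𝓞 K) // Ideal.absNorm P.asIdeal % 4 = 1},
              (Ideal.absNorm P.1.asIdeal : ℝ) ^ (-(2 : ℝ)) :=
            ((summable_primes K one_lt_two).subtype _).sum_le_tsum _ fun _ _ ↦ by positivity
        _ ≤ C := (summable_primes K one_lt_two).tsum_subtype_le _ _ fun _ ↦ by positivity
    rw [h3, Real.exp_neg, ← div_eq_mul_inv, div_le_iff₀ (Real.exp_pos _)] at h2
    have h5 : Real.exp (2 * ∑ P ∈ S, x P.1 ^ 2) ≤ Real.exp (2 * C) :=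
      Real.exp_le_exp.mpr (by linarith)
    rw [mul_comm (Real.exp (2 * C))]
    exact h2.trans (mul_le_mul_of_nonneg_left h5 (realZeta_nonneg _ _))
  have hpos : 0 < Real.exp (2 * C) * Z := lt_of_lt_of_le (Real.exp_pos _) (hfin ∅)
  rw [← Real.le_log_iff_exp_le hpos]
  have : ∑' P : {P : HeightOneSpectrum (𝓞 K) // Ideal.absNorm P.asIdeal % 4 = 1}, x P.1
      ≤ Real.log (Real.exp (2 * C) * Z) / 2 := by
    refine Summable.tsum_le_of_sum_le ((summable_primes K hs).subtype _) fun S ↦ ?_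
    have := (Real.le_log_iff_exp_le hpos).mpr (hfin S)
    linarith
  linarith

theorem not_summable_degree_one_three_mod_four (hK : ∀ r : K, r ^ 2 ≠ -1) :
    ¬ Summable fun ℓ : {ℓ : ℕ // ℓ.Prime ∧ ℓ % 4 = 3 ∧
      ∃ P : HeightOneSpectrum (𝓞 K), Ideal.absNorm P.asIdeal = ℓ} ↦ (1 / (ℓ : ℕ) : ℝ) := by
  classical
  intro hsum
  have : Fact (∀ r : K, r ^ 2 ≠ -1 + 0 * r) := ⟨fun r ↦ by simpa using hK r⟩
  have hB := summable_primes_ne_one_mod_four K hsum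
  set C1 := ∑' P : {P : HeightOneSpectrum (𝓞 K) // Ideal.absNorm P.asIdeal % 4 ≠ 1},
      (Ideal.absNorm P.1.asIdeal : ℝ)⁻¹ with hC1
  set C2 := ∑' P : HeightOneSpectrum (𝓞 K), (Ideal.absNorm P.asIdeal : ℝ) ^ (-(2 : ℝ))
  have key : ∀ s : ℝ, 1 < s → realZeta K s ^ 2 ≤
      (Real.exp (2 * C1) * realZeta K 2 ^ 2 * Real.exp (2 * C2)) * realZeta (GaussExt K) s := by
    intro s hs
    have h1 := realZeta_le K hs
    have h2 := exp_two_mul_tsum_le K hs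
    have h3 : realZeta K (2 * s) ≤ realZeta K 2 := by
      refine Summable.tsum_le_tsum (fun I ↦ ?_) (summable_realZeta K (by linarith))
        (summable_realZeta K one_lt_two)
      exact Real.rpow_le_rpow_of_exponent_le (one_le_absNorm K I.2) (by linarith)
    have h4 := (summable_primes K hs).tsum_subtype_add_tsum_subtype_compl
      {P | Ideal.absNorm P.asIdeal % 4 = 1}
    have h5 : ∑' P : ({P : HeightOneSpectrum (𝓞 K) | Ideal.absNorm P.asIdeal % 4 = 1}ᶜ : Set _),
        (Ideal.absNorm P.1.asIdeal : ℝ) ^ (-s) ≤ C1 := by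
      refine Summable.tsum_le_tsum (fun P ↦ ?_) ((summable_primes K hs).subtype _) hB
      rw [← Real.rpow_neg_one]
      exact Real.rpow_le_rpow_of_exponent_le (one_le_absNorm K P.1.ne_bot) (by linarith)
    set a := ∑' P : {P : HeightOneSpectrum (𝓞 K) // Ideal.absNorm P.asIdeal % 4 = 1},
      (Ideal.absNorm P.1.asIdeal : ℝ) ^ (-s) with ha
    have h6 : realZeta K s ≤ Real.exp (a + C1) * realZeta K 2 := by
      refine h1.trans (mul_le_mul (Real.exp_le_exp.mpr ?_) h3 (realZeta_nonneg _ _)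
        (Real.exp_pos _).le)
      rw [← h4]
      exact add_le_add le_rfl h5
    calc realZeta K s ^ 2 ≤ (Real.exp (a + C1) * realZeta K 2) ^ 2 :=
          pow_le_pow_left₀ (realZeta_nonneg _ _) h6 2
      _ = (Real.exp (2 * C1) * realZeta K 2 ^ 2) * Real.exp (2 * a) := by
          rw [mul_pow, ← Real.exp_nat_mul, show ((2 : ℕ) : ℝ) * (a + C1) = 2 * C1 + 2 * a by
            push_cast; ring, Real.exp_add]; ring
      _ ≤ (Real.exp (2 * C1) * realZeta K 2 ^ 2) * (Real.exp (2 * C2) * realZeta (GaussExt K) s) :=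
          mul_le_mul_of_nonneg_left h2 (by positivity)
      _ = _ := by ring
  set C := Real.exp (2 * C1) * realZeta K 2 ^ 2 * Real.exp (2 * C2)
  have t1 := (tendsto_sub_one_mul_realZeta K).pow 2
  have t0 : Tendsto (fun s : ℝ ↦ s - 1) (𝓝[>] 1) (𝓝 0) := by
    have : Tendsto (fun s : ℝ ↦ s - 1) (𝓝 1) (𝓝 (1 - 1)) := by
      exact (continuous_id.sub continuous_const).tendsto 1
    rw [sub_self] at this
    exact this.mono_left nhdsWithin_le_nhds
  have t2 := (t0.mul (tendsto_sub_one_mul_realZeta (GaussExt K))).const_mul C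
  rw [zero_mul, mul_zero] at t2
  have h := le_of_tendsto_of_tendsto t1 t2 (by
    filter_upwards [self_mem_nhdsWithin] with s hs
    have hs' : (0 : ℝ) ≤ (s - 1) ^ 2 := sq_nonneg _
    have := mul_le_mul_of_nonneg_left (key s hs) hs'
    calc _ = (s - 1) ^ 2 * realZeta K s ^ 2 := by ring
      _ ≤ _ := this
      _ = _ := by ring)
  have := dedekindZeta_residue_pos K
  have : 0 < dedekindZeta_residue K ^ 2 := by positivity
  linarith

end DegreeOne

end

section

open NumberField Filter Topology IsDedekindDomain

section HomClosure

theorem nonempty_closure_hom {A E F : Type*} [CommRing A] [Field E] [Field F] (q : A)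
    (φ : A →+* E) (ψ : A →+* F) (hφ : φ q ≠ 0) (hψ : ψ q ≠ 0) (hker : ∀ a, φ a = 0 → ψ a = 0)
    (S : Set E) (hS : ∀ s ∈ S, ∃ a, ∃ n : ℕ, s * φ q ^ n = φ a) :
    Nonempty (Subring.closure S →+* F) := by
  let g : Localization.Away q →+* E := IsLocalization.Away.lift q (g := φ) (IsUnit.mk0 _ hφ)
  let f : Localization.Away q →+* F := IsLocalization.Away.lift q (g := ψ) (IsUnit.mk0 _ hψ)
  have hg : ∀ a, g (algebraMap _ _ a) = φ a := fun a ↦ IsLocalization.Away.lift_eq q _ a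
  have hf : ∀ a, f (algebraMap _ _ a) = ψ a := fun a ↦ IsLocalization.Away.lift_eq q _ a
  have hk : RingHom.ker g ≤ RingHom.ker f := by
    intro b hb
    rw [RingHom.mem_ker] at hb ⊢
    obtain ⟨n, a, ha⟩ := IsLocalization.Away.surj q b
    have h1 := congrArg g ha
    rw [map_mul, hb, zero_mul, hg] at h1
    have h2 := congrArg f ha
    rw [map_mul, hf, hker a h1.symm, map_pow, hf] at h2
    exact (mul_eq_zero.mp h2).resolve_right (pow_ne_zero _ hψ)
  have hle : Subring.closure S ≤ g.range := by
    rw [Subring.closure_le]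
    intro s hs
    obtain ⟨a, n, h⟩ := hS s hs
    refine ⟨algebraMap _ _ a * IsLocalization.Away.invSelf q ^ n, ?_⟩
    have h1 : g (IsLocalization.Away.invSelf q) * φ q = 1 := by
      rw [← hg, ← map_mul, mul_comm, IsLocalization.Away.mul_invSelf, map_one]
    rw [map_mul, hg, ← h, map_pow, mul_assoc, ← mul_pow, mul_comm (φ q), h1, one_pow, mul_one]
  have hsurj : Function.Surjective g.rangeRestrict := g.rangeRestrict_surjective
  have hk' : RingHom.ker g.rangeRestrict ≤ RingHom.ker f := by
    rwa [RingHom.ker_rangeRestrict]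
  exact ⟨((RingHom.liftOfSurjective (f := g.rangeRestrict) hsurj) ⟨f, hk'⟩).comp
      (Subring.inclusion hle)⟩

theorem exists_hom_zmod (K : Type*) [Field K] [NumberField K] (S : Finset K) :
    ∃ d : ℕ, d ≠ 0 ∧ ∀ ℓ : ℕ, ℓ.Prime → ¬ ℓ ∣ d →
      (∃ P : HeightOneSpectrum (𝓞 K), Ideal.absNorm P.asIdeal = ℓ) →
      Nonempty (Subring.closure (S : Set K) →+* ZMod ℓ) := by
  classical
  obtain ⟨d, hd0, hd⟩ : ∃ d : ℕ, d ≠ 0 ∧ ∀ s ∈ S, IsIntegral ℤ ((d : K) * s) := by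
    induction S using Finset.induction_on with
    | empty => exact ⟨1, one_ne_zero, by simp⟩
    | insert a S ha ih =>
      obtain ⟨d, hd0, hd⟩ := ih
      have : IsAlgebraic ℤ a :=
          (IsFractionRing.isAlgebraic_iff ℤ ℚ K).mpr (IsAlgebraic.of_finite ℚ a)
      obtain ⟨e, he0, he⟩ := this.exists_integral_multiple
      have he' : IsIntegral ℤ ((e.natAbs : K) * a) := by
        rcases Int.natAbs_eq e with h | h
        · rw [h] at he; simpa [Algebra.smul_def] using he
        · rw [h] at he; simpa [Algebra.smul_def] using he
      refine ⟨e.natAbs * d, mul_ne_zero (by simpa using he0) hd0, ?_⟩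
      intro s hs
      rcases Finset.mem_insert.mp hs with rfl | hs
      · have := (isIntegral_algebraMap (R := ℤ) (A := K) (x := (d : ℤ))).mul he'
        simp only [map_natCast] at this
        rwa [Nat.cast_mul, mul_comm (e.natAbs : K), mul_assoc]
      · have := (isIntegral_algebraMap (R := ℤ) (A := K) (x := (e.natAbs : ℤ))).mul (hd s hs)
        simp only [map_natCast] at this
        rwa [Nat.cast_mul, mul_assoc]
  refine ⟨d, hd0, fun ℓ hℓ hld ⟨P, hP⟩ ↦ ?_⟩
  have := P.isMaximal
  have : Fact ℓ.Prime := ⟨hℓ⟩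
  let := Ideal.Quotient.field P.asIdeal
  have hcard : Nat.card (𝓞 K ⧸ P.asIdeal) = ℓ := by
    rw [← hP, Ideal.absNorm_apply, Submodule.cardQuot_apply]
  have hfin : Finite (𝓞 K ⧸ P.asIdeal) := by
    apply Nat.finite_of_card_ne_zero; rw [hcard]; exact hℓ.ne_zero
  let : Fintype (𝓞 K ⧸ P.asIdeal) := Fintype.ofFinite _
  let e := ZMod.ringEquivOfPrime (𝓞 K ⧸ P.asIdeal) hℓ (by rw [← hcard, Nat.card_eq_fintype_card])
  let ψ : 𝓞 K →+* ZMod ℓ := (e.symm : _ →+* ZMod ℓ).comp (Ideal.Quotient.mk P.asIdeal)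
  refine nonempty_closure_hom (d : 𝓞 K) (algebraMap (𝓞 K) K) ψ ?_ ?_ ?_ _ ?_
  · simpa using hd0
  · rw [map_natCast]
    rwa [Ne, ZMod.natCast_eq_zero_iff]
  · intro a ha
    rw [RingOfIntegers.coe_eq_zero_iff] at ha
    simp [ha]
  · intro s hs
    exact ⟨⟨_, hd s hs⟩, 1, by rw [map_natCast, pow_one, mul_comm]; rfl⟩

end HomClosure

end

section

open Filter Topology

section SpecializeReal

theorem exists_finset_polynomial_presentation (E : Type*) [Field E] [Algebra ℚ E]
    [Algebra.EssFiniteType ℚ E] :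
    ∃ (T : Finset E) (α : E) (φ : Polynomial (MvPolynomial T ℚ) →+* E)
      (f : Polynomial (MvPolynomial T ℚ)),
      φ = Polynomial.eval₂RingHom (MvPolynomial.aeval (R := ℚ) (Subtype.val : T → E)).toRingHom α ∧
      Function.Injective (MvPolynomial.aeval (R := ℚ) (Subtype.val : T → E)) ∧
      φ f = 0 ∧ f ≠ 0 ∧ (∀ g, g ≠ 0 → φ g = 0 → f.natDegree ≤ g.natDegree) ∧
      ∀ e : E, ∃ q : MvPolynomial T ℚ, q ≠ 0 ∧ ∃ a, e * φ (Polynomial.C q) = φ a := by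
  classical
  obtain ⟨T, hT, hsep⟩ := exists_isTranscendenceBasis_and_isSeparable_of_perfectField ℚ E
  set k := IntermediateField.adjoin ℚ (T : Set E) with hk
  have : Algebra.EssFiniteType k E := Algebra.EssFiniteType.of_comp ℚ k E
  have halg : Algebra.IsAlgebraic k E := inferInstance
  have hfin : FiniteDimensional k E := by
    obtain ⟨s, hs⟩ := IntermediateField.fg_top k E
    have h := IntermediateField.finiteDimensional_adjoin (K := k) (S := (s : Set E))
      (fun x _ ↦ Algebra.IsIntegral.isIntegral x)
    rw [hs] at h
    exact Module.Finite.equiv (IntermediateField.topEquiv (F := k) (E := E)).toLinearEquiv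
  obtain ⟨α, hα⟩ := Field.exists_primitive_element k E
  set ev : MvPolynomial T ℚ →ₐ[ℚ] E := MvPolynomial.aeval (R := ℚ) (Subtype.val : T → E) with hev
  have hinj : Function.Injective ev := hT.1
  set φ : Polynomial (MvPolynomial T ℚ) →+* E := Polynomial.eval₂RingHom ev.toRingHom α with hφ
  have hφC : ∀ q, φ (Polynomial.C q) = ev q := fun q ↦ by simp [hφ]
  have hφX : φ Polynomial.X = α := by simp [hφ]
  have hex : ∀ e : E, ∃ q : MvPolynomial T ℚ, q ≠ 0 ∧ ∃ a, e * φ (Polynomial.C q) = φ a := by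
    intro e
    have he : e ∈ Algebra.adjoin k ({α} : Set E) := by
      rw [← IntermediateField.adjoin_simple_toSubalgebra_of_isAlgebraic (halg.isAlgebraic α), hα]
      trivial
    induction he using Algebra.adjoin_induction with
    | mem x hx =>
      rw [Set.mem_singleton_iff.mp hx]
      exact ⟨1, one_ne_zero, Polynomial.X, by simp [hφX]⟩
    | algebraMap r =>
      obtain ⟨a, b, hab⟩ := (IntermediateField.mem_adjoin_iff ℚ (r : E)).mp r.2
      change (r : E) = ev a / ev b at hab
      change ∃ q : MvPolynomial T ℚ, q ≠ 0 ∧ ∃ a, (r : E) * φ (Polynomial.C q) = φ a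
      rcases eq_or_ne b 0 with rfl | hb
      · exact ⟨1, one_ne_zero, 0, by rw [hab]; simp⟩
      · refine ⟨b, hb, Polynomial.C a, ?_⟩
        rw [hφC, hφC, hab, div_mul_cancel₀]
        exact fun h ↦ hb (hinj (by rw [h, map_zero]))
    | add x y _ _ hx hy =>
      obtain ⟨q, hq, a, ha⟩ := hx
      obtain ⟨q', hq', a', ha'⟩ := hy
      refine ⟨q * q', mul_ne_zero hq hq', a * Polynomial.C q' + a' * Polynomial.C q, ?_⟩
      simp only [map_add, map_mul]
      linear_combination φ (Polynomial.C q') * ha + φ (Polynomial.C q) * ha'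
    | mul x y _ _ hx hy =>
      obtain ⟨q, hq, a, ha⟩ := hx
      obtain ⟨q', hq', a', ha'⟩ := hy
      refine ⟨q * q', mul_ne_zero hq hq', a * a', ?_⟩
      simp only [map_mul]
      linear_combination y * φ (Polynomial.C q') * ha + φ a * ha'
  have hne : ∃ g : Polynomial (MvPolynomial T ℚ), g ≠ 0 ∧ φ g = 0 := by
    have h1 : IsAlgebraic (Algebra.adjoin ℚ (Set.range (Subtype.val : T → E))) α :=
      hT.isAlgebraic.isAlgebraic α
    obtain ⟨p, hp0, hp⟩ := h1
    refine ⟨p.map (hT.1.aevalEquiv.symm : _ →+* MvPolynomial T ℚ), ?_, ?_⟩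
    · rwa [Ne, Polynomial.map_eq_zero_iff]
      exact hT.1.aevalEquiv.symm.injective
    · simp only [hφ, Polynomial.coe_eval₂RingHom, Polynomial.eval₂_map]
      have hring : ev.toRingHom.comp (hT.1.aevalEquiv.symm : _ →+* MvPolynomial T ℚ) =
          algebraMap (Algebra.adjoin ℚ (Set.range (Subtype.val : T → E))) E := by
        refine RingHom.ext fun x ↦ ?_
        have := hT.1.algebraMap_aevalEquiv (hT.1.aevalEquiv.symm x)
        rw [AlgEquiv.apply_symm_apply] at this
        exact this.symm
      rw [hring]
      exact hp
  let s : Set (Polynomial (MvPolynomial T ℚ)) := {g | g ≠ 0 ∧ φ g = 0}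
  have hs : s.Nonempty := hne
  obtain ⟨f, hf, hmin⟩ : ∃ f ∈ s, ∀ g ∈ s, f.natDegree ≤ g.natDegree :=
    ⟨Function.argminOn _ s hs, Function.argminOn_mem _ s hs,
      fun g hg ↦ Function.argminOn_le _ s hg⟩
  exact ⟨T, α, φ, f, rfl, hinj, hf.2, hf.1, fun g h1 h2 ↦ hmin g ⟨h1, h2⟩, hex⟩

theorem eq_zero_of_minimal {R E F : Type*} [CommRing R] [IsDomain R] [Field E] [Field F]
    (φ : Polynomial R →+* E) (ψ : Polynomial R →+* F) (f : Polynomial R) (hf0 : f ≠ 0)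
    (hφ : φ f = 0) (hψ : ψ f = 0) (hlc : ψ (Polynomial.C f.leadingCoeff) ≠ 0)
    (hmin : ∀ g, g ≠ 0 → φ g = 0 → f.natDegree ≤ g.natDegree) (g : Polynomial R) (hg : φ g = 0) :
    ψ g = 0 := by
  induction hn : g.degree using WellFounded.induction
    (r := ((· < ·) : WithBot ℕ → WithBot ℕ → Prop))
    generalizing g
  · exact wellFounded_lt
  rename_i n ih
  rcases eq_or_ne g 0 with rfl | hg0
  · simp
  have hdeg := hmin g hg0 hg
  set g' := Polynomial.C f.leadingCoeff * g -
    Polynomial.C g.leadingCoeff * Polynomial.X ^ (g.natDegree - f.natDegree) * f with hg'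
  have h1 : φ g' = 0 := by rw [hg', map_sub, map_mul, map_mul, hg, hφ]; ring
  have hl : f.leadingCoeff ≠ 0 := Polynomial.leadingCoeff_ne_zero.mpr hf0
  have hl' : g.leadingCoeff ≠ 0 := Polynomial.leadingCoeff_ne_zero.mpr hg0
  have h2 : g'.degree < g.degree := by
    have e1 : (Polynomial.C f.leadingCoeff * g).degree = g.degree := Polynomial.degree_C_mul hl
    rw [← e1]
    apply Polynomial.degree_sub_lt_left
    · rw [e1, mul_assoc, Polynomial.degree_C_mul hl', Polynomial.degree_mul,
        Polynomial.degree_X_pow,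
        Polynomial.degree_eq_natDegree hf0, Polynomial.degree_eq_natDegree hg0]
      exact_mod_cast (Nat.sub_add_cancel hdeg).symm
    · exact mul_ne_zero (by simpa using hl) hg0
    · rw [Polynomial.leadingCoeff_mul, Polynomial.leadingCoeff_mul, Polynomial.leadingCoeff_mul,
        Polynomial.leadingCoeff_X_pow, Polynomial.leadingCoeff_C, Polynomial.leadingCoeff_C,
        mul_one, mul_comm]
  have h3 := ih g'.degree (hn ▸ h2) g' h1 rfl
  rw [hg', map_sub, map_mul, map_mul, hψ, mul_zero, sub_zero] at h3
  exact (mul_eq_zero.mp h3).resolve_left hlc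

theorem exists_eval_neg_of_derivative_ne_zero (g : Polynomial ℝ) (a : ℝ) (ha : g.eval a = 0)
    (hd : g.derivative.eval a ≠ 0) : ∃ y, g.eval y < 0 := by
  by_contra! h
  have h1 : IsLocalMin (fun x ↦ g.eval x) a := Filter.Eventually.of_forall fun x ↦ by
    simp only [ha]; exact h x
  have := h1.deriv_eq_zero
  rw [Polynomial.deriv] at this
  exact hd this

theorem exists_numberField_hom (S : Finset ℝ) :
    ∃ K : IntermediateField ℚ ℝ, FiniteDimensional ℚ K ∧
      Nonempty (Subring.closure (S : Set ℝ) →+* K) := by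
  classical
  let E := IntermediateField.adjoin ℚ (S : Set ℝ)
  have : Algebra.EssFiniteType ℚ E :=
    IntermediateField.essFiniteType_iff.mpr (IntermediateField.fg_adjoin_finset S)
  obtain ⟨T, α, φ, f, hφ, hinj, hf, hf0, hmin, hex⟩ := exists_finset_polynomial_presentation E
  let j : E →ₐ[ℚ] ℝ := E.val
  obtain ⟨q, hq0, hq⟩ : ∃ q : MvPolynomial T ℚ, q ≠ 0 ∧ ∀ s ∈ S, ∃ a,
      s * j (φ (Polynomial.C q)) = j (φ a) := by
    have : ∀ S' ⊆ S, ∃ q : MvPolynomial T ℚ, q ≠ 0 ∧ ∀ s ∈ S', ∃ a,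
      s * j (φ (Polynomial.C q)) = j (φ a) := by
      intro S'
      induction S' using Finset.induction_on with
      | empty => exact fun _ ↦ ⟨1, one_ne_zero, by simp⟩
      | insert s S' hs ih =>
        intro hS
        obtain ⟨q, hq0, hq⟩ := ih ((Finset.subset_insert _ _).trans hS)
        have hsE : s ∈ E := IntermediateField.subset_adjoin _ _ (hS (Finset.mem_insert_self _ _))
        obtain ⟨q', hq', a, ha⟩ := hex ⟨s, hsE⟩
        have ha' : s * j (φ (Polynomial.C q')) = j (φ a) := by rw [← ha, map_mul]; rfl
        refine ⟨q' * q, mul_ne_zero hq' hq0, fun t ht ↦ ?_⟩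
        rcases Finset.mem_insert.mp ht with rfl | ht
        · exact ⟨a * Polynomial.C q, by rw [Polynomial.C_mul, map_mul, map_mul, map_mul, map_mul,
            ← mul_assoc, ha']⟩
        · obtain ⟨b, hb⟩ := hq t ht
          exact ⟨Polynomial.C q' * b, by rw [Polynomial.C_mul, map_mul, map_mul, map_mul, map_mul,
            ← hb, mul_left_comm]⟩
    exact this S subset_rfl
  let x : T → ℝ := fun i ↦ j i.1
  let c : ℚ →+* ℝ := algebraMap ℚ ℝ
  have hevx : ∀ p : MvPolynomial T ℚ, MvPolynomial.eval₂ c x p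
      = j (MvPolynomial.aeval (R := ℚ) (Subtype.val : T → E) p) := by
    intro p
    rw [← MvPolynomial.aeval_def, ← AlgHom.comp_apply]
    congr 1
    ext i; simp [x]
  have hevne : ∀ p : MvPolynomial T ℚ, p ≠ 0 → MvPolynomial.eval₂ c x p ≠ 0 := by
    intro p hp h
    rw [hevx] at h
    exact hp (hinj (by rw [map_zero]; exact j.toRingHom.injective (h.trans (map_zero j).symm)))
  let fx : (T → ℝ) → Polynomial ℝ := fun t ↦ f.map (MvPolynomial.eval₂Hom c t)
  have hfx : ∀ g : Polynomial (MvPolynomial T ℚ),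
      (g.map (MvPolynomial.eval₂Hom c x)).eval (j α) = j (φ g) := by
    intro g
    rw [hφ, Polynomial.eval_map, Polynomial.coe_eval₂RingHom]
    change _ = (j : E →+* ℝ) _
    rw [Polynomial.hom_eval₂]
    congr 1
    ext p
    · simp
    · simp [x]
  have hroot : (fx x).eval (j α) = 0 := by rw [hfx, hf, map_zero]
  have hdeg : f.natDegree ≠ 0 := by
    intro h
    obtain ⟨r, hr⟩ := Polynomial.natDegree_eq_zero.mp h
    rw [← hr, hφ] at hf
    simp at hf
    have : r = 0 := hinj (by rw [map_zero]; exact hf)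
    rw [this] at hr
    exact hf0 (by rw [← hr]; simp)
  have hder : (fx x).derivative.eval (j α) ≠ 0 := by
    rw [Polynomial.derivative_map, hfx]
    intro h
    have h0 : φ f.derivative = 0 := j.toRingHom.injective (h.trans (map_zero j).symm)
    by_cases hd0 : f.derivative = 0
    · exact hdeg (Polynomial.derivative_eq_zero.mp hd0)
    · have := hmin _ hd0 h0
      have := Polynomial.natDegree_derivative_lt hdeg
      omega
  obtain ⟨y1, hy1⟩ := exists_eval_neg_of_derivative_ne_zero _ _ hroot hder
  obtain ⟨y2, hy2⟩ := exists_eval_neg_of_derivative_ne_zero (-(fx x)) (j α) (by simp [hroot])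
    (by simpa using hder)
  have hcontp : ∀ p : MvPolynomial T ℚ, Continuous fun t : T → ℝ ↦ MvPolynomial.eval₂ c t p := by
    intro p
    simp only [← MvPolynomial.eval_map]
    exact MvPolynomial.continuous_eval _
  have hcont : ∀ y, Continuous fun t : T → ℝ ↦ (fx t).eval y := by
    intro y
    simp only [fx, Polynomial.eval_map, Polynomial.eval₂_eq_sum_range]
    exact continuous_finsetSum _ fun i _ ↦ (hcontp _).mul continuous_const
  have hlc0 : f.leadingCoeff ≠ 0 := Polynomial.leadingCoeff_ne_zero.mpr hf0
  let U : Set (T → ℝ) := {t | (fx t).eval y1 < 0} ∩ {t | 0 < (fx t).eval y2} ∩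
    {t | MvPolynomial.eval₂ c t q ≠ 0} ∩ {t | MvPolynomial.eval₂ c t f.leadingCoeff ≠ 0}
  have hU : IsOpen U := by
    refine IsOpen.inter (IsOpen.inter (IsOpen.inter ?_ ?_) ?_) ?_
    · exact isOpen_lt (hcont y1) continuous_const
    · exact isOpen_lt continuous_const (hcont y2)
    · exact isOpen_ne_fun (hcontp _) continuous_const
    · exact isOpen_ne_fun (hcontp _) continuous_const
  have hxU : x ∈ U := ⟨⟨⟨hy1, by simpa using hy2⟩, hevne q hq0⟩, hevne _ hlc0⟩
  have hdense : DenseRange (fun (t : T → ℚ) (i : T) ↦ ((t i : ℚ) : ℝ)) :=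
    DenseRange.piMap fun _ ↦ Rat.denseRange_cast
  obtain ⟨t, ht⟩ := hdense.exists_mem_open hU ⟨x, hxU⟩
  obtain ⟨⟨⟨ht1, ht2⟩, ht3⟩, ht4⟩ := ht
  set tr : T → ℝ := fun i ↦ ((t i : ℚ) : ℝ) with htr
  obtain ⟨α0, hα0⟩ := mem_range_of_exists_le_of_exists_ge (fx tr).continuous
    ⟨y1, ht1.le⟩ ⟨y2, ht2.le⟩
  have hevt : ∀ p : MvPolynomial T ℚ, MvPolynomial.eval₂ c tr p =
      ((MvPolynomial.eval t p : ℚ) : ℝ) := by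
    intro p
    change _ = c _
    rw [MvPolynomial.eval, MvPolynomial.coe_eval₂Hom, MvPolynomial.eval₂_comp_left]
    rfl
  let f0 : Polynomial ℚ := f.map (MvPolynomial.eval t)
  have hf0t : f0 ≠ 0 := by
    intro h
    have : f0.coeff f.natDegree = 0 := by rw [h]; simp
    rw [Polynomial.coeff_map] at this
    apply ht4
    rw [hevt]
    exact_mod_cast this
  have hf0r : Polynomial.aeval α0 f0 = 0 := by
    rw [← hα0, Polynomial.aeval_def, Polynomial.eval₂_map]
    simp only [fx, Polynomial.eval_map]
    congr 1
    ext p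
    · simp
    · simp [tr]
  have hInt : IsIntegral ℚ α0 := IsAlgebraic.isIntegral ⟨f0, hf0t, hf0r⟩
  let K := IntermediateField.adjoin ℚ ({α0} : Set ℝ)
  refine ⟨K, IntermediateField.adjoin.finiteDimensional hInt, ?_⟩
  let ψ : Polynomial (MvPolynomial T ℚ) →+* K :=
    Polynomial.eval₂RingHom ((algebraMap ℚ K).comp (MvPolynomial.eval t))
      ⟨α0, IntermediateField.mem_adjoin_simple_self ℚ α0⟩
  have hψC : ∀ p, ψ (Polynomial.C p) = 0 → MvPolynomial.eval₂ c tr p = 0 := by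
    intro p h
    rw [hevt]
    simp [ψ] at h
    simp [h]
  have hψf : ψ f = 0 := by
    have : Polynomial.aeval (⟨α0, IntermediateField.mem_adjoin_simple_self ℚ α0⟩ : K) f0 = 0 := by
      apply K.val.toRingHom.injective
      rw [map_zero, ← hf0r]
      exact (Polynomial.aeval_algHom_apply K.val _ f0).symm
    rw [Polynomial.aeval_def, Polynomial.eval₂_map] at this
    exact this
  refine nonempty_closure_hom (Polynomial.C q) ((j : E →+* ℝ).comp φ) ψ ?_
    (fun h ↦ ht3 (hψC _ h)) ?_ _ ?_
  · intro h
    apply hevne q hq0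
    rw [hevx, ← h]
    simp [hφ]
  · intro a ha
    exact eq_zero_of_minimal φ ψ f hf0 hf hψf (fun h ↦ ht4 (hψC _ h)) hmin a
      (j.toRingHom.injective (ha.trans (map_zero j).symm))
  · intro s hs
    obtain ⟨a, ha⟩ := hq s hs
    exact ⟨a, 1, by rw [pow_one]; exact ha⟩

end SpecializeReal

end

section

open NumberField Filter Topology IsDedekindDomain ComplexConjugate

section GoodPrimes

theorem not_summable_primes_hom_zmod (S : Finset ℝ) :
    ¬ Summable fun ℓ : {ℓ : ℕ // ℓ.Prime ∧ ℓ % 4 = 3 ∧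
      Nonempty (Subring.closure (S : Set ℝ) →+* ZMod ℓ)} ↦ (1 / (ℓ : ℕ) : ℝ) := by
  classical
  intro hsum
  obtain ⟨K, hK, ⟨f⟩⟩ := exists_numberField_hom S
  have : NumberField K := { to_finiteDimensional := hK }
  let T : Finset K := S.attach.image fun s ↦ f ⟨s.1, Subring.subset_closure s.2⟩
  have hT : ∀ x : Subring.closure (S : Set ℝ), f x ∈ Subring.closure (T : Set K) := by
    rintro ⟨x, hx⟩
    induction hx using Subring.closure_induction with
    | mem x hx =>
      exact Subring.subset_closure
          (Finset.mem_coe.mpr (Finset.mem_image.mpr ⟨⟨x, hx⟩, by simp, rfl⟩))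
    | zero => exact (map_zero f).symm ▸ zero_mem _
    | one => exact (map_one f).symm ▸ one_mem _
    | add x y hx hy h1 h2 =>
      have := map_add f ⟨x, hx⟩ ⟨y, hy⟩
      exact this ▸ add_mem h1 h2
    | neg x hx h1 =>
      have := map_neg f ⟨x, hx⟩
      exact this ▸ neg_mem h1
    | mul x y hx hy h1 h2 =>
      have := map_mul f ⟨x, hx⟩ ⟨y, hy⟩
      exact this ▸ mul_mem h1 h2
  let f' := f.codRestrict _ hT
  obtain ⟨d, hd0, hd⟩ := exists_hom_zmod K T
  have hneg : ∀ r : K, r ^ 2 ≠ -1 := by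
    intro r hr
    have : (r : ℝ) ^ 2 = -1 := by exact_mod_cast congrArg Subtype.val hr
    nlinarith [sq_nonneg (r : ℝ)]
  refine not_summable_degree_one_three_mod_four K hneg ?_
  have h1 := (summable_subtype_iff_indicator (s := {ℓ : ℕ | ℓ.Prime ∧ ℓ % 4 = 3 ∧
      Nonempty (Subring.closure (S : Set ℝ) →+* ZMod ℓ)}) (f := fun ℓ : ℕ ↦ (1 / ℓ : ℝ))).mp hsum
  have h2 : Summable ({ℓ : ℕ | ℓ ∈ d.divisors}.indicator (fun ℓ : ℕ ↦ (1 / ℓ : ℝ))) :=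
    summable_of_hasFiniteSupport
        ((Finset.finite_toSet d.divisors).subset Set.support_indicator_subset)
  refine (summable_subtype_iff_indicator (s := {ℓ : ℕ | ℓ.Prime ∧ ℓ % 4 = 3 ∧
      ∃ P : HeightOneSpectrum (𝓞 K), Ideal.absNorm P.asIdeal = ℓ})
      (f := fun ℓ : ℕ ↦ (1 / ℓ : ℝ))).mpr ?_
  refine Summable.of_nonneg_of_le (fun ℓ ↦ Set.indicator_nonneg (fun _ _ ↦ by positivity) _) ?_
    (h1.add h2)
  intro ℓ
  by_cases hm : ℓ ∈ {ℓ : ℕ | ℓ.Prime ∧ ℓ % 4 = 3 ∧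
      ∃ P : HeightOneSpectrum (𝓞 K), Ideal.absNorm P.asIdeal = ℓ}
  · have i1 : ∀ (V : Set ℕ), 0 ≤ V.indicator (fun n : ℕ ↦ (1 / n : ℝ)) ℓ := fun V ↦
      Set.indicator_nonneg (fun _ _ ↦ by positivity) _
    rw [Set.indicator_of_mem hm]
    by_cases hdiv : ℓ ∣ d
    · rw [Set.indicator_of_mem (s := {ℓ : ℕ | ℓ ∈ d.divisors})
        (show ℓ ∈ d.divisors from Nat.mem_divisors.mpr ⟨hdiv, hd0⟩)]
      linarith [i1 {ℓ : ℕ | ℓ.Prime ∧ ℓ % 4 = 3 ∧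
        Nonempty (Subring.closure (S : Set ℝ) →+* ZMod ℓ)}]
    · obtain ⟨g⟩ := hd ℓ hm.1 hdiv hm.2.2
      rw [Set.indicator_of_mem (s := {ℓ : ℕ | ℓ.Prime ∧ ℓ % 4 = 3 ∧
        Nonempty (Subring.closure (S : Set ℝ) →+* ZMod ℓ)}) ⟨hm.1, hm.2.1, ⟨g.comp f'⟩⟩]
      linarith [i1 {ℓ : ℕ | ℓ ∈ d.divisors}]
  · rw [Set.indicator_of_notMem hm]
    exact add_nonneg (Set.indicator_nonneg (fun _ _ ↦ by positivity) _)
      (Set.indicator_nonneg (fun _ _ ↦ by positivity) _)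

/-- The subring of complex numbers with real and imaginary part in a given subring of `ℝ`. -/
def gaussSubring (B : Subring ℝ) : Subring ℂ where
  carrier := {z | z.re ∈ B ∧ z.im ∈ B}
  mul_mem' {a b} ha hb := by
    simp only [Set.mem_ofPred_eq, Complex.mul_re, Complex.mul_im] at *
    exact ⟨sub_mem (mul_mem ha.1 hb.1) (mul_mem ha.2 hb.2),
      add_mem (mul_mem ha.1 hb.2) (mul_mem ha.2 hb.1)⟩
  one_mem' := by simp [one_mem, zero_mem]
  add_mem' {a b} ha hb := by
    simp only [Set.mem_ofPred_eq, Complex.add_re, Complex.add_im] at *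
    exact ⟨add_mem ha.1 hb.1, add_mem ha.2 hb.2⟩
  zero_mem' := by simp [zero_mem]
  neg_mem' {a} ha := by
    simp only [Set.mem_ofPred_eq, Complex.neg_re, Complex.neg_im] at *
    exact ⟨neg_mem ha.1, neg_mem ha.2⟩

/-- A prime `ℓ` admitting a reduction of `R` in characteristic `ℓ` under which complex
conjugation becomes Frobenius. -/
def FrobConj (R : Subring ℂ) (ℓ : ℕ) : Prop :=
  ∃ (Ω : Type) (_ : Field Ω) (_ : IsAlgClosed Ω) (_ : CharP Ω ℓ) (χ : R →+* Ω),
    ∀ a b : R, (b : ℂ) = conj (a : ℂ) → χ b = χ a ^ ℓ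

theorem FrobConj.mono {R R' : Subring ℂ} (h : R ≤ R') {ℓ : ℕ} (hR : FrobConj R' ℓ) :
    FrobConj R ℓ := by
  obtain ⟨Ω, i1, i2, i3, χ, hχ⟩ := hR
  exact ⟨Ω, i1, i2, i3, χ.comp (Subring.inclusion h), fun a b hab ↦ hχ _ _ hab⟩

theorem frobConj_gaussSubring (B : Subring ℝ) (ℓ : ℕ) (hℓ : ℓ.Prime) (h4 : ℓ % 4 = 3)
    (χ0 : B →+* ZMod ℓ) : FrobConj (gaussSubring B) ℓ := by
  have : Fact ℓ.Prime := ⟨hℓ⟩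
  let Ω := AlgebraicClosure (ZMod ℓ)
  have : CharP Ω ℓ := charP_of_injective_algebraMap (algebraMap (ZMod ℓ) Ω).injective ℓ
  obtain ⟨j, hj⟩ := IsAlgClosed.exists_pow_nat_eq (-1 : Ω) (n := 2) (by norm_num)
  have hj4 : j ^ 4 = 1 := by rw [show 4 = 2 * 2 from rfl, pow_mul, hj]; ring
  have hjl : j ^ ℓ = -j := by
    have h (n : ℕ) (hn : n % 4 = 3) : j ^ n = -j := by
      rw [← Nat.div_add_mod n 4, hn, pow_add, pow_mul, hj4, one_pow, one_mul, pow_succ, hj]; ring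
    exact h ℓ h4
  let c : B →+* Ω := (algebraMap (ZMod ℓ) Ω).comp χ0
  have hc : ∀ b, c b ^ ℓ = c b := by
    intro b
    rw [show c b = algebraMap _ Ω (χ0 b) from rfl, ← map_pow, ZMod.pow_card]
  let χ : gaussSubring B →+* Ω :=
    { toFun z := c ⟨z.1.re, z.2.1⟩ + j * c ⟨z.1.im, z.2.2⟩
      map_one' := by
        have h1 : (⟨(1 : gaussSubring B).1.re, (1 : gaussSubring B).2.1⟩ : B) = 1 := by ext; simp
        have h2 : (⟨(1 : gaussSubring B).1.im, (1 : gaussSubring B).2.2⟩ : B) = 0 := by ext; simp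
        rw [h1, h2]; simp
      map_zero' := by
        have h1 : (⟨(0 : gaussSubring B).1.re, (0 : gaussSubring B).2.1⟩ : B) = 0 := by ext; simp
        have h2 : (⟨(0 : gaussSubring B).1.im, (0 : gaussSubring B).2.2⟩ : B) = 0 := by ext; simp
        rw [h1, h2]; simp
      map_add' x y := by
        have h1 : (⟨(x + y).1.re, (x + y).2.1⟩ : B) = ⟨x.1.re, x.2.1⟩ + ⟨y.1.re, y.2.1⟩ := by
          ext; simp
        have h2 : (⟨(x + y).1.im, (x + y).2.2⟩ : B) = ⟨x.1.im, x.2.2⟩ + ⟨y.1.im, y.2.2⟩ := by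
          ext; simp
        rw [h1, h2]; simp only [map_add]; ring
      map_mul' x y := by
        have h1 : (⟨(x * y).1.re, (x * y).2.1⟩ : B) =
          ⟨x.1.re, x.2.1⟩ * ⟨y.1.re, y.2.1⟩ - ⟨x.1.im, x.2.2⟩ * ⟨y.1.im, y.2.2⟩ := by ext; simp
        have h2 : (⟨(x * y).1.im, (x * y).2.2⟩ : B) =
          ⟨x.1.re, x.2.1⟩ * ⟨y.1.im, y.2.2⟩ + ⟨x.1.im, x.2.2⟩ * ⟨y.1.re, y.2.1⟩ := by ext; simp
        rw [h1, h2]; simp only [map_add, map_sub, map_mul]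
        linear_combination -c ⟨x.1.im, x.2.2⟩ * c ⟨y.1.im, y.2.2⟩ * hj }
  have hχ : ∀ z, χ z = c ⟨z.1.re, z.2.1⟩ + j * c ⟨z.1.im, z.2.2⟩ := fun z ↦ rfl
  refine ⟨Ω, inferInstance, inferInstance, inferInstance, χ, fun a b hab ↦ ?_⟩
  rw [hχ, hχ, add_pow_char, mul_pow, hc, hc, hjl]
  have h1 : (⟨b.1.re, b.2.1⟩ : B) = ⟨a.1.re, a.2.1⟩ := by ext; simp [hab]
  have h2 : (⟨b.1.im, b.2.2⟩ : B) = -⟨a.1.im, a.2.2⟩ := by ext; simp [hab]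
  rw [h1, h2, map_neg]; ring

theorem FrobConj.dvd_add_one {R : Subring ℂ} {ℓ : ℕ} (h : FrobConj R ℓ) {N : ℕ} (hN : 0 < N) {ζ : ℂ}
    (hζ : IsPrimitiveRoot ζ N) (hζR : ζ ∈ R) (hinv : ∀ k, 0 < k → k < N → (1 - ζ ^ k)⁻¹ ∈ R) :
    N ∣ ℓ + 1 := by
  obtain ⟨Ω, _, _, _, χ, hχ⟩ := h
  let z : R := ⟨ζ, hζR⟩
  have hzN : z ^ N = 1 := Subtype.ext hζ.pow_eq_one
  have hord : orderOf (χ z) = N := by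
    rw [orderOf_eq_iff hN]
    refine ⟨by rw [← map_pow, hzN, map_one], fun k hk hk0 h ↦ ?_⟩
    have h1 : (1 - z ^ k) * ⟨_, hinv k hk0 hk⟩ = 1 := by
      apply Subtype.ext
      refine mul_inv_cancel₀ (sub_ne_zero.mpr fun h ↦ ?_)
      exact hζ.pow_ne_one_of_pos_of_lt hk0.ne' hk h.symm
    have h2 := congrArg χ h1
    rw [map_mul, map_sub, map_one, map_pow, h, sub_self, zero_mul] at h2
    exact zero_ne_one h2
  rw [← hord]
  apply orderOf_dvd_of_pow_eq_one
  have hnorm : conj ζ * ζ = 1 := by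
    rw [mul_comm, Complex.mul_conj, Complex.normSq_eq_norm_sq, hζ.norm'_eq_one hN.ne']; simp
  have hzi : (z ^ (N - 1) : R) = conj (z : ℂ) := by
    have h1 : (conj ζ) * (ζ * ζ ^ (N - 1)) = conj ζ := by
      rw [← pow_succ', Nat.sub_add_cancel hN, hζ.pow_eq_one, mul_one]
    change ζ ^ (N - 1) = conj ζ
    rw [← h1, ← mul_assoc, hnorm, one_mul]
  rw [pow_succ, ← hχ _ _ hzi, ← map_mul, ← pow_succ, Nat.sub_add_cancel hN, hzN, map_one]

/-- Primes with a reduction compatible with complex conjugation are plentiful. -/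
theorem exists_frobConj_primes (S : Finset ℂ) (N : ℕ) (hN : 0 < N) :
    ∃ R : Subring ℂ, (∀ s ∈ S, s ∈ R) ∧ (∀ a ∈ R, conj a ∈ R) ∧
      ¬ Summable fun ℓ : {ℓ : ℕ // ℓ.Prime ∧ N ∣ ℓ + 1 ∧ FrobConj R ℓ} ↦ (1 / (ℓ : ℕ) : ℝ) := by
  classical
  set ζ : ℂ := Complex.exp (2 * Real.pi * Complex.I / N) with hζd
  have hζ : IsPrimitiveRoot ζ N := Complex.isPrimitiveRoot_exp N hN.ne'
  let S' : Finset ℂ := insert ζ (S ∪ (Finset.range N).image fun k ↦ (1 - ζ ^ k)⁻¹)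
  let S0 : Finset ℝ := S'.image Complex.re ∪ S'.image Complex.im
  let B := Subring.closure (S0 : Set ℝ)
  have hS' : ∀ s ∈ S', s ∈ gaussSubring B := fun s hs ↦
    ⟨Subring.subset_closure (Finset.mem_coe.mpr
      (Finset.mem_union_left _ (Finset.mem_image_of_mem _ hs))),
     Subring.subset_closure (Finset.mem_coe.mpr
      (Finset.mem_union_right _ (Finset.mem_image_of_mem _ hs)))⟩
  refine ⟨gaussSubring B, fun s hs ↦ hS' s (by simp [S', hs]), fun a ha ↦ ?_, fun h ↦ ?_⟩
  · exact ⟨by simpa using ha.1, by simpa using ha.2⟩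
  · refine not_summable_primes_hom_zmod S0 ?_
    have hinj : ∀ ℓ : ℕ, (ℓ.Prime ∧ ℓ % 4 = 3 ∧
      Nonempty (Subring.closure (S0 : Set ℝ) →+* ZMod ℓ)) →
      (ℓ.Prime ∧ N ∣ ℓ + 1 ∧ FrobConj (gaussSubring B) ℓ) := by
      rintro ℓ ⟨h1, h2, ⟨χ⟩⟩
      have h3 := frobConj_gaussSubring B ℓ h1 h2 χ
      refine ⟨h1, h3.dvd_add_one hN hζ (hS' _ (by simp [S'])) fun k _ hk ↦ hS' _ ?_, h3⟩
      simp only [S', Finset.mem_insert, Finset.mem_union, Finset.mem_image, Finset.mem_range]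
      exact Or.inr (Or.inr ⟨k, hk, rfl⟩)
    exact h.comp_injective (i := Subtype.map id hinj)
      (Subtype.map_injective _ Function.injective_id)

end GoodPrimes

end

section

open Matrix MatrixGroups

section HeckeReps

/-- Representatives for the Hecke operator at the prime `ℓ ≡ -1 (mod N)`; all of them are
congruent to `diag(1, -1)` modulo `N`. -/
def heckeRep (N ℓ : ℕ) : Option (ZMod ℓ) → Matrix (Fin 2) (Fin 2) ℤ
  | none => !![-ℓ, 0; 0, -1]
  | some b => !![1, N * b.val; 0, ℓ]

theorem det_heckeRep (N ℓ : ℕ) (i : Option (ZMod ℓ)) : (heckeRep N ℓ i).det = ℓ := by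
  cases i <;> simp [heckeRep, det_fin_two]

theorem exists_eq_mul_heckeRep {N ℓ : ℕ} (hℓ : ℓ.Prime) (hN : N ∣ ℓ + 1)
    (δ : Matrix (Fin 2) (Fin 2) ℤ) (hδ : δ.det = ℓ) :
    ∃ (i : Option (ZMod ℓ)) (γ : SL(2, ℤ)),
      δ = (γ : Matrix (Fin 2) (Fin 2) ℤ) * heckeRep N ℓ i := by
  have : Fact ℓ.Prime := ⟨hℓ⟩
  have hNℓ : ((N : ℕ) : ZMod ℓ) ≠ 0 := by
    rw [Ne, ZMod.natCast_eq_zero_iff]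
    intro h
    have h1 : ℓ ∣ 1 := by simpa using (Nat.dvd_add_right (dvd_refl ℓ)).mp (h.trans hN)
    exact hℓ.one_lt.ne' (Nat.dvd_one.mp h1)
  have hℓ0 : (ℓ : ℤ) ≠ 0 := by exact_mod_cast hℓ.ne_zero
  suffices h : ∃ (i : Option (ZMod ℓ)) (γ : Matrix (Fin 2) (Fin 2) ℤ), δ = γ * heckeRep N ℓ i by
    obtain ⟨i, γ, h⟩ := h
    refine ⟨i, ⟨γ, ?_⟩, h⟩
    have := congrArg det h
    rw [det_mul, det_heckeRep, hδ] at this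
    exact mul_right_cancel₀ hℓ0 (by rw [one_mul]; exact this.symm)
  have hd : ((δ 0 0 * δ 1 1 - δ 0 1 * δ 1 0 : ℤ) : ZMod ℓ) = 0 := by
    rw [← det_fin_two, hδ]; simp
  push_cast at hd
  by_cases ha : ((δ 0 0 : ℤ) : ZMod ℓ) = 0
  · by_cases hc : ((δ 1 0 : ℤ) : ZMod ℓ) = 0
    · obtain ⟨a, ha⟩ := (ZMod.intCast_zmod_eq_zero_iff_dvd _ _).mp ha
      obtain ⟨c, hc⟩ := (ZMod.intCast_zmod_eq_zero_iff_dvd _ _).mp hc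
      refine ⟨none, !![-a, -δ 0 1; -c, -δ 1 1], ?_⟩
      ext i j
      fin_cases i <;> fin_cases j <;> simp [heckeRep, mul_apply, ha, hc, mul_comm]
    · refine ⟨some ((δ 1 1 : ZMod ℓ) / (N * δ 1 0)), ?_⟩
      set b := (δ 1 1 : ZMod ℓ) / (N * δ 1 0) with hb
      have hb' : ((N * b.val : ℤ) : ZMod ℓ) * δ 1 0 = δ 1 1 := by
        push_cast; rw [ZMod.natCast_zmod_val, hb]; field_simp
      have h1 : (ℓ : ℤ) ∣ δ 0 1 - δ 0 0 * (N * b.val) := by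
        rw [← ZMod.intCast_zmod_eq_zero_iff_dvd]
        push_cast
        rw [ha, zero_mul, sub_zero]
        rw [ha, zero_mul, zero_sub, neg_eq_zero] at hd
        exact (mul_eq_zero.mp hd).resolve_right hc
      have h2 : (ℓ : ℤ) ∣ δ 1 1 - δ 1 0 * (N * b.val) := by
        rw [← ZMod.intCast_zmod_eq_zero_iff_dvd]
        push_cast at hb' ⊢
        rw [← hb']; ring
      obtain ⟨x, hx⟩ := h1
      obtain ⟨y, hy⟩ := h2
      refine ⟨!![δ 0 0, x; δ 1 0, y], ?_⟩
      ext i j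
      fin_cases i <;> fin_cases j <;> simp [heckeRep, mul_apply, -ZMod.natCast_val] <;> linarith
  · refine ⟨some ((δ 0 1 : ZMod ℓ) / (N * δ 0 0)), ?_⟩
    set b := (δ 0 1 : ZMod ℓ) / (N * δ 0 0) with hb
    have hb' : ((N * b.val : ℤ) : ZMod ℓ) * δ 0 0 = δ 0 1 := by
      push_cast; rw [ZMod.natCast_zmod_val, hb]; field_simp
    have h1 : (ℓ : ℤ) ∣ δ 0 1 - δ 0 0 * (N * b.val) := by
      rw [← ZMod.intCast_zmod_eq_zero_iff_dvd]
      push_cast at hb' ⊢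
      rw [← hb']; ring
    have h2 : (ℓ : ℤ) ∣ δ 1 1 - δ 1 0 * (N * b.val) := by
      rw [← ZMod.intCast_zmod_eq_zero_iff_dvd]
      push_cast at hb' ⊢
      refine (mul_eq_zero.mp (?_ : (δ 0 0 : ZMod ℓ) * _ = 0)).resolve_left ha
      rw [← hb'] at hd
      linear_combination hd
    obtain ⟨x, hx⟩ := h1
    obtain ⟨y, hy⟩ := h2
    refine ⟨!![δ 0 0, x; δ 1 0, y], ?_⟩
    ext i j
    fin_cases i <;> fin_cases j <;> simp [heckeRep, mul_apply, -ZMod.natCast_val] <;> linarith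

theorem heckeRep_index_unique {N ℓ : ℕ} (hℓ : ℓ.Prime) (hN : N ∣ ℓ + 1) (i j : Option (ZMod ℓ))
    (γ : Matrix (Fin 2) (Fin 2) ℤ) (h : heckeRep N ℓ i = γ * heckeRep N ℓ j) : i = j := by
  have : Fact ℓ.Prime := ⟨hℓ⟩
  have hNℓ : ((N : ℕ) : ZMod ℓ) ≠ 0 := by
    rw [Ne, ZMod.natCast_eq_zero_iff]
    intro h
    have h1 : ℓ ∣ 1 := by simpa using (Nat.dvd_add_right (dvd_refl ℓ)).mp (h.trans hN)
    exact hℓ.one_lt.ne' (Nat.dvd_one.mp h1)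
  have h0 : ∀ a b, heckeRep N ℓ i a b = (γ * heckeRep N ℓ j) a b := fun a b ↦ by rw [h]
  have h00 := h0 0 0
  have h01 := h0 0 1
  have h10 := h0 1 0
  have h11 := h0 1 1
  have hℓ1 : ¬ (ℓ : ℤ) ∣ 1 := by
    intro h
    exact hℓ.one_lt.ne' (Nat.dvd_one.mp (by exact_mod_cast h))
  have hℓ1' : ¬ (ℓ : ℤ) ∣ -1 := by rwa [dvd_neg]
  rcases i with _ | i <;> rcases j with _ | j
  · rfl
  · simp [heckeRep, mul_apply, -ZMod.natCast_val] at h00 h01 h10 h11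
    exact absurd ⟨γ 1 1, by linear_combination h11 - (N * j.val : ℤ) * h10⟩ hℓ1'
  · simp [heckeRep, mul_apply, -ZMod.natCast_val] at h00 h01 h10 h11
    exact absurd ⟨-γ 0 0, by linarith⟩ hℓ1
  · simp [heckeRep, mul_apply, -ZMod.natCast_val] at h00 h01 h10 h11
    have h : ((N * i.val : ℤ) : ZMod ℓ) = ((N * j.val + γ 0 1 * ℓ : ℤ) : ZMod ℓ) :=
      congrArg _ (by linear_combination h01 - (N * j.val : ℤ) * h00)
    push_cast at h
    rw [ZMod.natCast_zmod_val, ZMod.natCast_zmod_val, ZMod.natCast_self, mul_zero, add_zero] at h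
    rw [mul_left_cancel₀ hNℓ h]

/-- Arithmetic conditions on a prime under which `heckeRep` is a system of representatives. -/
structure HeckePrime (N ℓ : ℕ) : Prop where
  prime : ℓ.Prime
  dvd : N ∣ ℓ + 1
  one_lt : 1 < N

variable {N ℓ : ℕ} (H : HeckePrime N ℓ)
include H

theorem HeckePrime.exists_factor (γ : SL(2, ℤ)) (i : Option (ZMod ℓ)) :
    ∃ x : Option (ZMod ℓ) × SL(2, ℤ), heckeRep N ℓ i * (γ : Matrix (Fin 2) (Fin 2) ℤ) =
      (x.2 : Matrix (Fin 2) (Fin 2) ℤ) * heckeRep N ℓ x.1 := by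
  obtain ⟨j, g, h⟩ :=
      exists_eq_mul_heckeRep H.prime H.dvd (heckeRep N ℓ i * (γ : Matrix (Fin 2) (Fin 2) ℤ))
    (by rw [det_mul, det_heckeRep, γ.2, mul_one])
  exact ⟨(j, g), h⟩

/-- The permutation of the Hecke representatives induced by right multiplication by `γ`. -/
noncomputable def HeckePrime.idx (γ : SL(2, ℤ)) (i : Option (ZMod ℓ)) : Option (ZMod ℓ) :=
  (H.exists_factor γ i).choose.1

/-- The matrix `γᵢ` with `βᵢ γ = γᵢ βⱼ`. -/
noncomputable def HeckePrime.factor (γ : SL(2, ℤ)) (i : Option (ZMod ℓ)) : SL(2, ℤ) :=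
  (H.exists_factor γ i).choose.2

theorem HeckePrime.rep_mul (γ : SL(2, ℤ)) (i : Option (ZMod ℓ)) :
    heckeRep N ℓ i * (γ : Matrix (Fin 2) (Fin 2) ℤ) = (H.factor γ i : Matrix (Fin 2) (Fin 2) ℤ) *
      heckeRep N ℓ (H.idx γ i) :=
  (H.exists_factor γ i).choose_spec

theorem HeckePrime.eq_of_mul_eq {i j : Option (ZMod ℓ)} {g g' : SL(2, ℤ)}
    (h : (g : Matrix (Fin 2) (Fin 2) ℤ) * heckeRep N ℓ i =
      (g' : Matrix (Fin 2) (Fin 2) ℤ) * heckeRep N ℓ j) : i = j ∧ g = g' := by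
  have hij : i = j := by
    refine heckeRep_index_unique H.prime H.dvd i j
      ((g⁻¹ * g' : SL(2, ℤ)) : Matrix (Fin 2) (Fin 2) ℤ) ?_
    rw [Matrix.SpecialLinearGroup.coe_mul, mul_assoc, ← h, ← mul_assoc,
        ← Matrix.SpecialLinearGroup.coe_mul]
    simp
  refine ⟨hij, ?_⟩
  subst hij
  have hdet : (heckeRep N ℓ i).det ≠ 0 := by
    rw [det_heckeRep]; exact_mod_cast H.prime.ne_zero
  have h2 := congrArg (· * (heckeRep N ℓ i).adjugate) h
  simp only [Matrix.mul_assoc, mul_adjugate, Matrix.mul_smul, Matrix.mul_one] at h2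
  ext a b
  have := congrFun₂ h2 a b
  simpa [hdet] using this

theorem HeckePrime.factor_mul (γ δ : SL(2, ℤ)) (i : Option (ZMod ℓ)) :
    H.idx (γ * δ) i = H.idx δ (H.idx γ i) ∧
      H.factor (γ * δ) i = H.factor γ i * H.factor δ (H.idx γ i) := by
  refine H.eq_of_mul_eq ?_
  rw [← H.rep_mul, Matrix.SpecialLinearGroup.coe_mul, Matrix.SpecialLinearGroup.coe_mul,
      ← mul_assoc, H.rep_mul,
    mul_assoc, H.rep_mul, mul_assoc]

theorem HeckePrime.idx_bijective (γ : SL(2, ℤ)) : Function.Bijective (H.idx γ) := by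
  have : Fact ℓ.Prime := ⟨H.prime⟩
  refine Function.Injective.bijective_of_finite fun i j hij ↦ ?_
  have h1 := H.rep_mul γ i
  rw [hij] at h1
  have h2 := H.rep_mul γ j
  have h3 : heckeRep N ℓ i * (γ : Matrix (Fin 2) (Fin 2) ℤ) =
      ((H.factor γ i * (H.factor γ j)⁻¹ : SL(2, ℤ)) : Matrix (Fin 2) (Fin 2) ℤ) *
        (heckeRep N ℓ j * (γ : Matrix (Fin 2) (Fin 2) ℤ)) := by
    rw [h1, h2, ← mul_assoc, ← Matrix.SpecialLinearGroup.coe_mul]; simp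
  rw [← mul_assoc] at h3
  refine heckeRep_index_unique H.prime H.dvd i j _ (?_ : _ =
      ((H.factor γ i * (H.factor γ j)⁻¹ : SL(2, ℤ)) : Matrix (Fin 2) (Fin 2) ℤ) * _)
  have h4 := congrArg (· * ((γ⁻¹ : SL(2, ℤ)) : Matrix (Fin 2) (Fin 2) ℤ)) h3
  simp only [mul_assoc _ (γ : Matrix (Fin 2) (Fin 2) ℤ), ← Matrix.SpecialLinearGroup.coe_mul γ,
    mul_inv_cancel] at h4
  rw [Matrix.SpecialLinearGroup.coe_one, mul_one] at h4
  rw [h4, mul_assoc, mul_one]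

theorem HeckePrime.idx_perm_sum {X : Type*} [AddCommMonoid X] [Fintype (Option (ZMod ℓ))]
    (γ : SL(2, ℤ)) (f : Option (ZMod ℓ) → X) : ∑ i, f (H.idx γ i) = ∑ i, f i :=
  (H.idx_bijective γ).sum_comp f

theorem HeckePrime.map_rep {M : ℕ} (hM : M ∣ N) (i : Option (ZMod ℓ)) :
    (heckeRep N ℓ i).map (Int.cast : ℤ → ZMod M) = !![1, 0; 0, -1] := by
  have h1 : (ℓ : ZMod M) = -1 := by
    rw [eq_neg_iff_add_eq_zero]
    exact_mod_cast (ZMod.natCast_eq_zero_iff _ _).mpr (hM.trans H.dvd)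
  have h2 : (N : ZMod M) = 0 := (ZMod.natCast_eq_zero_iff _ _).mpr hM
  ext a b
  rcases i with _ | i <;> fin_cases a <;> fin_cases b <;> simp [heckeRep, h1, h2]

theorem HeckePrime.map_factor {M : ℕ} (hM : M ∣ N) (γ : SL(2, ℤ)) (i : Option (ZMod ℓ)) :
    (H.factor γ i : Matrix (Fin 2) (Fin 2) ℤ).map (Int.cast : ℤ → ZMod M) =
      !![1, 0; 0, -1] * γ.1.map (Int.cast : ℤ → ZMod M) * !![1, 0; 0, -1] := by
  have h := congrArg (fun A : Matrix (Fin 2) (Fin 2) ℤ ↦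
      A.map (Int.castRingHom (ZMod M))) (H.rep_mul γ i)
  simp only [Matrix.map_mul] at h
  change (heckeRep N ℓ i).map (Int.cast : ℤ → ZMod M) * _ =
    _ * (heckeRep N ℓ (H.idx γ i)).map (Int.cast : ℤ → ZMod M) at h
  rw [H.map_rep hM, H.map_rep hM] at h
  change _ = (H.factor γ i : Matrix (Fin 2) (Fin 2) ℤ).map (Int.cast : ℤ → ZMod M) * _ at h
  change _ = !![1, 0; 0, -1] * γ.1.map (Int.castRingHom (ZMod M)) * _
  rw [h, mul_assoc]
  simp [← Matrix.one_fin_two]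

theorem HeckePrime.factor_mem_Gamma {M : ℕ} (hM : M ∣ N) {γ : SL(2, ℤ)}
    (hγ : γ ∈ CongruenceSubgroup.Gamma M) (i : Option (ZMod ℓ)) :
    H.factor γ i ∈ CongruenceSubgroup.Gamma M := by
  rw [CongruenceSubgroup.Gamma_mem'] at hγ ⊢
  ext a b
  have h := congrArg (fun A : SL(2, ZMod M) ↦ (A : Matrix (Fin 2) (Fin 2) (ZMod M))) hγ
  change γ.1.map (Int.cast : ℤ → ZMod M) = 1 at h
  have h2 := H.map_factor hM γ i
  rw [h] at h2
  change ((H.factor γ i : Matrix (Fin 2) (Fin 2) ℤ).map (Int.cast : ℤ → ZMod M)) a b = _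
  rw [h2]
  fin_cases a <;> fin_cases b <;> simp

theorem HeckePrime.factor_div_mem_Gamma {M : ℕ} (hM : M ∣ N) (γ : SL(2, ℤ))
    (i j : Option (ZMod ℓ)) :
    H.factor γ i * (H.factor γ j)⁻¹ ∈ CongruenceSubgroup.Gamma M := by
  rw [CongruenceSubgroup.Gamma_mem', map_mul, map_inv, mul_inv_eq_one]
  ext a b
  change ((H.factor γ i : Matrix (Fin 2) (Fin 2) ℤ).map (Int.cast : ℤ → ZMod M)) a b =
    ((H.factor γ j : Matrix (Fin 2) (Fin 2) ℤ).map (Int.cast : ℤ → ZMod M)) a b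
  rw [H.map_factor hM, H.map_factor hM]

end HeckeReps

end

section

open Matrix MatrixGroups CongruenceSubgroup

section HeckeHom

/-- Additivity of a function on `SL(2, ℤ)` restricted to the principal congruence subgroup. -/
def AddOnGamma {A : Type*} [Add A] (M : ℕ) (φ : SL(2, ℤ) → A) : Prop :=
  ∀ γ ∈ Gamma M, ∀ δ ∈ Gamma M, φ (γ * δ) = φ γ + φ δ

variable {N ℓ : ℕ} (H : HeckePrime N ℓ) [NeZero ℓ] {A : Type*} [AddCommGroup A]

theorem Gamma_le_Gamma {M N : ℕ} (h : M ∣ N) : Gamma N ≤ Gamma M := by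
  intro γ hγ
  rw [Gamma_mem] at hγ ⊢
  have hc : ∀ x y : ℤ, (x : ZMod N) = y → (x : ZMod M) = y := fun x y hxy ↦ by
    rw [ZMod.intCast_eq_intCast_iff_dvd_sub] at hxy ⊢
    exact (Int.natCast_dvd_natCast.mpr h).trans hxy
  have h1 := fun (x : ℤ) (hx : (x : ZMod N) = 1) ↦ hc x 1 (by simpa using hx)
  have h0 := fun (x : ℤ) (hx : (x : ZMod N) = 0) ↦ hc x 0 (by simpa using hx)
  simp only [Int.cast_one, Int.cast_zero] at h0 h1
  exact ⟨h1 _ hγ.1, h0 _ hγ.2.1, h0 _ hγ.2.2.1, h1 _ hγ.2.2.2⟩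

/-- The Hecke operator (transfer) on homomorphisms. -/
noncomputable def HeckePrime.heckeHom (φ : SL(2, ℤ) → A) (γ : SL(2, ℤ)) : A :=
  ∑ i, φ (H.factor γ i)

theorem HeckePrime.addOnGamma_heckeHom {M : ℕ} (hM : M ∣ N) {φ : SL(2, ℤ) → A}
    (hφ : AddOnGamma M φ) : AddOnGamma M (H.heckeHom φ) := by
  intro γ hγ δ hδ
  simp only [heckeHom]
  rw [← H.idx_perm_sum γ (fun i ↦ φ (H.factor δ i)), ← Finset.sum_add_distrib]
  refine Finset.sum_congr rfl fun i _ ↦ ?_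
  rw [(H.factor_mul γ δ i).2]
  exact hφ _ (H.factor_mem_Gamma hM hγ _) _ (H.factor_mem_Gamma hM hδ _)

theorem HeckePrime.heckeHom_eq_zero_of_vanish {p M : ℕ} (hp : p ∣ N) (hM : M ∣ N)
    (hA : ∀ a : A, p • a = 0)
    {φ : SL(2, ℤ) → A} (hφ : AddOnGamma M φ) (hφ0 : ∀ γ ∈ Gamma N, φ γ = 0)
    {γ : SL(2, ℤ)} (hγ : γ ∈ Gamma M) : H.heckeHom φ γ = 0 := by
  have h1 : ∀ i, φ (H.factor γ i) = φ (H.factor γ none) := by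
    intro i
    have h2 := H.factor_div_mem_Gamma (dvd_refl N) γ i none
    have h3 := hφ _ (Gamma_le_Gamma hM h2) _ (H.factor_mem_Gamma hM hγ none)
    rwa [inv_mul_cancel_right, hφ0 _ h2, zero_add] at h3
  rw [heckeHom, Finset.sum_congr rfl fun i _ ↦ h1 i, Finset.sum_const, Finset.card_univ,
    Fintype.card_option, ZMod.card]
  obtain ⟨c, hc⟩ := hp.trans H.dvd
  rw [hc, mul_comm, mul_smul, hA, smul_zero]

end HeckeHom

end

section

section CoeffRing

open PowerSeries

variable {K : Type*} [Field K]

/-- Power series with coefficients in a given subring. -/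
noncomputable def coeffRing (B : Subring K) : Subring K⟦X⟧ := (PowerSeries.map B.subtype).range

theorem mem_coeffRing {B : Subring K} {f : K⟦X⟧} : f ∈ coeffRing B ↔ ∀ n, coeff n f ∈ B := by
  constructor
  · rintro ⟨g, rfl⟩ n
    simp
  · intro h
    exact ⟨PowerSeries.mk fun n ↦ ⟨_, h n⟩, by ext n; simp⟩

theorem coeffRing_mono {B C : Subring K} (h : B ≤ C) : coeffRing B ≤ coeffRing C :=
  fun _ hf ↦ mem_coeffRing.mpr fun n ↦ h (mem_coeffRing.mp hf n)

theorem X_mem_coeffRing (B : Subring K) : (X : K⟦X⟧) ∈ coeffRing B := by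
  refine mem_coeffRing.mpr fun n ↦ ?_
  rw [coeff_X]; split_ifs
  exacts [one_mem _, zero_mem _]

theorem trunc_mem_coeffRing {B : Subring K} {f : K⟦X⟧} {n : ℕ} (h : ∀ k < n, coeff k f ∈ B) :
    ((trunc n f : Polynomial K) : K⟦X⟧) ∈ coeffRing B := by
  refine mem_coeffRing.mpr fun k ↦ ?_
  rw [Polynomial.coeff_coe, coeff_trunc]
  split_ifs with hk
  exacts [h k hk, zero_mem _]

theorem aeval_mem_coeffRing {B : Subring K} {t : K⟦X⟧} (ht : t ∈ coeffRing B)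
    (P : Polynomial (coeffRing B)) : Polynomial.aeval t P ∈ coeffRing B := by
  have h := Polynomial.aeval_algebraMap_apply K⟦X⟧ (⟨t, ht⟩ : coeffRing B) P
  change Polynomial.aeval t P = _ at h
  rw [h]
  exact (Polynomial.aeval (⟨t, ht⟩ : coeffRing B) P).2

theorem aeval_map_inclusion_coeffRing {B C : Subring K} (h : B ≤ C)
    (P : Polynomial (coeffRing B)) (g : K⟦X⟧) :
    Polynomial.aeval g (P.map (Subring.inclusion (coeffRing_mono h))) = Polynomial.aeval g P := by
  rw [Polynomial.aeval_def, Polynomial.eval₂_map, Polynomial.aeval_def]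
  rfl

theorem charZero_powerSeries (K : Type*) [Field K] [CharZero K] : CharZero K⟦X⟧ :=
  charZero_of_injective_ringHom (f := (C : K →+* K⟦X⟧)) C_injective

/-- A series solving a unit-leading fixed point equation over `B` has coefficients in `B`. -/
theorem mem_coeffRing_of_fixed {B : Subring K} {u C D : K⟦X⟧} {P : Polynomial (coeffRing B)}
    (hC : C ∈ coeffRing B) (hD : D ∈ coeffRing B) (hd0 : coeff 0 D ≠ 0) (hd : (coeff 0 D)⁻¹ ∈ B)
    (h : D * u = C + X * Polynomial.aeval u P) : u ∈ coeffRing B := by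
  refine mem_coeffRing.mpr fun n ↦ ?_
  induction n using Nat.strong_induction_on with
  | _ n ih =>
    have ht := trunc_mem_coeffRing ih
    set t : K⟦X⟧ := ((trunc n u : Polynomial K) : K⟦X⟧) with ht_def
    have hdvd : X ^ n ∣ u - t := by
      rw [X_pow_dvd_iff]
      intro m hm
      rw [map_sub, ht_def, Polynomial.coeff_coe, coeff_trunc, if_pos hm, sub_self]
    have hPt : Polynomial.aeval t P ∈ coeffRing B :=
      aeval_mem_coeffRing ht P
    have hdP : X ^ n ∣ Polynomial.aeval u P - Polynomial.aeval t P := by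
      simp only [Polynomial.aeval_def, ← Polynomial.eval_map]
      exact hdvd.trans (Polynomial.sub_dvd_eval_sub _ _ _)
    have h1 : coeff n (X * Polynomial.aeval u P) ∈ B := by
      cases n with
      | zero => simp [zero_mem]
      | succ k =>
        rw [coeff_succ_X_mul]
        have := (X_pow_dvd_iff.mp hdP) k (Nat.lt_succ_self k)
        rw [map_sub, sub_eq_zero] at this
        rw [this]
        exact mem_coeffRing.mp hPt k
    have h2 := congrArg (coeff n) h
    rw [coeff_mul, map_add] at h2
    have h3 : ∑ x ∈ (Finset.HasAntidiagonal.antidiagonal n).erase (0, n),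
        coeff x.1 D * coeff x.2 u ∈ B := by
      refine sum_mem fun x hx ↦ mul_mem (mem_coeffRing.mp hD _) (ih _ ?_)
      rw [Finset.mem_erase, Finset.HasAntidiagonal.mem_antidiagonal] at hx
      rcases x with ⟨a, b⟩
      have : a ≠ 0 := by
        rintro rfl
        simp at hx
      simp only at hx ⊢
      omega
    have hmem : (0, n) ∈ Finset.HasAntidiagonal.antidiagonal n := by simp
    rw [← Finset.add_sum_erase _ _ hmem] at h2
    have h4 : coeff n u = (coeff 0 D)⁻¹ * (coeff n C + coeff n (X * Polynomial.aeval u P)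
        - ∑ x ∈ (Finset.HasAntidiagonal.antidiagonal n).erase (0, n),
          coeff x.1 D * coeff x.2 u) := by
      rw [eq_inv_mul_iff_mul_eq₀ hd0, ← h2]
      ring
    rw [h4]
    exact mul_mem hd (sub_mem (add_mem (mem_coeffRing.mp hC _) h1) h3)

/-- The coefficients of a power series that is algebraic over series with coefficients in a
finitely generated ring lie in a finitely generated ring. -/
theorem exists_finite_coeff_of_algebraic [CharZero K] {S : Finset K} {A : Subring K}
    (hA : A = Subring.closure (S : Set K)) {f : K⟦X⟧}
    (hex' : ∃ Q : Polynomial (coeffRing A), Q ≠ 0 ∧ Polynomial.aeval f Q = 0) :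
    ∃ T : Finset K, f ∈ coeffRing (Subring.closure (T : Set K)) := by
  classical
  have := charZero_powerSeries K
  have hex : ∃ d, ∃ Q : Polynomial (coeffRing A), Q ≠ 0 ∧ Polynomial.aeval f Q = 0 ∧
      Q.natDegree = d := by
    obtain ⟨Q, h, h'⟩ := hex'
    exact ⟨_, Q, h, h', rfl⟩
  obtain ⟨P, hP0, hP, hPd⟩ := Nat.find_spec hex
  have hmin : ∀ P' : Polynomial (coeffRing A), P' ≠ 0 → P'.natDegree < P.natDegree →
      Polynomial.aeval f P' ≠ 0 := by
    intro P' h0 hd h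
    rw [hPd] at hd
    exact Nat.find_min hex hd ⟨P', h0, h, rfl⟩
  have hdeg : P.natDegree ≠ 0 := by
    intro h
    rw [Polynomial.natDegree_eq_zero] at h
    obtain ⟨c, rfl⟩ := h
    rw [Polynomial.aeval_C] at hP
    have : c = 0 := Subtype.ext hP
    exact hP0 (by rw [this, map_zero])
  have : IsAddTorsionFree (coeffRing A) :=
    Function.Injective.isAddTorsionFree (coeffRing A).subtype.toAddMonoidHom
      Subtype.val_injective
  have hder0 : P.derivative ≠ 0 := fun h ↦ hdeg (Polynomial.derivative_eq_zero.mp h)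
  have hPf := hmin _ hder0 (Polynomial.natDegree_derivative_lt hdeg)
  set r := (Polynomial.aeval f P.derivative).order.toNat with hr
  have hr' : (Polynomial.aeval f P.derivative).order = r := by
    rw [hr, ENat.natCast_toNat]
    rwa [Ne, order_eq_top]
  set t : K⟦X⟧ := ((trunc (r + 1) f : Polynomial K) : K⟦X⟧) with ht
  set u : K⟦X⟧ := PowerSeries.mk fun i ↦ coeff (i + (r + 1)) f with hu
  have hf : f = t + X ^ (r + 1) * u := by
    rw [add_comm]; exact eq_X_pow_mul_shift_add_trunc (r + 1) f
  obtain ⟨T, A1, hA1, hAA1, ht1⟩ : ∃ (T : Finset K) (A1 : Subring K),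
      A1 = Subring.closure (T : Set K) ∧ A ≤ A1 ∧ t ∈ coeffRing A1 := by
    refine ⟨S ∪ (Finset.range (r + 1)).image fun k ↦ coeff k f, _, rfl, ?_, ?_⟩
    · rw [hA]; exact Subring.closure_mono (by simp)
    · refine trunc_mem_coeffRing fun k hk ↦ Subring.subset_closure ?_
      simp only [Finset.coe_union, Finset.coe_image, Set.mem_union]
      exact Or.inr ⟨k, by simpa using hk, rfl⟩
  set Q1 : Polynomial (coeffRing A1) := P.map (Subring.inclusion (coeffRing_mono hAA1)) with hQ1
  have haev : ∀ g : K⟦X⟧, Polynomial.aeval g Q1 = Polynomial.aeval g P :=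
    aeval_map_inclusion_coeffRing hAA1 P
  have haev' : ∀ g : K⟦X⟧, Polynomial.aeval g Q1.derivative = Polynomial.aeval g P.derivative := by
    intro g
    rw [hQ1, Polynomial.derivative_map]
    exact aeval_map_inclusion_coeffRing hAA1 _ g
  set t' : coeffRing A1 := ⟨t, ht1⟩
  set X' : coeffRing A1 := ⟨X, X_mem_coeffRing _⟩
  obtain ⟨Y, hY⟩ : ∃ Y : Polynomial (coeffRing A1),
    Y = Polynomial.C (X' ^ (r + 1)) * Polynomial.X := ⟨_, rfl⟩
  obtain ⟨k, hk⟩ := Polynomial.binomExpansion (Q1.map Polynomial.C) (Polynomial.C t') Y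
  have hk2 : Polynomial.aeval f Q1 = Polynomial.aeval t Q1 +
      Polynomial.aeval t Q1.derivative * (X ^ (r + 1) * u) +
      Polynomial.aeval u k * (X ^ (r + 1) * u) ^ 2 := by
    have h := congrArg (Polynomial.aeval u) hk
    have e1 : ∀ (R : Polynomial (coeffRing A1)) (y : Polynomial (coeffRing A1)),
        Polynomial.aeval u (Polynomial.eval y (R.map Polynomial.C)) =
        Polynomial.aeval (Polynomial.aeval u y) R := by
      intro R y
      rw [Polynomial.eval_map, Polynomial.aeval_def (R := coeffRing A1) _ R]
      have := Polynomial.hom_eval₂ R (Polynomial.C)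
        (Polynomial.aeval (R := coeffRing A1) u).toRingHom y
      refine this.trans ?_
      congr 1
      ext x
      simp
    have e2 : Polynomial.aeval u (Polynomial.C t') = t := by
      rw [Polynomial.aeval_C]; rfl
    have e3 : Polynomial.aeval u Y = X ^ (r + 1) * u := by
      rw [hY, map_mul, Polynomial.aeval_C, Polynomial.aeval_X]; rfl
    rw [Polynomial.derivative_map, e1, map_add, map_add, map_add, map_mul, map_mul, map_pow, e1, e1,
      e2, e3, ← hf] at h
    exact h
  rw [haev, hP] at hk2
  have hdvd : X ^ (r + 1) ∣ Polynomial.aeval f P.derivative - Polynomial.aeval t P.derivative := by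
    simp only [Polynomial.aeval_def, ← Polynomial.eval_map]
    refine Dvd.dvd.trans ?_ (Polynomial.sub_dvd_eval_sub _ _ _)
    exact ⟨u, by rw [hf]; ring⟩
  have hcoef : ∀ m ≤ r, coeff m (Polynomial.aeval t P.derivative) =
      coeff m (Polynomial.aeval f P.derivative) := by
    intro m hm
    have := (X_pow_dvd_iff.mp hdvd) m (Nat.lt_succ_of_le hm)
    rw [map_sub, sub_eq_zero] at this
    exact this.symm
  obtain ⟨D, hD⟩ : X ^ r ∣ Polynomial.aeval t Q1.derivative := by
    rw [X_pow_dvd_iff]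
    intro m hm
    rw [haev', hcoef m hm.le]
    exact coeff_of_lt_order m (by rw [hr']; exact_mod_cast hm)
  have hD0 : coeff 0 D ≠ 0 := by
    have h1 : coeff r (Polynomial.aeval t Q1.derivative) ≠ 0 := by
      rw [haev', hcoef r le_rfl, hr]
      exact coeff_order hPf
    rw [hD] at h1
    have := coeff_X_pow_mul D r 0
    rw [zero_add] at this
    rwa [this] at h1
  have hDmem : D ∈ coeffRing A1 := by
    refine mem_coeffRing.mpr fun n ↦ ?_
    rw [← coeff_X_pow_mul D r n, ← hD]
    exact mem_coeffRing.mp (aeval_mem_coeffRing ht1 _) _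
  set Cs : K⟦X⟧ := -(D * u + X * (Polynomial.aeval u k * u ^ 2)) with hCs
  have hC : Polynomial.aeval t Q1 = X ^ (2 * r + 1) * Cs := by
    rw [hD] at hk2
    have : Polynomial.aeval t Q1 = - (X ^ r * D * (X ^ (r + 1) * u) +
      Polynomial.aeval u k * (X ^ (r + 1) * u) ^ 2) := by linear_combination -hk2
    rw [this, hCs]; ring
  have hCmem : Cs ∈ coeffRing A1 := by
    refine mem_coeffRing.mpr fun n ↦ ?_
    rw [← coeff_X_pow_mul Cs (2 * r + 1) n, ← hC]
    exact mem_coeffRing.mp (aeval_mem_coeffRing ht1 _) _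
  refine ⟨insert (coeff 0 D)⁻¹ T, ?_⟩
  have hle : A1 ≤ Subring.closure ((insert (coeff 0 D)⁻¹ T : Finset K) : Set K) := by
    rw [hA1]; exact Subring.closure_mono (by simp)
  set A2 := Subring.closure ((insert (coeff 0 D)⁻¹ T : Finset K) : Set K) with hA2
  have hu2 : u ∈ coeffRing A2 := by
    refine mem_coeffRing_of_fixed (D := D) (C := -Cs)
      (P := -((k * Polynomial.X ^ 2).map (Subring.inclusion (coeffRing_mono hle))))
      (neg_mem (coeffRing_mono hle hCmem)) (coeffRing_mono hle hDmem) hD0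
      (Subring.subset_closure (by simp)) ?_
    rw [map_neg, aeval_map_inclusion_coeffRing hle, map_mul, map_pow, Polynomial.aeval_X, hCs]
    ring
  rw [hf]
  exact add_mem (coeffRing_mono hle ht1) (mul_mem (pow_mem (X_mem_coeffRing _) _) hu2)
end CoeffRing

end

section

section GradedForms

open PowerSeries

variable {K : Type*} [Field K]

theorem linearIndependent_of_order {ι : Type*} {e : ι → K⟦X⟧} {o : ι → ℕ}
    (ho : Function.Injective o) (h' : ∀ i, (e i).order = o i) : LinearIndependent K e := by
  classical
  have h0 := fun i ↦ (order_eq_nat.mp (h' i)).1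
  have h := fun i ↦ (order_eq_nat.mp (h' i)).2
  rw [linearIndependent_iff']
  intro s g hg
  by_contra! hne
  have hne' : (s.filter fun i ↦ g i ≠ 0).Nonempty := by
    obtain ⟨i, hi, hi'⟩ := hne
    exact ⟨i, Finset.mem_filter.mpr ⟨hi, hi'⟩⟩
  obtain ⟨i, hi, hmin⟩ := Finset.exists_min_image _ o hne'
  rw [Finset.mem_filter] at hi
  have h1 := congrArg (coeff (o i)) hg
  rw [map_sum, Finset.sum_eq_single i] at h1
  · rw [map_smul, map_zero, smul_eq_mul, mul_eq_zero] at h1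
    exact h1.elim hi.2 (h0 i)
  · intro j hj hji
    rw [map_smul, smul_eq_mul]
    by_cases hgj : g j = 0
    · rw [hgj, zero_mul]
    · rw [h j _ (lt_of_le_of_ne (hmin j (Finset.mem_filter.mpr ⟨hj, hgj⟩))
        (fun h' ↦ hji (ho h').symm)), mul_zero]
  · exact fun h' ↦ absurd hi.1 h'

theorem finrank_le_of_coeff {V : Submodule K K⟦X⟧} {r : ℕ}
    (h : ∀ f ∈ V, (∀ n < r, coeff n f = 0) → f = 0) :
    FiniteDimensional K V ∧ Module.finrank K V ≤ r := by
  let L : V →ₗ[K] (Fin r → K) :=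
    LinearMap.pi fun n ↦ (coeff (n : ℕ)).comp V.subtype
  have hL : Function.Injective L := by
    rw [← LinearMap.ker_eq_bot, LinearMap.ker_eq_bot']
    intro f hf
    refine Subtype.ext (h f f.2 fun n hn ↦ ?_)
    exact congrFun hf ⟨n, hn⟩
  refine ⟨FiniteDimensional.of_injective L hL, ?_⟩
  simpa using LinearMap.finrank_le_finrank_of_injective hL

/-- Linearly independent series have a nonvanishing minor of coefficients. -/
theorem exists_minor_ne_zero {n : ℕ} {e : Fin n → K⟦X⟧} (he : LinearIndependent K e) :
    ∃ c : Fin n → ℕ, (Matrix.of fun i j ↦ coeff (c j) (e i)).det ≠ 0 := by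
  classical
  let v : ℕ → (Fin n → K) := fun k i ↦ coeff k (e i)
  have hspan : Submodule.span K (Set.range v) = ⊤ := by
    by_contra hne
    obtain ⟨f, hf0, hf⟩ := Submodule.exists_le_ker_of_lt_top _ (lt_top_iff_ne_top.mpr hne)
    refine hf0 ?_
    have h1 : ∀ k, f (v k) = 0 := fun k ↦ hf (Submodule.subset_span ⟨k, rfl⟩)
    have h2 : ∑ i, f (Pi.single i 1) • e i = 0 := by
      ext k
      rw [map_sum, map_zero, ← h1 k]
      conv_rhs => rw [← LinearMap.sum_single_apply (v := v k), map_sum]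
      refine Finset.sum_congr rfl fun i _ ↦ ?_
      have : LinearMap.single K (fun _ : Fin n ↦ K) i (v k i) = v k i • Pi.single i (1 : K) := by
        rw [← Pi.single_smul]; simp
      rw [map_smul, smul_eq_mul, mul_comm]
      simp only [LinearMap.coe_single] at this
      rw [this, map_smul, smul_eq_mul]
    have h3 := Fintype.linearIndependent_iff.mp he _ h2
    refine LinearMap.pi_ext' fun i ↦ LinearMap.ext_ring ?_
    simpa using h3 i
  obtain ⟨κ, a, ha, hspan', hli⟩ := exists_linearIndependent' K v
  rw [hspan] at hspan'
  let b := Module.Basis.mk hli hspan'.ge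
  let eq := b.indexEquiv (Pi.basisFun K (Fin n))
  refine ⟨fun j ↦ a (eq.symm j), ?_⟩
  rw [← Matrix.det_transpose, ← isUnit_iff_ne_zero, ← Matrix.isUnit_iff_isUnit_det,
    ← Matrix.linearIndependent_rows_iff_isUnit]
  exact hli.comp _ eq.symm.injective

theorem exists_linear_gap {d : ℕ → ℕ} {α : ℕ} (h1 : ∀ s, d s ≤ α * s + 1)
    (h2 : ∀ s, s + 1 ≤ d s) :
    ∃ (c C : ℝ) (s : ℕ), 0 ≤ c ∧ (∀ s, (d s : ℝ) ≤ c * s + C) ∧ c * (s + 1) + 1 < 2 * d s := by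
  set T : Set ℝ := {c | ∃ C : ℝ, ∀ s, (d s : ℝ) ≤ c * s + C} with hT
  have hne : T.Nonempty := ⟨α, 1, fun s ↦ by exact_mod_cast h1 s⟩
  have hlb : ∀ c ∈ T, (1 : ℝ) ≤ c := by
    rintro c ⟨C, hC⟩
    by_contra! hc
    obtain ⟨s, hs⟩ := exists_nat_gt ((C - 1) / (1 - c))
    rw [div_lt_iff₀ (by linarith)] at hs
    have h3 : ((s : ℝ) + 1) ≤ d s := by exact_mod_cast h2 s
    linarith [hC s]
  have hinf : 1 ≤ sInf T := le_csInf hne hlb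
  obtain ⟨c, hc, hc'⟩ := exists_lt_of_csInf_lt hne (show sInf T < 4 / 3 * sInf T by linarith)
  have hcT : 3 * c / 4 ∉ T := fun h ↦ by
    have := csInf_le ⟨1, fun x hx ↦ hlb x hx⟩ h
    linarith
  rw [hT, Set.mem_ofPred_eq] at hcT
  push Not at hcT
  obtain ⟨s, hs⟩ := hcT (c + 1)
  obtain ⟨C, hC⟩ := hc
  have hc1 := hlb c ⟨C, hC⟩
  refine ⟨c, C, s, by linarith, hC, ?_⟩
  have : 0 ≤ c * (s : ℝ) := by positivity
  linarith

/-- A graded ring of power series of linear growth (abstracting modular forms of weight `12 s`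
with the characters `ζ ^ j`). -/
structure GradedForms (p : ℕ) (M : ℕ → ZMod p → Submodule K K⟦X⟧) (x₀ x₁ : K⟦X⟧) : Prop where
  one_mem : 1 ∈ M 0 0
  mul_mem : ∀ {s t i j f g}, f ∈ M s i → g ∈ M t j → f * g ∈ M (s + t) (i + j)
  sturm : ∃ α : ℕ, ∀ s, ∀ f ∈ M s 0, (∀ n ≤ α * s, coeff n f = 0) → f = 0
  x₀_mem : x₀ ∈ M 1 0
  x₁_mem : x₁ ∈ M 1 0
  order_x₀ : x₀.order = 0
  order_x₁ : x₁.order = 1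

namespace GradedForms

variable {p : ℕ} {M : ℕ → ZMod p → Submodule K K⟦X⟧} {x₀ x₁ : K⟦X⟧} (H : GradedForms p M x₀ x₁)
include H

theorem pow_mem {s i f} (hf : f ∈ M s i) (n : ℕ) : f ^ n ∈ M (n * s) (n * i) := by
  induction n with
  | zero => simpa using H.one_mem
  | succ n ih =>
    rw [pow_succ]
    convert H.mul_mem ih hf using 2 <;> push_cast <;> ring

theorem mono_mem {s i f} (hf : f ∈ M s i) (a b : ℕ) : f * x₀ ^ a * x₁ ^ b ∈ M (s + a + b) i := by
  have h := H.mul_mem (H.mul_mem hf (H.pow_mem H.x₀_mem a)) (H.pow_mem H.x₁_mem b)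
  simpa using h

theorem order_mono (f : K⟦X⟧) (a b : ℕ) : (f * x₀ ^ a * x₁ ^ b).order = f.order + b := by
  rw [order_mul, order_mul, order_pow, order_pow, H.order_x₀, H.order_x₁]
  simp

theorem finrank_le : ∃ α : ℕ, ∀ s, FiniteDimensional K (M s 0) ∧
    Module.finrank K (M s 0) ≤ α * s + 1 := by
  obtain ⟨α, hα⟩ := H.sturm
  exact ⟨α, fun s ↦ finrank_le_of_coeff fun f hf h ↦ hα s f hf fun n hn ↦ h n (by omega)⟩

theorem le_finrank (s : ℕ) : s + 1 ≤ Module.finrank K (M s 0) := by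
  obtain ⟨α, hα⟩ := H.finrank_le
  have := (hα s).1
  let e : Fin (s + 1) → M s 0 := fun i ↦ ⟨1 * x₀ ^ (s - i) * x₁ ^ (i : ℕ), by
    convert H.mono_mem H.one_mem (s - i) i using 2
    have := i.2
    omega⟩
  have he : LinearIndependent K e := by
    refine LinearIndependent.of_comp (M s 0).subtype ?_
    refine linearIndependent_of_order (o := fun i : Fin (s + 1) ↦ (i : ℕ)) Fin.val_injective
      fun i ↦ ?_
    change (1 * x₀ ^ (s - i) * x₁ ^ (i : ℕ)).order = _
    rw [H.order_mono, order_one, zero_add]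
  simpa using he.fintype_card_le_finrank

/-- The coefficients of a form lie in a finitely generated ring. -/
theorem exists_finite_coeff [CharZero K] {S : Finset K}
    (h0 : x₀ ∈ coeffRing (Subring.closure (S : Set K)))
    (h1 : x₁ ∈ coeffRing (Subring.closure (S : Set K))) {t : ℕ} {f : K⟦X⟧} (hf : f ∈ M t 0) :
    ∃ T : Finset K, f ∈ coeffRing (Subring.closure (T : Set K)) := by
  classical
  obtain ⟨α, hα⟩ := H.finrank_le
  set m := α ^ 2 * t + 1 with hm
  set n := t * α + m with hn
  have := (hα n).1
  have hmem : ∀ i : Fin (α + 1) × Fin (m + 1),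
      f ^ (i.1 : ℕ) * x₀ ^ (n - t * i.1 - i.2) * x₁ ^ (i.2 : ℕ) ∈ M n 0 := by
    intro i
    convert H.mono_mem (H.pow_mem hf i.1) (n - t * i.1 - i.2) i.2 using 2
    · have h1 := Nat.mul_le_mul_left t (Nat.lt_succ_iff.mp i.1.2)
      have h2 := i.2.2
      rw [mul_comm (i.1 : ℕ) t]
      omega
    · simp
  have hdep : ¬ LinearIndependent K (fun i : Fin (α + 1) × Fin (m + 1) ↦
      f ^ (i.1 : ℕ) * x₀ ^ (n - t * i.1 - i.2) * x₁ ^ (i.2 : ℕ)) := by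
    intro hli
    have hli' : LinearIndependent K (fun i : Fin (α + 1) × Fin (m + 1) ↦ (⟨_, hmem i⟩ : M n 0)) :=
      LinearIndependent.of_comp (M n 0).subtype hli
    have h3 := hli'.fintype_card_le_finrank.trans (hα n).2
    simp only [Fintype.card_prod, Fintype.card_fin] at h3
    rw [hn, hm] at h3
    nlinarith
  rw [Fintype.not_linearIndependent_iff] at hdep
  obtain ⟨g, hg, ⟨i₀, l₀⟩, hi₀⟩ := hdep
  set T : Finset K := S ∪ Finset.univ.image g with hT
  set A := Subring.closure (T : Set K) with hA
  have hSA : Subring.closure (S : Set K) ≤ A := Subring.closure_mono (by simp [hT])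
  have hgA : ∀ i, g i ∈ A := fun i ↦ Subring.subset_closure (by simp [hT])
  have hC : ∀ c ∈ A, (C c : K⟦X⟧) ∈ coeffRing A := fun c hc ↦ by
    refine mem_coeffRing.mpr fun k ↦ ?_
    rw [coeff_C]; split_ifs
    exacts [hc, zero_mem _]
  let q : Fin (α + 1) → K⟦X⟧ := fun i ↦
    ∑ l : Fin (m + 1), C (g (i, l)) * (x₀ ^ (n - t * i - l) * x₁ ^ (l : ℕ))
  have hq : ∀ i, q i ∈ coeffRing A :=
      fun i ↦ Subring.sum_mem _ fun l _ ↦ Subring.mul_mem _ (hC _ (hgA _))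
    (Subring.mul_mem _ (Subring.pow_mem _ (coeffRing_mono hSA h0) _)
      (Subring.pow_mem _ (coeffRing_mono hSA h1) _))
  refine exists_finite_coeff_of_algebraic (S := T) hA
    ⟨∑ i : Fin (α + 1), Polynomial.monomial (i : ℕ) (⟨q i, hq i⟩ : coeffRing A), ?_, ?_⟩
  · intro h
    have h4 := congrArg (fun P ↦ P.coeff (i₀ : ℕ)) h
    simp only [Polynomial.finsetSum_coeff, Polynomial.coeff_monomial, Polynomial.coeff_zero] at h4
    rw [Finset.sum_eq_single i₀ (fun j _ hj ↦ if_neg fun h ↦ hj (Fin.ext h)) (by simp),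
      if_pos rfl] at h4
    have h5 : q i₀ = 0 := congrArg Subtype.val h4
    have hli : LinearIndependent K (fun l : Fin (m + 1) ↦
        1 * x₀ ^ (n - t * i₀ - l) * x₁ ^ (l : ℕ)) :=
      linearIndependent_of_order (o := fun l : Fin (m + 1) ↦ (l : ℕ)) Fin.val_injective fun l ↦ by
        rw [H.order_mono, order_one, zero_add]
    refine hi₀ (Fintype.linearIndependent_iff.mp hli (fun l ↦ g (i₀, l)) ?_ l₀)
    rw [← h5]
    refine Finset.sum_congr rfl fun l _ ↦ ?_
    rw [smul_eq_C_mul, one_mul]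
  · rw [map_sum, ← hg, Fintype.sum_prod_type]
    refine Finset.sum_congr rfl fun i _ ↦ ?_
    rw [Polynomial.aeval_monomial]
    change q i * _ = _
    rw [Finset.sum_mul]
    refine Finset.sum_congr rfl fun l _ ↦ ?_
    rw [smul_eq_C_mul]
    ring

end GradedForms
end GradedForms

end

section

section Reduction

open PowerSeries

variable {K : Type*} [Field K]

theorem exists_finite_coeff_of_pow [CharZero K] {n : ℕ} (hn : n ≠ 0) {f : K⟦X⟧} {S : Finset K}
    (h : f ^ n ∈ coeffRing (Subring.closure (S : Set K))) :
    ∃ T : Finset K, f ∈ coeffRing (Subring.closure (T : Set K)) := by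
  refine exists_finite_coeff_of_algebraic (S := S) rfl
    ⟨Polynomial.X ^ n - Polynomial.C ⟨f ^ n, h⟩, Polynomial.X_pow_sub_C_ne_zero
      (Nat.pos_of_ne_zero hn) _, ?_⟩
  rw [map_sub, map_pow, Polynomial.aeval_X, Polynomial.aeval_C]
  exact sub_self _

theorem linearIndependent_of_minor {n : ℕ} {e : Fin n → K⟦X⟧} {c : Fin n → ℕ}
    (h : (Matrix.of fun i j ↦ coeff (c j) (e i)).det ≠ 0) : LinearIndependent K e := by
  rw [← isUnit_iff_ne_zero, ← Matrix.isUnit_iff_isUnit_det,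
    ← Matrix.linearIndependent_rows_iff_isUnit] at h
  let L : K⟦X⟧ →ₗ[K] (Fin n → K) := LinearMap.pi fun j ↦ coeff (c j)
  refine LinearIndependent.of_comp L ?_
  exact h

theorem map_det_coeff {R L : Type*} [CommRing R] [Field L] (g : R →+* L) {n : ℕ}
    (e : Fin n → R⟦X⟧) (c : Fin n → ℕ) :
    (Matrix.of fun i j ↦ coeff (c j) (PowerSeries.map g (e i))).det =
      g (Matrix.of fun i j ↦ coeff (c j) (e i)).det := by
  rw [RingHom.map_det]
  congr 1

/-- Linear independence of a reduction implies linear independence. -/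
theorem linearIndependent_of_map {R L : Type*} [CommRing R] [Field L] {g : R →+* K} {χ : R →+* L}
    (hg : Function.Injective g) {ι : Type*} [Fintype ι] {e : ι → R⟦X⟧}
    (h : LinearIndependent L fun i ↦ PowerSeries.map χ (e i)) :
    LinearIndependent K fun i ↦ PowerSeries.map g (e i) := by
  classical
  let q := Fintype.equivFin ι
  have h' : LinearIndependent L (fun i ↦ PowerSeries.map χ (e (q.symm i))) :=
    h.comp _ q.symm.injective
  obtain ⟨c, hc⟩ := exists_minor_ne_zero h'
  rw [map_det_coeff χ (fun i ↦ e (q.symm i))] at hc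
  have hd : g (Matrix.of fun i j ↦ coeff (c j) (e (q.symm i))).det ≠ 0 := by
    rw [Ne, map_eq_zero_iff g hg]
    exact fun h0 ↦ hc (by rw [h0, map_zero])
  rw [← map_det_coeff] at hd
  have h2 := (linearIndependent_of_minor hd).comp _ q.injective
  simpa [Function.comp_def] using h2

/-- A reduction of series with few coefficients admits a combination of high order. -/
theorem exists_combination_high_order {R L : Type*} [CommRing R] [Field L] (χ : R →+* L)
    {n r : ℕ} (hr : r < n) (e : Fin n → R⟦X⟧)
    (he : LinearIndependent L fun i ↦ PowerSeries.map χ (e i)) :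
    ∃ y : Fin n → R, PowerSeries.map χ (∑ i, C (y i) * e i) ≠ 0 ∧
      ∀ k < r, coeff k (PowerSeries.map χ (∑ i, C (y i) * e i)) = 0 := by
  let T : (Fin n → χ.range) →ₗ[χ.range] (Fin r → χ.range) :=
    LinearMap.pi fun k ↦ ∑ i, (χ.rangeRestrict (coeff (k : ℕ) (e i))) • LinearMap.proj i
  have hT : ¬ Function.Injective T := fun h ↦ hr.not_ge (le_of_fin_injective _ T h)
  rw [← LinearMap.ker_eq_bot, LinearMap.ker_eq_bot'] at hT
  push Not at hT
  obtain ⟨x, hx, hx0⟩ := hT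
  have hy : ∀ i, ∃ y, χ.rangeRestrict y = x i := fun i ↦ χ.rangeRestrict_surjective (x i)
  choose y hy using hy
  have hy' : ∀ i, χ (y i) = (x i : L) := fun i ↦ congrArg Subtype.val (hy i)
  have hsum : PowerSeries.map χ (∑ i, C (y i) * e i) =
      ∑ i, (x i : L) • PowerSeries.map χ (e i) := by
    rw [map_sum]
    refine Finset.sum_congr rfl fun i _ ↦ ?_
    rw [map_mul, map_C, hy', smul_eq_C_mul]
  refine ⟨y, fun h ↦ hx0 ?_, fun k hk ↦ ?_⟩
  · rw [hsum] at h
    ext i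
    exact Fintype.linearIndependent_iff.mp he _ h i
  · have h1 := congrArg Subtype.val (congrFun hx ⟨k, hk⟩)
    simp only [T, LinearMap.pi_apply, LinearMap.sum_apply, LinearMap.smul_apply,
      LinearMap.proj_apply, smul_eq_mul, AddSubmonoidClass.coe_finsetSum, Subring.coe_mul,
      Pi.zero_apply] at h1
    rw [hsum, map_sum]
    refine Eq.trans (Finset.sum_congr rfl fun i _ ↦ ?_) h1
    rw [map_smul, smul_eq_mul, coeff_map, mul_comm]
    rfl

namespace GradedForms

variable {p : ℕ} {M : ℕ → ZMod p → Submodule K K⟦X⟧} {x₀ x₁ : K⟦X⟧} (H : GradedForms p M x₀ x₁)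
include H

theorem linearIndependent_sum {s d : ℕ} {u : Fin d → K⟦X⟧} (hu : LinearIndependent K u)
    (huM : ∀ i, u i ∈ M s 0) {h : K⟦X⟧} (hh : h ∈ M 1 1) (h0 : h ≠ 0)
    (hdisj : M (s + 1) 0 ⊓ M (s + 1) 1 = ⊥) :
    LinearIndependent K (Sum.elim (fun i ↦ u i * x₀) (fun i ↦ u i * h)) := by
  have hx0 : x₀ ≠ 0 := fun h ↦ by simpa [h] using H.order_x₀
  have key : ∀ z : K⟦X⟧, z ≠ 0 → LinearIndependent K (fun i ↦ u i * z) := by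
    intro z hz
    have := hu.map' (LinearMap.mulRight K z) (by
      rw [LinearMap.ker_eq_bot]
      exact mul_left_injective₀ hz)
    simpa [Function.comp_def] using this
  refine (key x₀ hx0).sum_type (key h h0) ?_
  rw [Submodule.disjoint_def]
  intro x h1 h2
  have h1' : x ∈ M (s + 1) 0 := by
    refine (Submodule.span_le.mpr ?_) h1
    rintro _ ⟨i, rfl⟩
    simpa using H.mul_mem (huM i) H.x₀_mem
  have h2' : x ∈ M (s + 1) 1 := by
    refine (Submodule.span_le.mpr ?_) h2
    rintro _ ⟨i, rfl⟩
    simpa using H.mul_mem (huM i) hh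
  rw [← Submodule.mem_bot K, ← hdisj]
  exact ⟨h1', h2'⟩

/-- The form of trivial character reducing to `(a + b) ^ i * w ^ (p - 1)`. -/
theorem exists_lift_pow [NeZero p] {R L : Type*} [CommRing R] [Field L] (g : R →+* K)
    (χ : R →+* L) {t κ : ℕ} {a b v w : R⟦X⟧} (ha : PowerSeries.map g a ∈ M t 0)
    (hb : PowerSeries.map g b ∈ M t 1) (hv : PowerSeries.map g v ∈ M κ 1)
    (hw : PowerSeries.map g w ∈ M κ 0) (hvw : PowerSeries.map χ v = PowerSeries.map χ w) (i : ℕ) :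
    ∃ G : R⟦X⟧, PowerSeries.map g G ∈ M (t * i + (p - 1) * κ) 0 ∧
      PowerSeries.map χ G = PowerSeries.map χ (a + b) ^ i * PowerSeries.map χ w ^ (p - 1) := by
  let n : ℕ → ℕ := fun j ↦ (-(j : ZMod p)).val
  have hn : ∀ j, n j ≤ p - 1 := fun j ↦ Nat.le_sub_one_of_lt (ZMod.val_lt _)
  refine ⟨∑ j ∈ Finset.range (i + 1), a ^ j * b ^ (i - j) * (i.choose j) *
    (w ^ (p - 1 - n (i - j)) * v ^ n (i - j)), ?_, ?_⟩
  · rw [map_sum]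
    refine Submodule.sum_mem _ fun j hj ↦ ?_
    have hji : j ≤ i := Nat.lt_succ_iff.mp (Finset.mem_range.mp hj)
    have h1 := H.mul_mem (H.mul_mem (H.pow_mem ha j) (H.pow_mem hb (i - j)))
      (H.mul_mem (H.pow_mem hw (p - 1 - n (i - j))) (H.pow_mem hv (n (i - j))))
    have e1 : j * t + (i - j) * t + ((p - 1 - n (i - j)) * κ + n (i - j) * κ) =
        t * i + (p - 1) * κ := by
      rw [← add_mul, ← add_mul, Nat.add_sub_cancel' hji, Nat.sub_add_cancel (hn _), mul_comm i]
    have e2 : (j : ZMod p) * 0 + ((i - j : ℕ) : ZMod p) * 1 +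
        (((p - 1 - n (i - j) : ℕ) : ZMod p) * 0 + ((n (i - j) : ℕ) : ZMod p) * 1) = 0 := by
      simp only [n, ZMod.natCast_val, ZMod.cast_id', id_eq]
      ring
    rw [e1, e2] at h1
    have h2 := Submodule.smul_mem _ ((i.choose j : ℕ) : K) h1
    convert h2 using 1
    rw [smul_eq_C_mul]
    simp only [map_mul, map_pow, map_natCast]
    ring
  · rw [map_sum, map_add, add_pow, Finset.sum_mul]
    refine Finset.sum_congr rfl fun j _ ↦ ?_
    simp only [map_mul, map_pow, map_natCast, hvw]
    rw [← pow_add, Nat.sub_add_cancel (hn _)]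

/-- Counting forms: a reduction of high order bounds the growth of dimensions from below. -/
theorem mul_order_le [NeZero p] {R L : Type*} [CommRing R] [Field L] {g : R →+* K}
    (hg : Function.Injective g)
    (χ : R →+* L) {t κ r : ℕ} {a b v w y₀ y₁ : R⟦X⟧} (ha : PowerSeries.map g a ∈ M t 0)
    (hb : PowerSeries.map g b ∈ M t 1) (hv : PowerSeries.map g v ∈ M κ 1)
    (hw : PowerSeries.map g w ∈ M κ 0) (hvw : PowerSeries.map χ v = PowerSeries.map χ w)
    (hw0 : PowerSeries.map χ w ≠ 0) (hy₀ : PowerSeries.map g y₀ = x₀)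
    (hy₁ : PowerSeries.map g y₁ = x₁) (h₀ : (PowerSeries.map χ y₀).order = 0)
    (h₁ : (PowerSeries.map χ y₁).order = 1) (hr : (PowerSeries.map χ (a + b)).order = r) (m : ℕ) :
    m * r ≤ Module.finrank K (M (t * m + r + (p - 1) * κ) 0) := by
  choose G hGM hGχ using H.exists_lift_pow g χ ha hb hv hw hvw
  set ω := (PowerSeries.map χ w ^ (p - 1)).order.toNat with hω
  have hω' : (PowerSeries.map χ w ^ (p - 1)).order = ω := by
    rw [hω, ENat.natCast_toNat]
    rw [Ne, order_eq_top]
    exact pow_ne_zero _ hw0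
  set n := t * m + r + (p - 1) * κ with hn
  let ex : Fin m × Fin r → ℕ := fun x ↦ n - (t * x.1 + (p - 1) * κ) - x.2
  let e : Fin m × Fin r → R⟦X⟧ := fun x ↦ G x.1 * y₀ ^ ex x * y₁ ^ (x.2 : ℕ)
  have hord : ∀ x, (PowerSeries.map χ (e x)).order = ((r * x.1 + x.2 + ω : ℕ) : ℕ∞) := by
    intro x
    simp only [e, map_mul, map_pow, order_mul, order_pow, hGχ, h₀, h₁, hr, hω']
    push_cast
    simp only [nsmul_eq_mul, mul_zero, mul_one, add_zero]
    ring
  have hinj : Function.Injective (fun x : Fin m × Fin r ↦ r * (x.1 : ℕ) + x.2 + ω) := by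
    rintro ⟨i, j⟩ ⟨i', j'⟩ h
    simp only [add_left_inj] at h
    have hr0 : 0 < r := j.pos
    have h1 := congrArg (· / r) h
    have h2 := congrArg (· % r) h
    simp only [Nat.mul_add_div hr0, Nat.mul_add_mod, Nat.div_eq_of_lt j.2, Nat.div_eq_of_lt j'.2,
      Nat.mod_eq_of_lt j.2, Nat.mod_eq_of_lt j'.2, add_zero] at h1 h2
    exact Prod.ext (Fin.ext h1) (Fin.ext h2)
  have hli := linearIndependent_of_map hg (linearIndependent_of_order hinj hord)
  have hmem : ∀ x, PowerSeries.map g (e x) ∈ M n 0 := by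
    intro x
    simp only [e, map_mul, map_pow, hy₀, hy₁]
    convert H.mono_mem (hGM x.1) (ex x) x.2 using 2
    have h1 := x.2.2
    have h2 : t * x.1 ≤ t * m := Nat.mul_le_mul_left t x.1.2.le
    simp only [ex]
    omega
  obtain ⟨α, hα⟩ := H.finrank_le
  have := (hα n).1
  have hli' : LinearIndependent K (fun x ↦ (⟨_, hmem x⟩ : M n 0)) :=
    LinearIndependent.of_comp (M n 0).subtype hli
  simpa using hli'.fintype_card_le_finrank

/-- Outside a finite set of coefficients, forms with different characters have different
reductions. -/
theorem exists_finite_reduction [NeZero p] [CharZero K] {S₀ : Finset K}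
    (hx₀ : x₀ ∈ coeffRing (Subring.closure (S₀ : Set K)))
    (hx₁ : x₁ ∈ coeffRing (Subring.closure (S₀ : Set K)))
    (hdisj : ∀ s, M s 0 ⊓ M s 1 = ⊥) {h : K⟦X⟧} (hh : h ∈ M 1 1) (h0 : h ≠ 0) :
    ∃ S : Finset K, ∀ R : Subring K, (∀ s ∈ S, s ∈ R) → ∀ (L : Type) [Field L] (χ : R →+* L)
      (κ : ℕ) (v w : R⟦X⟧), PowerSeries.map R.subtype v ∈ M κ 1 →
      PowerSeries.map R.subtype w ∈ M κ 0 → PowerSeries.map χ v = PowerSeries.map χ w →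
      PowerSeries.map χ w = 0 := by
  classical
  obtain ⟨α, hα⟩ := H.finrank_le
  obtain ⟨c, C₀, s, hc0, hc, hgap⟩ := exists_linear_gap (fun s ↦ (hα s).2) H.le_finrank
  set d := Module.finrank K (M s 0) with hd
  have := (hα s).1
  let u : Fin d → K⟦X⟧ := fun i ↦ (Module.finBasis K (M s 0) i : K⟦X⟧)
  have huM : ∀ i, u i ∈ M s 0 := fun i ↦ (Module.finBasis K (M s 0) i).2
  have hu : LinearIndependent K u :=
    (Module.finBasis K (M s 0)).linearIndependent.map' (M s 0).subtype (by simp)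
  have hsum := (H.linearIndependent_sum hu huM hh h0 (hdisj _)).comp _ finSumFinEquiv.symm.injective
  obtain ⟨col, hcol⟩ := exists_minor_ne_zero hsum
  set δ := (Matrix.of fun i j ↦ coeff (col j)
    ((Sum.elim (fun i ↦ u i * x₀) (fun i ↦ u i * h) ∘ finSumFinEquiv.symm) i)).det with hδ
  obtain ⟨Th, hTh⟩ : ∃ T : Finset K, h ∈ coeffRing (Subring.closure (T : Set K)) := by
    have h1 := H.pow_mem hh p
    rw [CharP.cast_eq_zero, zero_mul] at h1
    obtain ⟨T, hT⟩ := H.exists_finite_coeff hx₀ hx₁ h1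
    exact exists_finite_coeff_of_pow (NeZero.ne p) hT
  choose Tu hTu using fun i ↦ H.exists_finite_coeff hx₀ hx₁ (huM i)
  have hx₀0 : coeff 0 x₀ ≠ 0 := (order_eq_nat.mp H.order_x₀).1
  have hx₁0 : coeff 0 x₁ = 0 := ((order_eq_nat (n := 1)).mp H.order_x₁).2 0 one_pos
  have hx₁1 : coeff 1 x₁ ≠ 0 := ((order_eq_nat (n := 1)).mp H.order_x₁).1
  refine ⟨S₀ ∪ Th ∪ Finset.univ.biUnion Tu ∪ {δ⁻¹, (coeff 0 x₀)⁻¹, (coeff 1 x₁)⁻¹},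
    fun R hR L _ χ κ v w hv hw hvw ↦ ?_⟩
  by_contra hw0
  have hlift : ∀ (T : Finset K) (f : K⟦X⟧), (∀ s ∈ T, s ∈ R) →
      f ∈ coeffRing (Subring.closure (T : Set K)) →
      ∃ f' : R⟦X⟧, PowerSeries.map R.subtype f' = f := fun T f hT hf ↦
    coeffRing_mono ((Subring.closure_le).mpr fun s hs ↦ hT s hs) hf
  obtain ⟨y₀, hy₀⟩ := hlift S₀ x₀ (fun s hs ↦ hR s (by simp [hs])) hx₀
  obtain ⟨y₁, hy₁⟩ := hlift S₀ x₁ (fun s hs ↦ hR s (by simp [hs])) hx₁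
  obtain ⟨h', hh'⟩ := hlift Th h (fun s hs ↦ hR s (by simp [hs])) hTh
  choose u' hu' using fun i ↦ hlift (Tu i) (u i) (fun s hs ↦ hR s (by
    simp only [Finset.mem_union, Finset.mem_biUnion, Finset.mem_univ, true_and]
    exact Or.inl (Or.inr ⟨i, hs⟩))) (hTu i)
  have hunit : ∀ x : R, (x : K) ≠ 0 → (x : K)⁻¹ ∈ R → χ x ≠ 0 := by
    intro x hx hx' h1
    have h2 : x * ⟨_, hx'⟩ = 1 := Subtype.ext (mul_inv_cancel₀ hx)
    have h3 := congrArg χ h2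
    rw [map_mul, h1, zero_mul, map_one] at h3
    exact zero_ne_one h3
  have hcoeff : ∀ (f : R⟦X⟧) n, ((coeff n f : R) : K) = coeff n (PowerSeries.map R.subtype f) :=
    fun f n ↦ by simp
  have ho₀ : (PowerSeries.map χ y₀).order = 0 := by
    refine (order_eq_nat (n := 0)).mpr ⟨?_, by simp⟩
    rw [coeff_map]
    refine hunit _ ?_ ?_ <;> rw [hcoeff, hy₀]
    exacts [hx₀0, hR _ (by simp)]
  have ho₁ : (PowerSeries.map χ y₁).order = 1 := by
    refine (order_eq_nat (n := 1)).mpr ⟨?_, fun m hm ↦ ?_⟩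
    · rw [coeff_map]
      refine hunit _ ?_ ?_ <;> rw [hcoeff, hy₁]
      exacts [hx₁1, hR _ (by simp)]
    · obtain rfl : m = 0 := by omega
      rw [coeff_map]
      have : coeff 0 y₁ = 0 := Subtype.ext (by rw [hcoeff, hy₁, hx₁0]; rfl)
      rw [this, map_zero]
  let e : Fin d ⊕ Fin d → R⟦X⟧ := Sum.elim (fun i ↦ u' i * y₀) (fun i ↦ u' i * h')
  have he : ∀ k, PowerSeries.map R.subtype (e k) =
      Sum.elim (fun i ↦ u i * x₀) (fun i ↦ u i * h) k := by
    rintro (i | i) <;> simp [e, hu', hy₀, hh']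
  have hindep : LinearIndependent L
      (fun i ↦ PowerSeries.map χ ((e ∘ finSumFinEquiv.symm) i)) := by
    refine linearIndependent_of_minor (c := col) ?_
    rw [map_det_coeff]
    have h1 : ((Matrix.of fun i j ↦ coeff (col j) ((e ∘ finSumFinEquiv.symm) i)).det : K) = δ := by
      have := map_det_coeff R.subtype (e ∘ finSumFinEquiv.symm) col
      refine this.symm.trans ?_
      simp only [Function.comp_apply, he, hδ]
    refine hunit _ ?_ ?_ <;> rw [h1]
    exacts [hcol, hR _ (by simp)]
  set r₀ := ⌊c * (s + 1)⌋₊ + 1 with hr₀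
  have hr₀' : r₀ < d + d := by
    have h1 := Nat.floor_le (show 0 ≤ c * ((s : ℝ) + 1) by positivity)
    have : (r₀ : ℝ) < ((d + d : ℕ) : ℝ) := by rw [hr₀]; push_cast; linarith
    exact_mod_cast this
  obtain ⟨y, hy0, hy⟩ := exists_combination_high_order χ hr₀' (e ∘ finSumFinEquiv.symm) hindep
  set a : R⟦X⟧ := ∑ i, C (y (finSumFinEquiv (Sum.inl i))) * e (Sum.inl i) with ha
  set b : R⟦X⟧ := ∑ i, C (y (finSumFinEquiv (Sum.inr i))) * e (Sum.inr i) with hb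
  have hab : ∑ i, C (y i) * (e ∘ finSumFinEquiv.symm) i = a + b := by
    rw [← finSumFinEquiv.sum_comp, Fintype.sum_sum_type]
    simp only [ha, hb, Function.comp_apply, Equiv.symm_apply_apply]
  rw [hab] at hy0 hy
  have haM : PowerSeries.map R.subtype a ∈ M (s + 1) 0 := by
    rw [ha, map_sum]
    refine Submodule.sum_mem _ fun i _ ↦ ?_
    rw [map_mul, map_C, he, ← smul_eq_C_mul]
    refine Submodule.smul_mem _ _ ?_
    simpa using H.mul_mem (huM i) H.x₀_mem
  have hbM : PowerSeries.map R.subtype b ∈ M (s + 1) 1 := by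
    rw [hb, map_sum]
    refine Submodule.sum_mem _ fun i _ ↦ ?_
    rw [map_mul, map_C, he, ← smul_eq_C_mul]
    refine Submodule.smul_mem _ _ ?_
    simpa using H.mul_mem (huM i) hh
  set r := (PowerSeries.map χ (a + b)).order.toNat with hr
  have hr' : (PowerSeries.map χ (a + b)).order = r := by
    rw [hr, ENat.natCast_toNat]
    rwa [Ne, order_eq_top]
  have hr₀r : r₀ ≤ r := by
    have := le_order _ (r₀ : ℕ∞) fun i hi ↦ hy i (by exact_mod_cast hi)
    rw [hr'] at this
    exact_mod_cast this
  have hle := H.mul_order_le R.subtype_injective χ haM hbM hv hw hvw hw0 hy₀ hy₁ ho₀ ho₁ hr'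
  have hpos : 0 < r - c * (s + 1) := by
    have h1 := Nat.lt_floor_add_one (c * ((s : ℝ) + 1))
    have h2 : ((r₀ : ℕ) : ℝ) ≤ r := by exact_mod_cast hr₀r
    rw [hr₀] at h2
    push_cast at h2
    linarith
  obtain ⟨m, hm⟩ := exists_nat_gt ((c * (r + (p - 1 : ℕ) * κ) + C₀) / (r - c * (s + 1)))
  rw [div_lt_iff₀ hpos] at hm
  have h1 := hc ((s + 1) * m + r + (p - 1) * κ)
  have h2 : ((m * r : ℕ) : ℝ) ≤ _ := Nat.cast_le.mpr (hle m)
  push_cast at h1 h2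
  linarith

end GradedForms
end Reduction

end

section

noncomputable section

open UpperHalfPlane OnePoint Matrix.SpecialLinearGroup
open scoped MatrixGroups ModularForm Manifold

/-- The real matrix attached to an integral matrix of nonzero determinant. -/
def intGL (A : Matrix (Fin 2) (Fin 2) ℤ) : GL (Fin 2) ℝ :=
  if h : (A.map (Int.cast : ℤ → ℝ)).det ≠ 0 then
    Matrix.GeneralLinearGroup.mkOfDetNeZero _ h else 1

section intGL

variable {A B : Matrix (Fin 2) (Fin 2) ℤ}

lemma det_map_intCast_ne_zero (hA : A.det ≠ 0) : (A.map (Int.cast : ℤ → ℝ)).det ≠ 0 := by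
  have : (A.map (Int.cast : ℤ → ℝ)).det = (A.det : ℝ) := by
    simp [Matrix.det_fin_two]
  rw [this]
  exact_mod_cast hA

lemma coe_intGL (hA : A.det ≠ 0) :
    (intGL A : Matrix (Fin 2) (Fin 2) ℝ) = A.map (Int.cast : ℤ → ℝ) := by
  rw [intGL, dif_pos (det_map_intCast_ne_zero hA)]
  rfl

lemma intGL_apply (hA : A.det ≠ 0) (i j : Fin 2) : intGL A i j = A i j := by
  rw [coe_intGL hA]; rfl

lemma det_intGL (hA : A.det ≠ 0) : (intGL A).det.val = A.det := by
  rw [Matrix.GeneralLinearGroup.val_det_apply, coe_intGL hA]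
  simp [Matrix.det_fin_two]

lemma intGL_mul (hA : A.det ≠ 0) (hB : B.det ≠ 0) : intGL (A * B) = intGL A * intGL B := by
  apply Units.ext
  rw [Units.val_mul, coe_intGL hA, coe_intGL hB, coe_intGL (by simp [hA, hB])]
  exact Matrix.map_mul (f := Int.castRingHom ℝ)

lemma intGL_coe (γ : SL(2, ℤ)) : intGL (γ : Matrix (Fin 2) (Fin 2) ℤ) = mapGL ℝ γ := by
  apply Units.ext
  rw [coe_intGL (by simp)]
  rfl

lemma isCusp_intGL_smul {c : OnePoint ℝ} (hA : A.det ≠ 0) (hc : IsCusp c 𝒮ℒ) :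
    IsCusp (intGL A • c) 𝒮ℒ := by
  rw [isCusp_SL2Z_iff] at hc ⊢
  obtain ⟨c, rfl⟩ := hc
  have hQ : (A.map (Int.cast : ℤ → ℚ)).det ≠ 0 := by
    have : (A.map (Int.cast : ℤ → ℚ)).det = (A.det : ℚ) := by simp [Matrix.det_fin_two]
    rw [this]
    exact_mod_cast hA
  refine ⟨Matrix.GeneralLinearGroup.mkOfDetNeZero _ hQ • c, ?_⟩
  rw [← Rat.coe_castHom, OnePoint.map_smul]
  congr 1
  apply Units.ext
  rw [coe_intGL hA]
  ext i j
  simp [Matrix.GeneralLinearGroup.mkOfDetNeZero]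

end intGL

/-- Holomorphic functions on the upper half plane which are bounded at all rational cusps for
the weight `k` slash action. -/
def IsAutForm (k : ℤ) (f : ℍ → ℂ) : Prop :=
  MDiff f ∧ ∀ c : OnePoint ℝ, IsCusp c 𝒮ℒ → IsBoundedAt c f k

namespace IsAutForm

variable {k l : ℤ} {f g : ℍ → ℂ}

lemma of_slash (hf : MDiff f) (h : ∀ γ : SL(2, ℤ), IsBoundedAtImInfty (f ∣[k] γ)) :
    IsAutForm k f :=
  ⟨hf, fun _ hc ↦ (isBoundedAt_iff_forall_SL2Z hc).2 fun γ _ ↦ h γ⟩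

lemma mdiff (hf : IsAutForm k f) : MDiff f := hf.1

lemma bdd_slash (hf : IsAutForm k f) (γ : SL(2, ℤ)) : IsBoundedAtImInfty (f ∣[k] γ) :=
  (isBoundedAt_iff_forall_SL2Z (isCusp_SL2Z_iff'.2 ⟨γ, rfl⟩)).1
    (hf.2 _ (isCusp_SL2Z_iff'.2 ⟨γ, rfl⟩)) γ rfl

lemma bdd (hf : IsAutForm k f) : IsBoundedAtImInfty f := by
  simpa using hf.bdd_slash 1

lemma add (hf : IsAutForm k f) (hg : IsAutForm k g) : IsAutForm k (f + g) :=
  ⟨hf.1.add hg.1, fun c hc ↦ (hf.2 c hc).add (hg.2 c hc)⟩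

lemma smul (a : ℂ) (hf : IsAutForm k f) : IsAutForm k (a • f) :=
  of_slash (hf.1.const_smul a) fun γ ↦ by
    rw [ModularForm.SL_smul_slash]
    exact Asymptotics.IsBigO.const_smul_left (hf.bdd_slash γ) a

lemma mul (hf : IsAutForm k f) (hg : IsAutForm l g) : IsAutForm (k + l) (f * g) :=
  of_slash (hf.1.mul hg.1) fun γ ↦ by
    rw [ModularForm.mul_slash_SL2]
    exact (hf.bdd_slash γ).mul (hg.bdd_slash γ)

lemma const (a : ℂ) : IsAutForm 0 (fun _ ↦ a) :=
  of_slash mdifferentiable_const fun γ ↦ by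
    have := ModularForm.is_invariant_const γ a
    rw [show (fun _ : ℍ ↦ a) = Function.const ℍ a from rfl, this]
    exact Filter.const_boundedAtFilter _ _

lemma zero : IsAutForm k 0 := by
  refine of_slash mdifferentiable_const fun γ ↦ ?_
  rw [SlashAction.zero_slash]
  exact Filter.const_boundedAtFilter _ _

lemma prod {ι : Type*} {s : Finset ι} {f : ι → ℍ → ℂ} (hf : ∀ i ∈ s, IsAutForm k (f i)) :
    IsAutForm (k * s.card) (∏ i ∈ s, f i) := by
  classical
  induction s using Finset.induction_on with
  | empty => simpa using! const 1
  | insert a s ha ih =>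
    rw [Finset.prod_insert ha, Finset.card_insert_of_notMem ha, show k * ((s.card + 1 : ℕ) : ℤ)
      = k + k * s.card by push_cast; ring]
    exact (hf a (by simp)).mul (ih fun i hi ↦ hf i (by simp [hi]))

lemma pow (hf : IsAutForm k f) (n : ℕ) : IsAutForm (k * n) (f ^ n) := by
  simpa using prod (s := Finset.range n) (f := fun _ ↦ f) (fun _ _ ↦ hf)

lemma slash (hf : IsAutForm k f) {A : Matrix (Fin 2) (Fin 2) ℤ} (hA : A.det ≠ 0) :
    IsAutForm k (f ∣[k] intGL A) :=
  ⟨hf.1.slash k _, fun c hc ↦ by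
    rw [← IsBoundedAt.smul_iff]
    exact hf.2 _ (isCusp_intGL_smul hA hc)⟩

lemma slash_SL (hf : IsAutForm k f) (γ : SL(2, ℤ)) : IsAutForm k (f ∣[k] γ) := by
  have := hf.slash (A := (γ : Matrix (Fin 2) (Fin 2) ℤ)) (by simp)
  rwa [intGL_coe] at this

end IsAutForm

lemma isAutForm_of_modularForm {k : ℤ} (f : ModularForm 𝒮ℒ k) : IsAutForm k f :=
  ⟨f.holo', fun _ hc ↦ f.bdd_at_cusps' hc⟩

end

end

section

noncomputable section

open UpperHalfPlane Function PowerSeries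
open scoped Manifold ModularForm MatrixGroups

/-- `f` is the expansion of the function `F` in powers of `exp (2πiz/N)`. -/
def HasQExp (N : ℕ) (f : ℂ⟦X⟧) (F : ℍ → ℂ) : Prop :=
  ∀ z : ℍ, HasSum (fun n ↦ coeff n f * Periodic.qParam N z ^ n) (F z)

namespace HasQExp

variable {N : ℕ} {f g : ℂ⟦X⟧} {F G : ℍ → ℂ}

lemma add (hf : HasQExp N f F) (hg : HasQExp N g G) : HasQExp N (f + g) (F + G) := fun z ↦ by
  simpa [add_mul] using (hf z).add (hg z)

lemma smul (a : ℂ) (hf : HasQExp N f F) : HasQExp N (a • f) (a • F) := fun z ↦ by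
  simpa [mul_assoc] using (hf z).mul_left a

lemma sub (hf : HasQExp N f F) (hg : HasQExp N g G) : HasQExp N (f - g) (F - G) := fun z ↦ by
  simpa [sub_mul] using (hf z).sub (hg z)

lemma const (a : ℂ) : HasQExp N (C a) (fun _ ↦ a) := fun z ↦ by
  convert hasSum_ite_eq 0 a using 2 with n
  rw [coeff_C]
  split_ifs with h <;> simp [h]

lemma one : HasQExp N 1 1 := by simpa using! const (N := N) 1

lemma zero : HasQExp N 0 0 := by simpa using! const (N := N) 0

lemma mul (hf : HasQExp N f F) (hg : HasQExp N g G) : HasQExp N (f * g) (F * G) := fun z ↦ by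
  have hs := summable_norm_sum_mul_antidiagonal_of_summable_norm (hf z).summable.norm
    (hg z).summable.norm
  have := tsum_mul_tsum_eq_tsum_sum_antidiagonal_of_summable_norm (hf z).summable.norm
    (hg z).summable.norm
  rw [(hf z).tsum_eq, (hg z).tsum_eq] at this
  have key : ∀ n, coeff n (f * g) * Periodic.qParam N z ^ n =
      ∑ x ∈ Finset.HasAntidiagonal.antidiagonal n, coeff x.1 f * Periodic.qParam N z ^ x.1 *
        (coeff x.2 g * Periodic.qParam N z ^ x.2) := fun n ↦ by
    rw [coeff_mul, Finset.sum_mul]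
    refine Finset.sum_congr rfl fun x hx ↦ ?_
    rw [← Finset.HasAntidiagonal.mem_antidiagonal.1 hx, pow_add]
    ring
  simp only [← key] at hs this
  rw [Pi.mul_apply, this]
  exact hs.of_norm.hasSum

lemma prod {ι : Type*} {s : Finset ι} {f : ι → ℂ⟦X⟧} {F : ι → ℍ → ℂ}
    (h : ∀ i ∈ s, HasQExp N (f i) (F i)) : HasQExp N (∏ i ∈ s, f i) (∏ i ∈ s, F i) := by
  classical
  induction s using Finset.induction_on with
  | empty => simpa using one
  | insert a s ha ih =>
    rw [Finset.prod_insert ha, Finset.prod_insert ha]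
    exact (h a (by simp)).mul (ih fun i hi ↦ h i (by simp [hi]))

lemma pow (hf : HasQExp N f F) (n : ℕ) : HasQExp N (f ^ n) (F ^ n) := by
  simpa using prod (s := Finset.range n) (f := fun _ ↦ f) (F := fun _ ↦ F) (fun _ _ ↦ hf)

lemma bdd (hN : 0 < N) (hf : HasQExp N f F) : IsBoundedAtImInfty F :=
  isBoundedAtImInfty_of_hasSum_qExpansion (h := N) (by exact_mod_cast hN) fun z ↦ by
    simpa using hf z

lemma apply_eq_of_qParam_eq (hf : HasQExp N f F) {z w : ℍ}
    (h : Periodic.qParam N z = Periodic.qParam N w) : F z = F w := by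
  refine (hf z).unique ?_
  rw [h]
  exact hf w

lemma vadd (hN : 0 < N) (hf : HasQExp N f F) (z : ℍ) : F ((N : ℝ) +ᵥ z) = F z := by
  refine hf.apply_eq_of_qParam_eq ?_
  rw [coe_vadd, add_comm]
  rw [Periodic.qParam, Periodic.qParam, mul_add, add_div, Complex.exp_add]
  have hN' : ((N : ℝ) : ℂ) ≠ 0 := by exact_mod_cast hN.ne'
  rw [mul_div_cancel_right₀ _ hN', Complex.exp_two_pi_mul_I, mul_one]

lemma eq_zero (hN : 0 < N) (hf : HasQExp N f 0) : f = 0 := by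
  have hN' : (0 : ℝ) < N := by exact_mod_cast hN
  have han : AnalyticAt ℂ (cuspFunction N (0 : ℍ → ℂ)) 0 :=
    analyticAt_cuspFunction_zero hN' (fun _ ↦ rfl) mdifferentiable_const
      (zero (N := N)|>.bdd hN)
  have h1 := (hasFPowerSeriesOnBall_cuspFunction hN' (c := fun n ↦ coeff n f) han
    (fun z ↦ hf z)).hasFPowerSeriesAt
  have h2 := (hasFPowerSeriesOnBall_cuspFunction hN' (c := fun n ↦ coeff n (0 : ℂ⟦X⟧)) han
    (fun z ↦ zero z)).hasFPowerSeriesAt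
  ext n
  simpa using congr_arg (FormalMultilinearSeries.coeff · n) (h1.eq_formalMultilinearSeries h2)

lemma unique (hN : 0 < N) (hf : HasQExp N f F) (hg : HasQExp N g F) : f = g := by
  have := hf.sub hg
  rw [sub_self] at this
  exact sub_eq_zero.1 (this.eq_zero hN)

lemma fun_eq (hf : HasQExp N f F) (hg : HasQExp N f G) : F = G :=
  funext fun z ↦ (hf z).unique (hg z)

lemma periodic_of_vadd (hp : ∀ z : ℍ, F ((N : ℝ) +ᵥ z) = F z) :
    Periodic (F ∘ ofComplex) (N : ℝ) := by
  intro w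
  by_cases! hw : 0 < w.im
  · have : 0 < (w + (N : ℝ)).im := by simpa using hw
    simp only [comp_apply, ofComplex_apply_of_im_pos this, ofComplex_apply_of_im_pos hw]
    rw [← hp ⟨w, hw⟩]
    congr 1
    ext
    simp [add_comm]
  · have : (w + (N : ℝ)).im ≤ 0 := by simpa using hw
    simp only [comp_apply, ofComplex_apply_of_im_nonpos this, ofComplex_apply_of_im_nonpos hw]

lemma exists_of_vadd (hN : 0 < N) (hF : MDiff F) (hb : IsBoundedAtImInfty F)
    (hp : ∀ z : ℍ, F ((N : ℝ) +ᵥ z) = F z) : HasQExp N (qExpansion N F) F := fun z ↦ by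
  simpa using hasSum_qExpansion (h := N) (by exact_mod_cast hN) (periodic_of_vadd hp) hF hb z

lemma tendsto (hN : 0 < N) (hF : MDiff F) (hf : HasQExp N f F) :
    Filter.Tendsto F atImInfty (nhds (coeff 0 f)) := by
  have hN' : (0 : ℝ) < N := by exact_mod_cast hN
  have hper := periodic_of_vadd (hf.vadd hN)
  have han := analyticAt_cuspFunction_zero hN' hper hF (hf.bdd hN)
  have h1 := (hasFPowerSeriesOnBall_cuspFunction hN' (c := fun n ↦ coeff n f) han
    (fun z ↦ hf z)).hasFPowerSeriesAt
  have h0 : cuspFunction N F 0 = coeff 0 f := by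
    simpa using (h1.coeff_zero (fun _ ↦ 0)).symm
  rw [← h0]
  have := han.continuousAt.tendsto.comp (qParam_tendsto_atImInfty hN')
  refine this.congr fun z ↦ ?_
  exact eq_cuspFunction z hN'.ne' hper

lemma expand {l : ℕ} (hl : l ≠ 0) (hf : HasQExp N f F) :
    HasQExp (N * l) (PowerSeries.expand l hl f) F := fun z ↦ by
  have hinj : Injective fun n : ℕ ↦ l * n := fun a b h ↦ by simpa [hl] using h
  have hs := hf z
  have hq : Periodic.qParam N z = Periodic.qParam ((N * l : ℕ) : ℝ) z ^ l := by
    rw [Periodic.qParam, Periodic.qParam, ← Complex.exp_nat_mul]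
    congr 1
    have : (l : ℂ) ≠ 0 := by exact_mod_cast hl
    push_cast
    field_simp
  rw [hq] at hs
  refine (hinj.hasSum_iff ?_).1 ?_
  · intro x hx
    rw [coeff_expand_of_not_dvd _ _ _ (fun ⟨c, hc⟩ ↦ hx ⟨c, hc.symm⟩), zero_mul]
  · convert hs using 2 with n
    simp [coeff_expand_mul, pow_mul]

lemma slash_of_upper {A : Matrix (Fin 2) (Fin 2) ℤ} (hdet : 0 < A.det) (hA : A 1 0 = 0)
    (k : ℤ) {M e : ℕ} (he : e ≠ 0) {ζ : ℂ} (hq : ∀ z : ℍ,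
      Periodic.qParam N ((A 0 0 * z + A 0 1) / A 1 1) = ζ * Periodic.qParam M z ^ e)
    (hf : HasQExp N f F) :
    HasQExp M (((A.det : ℂ) ^ (k - 1) * (A 1 1 : ℂ) ^ (-k)) •
      PowerSeries.expand e he (rescale ζ f)) (F ∣[k] intGL A) := by
  have hR : (0 : ℝ) < (intGL A).det.val := by
    rw [det_intGL hdet.ne']; exact_mod_cast hdet
  have hσ : ∀ x, σ (intGL A) x = x := fun x ↦ by
    simp [σ, hR, -Matrix.GeneralLinearGroup.val_det_apply]
  have hinj : Injective fun n : ℕ ↦ e * n := fun a b h ↦ by simpa [he] using h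
  intro z
  have hs := hf (intGL A • z)
  have hz : ((intGL A • z : ℍ) : ℂ) = (A 0 0 * z + A 0 1) / A 1 1 := by
    rw [coe_smul_of_det_pos hR, num, denom]
    simp [intGL_apply hdet.ne', hA]
  have hval : (F ∣[k] intGL A) z =
      (A.det : ℂ) ^ (k - 1) * (A 1 1 : ℂ) ^ (-k) * F (intGL A • z) := by
    have hd : ((|(intGL A).det.val| : ℝ) : ℂ) = (A.det : ℂ) := by
      rw [abs_of_pos hR, det_intGL hdet.ne', Complex.ofReal_intCast]
    have hden : denom (intGL A) z = (A 1 1 : ℂ) := by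
      rw [denom]
      simp [intGL_apply hdet.ne', hA]
    rw [ModularForm.slash_apply, hσ, hd, hden]
    ring
  rw [hval]
  simp only [coeff_smul, mul_assoc]
  simp only [← mul_assoc, smul_eq_mul]
  simp only [mul_assoc ((A.det : ℂ) ^ (k - 1) * (A 1 1 : ℂ) ^ (-k))]
  refine HasSum.mul_left _ ?_
  rw [hz, hq] at hs
  have key : ∀ n, coeff (e * n) (PowerSeries.expand e he (rescale ζ f)) *
      Periodic.qParam M z ^ (e * n) = coeff n f * (ζ * Periodic.qParam M z ^ e) ^ n := fun n ↦ by
    rw [coeff_expand_mul, coeff_rescale, pow_mul, mul_pow]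
    ring
  refine (hinj.hasSum_iff ?_).1 ?_
  · intro x hx
    rw [coeff_expand_of_not_dvd _ _ _ (fun ⟨c, hc⟩ ↦ hx ⟨c, hc.symm⟩), zero_mul]
  · simpa only [comp_def, key] using hs

end HasQExp
end

end

section

noncomputable section

open UpperHalfPlane Function PowerSeries CongruenceSubgroup Matrix.SpecialLinearGroup
open scoped Manifold ModularForm MatrixGroups

lemma slash_T_pow_apply (F : ℍ → ℂ) (k : ℤ) (N : ℕ) (z : ℍ) :
    (F ∣[k] (ModularGroup.T ^ N)) z = F ((N : ℝ) +ᵥ z) := by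
  rw [ModularForm.SL_slash_apply]
  have h1 := modular_T_zpow_smul z N
  rw [zpow_natCast] at h1
  have h2 : denom (ModularGroup.T ^ N : SL(2, ℤ)) z = 1 := by
    have := ModularGroup.coe_T_zpow N
    rw [zpow_natCast] at this
    rw [ModularGroup.denom_apply, this]; simp
  rw [h1, h2]
  simp

lemma T_pow_mem_Gamma (N : ℕ) : ModularGroup.T ^ N ∈ Gamma N := by
  have := ModularGroup.coe_T_zpow N
  rw [zpow_natCast] at this
  rw [Gamma_mem]
  simp [this]

lemma IsAutForm.exists_hasQExp {k : ℤ} {F : ℍ → ℂ} {N : ℕ} (hN : 0 < N) (hF : IsAutForm k F)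
    (hT : F ∣[k] (ModularGroup.T ^ N) = F) : ∃ f, HasQExp N f F :=
  ⟨_, HasQExp.exists_of_vadd hN hF.mdiff hF.bdd fun z ↦ by rw [← slash_T_pow_apply F k, hT]⟩

theorem exists_sturm_bound (N : ℕ) (hN : 0 < N) : ∃ α : ℕ, ∀ (s : ℕ) (F : ℍ → ℂ) (f : ℂ⟦X⟧),
    IsAutForm (12 * s) F → (∀ γ ∈ Gamma N, F ∣[(12 * s : ℤ)] γ = F) → HasQExp N f F →
    (∀ n ≤ α * s, coeff n f = 0) → f = 0 := by
  have : NeZero N := ⟨hN.ne'⟩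
  let 𝒢 : Subgroup (GL (Fin 2) ℝ) := (Gamma N).map (mapGL ℝ)
  let 𝒬 := 𝒮ℒ ⧸ 𝒢.subgroupOf 𝒮ℒ
  refine ⟨N * Nat.card 𝒬, fun s F f hF hinv hf hc ↦ ?_⟩
  let g : ModularForm 𝒢 (12 * s) :=
    { toFun := F
      slash_action_eq' := by
        rintro _ ⟨γ, hγ, rfl⟩
        exact hinv γ hγ
      holo' := hF.mdiff
      bdd_at_cusps' := fun hc ↦
        hF.2 _ ((Subgroup.IsArithmetic.isCusp_iff_isCusp_SL2Z 𝒢).1 hc) }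
  let G := ModularForm.norm 𝒮ℒ g
  let := Fintype.ofFinite 𝒬
  have hcoe : (G : ℍ → ℂ) = ∏ q : 𝒬, SlashInvariantForm.quotientFunc g q :=
    ModularForm.coe_norm 𝒮ℒ g
  have hq : ∀ q : 𝒬, ∃ a, HasQExp N a (SlashInvariantForm.quotientFunc g q) := by
    intro q
    induction q using Quotient.inductionOn with
    | h r =>
      obtain ⟨_, γ, rfl⟩ := r
      have h1 : SlashInvariantForm.quotientFunc g (⟦⟨mapGL ℝ γ, γ, rfl⟩⟧ : 𝒬) =
          F ∣[(12 * s : ℤ)] γ⁻¹ := by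
        rw [SlashInvariantForm.quotientFunc_mk, ModularForm.SL_slash, map_inv]
        rfl
      rw [h1]
      refine (hF.slash_SL γ⁻¹).exists_hasQExp hN ?_
      rw [← SlashAction.slash_mul, show γ⁻¹ * ModularGroup.T ^ N =
        (γ⁻¹ * ModularGroup.T ^ N * γ⁻¹⁻¹) * γ⁻¹ by group, SlashAction.slash_mul,
        hinv _ ((Gamma_normal N).conj_mem _ (T_pow_mem_Gamma N) γ⁻¹)]
  choose a ha using hq
  have ha1 : a (QuotientGroup.mk 1) = f := by
    refine (ha _).unique hN ?_
    convert hf using 1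
    change (g : ℍ → ℂ) ∣[(12 * s : ℤ)] ((1 : 𝒮ℒ) : GL (Fin 2) ℝ)⁻¹ = F
    simp only [OneMemClass.coe_one, inv_one, SlashAction.slash_one]
    rfl
  have hG1 : HasQExp 1 (qExpansion 1 G) G := by
    intro z
    simpa using ModularForm.hasSum_qExpansion G (h := 1) one_pos (by simp) z
  have h2 := (hG1.expand hN.ne').unique (N := 1 * N) (by simpa using hN)
    (g := ∏ q, a q) (by rw [one_mul, hcoe]; exact HasQExp.prod fun q _ ↦ ha q)
  have hord : ((N * (Nat.card 𝒬 * s) : ℕ) : ℕ∞) < N • (qExpansion 1 G).order := by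
    rw [← PowerSeries.order_expand N hN.ne', h2]
    have h3 : ((N * (Nat.card 𝒬 * s) + 1 : ℕ) : ℕ∞) ≤ f.order :=
      PowerSeries.nat_le_order _ _ fun i hi ↦ hc i (by rw [mul_assoc]; lia)
    have h4 : f.order ≤ (∏ q, a q).order := by
      classical
      rw [← Finset.mul_prod_erase Finset.univ a (Finset.mem_univ (QuotientGroup.mk 1)), ha1,
        PowerSeries.order_mul]
      exact le_self_add
    refine lt_of_lt_of_le ?_ (h3.trans h4)
    exact_mod_cast Nat.lt_succ_self _
  have hG0 : G = 0 := by
    apply ModularForm.sturm_bound_levelOne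
    have : (12 * s * Nat.card 𝒬 : ℤ).toNat / 12 = Nat.card 𝒬 * s := by
      rw [show (12 * s * Nat.card 𝒬 : ℤ) = ((12 * (Nat.card 𝒬 * s) : ℕ) : ℤ) by push_cast; ring,
        Int.toNat_natCast, Nat.mul_div_cancel_left _ (by norm_num)]
    rw [this]
    by_contra! hle
    have := nsmul_le_nsmul_right hle N
    refine absurd (lt_of_lt_of_le hord this) ?_
    rw [nsmul_eq_mul]
    push_cast
    exact lt_irrefl _
  have hg0 : (g : ℍ → ℂ) = 0 := (ModularForm.norm_eq_zero_iff 𝒮ℒ g).1 hG0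
  have : F = 0 := hg0
  subst this
  exact hf.eq_zero hN
end

end

section

noncomputable section

open UpperHalfPlane Function PowerSeries CongruenceSubgroup Matrix.SpecialLinearGroup
open scoped Manifold ModularForm MatrixGroups

lemma exists_rescaled_form {k : ℤ} {G : ℍ → ℂ} {x : ℂ⟦X⟧} (hG : IsAutForm k G)
    (hinv : ∀ γ : SL(2, ℤ), G ∣[k] γ = G) (hx : HasQExp 1 x G) {N : ℕ} (hN : 0 < N) :
    ∃ F, IsAutForm k F ∧ (∀ γ ∈ Gamma N, F ∣[k] γ = F) ∧ HasQExp N x F := by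
  let A : Matrix (Fin 2) (Fin 2) ℤ := !![1, 0; 0, N]
  have hA : A.det = N := by simp [A, Matrix.det_fin_two]
  have hA0 : 0 < A.det := by rw [hA]; exact_mod_cast hN
  have hNC : (N : ℂ) ≠ 0 := by exact_mod_cast hN.ne'
  have hq := HasQExp.slash_of_upper hA0 (by simp [A]) k (M := N) one_ne_zero (ζ := 1)
    (fun z ↦ by
      simp [A, Periodic.qParam]
      ring_nf) hx
  have hc : ((A.det : ℂ) ^ (k - 1) * (A 1 1 : ℂ) ^ (-k)) = (N : ℂ)⁻¹ := by
    rw [hA]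
    simp only [A, Matrix.of_apply, Matrix.cons_val', Matrix.cons_val_one, Matrix.cons_val_fin_one,
      Int.cast_natCast]
    rw [← zpow_add₀ hNC, show k - 1 + -k = -1 by ring, zpow_neg_one]
  rw [hc, rescale_one, expand_one] at hq
  refine ⟨(N : ℂ) • (G ∣[k] intGL A), (hG.slash hA0.ne').smul _, fun γ hγ ↦ ?_, ?_⟩
  · rw [ModularForm.SL_smul_slash]
    congr 1
    obtain ⟨b, hb⟩ : (N : ℤ) ∣ γ 0 1 := by
      rw [Gamma_mem] at hγ
      exact (ZMod.intCast_zmod_eq_zero_iff_dvd _ _).1 hγ.2.1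
    have hdet := γ.det_coe
    rw [Matrix.det_fin_two, hb] at hdet
    let δ : SL(2, ℤ) := ⟨!![γ 0 0, b; N * γ 1 0, γ 1 1], by
      rw [Matrix.det_fin_two_of]; linarith⟩
    have hm : A * (γ : Matrix (Fin 2) (Fin 2) ℤ) = (δ : Matrix (Fin 2) (Fin 2) ℤ) * A := by
      ext i j
      fin_cases i <;> fin_cases j <;>
        simp [A, δ, Matrix.mul_apply, hb, mul_comm]
    have h1 : ∀ (f : ℍ → ℂ) (δ : SL(2, ℤ)),
        f ∣[k] δ = f ∣[k] intGL (δ : Matrix (Fin 2) (Fin 2) ℤ) := fun f δ ↦ by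
      rw [intGL_coe]; rfl
    rw [h1, ← SlashAction.slash_mul,
      ← intGL_mul hA0.ne' (by simp), hm, intGL_mul (by simp) hA0.ne', SlashAction.slash_mul,
      ← h1, hinv]
  · have := hq.smul (N : ℂ)
    simpa [smul_smul, hNC] using this

lemma ModularForm.hasQExp {k : ℤ} (f : ModularForm 𝒮ℒ k) : HasQExp 1 (qExpansion 1 f) f :=
    fun z ↦ by
  simpa using ModularForm.hasSum_qExpansion f (h := 1) one_pos (by simp) z

lemma ModularForm.slash_SL_eq {k : ℤ} (f : ModularForm 𝒮ℒ k) (γ : SL(2, ℤ)) :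
    (f : ℍ → ℂ) ∣[k] γ = f :=
  f.slash_action_eq' _ ⟨γ, rfl⟩

/-- The `q`-expansion of `E₄³`. -/
def unitSeries : ℂ⟦X⟧ := qExpansion 1 ModularForm.E₄ ^ 3

/-- The `q`-expansion of the discriminant. -/
def deltaSeries : ℂ⟦X⟧ := qExpansion 1 ModularForm.discriminant

lemma order_unitSeries : unitSeries.order = 0 := by
  have h : coeff 0 unitSeries = 1 := by
    have := EisensteinSeries.E_qExpansion_coeff_zero (k := 4) (by norm_num) (by decide)
    simp only [unitSeries, coeff_zero_eq_constantCoeff, map_pow] at this ⊢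
    erw [this, one_pow]
  have := order_le 0 (by rw [h]; exact one_ne_zero)
  simpa using this

lemma order_deltaSeries : deltaSeries.order = 1 := ModularForm.discriminant_qExpansion_order

lemma qExpansion_E_mem_coeffRing {k : ℕ} (hk : 3 ≤ k) (hk2 : Even k) {R : Subring ℂ}
    (hR : -(2 * k / bernoulli k : ℂ) ∈ R) :
    qExpansion 1 (ModularForm.E hk) ∈ coeffRing R := by
  rw [mem_coeffRing]
  intro n
  rw [EisensteinSeries.E_qExpansion_coeff hk hk2]
  split_ifs
  · exact R.one_mem
  · exact R.mul_mem hR (natCast_mem R _)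

lemma hasQExp_discriminant : HasQExp 1 ((1 / 1728 : ℂ) •
    (qExpansion 1 ModularForm.E₄ ^ 3 - qExpansion 1 ModularForm.E₆ ^ 2))
    ModularForm.discriminant := by
  have := ((ModularForm.E₄.hasQExp.pow 3).sub (ModularForm.E₆.hasQExp.pow 2)).smul (1 / 1728)
  convert this using 1
  ext z
  rw [ModularForm.discriminant_eq_E₄_cube_sub_E₆_sq]
  simp [div_eq_inv_mul]

lemma discriminant_slash (γ : SL(2, ℤ)) :
    ModularForm.discriminant ∣[(12 : ℤ)] γ = ModularForm.discriminant :=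
  (CuspForm.discriminant).slash_action_eq' _ ⟨γ, rfl⟩

lemma isAutForm_discriminant : IsAutForm 12 ModularForm.discriminant := by
  have := (((isAutForm_of_modularForm ModularForm.E₄).pow 3).add
    (((isAutForm_of_modularForm ModularForm.E₆).pow 2).smul (-1))).smul (1 / 1728)
  convert! this using 1
  funext z
  rw [ModularForm.discriminant_eq_E₄_cube_sub_E₆_sq]
  simp [div_eq_inv_mul, sub_eq_add_neg]

lemma deltaSeries_eq : deltaSeries = (1 / 1728 : ℂ) •
    (qExpansion 1 ModularForm.E₄ ^ 3 - qExpansion 1 ModularForm.E₆ ^ 2) :=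
  HasQExp.unique one_pos (fun z ↦ by
    simpa [deltaSeries] using ModularForm.hasSum_qExpansion CuspForm.discriminant
      (h := 1) one_pos (by simp) z) hasQExp_discriminant

lemma exists_finset_unitSeries_deltaSeries : ∃ S : Finset ℂ,
    unitSeries ∈ coeffRing (Subring.closure (S : Set ℂ)) ∧
    deltaSeries ∈ coeffRing (Subring.closure (S : Set ℂ)) := by
  classical
  refine ⟨{-(2 * (4 : ℕ) / bernoulli 4 : ℂ), -(2 * (6 : ℕ) / bernoulli 6 : ℂ), 1 / 1728}, ?_, ?_⟩
  · exact Subring.pow_mem _ (qExpansion_E_mem_coeffRing _ (by decide)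
      (Subring.subset_closure (by simp))) 3
  · rw [deltaSeries_eq, smul_eq_C_mul]
    refine Subring.mul_mem _ ?_ (Subring.sub_mem _
      (Subring.pow_mem _ (qExpansion_E_mem_coeffRing _ (by decide)
      (Subring.subset_closure (by simp))) 3) (Subring.pow_mem _ (qExpansion_E_mem_coeffRing _
      (by decide) (Subring.subset_closure (by simp))) 2))
    rw [mem_coeffRing]
    intro n
    rw [coeff_C]
    split_ifs
    · exact Subring.subset_closure (by simp)
    · exact Subring.zero_mem _

lemma exists_form_unitSeries {N : ℕ} (hN : 0 < N) : ∃ F, IsAutForm 12 F ∧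
    (∀ γ ∈ Gamma N, F ∣[(12 : ℤ)] γ = F) ∧ HasQExp N unitSeries F := by
  refine exists_rescaled_form (G := (ModularForm.E₄ : ℍ → ℂ) ^ 3) ?_ (fun γ ↦ ?_) ?_ hN
  · exact (isAutForm_of_modularForm ModularForm.E₄).pow 3
  · have h := ModularForm.slash_SL_eq ModularForm.E₄ γ
    have h2 := ModularForm.mul_slash_SL2 8 4 γ
      (ModularForm.E₄ * ModularForm.E₄ : ℍ → ℂ) ModularForm.E₄
    have h3 := ModularForm.mul_slash_SL2 4 4 γ (ModularForm.E₄ : ℍ → ℂ) ModularForm.E₄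
    norm_num at h2 h3
    rw [pow_succ, pow_two, h2, h3, h]
  · exact ModularForm.E₄.hasQExp.pow 3

lemma exists_form_deltaSeries {N : ℕ} (hN : 0 < N) : ∃ F, IsAutForm 12 F ∧
    (∀ γ ∈ Gamma N, F ∣[(12 : ℤ)] γ = F) ∧ HasQExp N deltaSeries F :=
  exists_rescaled_form isAutForm_discriminant discriminant_slash
    (by rw [deltaSeries_eq]; exact hasQExp_discriminant) hN
end

end

section

noncomputable section

open UpperHalfPlane Function CongruenceSubgroup Matrix.SpecialLinearGroup Filter Topology
open EisensteinSeries Complex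
open scoped Manifold ModularForm MatrixGroups Matrix

/-- Right multiplication of row vectors by an element of `SL(2, ℤ)`. -/
def rowEquiv (γ : SL(2, ℤ)) : (Fin 2 → ℤ) ≃ (Fin 2 → ℤ) where
  toFun v := v ᵥ* (γ : Matrix (Fin 2) (Fin 2) ℤ)
  invFun v := v ᵥ* ((γ⁻¹ : SL(2, ℤ)) : Matrix (Fin 2) (Fin 2) ℤ)
  left_inv v := by
    simp [Matrix.vecMul_vecMul, ← Matrix.SpecialLinearGroup.coe_mul,
      -Matrix.SpecialLinearGroup.coe_inv]
  right_inv v := by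
    simp [Matrix.vecMul_vecMul, ← Matrix.SpecialLinearGroup.coe_mul,
      -Matrix.SpecialLinearGroup.coe_inv]

/-- The Eisenstein series with coefficients `c`. -/
def weightedEis (k : ℤ) (c : (Fin 2 → ℤ) → ℂ) (z : ℍ) : ℂ := ∑' v, c v * eisSummand k v z

namespace weightedEis

variable {k : ℤ} {c : (Fin 2 → ℤ) → ℂ}

lemma norm_summand_le (hc : ∀ v, ‖c v‖ ≤ 1) (v : Fin 2 → ℤ) (z : ℍ) :
    ‖c v * eisSummand k v z‖ ≤ ‖eisSummand k v z‖ := by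
  rw [norm_mul]
  exact mul_le_of_le_one_left (norm_nonneg _) (hc v)

lemma summable (hk : 3 ≤ k) (hc : ∀ v, ‖c v‖ ≤ 1) (z : ℍ) :
    Summable fun v ↦ c v * eisSummand k v z :=
  .of_norm_bounded (summable_norm_eisSummand hk z) (norm_summand_le hc · z)

/-- A bound for the summands of an Eisenstein series on a vertical strip. -/
def bound (k : ℤ) {B : ℝ} (A : ℝ) (hB : 0 < B) (v : Fin 2 → ℤ) : ℝ :=
  r ⟨⟨A, B⟩, hB⟩ ^ (-k) * ‖v‖ ^ (-k)

lemma summable_bound (hk : 3 ≤ k) (A : ℝ) {B : ℝ} (hB : 0 < B) : Summable (bound k A hB) := by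
  have hk' : (2 : ℝ) < k := by norm_cast
  exact_mod_cast (summable_one_div_norm_rpow hk').mul_left <| r ⟨⟨A, B⟩, hB⟩ ^ (-k)

lemma norm_eisSummand_le (hk : 3 ≤ k) {A B : ℝ} (hB : 0 < B) {z : ℍ} (hz : z ∈ verticalStrip A B)
    (v : Fin 2 → ℤ) : ‖eisSummand k v z‖ ≤ bound k A hB v := by
  have hk' : (2 : ℝ) < k := by norm_cast
  simp_rw [eisSummand, norm_zpow, bound]
  exact_mod_cast summand_bound_of_mem_verticalStrip (lt_trans two_pos hk').le v hB hz

lemma mdiff (hk : 3 ≤ k) (hc : ∀ v, ‖c v‖ ≤ 1) : MDiff (weightedEis k c) := by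
  rw [UpperHalfPlane.mdifferentiable_iff]
  intro w hw
  let U : Set ℂ := {x | |x.re| < |w.re| + 1 ∧ w.im / 2 < x.im}
  have hw' : 0 < w.im / 2 := half_pos hw
  have hU : IsOpen U :=
    (isOpen_lt (f := fun x : ℂ ↦ |x.re|) (by fun_prop) (by fun_prop)).inter
      (isOpen_lt (g := fun x : ℂ ↦ x.im) (by fun_prop) (by fun_prop))
  have hUs : U ⊆ {z : ℂ | 0 < z.im} := fun x hx ↦ hw'.trans hx.2
  have key := differentiableOn_tsum_of_summable_norm
    (summable_bound hk (|w.re| + 1) hw')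
    (F := fun v x ↦ c v * (eisSummand k v ∘ ofComplex) x) (U := U)
    (fun v ↦ ((eisSummand_extension_differentiableOn k v).mono hUs).const_mul _) hU
    (fun v x hx ↦ by
      have hx0 : 0 < x.im := hUs hx
      rw [comp_apply, ofComplex_apply_of_im_pos hx0]
      exact (norm_summand_le hc _ _).trans (norm_eisSummand_le hk hw'
        (z := ⟨x, hx0⟩) ⟨hx.1.le, hx.2.le⟩ v))
  exact ((key.differentiableAt (hU.mem_nhds ⟨by simp, half_lt_self hw⟩))).differentiableWithinAt

lemma slash (γ : SL(2, ℤ)) :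
    weightedEis k c ∣[k] γ = weightedEis k (fun v ↦ c ((rowEquiv γ).symm v)) := by
  ext1 z
  rw [ModularForm.SL_slash_apply, weightedEis]
  simp only [eisSummand_SL2_apply]
  rw [← tsum_mul_right, weightedEis]
  refine Eq.trans (tsum_congr fun v ↦ ?_) ((rowEquiv γ).tsum_eq _)
  rw [Equiv.symm_apply_apply]
  have h2 : denom γ z ^ k * denom γ z ^ (-k) = 1 := by
    rw [← zpow_add₀ (denom_ne_zero _ z)]; simp
  change c v * (denom γ z ^ k * eisSummand k (rowEquiv γ v) z) * denom γ z ^ (-k) = _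
  linear_combination c v * eisSummand k (rowEquiv γ v) z * h2

lemma isBoundedAtImInfty (hk : 3 ≤ k) (hc : ∀ v, ‖c v‖ ≤ 1) :
    IsBoundedAtImInfty (weightedEis k c) := by
  rw [UpperHalfPlane.isBoundedAtImInfty_iff]
  refine ⟨∑' v, bound k 1 two_pos v, 2, fun z hz ↦ ?_⟩
  obtain ⟨n, hn⟩ := ModularGroup_T_zpow_mem_verticalStrip z one_pos
  have hn2 := verticalStrip_anti_right (1 : ℕ) hz hn
  have h1 : ∀ v, ‖eisSummand k v (ModularGroup.T ^ ((1 : ℕ) * n) • z)‖ =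
      ‖eisSummand k (v ᵥ* (ModularGroup.T ^ ((1 : ℕ) * n) : SL(2, ℤ))) z‖ := fun v ↦ by
    rw [eisSummand_SL2_apply, ModularGroup.denom_apply]
    have h10 : (ModularGroup.T ^ ((1 : ℕ) * n) : SL(2, ℤ)) 1 0 = 0 := by
      rw [ModularGroup.coe_T_zpow]; rfl
    have h11 : (ModularGroup.T ^ ((1 : ℕ) * n) : SL(2, ℤ)) 1 1 = 1 := by
      rw [ModularGroup.coe_T_zpow]; rfl
    rw [h10, h11]
    simp
  set γ : SL(2, ℤ) := ModularGroup.T ^ ((1 : ℕ) * n)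
  calc ‖weightedEis k c z‖ ≤ ∑' v, ‖c v * eisSummand k v z‖ :=
        norm_tsum_le_tsum_norm (summable hk hc z).norm
    _ ≤ ∑' v, ‖eisSummand k v z‖ :=
        (summable hk hc z).norm.tsum_le_tsum (norm_summand_le hc · z)
          (summable_norm_eisSummand hk z)
    _ = ∑' v, ‖eisSummand k v (γ • z)‖ := by
        rw [← (rowEquiv γ).tsum_eq]
        exact tsum_congr fun v ↦ (h1 v).symm
    _ ≤ _ := (summable_norm_eisSummand hk _).tsum_le_tsum
        (fun v ↦ norm_eisSummand_le hk two_pos (by exact_mod_cast hn2) v)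
        (summable_bound hk 1 two_pos)

lemma isAutForm (hk : 3 ≤ k) (hc : ∀ v, ‖c v‖ ≤ 1) : IsAutForm k (weightedEis k c) :=
  .of_slash (mdiff hk hc) fun γ ↦ by
    rw [slash]
    exact isBoundedAtImInfty hk fun v ↦ hc _

lemma apply_neg_conj (z z' : ℍ) (hz : (z' : ℂ) = -(starRingEnd ℂ) z) :
    starRingEnd ℂ (weightedEis k c z') =
      weightedEis k (fun v ↦ starRingEnd ℂ (c ![-v 0, v 1])) z := by
  rw [weightedEis, weightedEis, Complex.conj_tsum]
  let e : (Fin 2 → ℤ) ≃ (Fin 2 → ℤ) :=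
    ⟨fun v ↦ ![-v 0, v 1], fun v ↦ ![-v 0, v 1], fun v ↦ by ext i; fin_cases i <;> simp,
      fun v ↦ by ext i; fin_cases i <;> simp⟩
  rw [← e.tsum_eq]
  refine tsum_congr fun v ↦ ?_
  simp [e, eisSummand, hz]

/-- The limit at the cusp `i∞`, provided the only `v = (0, d)` with nonzero coefficient is
`(0, 1)`. -/
lemma tendsto (hk : 3 ≤ k) (hc : ∀ v, ‖c v‖ ≤ 1)
    (h1 : ∀ v, v 0 = 0 → c v = if v 1 = 1 then 1 else 0) :
    Tendsto (fun y : ℕ ↦ weightedEis k c ⟨⟨0, y + 1⟩, by simp; positivity⟩) atTop (𝓝 1) := by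
  have hz : ∀ y : ℕ, (⟨⟨0, y + 1⟩, by simp; positivity⟩ : ℍ) ∈ verticalStrip 0 1 := fun y ↦ by
    constructor
    · simp [UpperHalfPlane.re]
    · simp [UpperHalfPlane.im]
  have key := tendsto_tsum_of_dominated_convergence (𝓕 := atTop)
    (f := fun (y : ℕ) v ↦ c v * eisSummand k v ⟨⟨0, y + 1⟩, by simp; positivity⟩)
    (g := fun v : Fin 2 → ℤ ↦ if v = ![0, 1] then 1 else 0)
    (summable_bound hk 0 one_pos) (fun v ↦ ?_) (Eventually.of_forall fun y v ↦
      (norm_summand_le hc _ _).trans (norm_eisSummand_le hk one_pos (hz y) v))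
  · rw [tsum_ite_eq] at key
    exact key
  by_cases hv : v 0 = 0
  · have : ∀ y : ℕ, c v * eisSummand k v ⟨⟨0, y + 1⟩, by simp; positivity⟩ =
        if v = ![0, 1] then 1 else 0 := fun y ↦ by
      rw [h1 v hv]
      by_cases h2 : v 1 = 1
      · have : v = ![0, 1] := by ext i; fin_cases i <;> simp [hv, h2]
        simp [this, eisSummand]
      · have : v ≠ ![0, 1] := fun h ↦ h2 (by simp [h])
        simp [this, h2]
    simp only [this]
    exact tendsto_const_nhds
  · have : v ≠ ![0, 1] := fun h ↦ hv (by simp [h])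
    simp only [this, if_false]
    rw [tendsto_zero_iff_norm_tendsto_zero]
    have hlim : Tendsto (fun y : ℕ ↦ ((y : ℝ) + 1)⁻¹) atTop (𝓝 0) :=
      tendsto_inv_atTop_zero.comp (tendsto_atTop_add_const_right _ _ tendsto_natCast_atTop_atTop)
    refine squeeze_zero (fun _ ↦ norm_nonneg _) (fun y ↦ ?_) hlim
    refine (norm_summand_le hc _ _).trans ?_
    have hle : (y : ℝ) + 1 ≤ ‖(v 0 * (⟨0, y + 1⟩ : ℂ) + v 1)‖ := by
      refine le_trans ?_ (Complex.abs_im_le_norm _)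
      have h3 : (1 : ℝ) ≤ |(v 0 : ℝ)| := by exact_mod_cast Int.one_le_abs hv
      have h4 : (0 : ℝ) ≤ (y : ℝ) + 1 := by positivity
      simp [abs_mul, abs_of_nonneg h4]
      nlinarith
    have h5 : (1 : ℝ) ≤ (y : ℝ) + 1 := by simp
    rw [eisSummand, norm_zpow]
    change ‖(v 0 * (⟨0, y + 1⟩ : ℂ) + v 1)‖ ^ (-k) ≤ _
    rw [zpow_neg]
    gcongr
    refine hle.trans ?_
    simpa using zpow_le_zpow_right₀ (h5.trans hle) (show (1 : ℤ) ≤ k by omega)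

end weightedEis

end

section

noncomputable section

open UpperHalfPlane Function CongruenceSubgroup Matrix.SpecialLinearGroup Filter Topology
open EisensteinSeries ZMod
open scoped Manifold ModularForm MatrixGroups Matrix

namespace AddOnGamma

variable {N : ℕ} {A : Type*} [AddCommGroup A] {φ : SL(2, ℤ) → A}

/-- The homomorphism on `Γ(N)` underlying an additive function. -/
def toHom (hφ : AddOnGamma N φ) : Gamma N →* Multiplicative A :=
  MonoidHom.mk' (fun γ ↦ Multiplicative.ofAdd (φ γ)) fun a b ↦ by
    rw [← ofAdd_add, Subgroup.coe_mul, hφ _ a.2 _ b.2]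

lemma map_one (hφ : AddOnGamma N φ) : φ 1 = 0 :=
  congr_arg Multiplicative.toAdd (_root_.map_one hφ.toHom)

lemma map_inv (hφ : AddOnGamma N φ) {γ : SL(2, ℤ)} (hγ : γ ∈ Gamma N) : φ γ⁻¹ = -φ γ := by
  refine eq_neg_of_add_eq_zero_right ?_
  rw [← hφ _ hγ _ (inv_mem hγ), mul_inv_cancel, hφ.map_one]

lemma map_zpow (hφ : AddOnGamma N φ) {γ : SL(2, ℤ)} (hγ : γ ∈ Gamma N) (n : ℤ) :
    φ (γ ^ n) = n • φ γ :=
  congr_arg Multiplicative.toAdd (_root_.map_zpow hφ.toHom ⟨γ, hγ⟩ n)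

lemma map_pow (hφ : AddOnGamma N φ) {γ : SL(2, ℤ)} (hγ : γ ∈ Gamma N) (n : ℕ) :
    φ (γ ^ n) = n • φ γ :=
  congr_arg Multiplicative.toAdd (_root_.map_pow hφ.toHom ⟨γ, hγ⟩ n)

/-- An additive function trivial on translations only depends on the bottom row. -/
lemma eq_of_row_eq (hφ : AddOnGamma N φ) (hT : φ (ModularGroup.T ^ N) = 0) {γ δ : SL(2, ℤ)}
    (hγ : γ ∈ Gamma N) (hδ : δ ∈ Gamma N)
    (h : (γ : Matrix (Fin 2) (Fin 2) ℤ) 1 = (δ : Matrix (Fin 2) (Fin 2) ℤ) 1) : φ γ = φ δ := by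
  obtain ⟨n, hn⟩ : ∃ n : ℤ, γ * δ⁻¹ = ModularGroup.T ^ n := by
    have h0 := congr_fun h 0
    have h1 := congr_fun h 1
    have hdγ := γ.det_coe
    have hdδ := δ.det_coe
    rw [Matrix.det_fin_two] at hdγ hdδ
    refine ⟨γ 0 1 * δ 0 0 - γ 0 0 * δ 0 1, ?_⟩
    ext i j
    rw [ModularGroup.coe_T_zpow]
    fin_cases i <;> fin_cases j <;>
      simp [Matrix.mul_apply, Matrix.adjugate_fin_two]
    · linear_combination hdγ - γ 0 0 * h1 + γ 0 1 * h0
    · ring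
    · linear_combination δ 1 1 * h0 - δ 1 0 * h1
    · linear_combination hdδ + δ 0 0 * h1 - δ 0 1 * h0
  have hmem : ModularGroup.T ^ n ∈ Gamma N := hn ▸ mul_mem hγ (inv_mem hδ)
  obtain ⟨j, rfl⟩ : (N : ℤ) ∣ n := by
    rw [Gamma_mem] at hmem
    have := hmem.2.1
    rw [ModularGroup.coe_T_zpow] at this
    simpa [ZMod.intCast_zmod_eq_zero_iff_dvd] using this
  have h0 : φ (ModularGroup.T ^ (N * j : ℤ)) = 0 := by
    rw [zpow_mul, zpow_natCast, hφ.map_zpow (T_pow_mem_Gamma N), hT, smul_zero]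
  have : γ = ModularGroup.T ^ (N * j : ℤ) * δ := by rw [← hn]; group
  rw [this, hφ _ hmem _ hδ, h0, zero_add]

end AddOnGamma

section RowCoeff

variable {p : ℕ} [NeZero p] {N : ℕ} {φ : SL(2, ℤ) → ZMod p}

open Classical in
/-- The function `(c, d) ↦ e(-φ(γ))` for `γ ∈ Γ(N)` with bottom row `(c, d)`. -/
def rowCoeff (N : ℕ) (φ : SL(2, ℤ) → ZMod p) (v : Fin 2 → ℤ) : ℂ :=
  if h : ∃ γ ∈ Gamma N, (γ : Matrix (Fin 2) (Fin 2) ℤ) 1 = v then stdAddChar (-φ h.choose) else 0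

lemma norm_rowCoeff_le (v : Fin 2 → ℤ) : ‖rowCoeff N φ v‖ ≤ 1 := by
  rw [rowCoeff]
  split_ifs
  · exact (AddChar.norm_apply _ _).le
  · simp

lemma rowCoeff_row (hφ : AddOnGamma N φ) (hT : φ (ModularGroup.T ^ N) = 0) {γ : SL(2, ℤ)}
    (hγ : γ ∈ Gamma N) : rowCoeff N φ ((γ : Matrix (Fin 2) (Fin 2) ℤ) 1) = stdAddChar (-φ γ) := by
  have h : ∃ δ ∈ Gamma N, (δ : Matrix (Fin 2) (Fin 2) ℤ) 1 = (γ : Matrix (Fin 2) (Fin 2) ℤ) 1 :=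
    ⟨γ, hγ, rfl⟩
  rw [rowCoeff, dif_pos h, hφ.eq_of_row_eq hT h.choose_spec.1 hγ h.choose_spec.2]

lemma rowCoeff_eq_zero {v : Fin 2 → ℤ}
    (h : ¬ ∃ γ ∈ Gamma N, (γ : Matrix (Fin 2) (Fin 2) ℤ) 1 = v) : rowCoeff N φ v = 0 := dif_neg h

lemma row_mul (γ δ : SL(2, ℤ)) : ((γ * δ : SL(2, ℤ)) : Matrix (Fin 2) (Fin 2) ℤ) 1 =
    rowEquiv δ ((γ : Matrix (Fin 2) (Fin 2) ℤ) 1) := by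
  rw [Matrix.SpecialLinearGroup.coe_mul]
  rfl

lemma rowCoeff_rowEquiv_symm (hφ : AddOnGamma N φ) (hT : φ (ModularGroup.T ^ N) = 0)
    {γ : SL(2, ℤ)} (hγ : γ ∈ Gamma N) (v : Fin 2 → ℤ) :
    rowCoeff N φ ((rowEquiv γ).symm v) = stdAddChar (φ γ) * rowCoeff N φ v := by
  by_cases h : ∃ δ ∈ Gamma N, (δ : Matrix (Fin 2) (Fin 2) ℤ) 1 = v
  · obtain ⟨δ, hδ, rfl⟩ := h
    have h1 : (rowEquiv γ).symm ((δ : Matrix (Fin 2) (Fin 2) ℤ) 1) =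
        ((δ * γ⁻¹ : SL(2, ℤ)) : Matrix (Fin 2) (Fin 2) ℤ) 1 := (row_mul δ γ⁻¹).symm
    rw [h1, rowCoeff_row hφ hT (mul_mem hδ (inv_mem hγ)), rowCoeff_row hφ hT hδ,
      hφ _ hδ _ (inv_mem hγ), hφ.map_inv hγ, ← AddChar.map_add_eq_mul]
    congr 1
    ring
  · rw [rowCoeff_eq_zero h, rowCoeff_eq_zero, mul_zero]
    rintro ⟨δ, hδ, hv⟩
    refine h ⟨δ * γ, mul_mem hδ hγ, ?_⟩
    rw [row_mul, hv, Equiv.apply_symm_apply]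

lemma rowCoeff_zero_left (hN : 3 ≤ N) (hφ : AddOnGamma N φ) (hT : φ (ModularGroup.T ^ N) = 0)
    {v : Fin 2 → ℤ} (hv : v 0 = 0) : rowCoeff N φ v = if v 1 = 1 then 1 else 0 := by
  by_cases h : ∃ δ ∈ Gamma N, (δ : Matrix (Fin 2) (Fin 2) ℤ) 1 = v
  · obtain ⟨δ, hδ, rfl⟩ := h
    have h1 : (δ : Matrix (Fin 2) (Fin 2) ℤ) 1 1 = 1 := by
      have hd := δ.det_coe
      rw [Matrix.det_fin_two, hv, mul_zero, sub_zero, mul_comm] at hd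
      rcases Int.isUnit_iff.1 (IsUnit.of_mul_eq_one _ hd) with h1 | h1
      · exact h1
      · have h2 := (Gamma_mem.1 hδ).2.2.2
        rw [h1] at h2
        have : (N : ℤ) ∣ 2 := by
          rw [← ZMod.intCast_zmod_eq_zero_iff_dvd]
          push_cast at h2 ⊢
          linear_combination -h2
        have := Int.le_of_dvd (by norm_num) this
        omega
    have h2 : (δ : Matrix (Fin 2) (Fin 2) ℤ) 1 = ((1 : SL(2, ℤ)) : Matrix (Fin 2) (Fin 2) ℤ) 1 := by
      ext i
      fin_cases i
      · simpa using hv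
      · simpa using h1
    rw [if_pos h1, h2, rowCoeff_row hφ hT (one_mem _), hφ.map_one]
    simp
  · rw [rowCoeff_eq_zero h, if_neg]
    intro h1
    refine h ⟨1, one_mem _, ?_⟩
    ext i
    fin_cases i
    · simpa using hv.symm
    · simpa using h1.symm

/-- Conjugation by `diag(1, -1)`. -/
def signConj (γ : SL(2, ℤ)) : SL(2, ℤ) :=
  ⟨!![γ 0 0, -γ 0 1; -γ 1 0, γ 1 1], by
    have := γ.det_coe
    rw [Matrix.det_fin_two] at this
    rw [Matrix.det_fin_two_of]
    linarith⟩

lemma coe_signConj (γ : SL(2, ℤ)) : (signConj γ : Matrix (Fin 2) (Fin 2) ℤ) =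
    !![γ 0 0, -γ 0 1; -γ 1 0, γ 1 1] := rfl

lemma signConj_mul (γ δ : SL(2, ℤ)) : signConj (γ * δ) = signConj γ * signConj δ := by
  ext i j
  fin_cases i <;> fin_cases j <;>
      simp [coe_signConj, Matrix.SpecialLinearGroup.coe_mul, Matrix.mul_apply] <;> ring

lemma signConj_mem {γ : SL(2, ℤ)} (hγ : γ ∈ Gamma N) : signConj γ ∈ Gamma N := by
  rw [Gamma_mem] at hγ ⊢
  simpa [coe_signConj] using hγ

omit [NeZero p] in
lemma addOnGamma_signConj (hφ : AddOnGamma N φ) : AddOnGamma N (fun γ ↦ -φ (signConj γ)) := by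
  intro γ hγ δ hδ
  beta_reduce
  rw [signConj_mul, hφ _ (signConj_mem hγ) _ (signConj_mem hδ), neg_add]

omit [NeZero p] in
lemma signConj_T_pow (hφ : AddOnGamma N φ) (hT : φ (ModularGroup.T ^ N) = 0) :
    φ (signConj (ModularGroup.T ^ N)) = 0 := by
  have hT' : ((ModularGroup.T ^ N : SL(2, ℤ)) : Matrix (Fin 2) (Fin 2) ℤ) =
      !![1, (N : ℤ); 0, 1] := by
    rw [← zpow_natCast, ModularGroup.coe_T_zpow]
  have : signConj (ModularGroup.T ^ N) = (ModularGroup.T ^ N)⁻¹ := by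
    apply Subtype.ext
    change (signConj (ModularGroup.T ^ N) : Matrix (Fin 2) (Fin 2) ℤ) = _
    rw [coe_signConj, Matrix.SpecialLinearGroup.coe_inv, hT', Matrix.adjugate_fin_two_of]
    simp
  rw [this, hφ.map_inv (T_pow_mem_Gamma N), hT, neg_zero]

lemma conj_rowCoeff (hφ : AddOnGamma N φ) (hT : φ (ModularGroup.T ^ N) = 0) (v : Fin 2 → ℤ) :
    starRingEnd ℂ (rowCoeff N φ ![-v 0, v 1]) = rowCoeff N (fun γ ↦ -φ (signConj γ)) v := by
  have hφ' := addOnGamma_signConj hφ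
  have hT' : -φ (signConj (ModularGroup.T ^ N)) = 0 := by rw [signConj_T_pow hφ hT, neg_zero]
  by_cases h : ∃ δ ∈ Gamma N, (δ : Matrix (Fin 2) (Fin 2) ℤ) 1 = v
  · obtain ⟨δ, hδ, rfl⟩ := h
    have h1 : ![-(δ : Matrix (Fin 2) (Fin 2) ℤ) 1 0, (δ : Matrix (Fin 2) (Fin 2) ℤ) 1 1] =
        (signConj δ : Matrix (Fin 2) (Fin 2) ℤ) 1 := by
      ext i; fin_cases i <;> simp [coe_signConj]
    rw [rowCoeff_row hφ' hT' hδ, h1, rowCoeff_row hφ hT (signConj_mem hδ),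
      ← AddChar.map_neg_eq_conj]
  · rw [rowCoeff_eq_zero h, rowCoeff_eq_zero, map_zero]
    rintro ⟨δ, hδ, hv⟩
    refine h ⟨signConj δ, signConj_mem hδ, ?_⟩
    have h0 := congr_fun hv 0
    have h1 := congr_fun hv 1
    ext i
    fin_cases i
    · simp at h0; simp [coe_signConj, h0]
    · simp at h1; simp [coe_signConj, h1]

lemma weightedEis_slash (k : ℤ) (hφ : AddOnGamma N φ) (hT : φ (ModularGroup.T ^ N) = 0)
    {γ : SL(2, ℤ)} (hγ : γ ∈ Gamma N) : weightedEis k (rowCoeff N φ) ∣[k] γ =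
      (stdAddChar (φ γ) : ℂ) • weightedEis k (rowCoeff N φ) := by
  rw [weightedEis.slash]
  ext z
  simp only [weightedEis, rowCoeff_rowEquiv_symm hφ hT hγ, Pi.smul_apply, smul_eq_mul, mul_assoc,
    tsum_mul_left]

/-- A modular form transforming by a given character of `Γ(N)`, nonvanishing at infinity, together
with its complex conjugate. -/
theorem exists_twisted_eisenstein {k : ℤ} (hk : 3 ≤ k) (hN : 3 ≤ N) (hφ : AddOnGamma N φ)
    (hT : φ (ModularGroup.T ^ N) = 0) :
    ∃ (E E' : ℍ → ℂ) (h h' : PowerSeries ℂ), IsAutForm k E ∧ IsAutForm k E' ∧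
      (∀ γ ∈ Gamma N, E ∣[k] γ = (stdAddChar (φ γ) : ℂ) • E) ∧
      (∀ γ ∈ Gamma N, E' ∣[k] γ = (stdAddChar (-φ (signConj γ)) : ℂ) • E') ∧
      HasQExp N h E ∧ HasQExp N h' E' ∧ PowerSeries.coeff 0 h = 1 ∧
      ∀ n, PowerSeries.coeff n h' = starRingEnd ℂ (PowerSeries.coeff n h) := by
  have hN0 : 0 < N := by omega
  have hφ' := addOnGamma_signConj hφ
  have hT' : -φ (signConj (ModularGroup.T ^ N)) = 0 := by rw [signConj_T_pow hφ hT, neg_zero]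
  have hE := weightedEis.isAutForm hk (norm_rowCoeff_le (N := N) (φ := φ))
  obtain ⟨h, hh⟩ := hE.exists_hasQExp hN0 (by
    rw [weightedEis_slash k hφ hT (T_pow_mem_Gamma N), hT]; simp)
  refine ⟨_, _, h, PowerSeries.map (starRingEnd ℂ) h, hE,
    weightedEis.isAutForm hk (norm_rowCoeff_le (N := N) (φ := fun γ ↦ -φ (signConj γ))),
    fun γ hγ ↦ weightedEis_slash k hφ hT hγ, fun γ hγ ↦ weightedEis_slash k hφ' hT' hγ, hh,
    fun z ↦ ?_, ?_, by simp⟩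
  · let z' : ℍ := ⟨-(starRingEnd ℂ) z, by simpa using z.im_pos⟩
    have h2 := (hh z').star
    have h3 : star (weightedEis k (rowCoeff N φ) z') = _ := weightedEis.apply_neg_conj z z' rfl
    simp only [conj_rowCoeff hφ hT] at h3
    rw [h3] at h2
    have h4 : star (Function.Periodic.qParam (N : ℝ) z') = Function.Periodic.qParam (N : ℝ) z := by
      simp [Function.Periodic.qParam, ← Complex.exp_conj, z', Complex.conj_ofNat]
    simpa [h4] using h2
  · have h1 := hh.tendsto hN0 hE.mdiff
    refine tendsto_nhds_unique (h1.comp ?_) (weightedEis.tendsto hk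
      (norm_rowCoeff_le (N := N) (φ := φ)) fun v hv ↦ rowCoeff_zero_left hN hφ hT hv)
    rw [atImInfty, tendsto_comap_iff]
    exact tendsto_atTop_add_const_right _ _ tendsto_natCast_atTop_atTop

end RowCoeff

end

section

noncomputable section

open UpperHalfPlane Function CongruenceSubgroup Matrix.SpecialLinearGroup ZMod PowerSeries
open scoped Manifold ModularForm MatrixGroups Matrix

/-- `q`-expansions of forms of weight `12 s` transforming under `Γ(N)` by the `j`-th power of the
character attached to `ψ`. -/
def charForms (p : ℕ) [NeZero p] (N : ℕ) (ψ : SL(2, ℤ) → ZMod p) (s : ℕ) (j : ZMod p) :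
    Submodule ℂ ℂ⟦X⟧ where
  carrier := {f | ∃ F : ℍ → ℂ, IsAutForm (12 * s) F ∧
    (∀ γ ∈ Gamma N, F ∣[(12 * s : ℤ)] γ = (stdAddChar (j * ψ γ) : ℂ) • F) ∧ HasQExp N f F}
  add_mem' := by
    rintro f g ⟨F, hF, hFγ, hf⟩ ⟨G, hG, hGγ, hg⟩
    refine ⟨F + G, hF.add hG, fun γ hγ ↦ ?_, hf.add hg⟩
    rw [SlashAction.add_slash, hFγ γ hγ, hGγ γ hγ, smul_add]
  zero_mem' := ⟨0, .zero, fun γ _ ↦ by simp, .zero⟩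
  smul_mem' := by
    rintro a f ⟨F, hF, hFγ, hf⟩
    refine ⟨a • F, hF.smul a, fun γ hγ ↦ ?_, hf.smul a⟩
    rw [ModularForm.SL_smul_slash, hFγ γ hγ, smul_comm]

variable {p : ℕ} [NeZero p] {N : ℕ} {ψ : SL(2, ℤ) → ZMod p}

lemma mem_charForms {s : ℕ} {j : ZMod p} {f : ℂ⟦X⟧} :
    f ∈ charForms p N ψ s j ↔ ∃ F : ℍ → ℂ, IsAutForm (12 * s) F ∧
    (∀ γ ∈ Gamma N, F ∣[(12 * s : ℤ)] γ = (stdAddChar (j * ψ γ) : ℂ) • F) ∧ HasQExp N f F := .rfl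

lemma gradedForms_charForms (hN : 0 < N) :
    GradedForms p (charForms p N ψ) unitSeries deltaSeries where
  one_mem := by
    refine ⟨1, by simpa using! IsAutForm.const 1, fun γ _ ↦ ?_, .one⟩
    simpa using ModularForm.is_invariant_one γ
  mul_mem := by
    rintro s t i j f g ⟨F, hF, hFγ, hf⟩ ⟨G, hG, hGγ, hg⟩
    have hw : (12 * ((s + t : ℕ) : ℤ)) = 12 * s + 12 * t := by push_cast; ring
    refine ⟨F * G, hw ▸ hF.mul hG, fun γ hγ ↦ ?_, hf.mul hg⟩
    rw [hw, ModularForm.mul_slash_SL2, hFγ γ hγ, hGγ γ hγ, smul_mul_smul_comm,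
      ← AddChar.map_add_eq_mul, ← add_mul]
  sturm := by
    obtain ⟨α, hα⟩ := exists_sturm_bound N hN
    refine ⟨α, ?_⟩
    rintro s f ⟨F, hF, hFγ, hf⟩ h0
    exact hα s F f hF (fun γ hγ ↦ by simpa using hFγ γ hγ) hf h0
  x₀_mem := by
    obtain ⟨F, hF, hFγ, hf⟩ := exists_form_unitSeries hN
    exact ⟨F, by simpa using hF, fun γ hγ ↦ by simpa using hFγ γ hγ, hf⟩
  x₁_mem := by
    obtain ⟨F, hF, hFγ, hf⟩ := exists_form_deltaSeries hN
    exact ⟨F, by simpa using hF, fun γ hγ ↦ by simpa using hFγ γ hγ, hf⟩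
  order_x₀ := order_unitSeries
  order_x₁ := order_deltaSeries

lemma charForms_disjoint (hN : 0 < N) {γ : SL(2, ℤ)} (hγ : γ ∈ Gamma N) (hψ : ψ γ ≠ 0) (s : ℕ) :
    charForms p N ψ s 0 ⊓ charForms p N ψ s 1 = ⊥ := by
  rw [eq_bot_iff]
  rintro f ⟨⟨F, hF, hFγ, hf⟩, ⟨G, hG, hGγ, hg⟩⟩
  obtain rfl := hf.fun_eq hg
  have h1 := hFγ γ hγ
  rw [hGγ γ hγ] at h1
  have h2 : (stdAddChar (ψ γ) : ℂ) ≠ 1 := fun h ↦ hψ <| by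
    apply injective_stdAddChar
    simpa using h
  have hF0 : F = 0 := by
    have : ((stdAddChar (ψ γ) : ℂ) - 1) • F = 0 := by
      rw [sub_smul, sub_eq_zero]
      simpa using h1
    exact (smul_eq_zero.1 this).resolve_left (sub_ne_zero.2 h2)
  subst hF0
  exact hf.eq_zero hN

/-- Coefficients of a form transforming by a character of finite order lie in a ring of
finite type. -/
lemma exists_finite_coeff_charForms (hN : 0 < N) {h : ℂ⟦X⟧} {s : ℕ} {j : ZMod p}
    (hh : h ∈ charForms p N ψ s j) :
    ∃ T : Finset ℂ, h ∈ coeffRing (Subring.closure (T : Set ℂ)) := by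
  obtain ⟨S₀, h0, h1⟩ := exists_finset_unitSeries_deltaSeries
  have hp : h ^ p ∈ charForms p N ψ (p * s) 0 := by
    have := (gradedForms_charForms (ψ := ψ) hN).pow_mem hh p
    simpa using this
  obtain ⟨T, hT⟩ := (gradedForms_charForms (ψ := ψ) hN).exists_finite_coeff h0 h1 hp
  exact exists_finite_coeff_of_pow (NeZero.ne p) hT

end

section

section RingHomExtension

theorem RingHom.exists_extension_of_isIntegral {R S Ω : Type*} [CommRing R] [CommRing S]
    [IsDomain S] [Algebra R S] [Algebra.IsIntegral R S] [Field Ω] [IsAlgClosed Ω]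
    (hinj : Function.Injective (algebraMap R S)) (χ : R →+* Ω) :
    ∃ χ' : S →+* Ω, ∀ a, χ' (algebraMap R S a) = χ a := by
  have hP : (RingHom.ker χ).IsPrime := RingHom.ker_isPrime χ
  obtain ⟨Q, hQ, hQP⟩ := Ideal.exists_ideal_over_prime_of_isIntegral_of_isDomain (S := S)
    (RingHom.ker χ) (by rw [(RingHom.injective_iff_ker_eq_bot _).mp hinj]; exact bot_le)
  have : Q.LiesOver (RingHom.ker χ) := ⟨hQP.symm⟩
  let : Algebra (R ⧸ RingHom.ker χ) Ω := (RingHom.kerLift χ).toAlgebra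
  have h1 : Module.IsTorsionFree (R ⧸ RingHom.ker χ) Ω :=
    (Module.isTorsionFree_iff_algebraMap_injective ..).mpr (RingHom.kerLift_injective χ)
  have h2 : Module.IsTorsionFree (R ⧸ RingHom.ker χ) (S ⧸ Q) :=
    (Module.isTorsionFree_iff_algebraMap_injective ..).mpr
      (FaithfulSMul.algebraMap_injective _ _)
  let f : S ⧸ Q →ₐ[R ⧸ RingHom.ker χ] Ω := IsAlgClosed.lift
  refine ⟨f.toRingHom.comp (Ideal.Quotient.mk Q), fun a ↦ ?_⟩
  exact f.commutes (Ideal.Quotient.mk _ a)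

theorem Subring.exists_extension_of_isIntegral {K Ω : Type*} [Field K] [Field Ω] [IsAlgClosed Ω]
    (A : Subring K) (χ : A →+* Ω) {x : K} (hx : IsIntegral A x) :
    ∃ (R : Subring K) (hA : A ≤ R) (χ' : R →+* Ω), x ∈ R ∧ ∀ a : A, χ' ⟨a, hA a.2⟩ = χ a := by
  have : Algebra.IsIntegral A (Algebra.adjoin A {x}) :=
    (Algebra.IsIntegral.adjoin (by simpa using hx))
  obtain ⟨χ', h⟩ := RingHom.exists_extension_of_isIntegral (R := A) (S := Algebra.adjoin A {x})
    (FaithfulSMul.algebraMap_injective _ _) χ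
  refine ⟨(Algebra.adjoin A {x}).toSubring, fun a ha ↦ ?_, χ',
    Algebra.subset_adjoin (Set.mem_singleton x), h⟩
  exact (Algebra.adjoin A {x}).algebraMap_mem ⟨a, ha⟩

end RingHomExtension

section CharExpand

open PowerSeries

variable {k : Type*} [CommRing k] {ℓ : ℕ}

theorem PowerSeries.expand_eq_pow_of_frobenius [ExpChar k ℓ] (hℓ : ℓ ≠ 0) {f g : k⟦X⟧}
    (hg : ∀ n, coeff n g = coeff n f ^ ℓ) : expand ℓ hℓ g = f ^ ℓ := by
  have : g = PowerSeries.map (frobenius k ℓ) f := by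
    ext n
    simp [hg, frobenius_def]
  rw [this, ← map_expand]
  exact MvPowerSeries.map_frobenius_expand ℓ hℓ

theorem PowerSeries.expand_injective (hℓ : ℓ ≠ 0) : Function.Injective (expand (R := k) ℓ hℓ) := by
  intro f g h
  ext n
  rw [← coeff_expand_mul ℓ hℓ, h, coeff_expand_mul]

/-- In characteristic `ℓ`, if the coefficients of `g` are the `ℓ`-th powers of those of `f` and
conversely, then the reductions `f(X^{ℓ²}) f^ℓ` and `g(X^ℓ)^{ℓ+1}` agree. -/
theorem PowerSeries.eq_pow_of_expand [ExpChar k ℓ] (hℓ : ℓ ≠ 0) {f g v : k⟦X⟧}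
    (hg : ∀ n, coeff n g = coeff n f ^ ℓ) (hf : ∀ n, coeff n f = coeff n g ^ ℓ)
    (hv : expand ℓ hℓ v = expand (ℓ ^ 2) (pow_ne_zero 2 hℓ) f * f ^ ℓ) : v = g ^ (ℓ + 1) := by
  apply PowerSeries.expand_injective hℓ
  have h1 := PowerSeries.expand_eq_pow_of_frobenius hℓ hg
  have h2 := PowerSeries.expand_eq_pow_of_frobenius hℓ hf
  have h3 : expand (ℓ ^ 2) (pow_ne_zero 2 hℓ) f = expand ℓ hℓ (expand ℓ hℓ f) := by
    rw [← expand_mul]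
    congr 1
    simp [pow_two]
  rw [hv, map_pow, h1, h3, h2, map_pow, h1]
  ring

end CharExpand

end

section

noncomputable section

open UpperHalfPlane Function Matrix.SpecialLinearGroup PowerSeries
open scoped Manifold ModularForm MatrixGroups Matrix

lemma smul_slash_intGL {A : Matrix (Fin 2) (Fin 2) ℤ} (hA : 0 < A.det) (k : ℤ) (c : ℂ)
    (f : ℍ → ℂ) : (c • f) ∣[k] intGL A = c • (f ∣[k] intGL A) := by
  have hR : (0 : ℝ) < (intGL A).det.val := by
    rw [det_intGL hA.ne']; exact_mod_cast hA
  rw [ModularForm.smul_slash]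
  congr 1
  simp only [σ, if_pos hR]
  rfl

section

variable {N ℓ : ℕ} (H : HeckePrime N ℓ)
include H

lemma HeckePrime.det_pos (i : Option (ZMod ℓ)) : 0 < (heckeRep N ℓ i).det := by
  rw [det_heckeRep]; exact_mod_cast H.prime.pos

lemma HeckePrime.slash_rep_slash (k : ℤ) (f : ℍ → ℂ) (γ : SL(2, ℤ)) (i : Option (ZMod ℓ)) :
    (f ∣[k] intGL (heckeRep N ℓ i)) ∣[k] γ =
      (f ∣[k] H.factor γ i) ∣[k] intGL (heckeRep N ℓ (H.idx γ i)) := by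
  have h1 : ∀ (g : ℍ → ℂ) (δ : SL(2, ℤ)), g ∣[k] δ = g ∣[k] intGL δ := fun g δ ↦ by
    rw [intGL_coe]; rfl
  have h2 : ∀ δ : SL(2, ℤ), (δ : Matrix (Fin 2) (Fin 2) ℤ).det ≠ 0 := fun δ ↦ by simp
  rw [h1, h1, ← SlashAction.slash_mul, ← SlashAction.slash_mul,
    ← intGL_mul (H.det_pos i).ne' (h2 γ), H.rep_mul, intGL_mul (h2 _) (H.det_pos _).ne']

lemma HeckePrime.hasQExp_slash_some {f : ℂ⟦X⟧} {F : ℍ → ℂ} (hf : HasQExp N f F) (k : ℤ)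
    (b : ZMod ℓ) : HasQExp (N * ℓ)
      ((ℓ : ℂ)⁻¹ • rescale (Complex.exp (2 * Real.pi * Complex.I / ℓ) ^ b.val) f)
      (F ∣[k] intGL (heckeRep N ℓ (some b))) := by
  have hℓ : (ℓ : ℂ) ≠ 0 := by exact_mod_cast H.prime.ne_zero
  have hN : (N : ℂ) ≠ 0 := by exact_mod_cast (zero_lt_one.trans H.one_lt).ne'
  have := hf.slash_of_upper (H.det_pos (some b)) (by simp [heckeRep]) k (M := N * ℓ) one_ne_zero
    (ζ := Complex.exp (2 * Real.pi * Complex.I / ℓ) ^ b.val) (fun z ↦ by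
      simp only [heckeRep, Periodic.qParam, ← Complex.exp_nat_mul, ← Complex.exp_add]
      congr 1
      simp [-ZMod.natCast_val]
      field_simp
      ring)
  rw [det_heckeRep, expand_one_apply] at this
  convert this using 2
  simp only [heckeRep]
  simp [zpow_sub₀ hℓ]
  field_simp

lemma HeckePrime.hasQExp_slash_none {f : ℂ⟦X⟧} {F : ℍ → ℂ} (hf : HasQExp N f F) (k : ℤ) :
    HasQExp (N * ℓ) (((ℓ : ℂ) ^ (k - 1) * (-1) ^ k) •
      expand (ℓ ^ 2) (pow_ne_zero 2 H.prime.ne_zero) f)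
      (F ∣[k] intGL (heckeRep N ℓ none)) := by
  have hℓ : (ℓ : ℂ) ≠ 0 := by exact_mod_cast H.prime.ne_zero
  have hN : (N : ℂ) ≠ 0 := by exact_mod_cast (zero_lt_one.trans H.one_lt).ne'
  have := hf.slash_of_upper (H.det_pos none) (by simp [heckeRep]) k (M := N * ℓ)
    (pow_ne_zero 2 H.prime.ne_zero) (ζ := 1) (fun z ↦ by
      simp only [heckeRep, Periodic.qParam, ← Complex.exp_nat_mul, one_mul]
      congr 1
      simp
      field_simp)
  rw [det_heckeRep] at this
  convert this using 2
  · simp only [heckeRep]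
    simp [← inv_zpow]
  · simp

open CongruenceSubgroup ZMod

variable [NeZero ℓ]

lemma HeckePrime.exists_norm_charForm {p : ℕ} [NeZero p] {φ : SL(2, ℤ) → ZMod p}
    (hT : H.heckeHom φ (ModularGroup.T ^ N) = 0) {E : ℍ → ℂ} {h : ℂ⟦X⟧} (hE : IsAutForm 12 E)
    (hEφ : ∀ γ ∈ Gamma N, E ∣[(12 : ℤ)] γ = (stdAddChar (φ γ) : ℂ) • E) (hh : HasQExp N h E) :
    ∃ v ∈ charForms p N (H.heckeHom φ) (ℓ + 1) 1, expand ℓ H.prime.ne_zero v =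
      expand (ℓ ^ 2) (pow_ne_zero 2 H.prime.ne_zero) h *
      ∏ b : ZMod ℓ, rescale (Complex.exp (2 * Real.pi * Complex.I / ℓ) ^ b.val) h := by
  have hN : 0 < N := zero_lt_one.trans H.one_lt
  have hℓ : (ℓ : ℂ) ≠ 0 := by exact_mod_cast H.prime.ne_zero
  set V : ℍ → ℂ := ∏ i, E ∣[(12 : ℤ)] intGL (heckeRep N ℓ i) with hV
  have hw : (12 * ((ℓ + 1 : ℕ) : ℤ)) = 12 * (Finset.univ : Finset (Option (ZMod ℓ))).card := by
    simp
  have hVaut : IsAutForm (12 * ((ℓ + 1 : ℕ) : ℤ)) V := by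
    rw [hw]
    exact IsAutForm.prod fun i _ ↦ hE.slash (H.det_pos i).ne'
  have hVγ : ∀ γ ∈ Gamma N, V ∣[12 * ((ℓ + 1 : ℕ) : ℤ)] γ =
      (stdAddChar (H.heckeHom φ γ) : ℂ) • V := by
    intro γ hγ
    have h1 : V ∣[12 * ((ℓ + 1 : ℕ) : ℤ)] γ =
        ∏ i, (E ∣[(12 : ℤ)] intGL (heckeRep N ℓ i)) ∣[(12 : ℤ)] γ := by
      rw [hw, hV, ModularForm.SL_slash, ModularForm.prod_slash]
      simp
      rfl
    rw [h1]
    simp only [H.slash_rep_slash]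
    have h2 : ∀ i, (E ∣[(12 : ℤ)] H.factor γ i) ∣[(12 : ℤ)] intGL (heckeRep N ℓ (H.idx γ i)) =
        (stdAddChar (φ (H.factor γ i)) : ℂ) •
          (E ∣[(12 : ℤ)] intGL (heckeRep N ℓ (H.idx γ i))) := fun i ↦ by
      rw [hEφ _ (H.factor_mem_Gamma (dvd_refl N) hγ i), smul_slash_intGL (H.det_pos _)]
    simp only [h2]
    rw [Finset.prod_smul, (H.idx_bijective γ).prod_comp
      (fun i ↦ E ∣[(12 : ℤ)] intGL (heckeRep N ℓ i)), HeckePrime.heckeHom]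
    congr 1
    exact (map_prod (stdAddChar (N := p)).toMonoidHom
      (fun i ↦ Multiplicative.ofAdd (φ (H.factor γ i))) Finset.univ).symm
  have hexp : HasQExp (N * ℓ) (((ℓ : ℂ) ^ (11 : ℕ) * (ℓ : ℂ)⁻¹ ^ ℓ) •
      (expand (ℓ ^ 2) (pow_ne_zero 2 H.prime.ne_zero) h *
      ∏ b : ZMod ℓ, rescale (Complex.exp (2 * Real.pi * Complex.I / ℓ) ^ b.val) h)) V := by
    have h1 : HasQExp (N * ℓ) _ V := HasQExp.prod (s := Finset.univ)
      (f := fun i ↦ i.casesOn (((ℓ : ℂ) ^ ((12 : ℤ) - 1) * (-1) ^ (12 : ℤ)) •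
      expand (ℓ ^ 2) (pow_ne_zero 2 H.prime.ne_zero) h) (fun b ↦ (ℓ : ℂ)⁻¹ •
      rescale (Complex.exp (2 * Real.pi * Complex.I / ℓ) ^ b.val) h)) (fun i _ ↦ by
        cases i with
        | none => exact H.hasQExp_slash_none hh 12
        | some b => exact H.hasQExp_slash_some hh 12 b)
    convert h1 using 1
    rw [Fintype.prod_option]
    simp only
    rw [Finset.prod_smul, smul_mul_smul_comm, Finset.prod_const, Finset.card_univ, ZMod.card]
    congr 2
    norm_num
  set c : ℂ := (ℓ : ℂ) ^ (11 : ℕ) * (ℓ : ℂ)⁻¹ ^ ℓ with hc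
  have hc0 : c ≠ 0 := by positivity
  have hV'γ : ∀ γ ∈ Gamma N, (c⁻¹ • V) ∣[12 * ((ℓ + 1 : ℕ) : ℤ)] γ =
      (stdAddChar (H.heckeHom φ γ) : ℂ) • (c⁻¹ • V) := fun γ hγ ↦ by
    rw [ModularForm.SL_smul_slash, hVγ γ hγ, smul_comm]
  obtain ⟨v, hv⟩ := (hVaut.smul c⁻¹).exists_hasQExp hN (by
    rw [hV'γ _ (T_pow_mem_Gamma N), hT, AddChar.map_zero_eq_one, one_smul])
  refine ⟨v, ⟨c⁻¹ • V, hVaut.smul _, fun γ hγ ↦ by rw [hV'γ γ hγ, one_mul], hv⟩, ?_⟩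
  refine (hv.expand H.prime.ne_zero).unique (Nat.mul_pos hN H.prime.pos) ?_
  simpa [smul_smul, hc0] using hexp.smul c⁻¹

end

end

section

noncomputable section

open UpperHalfPlane Function CongruenceSubgroup Matrix.SpecialLinearGroup ZMod PowerSeries
open scoped Manifold ModularForm MatrixGroups Matrix

lemma PowerSeries.exists_map_subtype_eq {K : Type*} [Field K] {R : Subring K} {f : K⟦X⟧}
    (hf : f ∈ coeffRing R) : ∃ g : R⟦X⟧, PowerSeries.map R.subtype g = f :=
  ⟨PowerSeries.mk fun n ↦ ⟨coeff n f, mem_coeffRing.mp hf n⟩, by ext n; simp⟩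

lemma PowerSeries.map_subtype_injective {K : Type*} [Field K] (R : Subring K) :
    Injective (PowerSeries.map R.subtype) := fun f g h ↦ by
  ext n
  simpa using congr_arg (coeff n) h

lemma mem_coeffRing_rescale {K : Type*} [Field K] {R : Subring K} {f : K⟦X⟧}
    (hf : f ∈ coeffRing R) {a : K} (ha : a ∈ R) : rescale a f ∈ coeffRing R :=
  mem_coeffRing.mpr fun n ↦ by
    rw [coeff_rescale]; exact mul_mem (pow_mem ha n) (mem_coeffRing.mp hf n)

lemma mem_coeffRing_expand {K : Type*} [Field K] {R : Subring K} {f : K⟦X⟧}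
    (hf : f ∈ coeffRing R) {e : ℕ} (he : e ≠ 0) : expand e he f ∈ coeffRing R :=
  mem_coeffRing.mpr fun n ↦ by
    rw [coeff_expand]
    split_ifs
    exacts [mem_coeffRing.mp hf _, zero_mem _]

lemma charForms_congr {p : ℕ} [NeZero p] {N : ℕ} {φ ψ : SL(2, ℤ) → ZMod p}
    (h : ∀ γ ∈ Gamma N, φ γ = ψ γ) (s : ℕ) (j : ZMod p) :
    charForms p N φ s j = charForms p N ψ s j := by
  ext f
  rw [mem_charForms, mem_charForms]
  refine exists_congr fun F ↦ and_congr_right fun _ ↦ and_congr_left fun _ ↦ ?_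
  exact forall₂_congr fun γ hγ ↦ by rw [h γ hγ]

/-- A finite set of coefficients such that congruences of reductions between forms with
character and forms without character over rings containing it are trivial. -/
def ReductionSet (p : ℕ) [NeZero p] (N : ℕ) (ψ : SL(2, ℤ) → ZMod p) (S : Finset ℂ) : Prop :=
  ∀ R : Subring ℂ, (∀ s ∈ S, s ∈ R) → ∀ (L : Type) [Field L] (χ : R →+* L)
    (κ : ℕ) (v w : R⟦X⟧), PowerSeries.map R.subtype v ∈ charForms p N ψ κ 1 →
    PowerSeries.map R.subtype w ∈ charForms p N ψ κ 0 →
    PowerSeries.map χ v = PowerSeries.map χ w → PowerSeries.map χ w = 0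

variable {p N : ℕ} [NeZero p]

lemma exists_reductionSet (hN : 3 ≤ N) {ψ : SL(2, ℤ) → ZMod p} (hψ : AddOnGamma N ψ)
    (hT : ψ (ModularGroup.T ^ N) = 0) (h0 : ∃ γ ∈ Gamma N, ψ γ ≠ 0) :
    ∃ S, ReductionSet p N ψ S := by
  obtain ⟨γ, hγ, hγ0⟩ := h0
  obtain ⟨E, -, h, -, hE, -, hEγ, -, hh, -, hh0, -⟩ :=
    exists_twisted_eisenstein (k := 12) (by norm_num) hN hψ hT
  obtain ⟨S₀, h1, h2⟩ := exists_finset_unitSeries_deltaSeries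
  refine GradedForms.exists_finite_reduction (gradedForms_charForms (ψ := ψ) (by omega)) h1 h2
    (fun s ↦ charForms_disjoint (by omega) hγ hγ0 s) (h := h) ?_ ?_
  · exact ⟨E, by simpa using hE, fun γ hγ ↦ by simpa using hEγ γ hγ, hh⟩
  · rintro rfl
    simp at hh0

variable {ℓ : ℕ} (H : HeckePrime N ℓ) [NeZero ℓ]
include H

lemma HeckePrime.not_reductionSet (hpN : p ∣ N) {φ ψ : SL(2, ℤ) → ZMod p}
    (hψ : ∀ γ ∈ Gamma N, ψ γ = H.heckeHom φ γ) (hψT : ψ (ModularGroup.T ^ N) = 0)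
    {E E' : ℍ → ℂ} {h h' : ℂ⟦X⟧}
    (hE : IsAutForm 12 E) (hE' : IsAutForm 12 E')
    (hEφ : ∀ γ ∈ Gamma N, E ∣[(12 : ℤ)] γ = (stdAddChar (φ γ) : ℂ) • E)
    (hE'φ : ∀ γ ∈ Gamma N, E' ∣[(12 : ℤ)] γ = (stdAddChar (-φ (signConj γ)) : ℂ) • E')
    (hh : HasQExp N h E) (hh' : HasQExp N h' E') (h0 : coeff 0 h = 1)
    (hc : ∀ n, coeff n h' = starRingEnd ℂ (coeff n h))
    {R : Subring ℂ} (hR : FrobConj R ℓ) (hconj : ∀ a ∈ R, starRingEnd ℂ a ∈ R)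
    (hhR : h ∈ coeffRing R) {S : Finset ℂ} (hSR : ∀ s ∈ S, s ∈ R) : ¬ ReductionSet p N ψ S := by
  intro hS
  obtain ⟨Ω, _, _, _, χ, hχ⟩ := hR
  have hℓ := H.prime.ne_zero
  have : Fact ℓ.Prime := ⟨H.prime⟩
  have hζ : Complex.exp (2 * Real.pi * Complex.I / ℓ) ^ ℓ = 1 :=
    (Complex.isPrimitiveRoot_exp ℓ hℓ).pow_eq_one
  set ζ := Complex.exp (2 * Real.pi * Complex.I / ℓ) with hζdef
  obtain ⟨R', hRR', χ', hζR', hχ'⟩ := R.exists_extension_of_isIntegral χ (x := ζ)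
    (IsIntegral.of_pow H.prime.pos (by rw [hζ]; exact isIntegral_one))
  obtain ⟨v, hv, hve⟩ := H.exists_norm_charForm
    (by rw [← hψ _ (T_pow_mem_Gamma N), hψT]) hE hEφ hh
  rw [← charForms_congr hψ] at hv
  have hw : h' ^ (ℓ + 1) ∈ charForms p N ψ (ℓ + 1) 0 := by
    refine ⟨E' ^ (ℓ + 1), by simpa using! hE'.pow (ℓ + 1), fun γ hγ ↦ ?_, hh'.pow _⟩
    have h1 : (E' ^ (ℓ + 1)) ∣[(12 * (ℓ + 1 : ℕ) : ℤ)] γ = (E' ∣[(12 : ℤ)] γ) ^ (ℓ + 1) := by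
      have := ModularForm.prod_slash (k := 12) (g := mapGL ℝ γ) (f := fun _ ↦ E')
        (s := Finset.range (ℓ + 1))
      simpa using! this
    obtain ⟨c, hc⟩ := hpN.trans H.dvd
    rw [h1, hE'φ γ hγ, smul_pow, zero_mul, AddChar.map_zero_eq_one, ← AddChar.map_nsmul_eq_pow,
      hc, mul_comm p c, mul_smul, nsmul_eq_mul p, CharP.cast_eq_zero, zero_mul, smul_zero,
      AddChar.map_zero_eq_one]
  obtain ⟨g, hg⟩ := PowerSeries.exists_map_subtype_eq hhR
  obtain ⟨g', hg'⟩ := PowerSeries.exists_map_subtype_eq (R := R) (f := h')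
    (mem_coeffRing.mpr fun n ↦ by rw [hc]; exact hconj _ (mem_coeffRing.mp hhR n))
  have hhR' := coeffRing_mono hRR' hhR
  obtain ⟨u, hu⟩ := PowerSeries.exists_map_subtype_eq (R := R') (f := v)
    (mem_coeffRing.mpr fun n ↦ by
      rw [← coeff_expand_mul ℓ hℓ, hve]
      exact mem_coeffRing.mp (mul_mem (mem_coeffRing_expand hhR' _)
        (prod_mem fun b _ ↦ mem_coeffRing_rescale hhR' (pow_mem hζR' _))) _)
  set ι := Subring.inclusion hRR' with hι
  have hsub : R'.subtype.comp ι = R.subtype := rfl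
  have hχι : χ'.comp ι = χ := RingHom.ext hχ'
  have hmapι : ∀ f : R⟦X⟧, PowerSeries.map R'.subtype (PowerSeries.map ι f) =
      PowerSeries.map R.subtype f := fun f ↦ by ext n; simp [hι]
  have hmapχ : ∀ f : R⟦X⟧, PowerSeries.map χ' (PowerSeries.map ι f) =
      PowerSeries.map χ f := fun f ↦ by ext n; simp [← hχι]
  have hue : expand ℓ hℓ u = expand (ℓ ^ 2) (pow_ne_zero 2 hℓ) (PowerSeries.map ι g) *
      ∏ b : ZMod ℓ, rescale (⟨ζ, hζR'⟩ ^ b.val) (PowerSeries.map ι g) := by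
    apply PowerSeries.map_subtype_injective R'
    rw [map_mul, map_prod]
    simp only [map_expand, ← rescale_map, hmapι, hu, hg, map_pow]
    exact hve
  have hχζ : χ' ⟨ζ, hζR'⟩ = 1 := by
    have h1 : χ' ⟨ζ, hζR'⟩ ^ ℓ = 1 := by
      rw [← map_pow, ← map_one χ']
      congr 1
      exact Subtype.ext hζ
    have h2 : (χ' ⟨ζ, hζR'⟩ - 1) ^ ℓ = 0 := by rw [sub_pow_char, h1, one_pow, sub_self]
    exact sub_eq_zero.mp (pow_eq_zero_iff hℓ |>.mp h2)
  have hcoe : ∀ n, ((coeff n g' : R) : ℂ) = starRingEnd ℂ ((coeff n g : R) : ℂ) := fun n ↦ by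
    have h1 := congr_arg (coeff n) hg
    have h2 := congr_arg (coeff n) hg'
    simp only [coeff_map, Subring.subtype_apply] at h1 h2
    rw [h1, h2, hc]
  have hred : PowerSeries.map χ' u = (PowerSeries.map χ g') ^ (ℓ + 1) := by
    refine PowerSeries.eq_pow_of_expand (f := PowerSeries.map χ g) hℓ (fun n ↦ ?_) (fun n ↦ ?_) ?_
    · simpa using hχ _ _ (hcoe n)
    · simpa using hχ (coeff n g') (coeff n g) (by rw [hcoe, Complex.conj_conj])
    · rw [← map_expand, hue, map_mul, map_prod]
      simp only [map_expand, ← rescale_map, hmapχ, map_pow, hχζ, one_pow, rescale_one,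
        RingHom.id_apply, Finset.prod_const, Finset.card_univ, ZMod.card]
  have hzero := hS R' (fun s hs ↦ hRR' (hSR s hs)) Ω χ' (ℓ + 1) u
    (PowerSeries.map ι g' ^ (ℓ + 1)) (by rw [hu]; exact hv) (by
      rw [map_pow, hmapι, hg']; exact hw) (by rw [hred, map_pow, hmapχ])
  rw [map_pow, hmapχ, pow_eq_zero_iff (Nat.succ_ne_zero ℓ)] at hzero
  have h1 : coeff 0 g' = 1 := by
    apply Subtype.ext
    rw [hcoe, show ((coeff 0 g : R) : ℂ) = coeff 0 h by rw [← hg]; rfl, h0, map_one]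
    rfl
  have h2 := congr_arg (coeff 0) hzero
  rw [coeff_map, h1, map_one] at h2
  simp at h2


omit [NeZero p] in
lemma HeckePrime.heckeHom_congr {φ ψ : SL(2, ℤ) → ZMod p} (h : ∀ γ ∈ Gamma N, φ γ = ψ γ)
    {γ : SL(2, ℤ)} (hγ : γ ∈ Gamma N) : H.heckeHom φ γ = H.heckeHom ψ γ :=
  Finset.sum_congr rfl fun i _ ↦ h _ (H.factor_mem_Gamma (dvd_refl N) hγ i)

omit H

instance instFGSL2Z : Group.FG SL(2, ℤ) :=
  ⟨⟨{ModularGroup.S, ModularGroup.T}, by simpa using SpecialLinearGroup.SL2Z_generators⟩⟩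

lemma finite_monoidHom_of_fg (G A : Type*) [Group G] [Group A] [Group.FG G] [Finite A] :
    Finite (G →* A) := by
  obtain ⟨S, hS⟩ := Group.FG.out (G := G)
  refine Finite.of_injective (β := S → A) (fun f s ↦ f s) fun f g hfg ↦ ?_
  refine MonoidHom.eq_of_eqOn_dense hS fun s hs ↦ congr_fun hfg ⟨s, hs⟩

open Classical in
/-- Extension by zero of a homomorphism on `Γ(N)`. -/
def extendGamma (χ : Gamma N →* Multiplicative (ZMod p)) (γ : SL(2, ℤ)) : ZMod p :=
  if h : γ ∈ Gamma N then (χ ⟨γ, h⟩).toAdd else 0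

omit [NeZero p] in
lemma extendGamma_apply (χ : Gamma N →* Multiplicative (ZMod p)) {γ : SL(2, ℤ)}
    (hγ : γ ∈ Gamma N) : extendGamma χ γ = (χ ⟨γ, hγ⟩).toAdd := dif_pos hγ

omit [NeZero p] in
lemma addOnGamma_extendGamma (χ : Gamma N →* Multiplicative (ZMod p)) :
    AddOnGamma N (extendGamma χ) := fun γ hγ δ hδ ↦ by
  rw [extendGamma_apply χ hγ, extendGamma_apply χ hδ, extendGamma_apply χ (mul_mem hγ hδ),
    ← toAdd_mul, ← map_mul]
  rfl

omit [NeZero p] in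
lemma extendGamma_toHom {φ : SL(2, ℤ) → ZMod p} (hφ : AddOnGamma N φ) {γ : SL(2, ℤ)}
    (hγ : γ ∈ Gamma N) : extendGamma hφ.toHom γ = φ γ := extendGamma_apply _ hγ

/-- Hecke operators at primes admitting a reduction with Frobenius acting as complex conjugation
annihilate the homomorphisms which are trivial on translations. -/
theorem exists_heckeHom_eq_zero (hN : 3 ≤ N) (hpN : p ∣ N) :
    ∃ S : Finset ℂ, ∀ (ℓ : ℕ) (H : HeckePrime N ℓ) [NeZero ℓ] (R : Subring ℂ), (∀ s ∈ S, s ∈ R) →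
      (∀ a ∈ R, starRingEnd ℂ a ∈ R) → FrobConj R ℓ →
      ∀ φ : SL(2, ℤ) → ZMod p, AddOnGamma N φ → φ (ModularGroup.T ^ N) = 0 →
        H.heckeHom φ (ModularGroup.T ^ N) = 0 → ∀ γ ∈ Gamma N, H.heckeHom φ γ = 0 := by
  classical
  have : NeZero N := ⟨by omega⟩
  have : Finite (Gamma N →* Multiplicative (ZMod p)) := finite_monoidHom_of_fg _ _
  have := Fintype.ofFinite (Gamma N →* Multiplicative (ZMod p))
  have key : ∀ χ : Gamma N →* Multiplicative (ZMod p), ∃ S : Finset ℂ,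
      (extendGamma χ (ModularGroup.T ^ N) = 0 → (∃ γ ∈ Gamma N, extendGamma χ γ ≠ 0) →
        ∃ S' ⊆ S, ReductionSet p N (extendGamma χ) S') ∧
      (extendGamma χ (ModularGroup.T ^ N) = 0 → ∃ (E E' : ℍ → ℂ) (h h' : PowerSeries ℂ),
        IsAutForm 12 E ∧ IsAutForm 12 E' ∧
        (∀ γ ∈ Gamma N, E ∣[(12 : ℤ)] γ = (stdAddChar (extendGamma χ γ) : ℂ) • E) ∧
        (∀ γ ∈ Gamma N, E' ∣[(12 : ℤ)] γ =
          (stdAddChar (-extendGamma χ (signConj γ)) : ℂ) • E') ∧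
        HasQExp N h E ∧ HasQExp N h' E' ∧ coeff 0 h = 1 ∧
        (∀ n, coeff n h' = starRingEnd ℂ (coeff n h)) ∧
        h ∈ coeffRing (Subring.closure (S : Set ℂ))) := by
    intro χ
    by_cases hT : extendGamma χ (ModularGroup.T ^ N) = 0
    · obtain ⟨E, E', h, h', hE, hE', hEγ, hE'γ, hh, hh', h0, hc⟩ :=
        exists_twisted_eisenstein (k := 12) (by norm_num) hN (addOnGamma_extendGamma χ) hT
      obtain ⟨T, hT'⟩ := exists_finite_coeff_charForms (p := p) (ψ := extendGamma χ) (h := h)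
        (s := 1) (j := 1) (by omega : 0 < N)
        ⟨E, by simpa using hE, fun γ hγ ↦ by simpa using hEγ γ hγ, hh⟩
      obtain ⟨S', hS'⟩ : ∃ S', (∃ γ ∈ Gamma N, extendGamma χ γ ≠ 0) →
          ReductionSet p N (extendGamma χ) S' := by
        by_cases h1 : ∃ γ ∈ Gamma N, extendGamma χ γ ≠ 0
        · obtain ⟨S, hS⟩ := exists_reductionSet hN (addOnGamma_extendGamma χ) hT h1
          exact ⟨S, fun _ ↦ hS⟩
        · exact ⟨∅, fun h2 ↦ absurd h2 h1⟩
      refine ⟨T ∪ S', fun _ h1 ↦ ⟨S', Finset.subset_union_right, hS' h1⟩, fun _ ↦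
        ⟨E, E', h, h', hE, hE', hEγ, hE'γ, hh, hh', h0, hc, ?_⟩⟩
      exact coeffRing_mono (Subring.closure_mono (by simp)) hT'
    · exact ⟨∅, fun h ↦ absurd h hT, fun h ↦ absurd h hT⟩
  choose S hS1 hS2 using key
  refine ⟨Finset.univ.biUnion S, fun ℓ H _ R hSR hconj hR φ hφ hφT hψT γ hγ ↦ ?_⟩
  by_contra hne
  have hψ := H.addOnGamma_heckeHom (dvd_refl N) hφ
  have hTm := T_pow_mem_Gamma N
  have hmem : ∀ χ, ∀ s ∈ S χ, s ∈ R := fun χ s hs ↦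
    hSR s (Finset.mem_biUnion.mpr ⟨χ, Finset.mem_univ χ, hs⟩)
  obtain ⟨S', hS', hred⟩ := hS1 hψ.toHom (by rw [extendGamma_toHom hψ hTm, hψT])
    ⟨γ, hγ, by rwa [extendGamma_toHom hψ hγ]⟩
  obtain ⟨E, E', h, h', hE, hE', hEγ, hE'γ, hh, hh', h0, hc, hhS⟩ := hS2 hφ.toHom
    (by rw [extendGamma_toHom hφ hTm, hφT])
  refine H.not_reductionSet hpN (φ := extendGamma hφ.toHom) (fun γ hγ ↦ ?_) ?_ hE hE' hEγ hE'γ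
    hh hh' h0 hc hR hconj (coeffRing_mono (Subring.closure_le.mpr (hmem _)) hhS)
    (fun s hs ↦ hmem _ s (hS' hs)) hred
  · rw [extendGamma_toHom hψ hγ]
    exact (H.heckeHom_congr (fun δ hδ ↦ extendGamma_toHom hφ hδ) hγ).symm
  · rw [extendGamma_toHom hψ hTm, hψT]

end

end

section

noncomputable section

open Polynomial

/-- The polynomial `(a X + b) ^ j (c X + d) ^ (n - j)`. -/
def symPoly (n : ℕ) (g : Matrix (Fin 2) (Fin 2) ℤ) (j : ℕ) : ℤ[X] :=
  (C (g 0 0) * X + C (g 0 1)) ^ j * (C (g 1 0) * X + C (g 1 1)) ^ (n - j)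

/-- The action of integral matrices on the coefficients of binary forms of degree `n`. -/
def symRep (n : ℕ) (g : Matrix (Fin 2) (Fin 2) ℤ) : Matrix (Fin (n + 1)) (Fin (n + 1)) ℤ :=
  .of fun i j ↦ (symPoly n g j).coeff i

lemma aeval_homogenize_eq_sum {R : Type*} [CommRing R] (P : ℤ[X]) (n : ℕ) (x y : R) :
    MvPolynomial.aeval ![x, y] (P.homogenize n) =
      ∑ i : Fin (n + 1), (P.coeff i : R) * (x ^ (i : ℕ) * y ^ (n - i)) := by
  rw [Polynomial.homogenize, map_sum,
    Finset.Nat.sum_antidiagonal_eq_sum_range_succ_mk, ← Fin.sum_univ_eq_sum_range]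
  refine Finset.sum_congr rfl fun i _ ↦ ?_
  simp [MvPolynomial.aeval_monomial, Finsupp.prod_fintype]

lemma sum_symRep {R : Type*} [CommRing R] (n : ℕ) (g : Matrix (Fin 2) (Fin 2) ℤ)
    (j : Fin (n + 1)) (x y : R) :
    ∑ i : Fin (n + 1), (symRep n g i j : R) * (x ^ (i : ℕ) * y ^ (n - i)) =
      (g 0 0 * x + g 0 1 * y) ^ (j : ℕ) * (g 1 0 * x + g 1 1 * y) ^ (n - j) := by
  have hd : ∀ a b : ℤ, (C a * X + C b).natDegree ≤ 1 := fun a b ↦ by compute_degree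
  have hl : ∀ a b : ℤ, MvPolynomial.aeval ![x, y] ((C a * X + C b).homogenize 1) =
      (a * x + b * y : R) := fun a b ↦ by
    rw [aeval_homogenize_eq_sum]
    have h0 : (C a * X + C b).coeff 0 = b := by rw [coeff_add, coeff_C_mul, coeff_X_zero,
      coeff_C_zero, mul_zero, zero_add]
    have h1 : (C a * X + C b).coeff 1 = a := by rw [coeff_add, coeff_C_mul, coeff_X_one,
      coeff_C_succ, mul_one, add_zero]
    rw [Fin.sum_univ_two]
    simp only [Fin.val_zero, Fin.val_one, h0, h1]
    simp
    ring
  have hp : ∀ (a b : ℤ) (m : ℕ), MvPolynomial.aeval ![x, y] (((C a * X + C b) ^ m).homogenize m) =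
      (a * x + b * y : R) ^ m := by
    intro a b m
    induction m with
    | zero => simp
    | succ m ih =>
      rw [pow_succ, homogenize_mul _ _ (by
        exact (natDegree_pow_le_of_le m (hd a b)).trans_eq (mul_one m)) (hd a b), map_mul, ih, hl,
        pow_succ]
  rw [← hp, ← hp, ← map_mul, ← homogenize_mul _ _
    ((natDegree_pow_le_of_le _ (hd _ _)).trans_eq (mul_one _))
    ((natDegree_pow_le_of_le _ (hd _ _)).trans_eq (mul_one _))]
  rw [show (j : ℕ) + (n - j) = n by omega, aeval_homogenize_eq_sum]
  rfl

lemma eq_of_sum_eq {n : ℕ} {a b : Fin (n + 1) → ℤ}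
    (h : ∑ i : Fin (n + 1), (a i : ℤ[X]) * (X ^ (i : ℕ) * 1 ^ (n - i)) =
      ∑ i : Fin (n + 1), (b i : ℤ[X]) * (X ^ (i : ℕ) * 1 ^ (n - i))) : a = b := by
  funext k
  have h1 : ∀ a : Fin (n + 1) → ℤ,
      (∑ i : Fin (n + 1), (a i : ℤ[X]) * (X ^ (i : ℕ) * 1 ^ (n - i))).coeff k = a k := fun a ↦ by
    rw [finsetSum_coeff, Finset.sum_eq_single k]
    · rw [one_pow, mul_one, ← C_eq_intCast, coeff_C_mul, coeff_X_pow, if_pos rfl]; simp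
    · intro i _ hi
      rw [one_pow, mul_one, ← C_eq_intCast, coeff_C_mul, coeff_X_pow,
        if_neg fun h ↦ hi (Fin.ext h.symm), mul_zero]
    · simp
  rw [← h1 a, h, h1]

lemma symRep_mul (n : ℕ) (g h : Matrix (Fin 2) (Fin 2) ℤ) :
    symRep n (g * h) = symRep n h * symRep n g := by
  ext i j
  refine congr_fun (eq_of_sum_eq (a := fun i ↦ symRep n (g * h) i j)
    (b := fun i ↦ (symRep n h * symRep n g) i j) ?_) i
  rw [sum_symRep]
  simp only [Matrix.mul_apply, Int.cast_sum, Int.cast_mul, Finset.sum_mul, Fin.sum_univ_two]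
  rw [Finset.sum_comm]
  have : ∀ k : Fin (n + 1), ∑ i : Fin (n + 1), ((symRep n h i k : ℤ[X]) *
      (symRep n g k j : ℤ[X])) * (X ^ (i : ℕ) * 1 ^ (n - i)) = (symRep n g k j : ℤ[X]) *
      (((h 0 0 : ℤ[X]) * X + (h 0 1 : ℤ[X]) * 1) ^ (k : ℕ) *
        ((h 1 0 : ℤ[X]) * X + (h 1 1 : ℤ[X]) * 1) ^ (n - k)) := fun k ↦ by
    rw [← sum_symRep, Finset.mul_sum]
    exact Finset.sum_congr rfl fun i _ ↦ by ring
  simp only [this]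
  rw [sum_symRep]
  push_cast
  ring

lemma symPoly_diag (n j : ℕ) (u : ℤ) : symPoly n !![1, 0; 0, u] j = C (u ^ (n - j)) * X ^ j := by
  simp [symPoly]
  ring

lemma symRep_one (n : ℕ) : symRep n 1 = 1 := by
  ext i j
  rw [Matrix.one_fin_two, symRep, Matrix.of_apply, symPoly_diag, coeff_C_mul, coeff_X_pow,
    Matrix.one_apply]
  simp [Fin.ext_iff]

/-- Matrices congruent to `diag(1, u)` act diagonally modulo `p`. -/
lemma symRep_cast (n : ℕ) {p : ℕ} {g : Matrix (Fin 2) (Fin 2) ℤ} {u : ℤ}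
    (hg : g.map (Int.cast : ℤ → ZMod p) = !![1, 0; 0, (u : ZMod p)]) (i j : Fin (n + 1)) :
    (symRep n g i j : ZMod p) = if i = j then (u : ZMod p) ^ (n - j) else 0 := by
  have h1 : ∀ a b, ((g a b : ℤ) : ZMod p) = !![1, 0; 0, (u : ZMod p)] a b := fun a b ↦ by
    rw [← hg]; rfl
  have h2 : (symPoly n g j).map (Int.castRingHom (ZMod p)) =
      C ((u : ZMod p) ^ (n - j)) * X ^ (j : ℕ) := by
    simp only [symPoly, Polynomial.map_mul, Polynomial.map_pow, Polynomial.map_add, map_C, map_X]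
    rw [eq_intCast, eq_intCast, eq_intCast, eq_intCast, h1, h1, h1, h1]
    simp
    ring
  have h3 := congr_arg (coeff · i) h2
  simp only [coeff_map, coeff_C_mul, coeff_X_pow] at h3
  rw [symRep, Matrix.of_apply]
  simpa [Fin.ext_iff] using h3

variable {n : ℕ} {A : Type*} [AddCommGroup A]

/-- Action of an integral matrix on binary forms with coefficients in `A`. -/
def symAct (g : Matrix (Fin 2) (Fin 2) ℤ) (P : Fin (n + 1) → A) (i : Fin (n + 1)) : A :=
  ∑ j, symRep n g i j • P j

lemma symAct_apply (g : Matrix (Fin 2) (Fin 2) ℤ) (P : Fin (n + 1) → A) (i : Fin (n + 1)) :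
    symAct g P i = ∑ j, symRep n g i j • P j := rfl

lemma symAct_add (g : Matrix (Fin 2) (Fin 2) ℤ) (P Q : Fin (n + 1) → A) :
    symAct g (P + Q) = symAct g P + symAct g Q := by
  ext i
  simp only [symAct_apply, Pi.add_apply, smul_add, Finset.sum_add_distrib]

lemma symAct_smul (g : Matrix (Fin 2) (Fin 2) ℤ) (a : ℤ) (P : Fin (n + 1) → A) :
    symAct g (a • P) = a • symAct g P := by
  ext i
  simp only [symAct_apply, Pi.smul_apply, Finset.smul_sum]
  exact Finset.sum_congr rfl fun j _ ↦ smul_comm _ _ _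

lemma symAct_sum (g : Matrix (Fin 2) (Fin 2) ℤ) {ι : Type*} (s : Finset ι)
    (P : ι → Fin (n + 1) → A) : symAct g (∑ i ∈ s, P i) = ∑ i ∈ s, symAct g (P i) := by
  ext i
  simp only [symAct_apply, Finset.sum_apply, Finset.smul_sum]
  exact Finset.sum_comm

lemma symAct_mul (g h : Matrix (Fin 2) (Fin 2) ℤ) (P : Fin (n + 1) → A) :
    symAct (g * h) P = symAct h (symAct g P) := by
  ext i
  simp only [symAct_apply, symRep_mul, Matrix.mul_apply, Finset.sum_smul, Finset.smul_sum,
    smul_smul]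
  exact Finset.sum_comm

lemma symAct_one (P : Fin (n + 1) → A) : symAct 1 P = P := by
  ext i
  simp [symAct_apply, symRep_one, Matrix.one_apply]

lemma symAct_map {B : Type*} [AddCommGroup B] (f : A →+ B) (g : Matrix (Fin 2) (Fin 2) ℤ)
    (P : Fin (n + 1) → A) (i : Fin (n + 1)) : f (symAct g P i) = symAct g (fun j ↦ f (P j)) i := by
  simp [symAct_apply]

/-- Evaluation of a binary form. -/
def formEval {R : Type*} [CommRing R] (P : Fin (n + 1) → R) (v : Fin 2 → R) : R :=
  ∑ i, P i * (v 0 ^ (i : ℕ) * v 1 ^ (n - i))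

lemma formEval_symAct {R : Type*} [CommRing R] (g : Matrix (Fin 2) (Fin 2) ℤ)
    (P : Fin (n + 1) → R) (v : Fin 2 → R) :
    formEval (symAct g P) v = formEval P ((g.map (Int.cast : ℤ → R)).mulVec v) := by
  simp only [formEval, symAct_apply, Finset.sum_mul]
  rw [Finset.sum_comm]
  refine Finset.sum_congr rfl fun j _ ↦ ?_
  simp only [zsmul_eq_mul, Matrix.mulVec, dotProduct, Fin.sum_univ_two, Matrix.map_apply]
  rw [← sum_symRep, Finset.mul_sum]
  exact Finset.sum_congr rfl fun i _ ↦ by ring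

end

end

section

noncomputable section

open Polynomial Matrix MatrixGroups CongruenceSubgroup

lemma Polynomial.aeval_apply_of_intertwine {V W : Type*} [AddCommGroup V] [AddCommGroup W]
    (S : Module.End ℤ V) (T : Module.End ℤ W) (L : V →ₗ[ℤ] W) (h : ∀ v, L (S v) = T (L v))
    (Q : ℤ[X]) (v : V) : L (aeval S Q v) = aeval T Q (L v) := by
  induction Q using Polynomial.induction_on' with
  | add p q hp hq => simp [hp, hq]
  | monomial k a =>
    have hk : ∀ (k : ℕ) (v : V), L ((S ^ k) v) = (T ^ k) (L v) := by
      intro k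
      induction k with
      | zero => simp
      | succ k ih => intro v; rw [pow_succ, Module.End.mul_apply, ih, h, pow_succ,
          Module.End.mul_apply]
    simp [aeval_monomial, hk]

section Cocycle

variable (n M : ℕ) (A : Type*) [AddCommGroup A]

/-- The `1`-cocycles of `Γ(M)` with values in binary forms of degree `n`. -/
def cocycles : Submodule ℤ (Gamma M → Fin (n + 1) → A) where
  carrier := {c | ∀ γ δ, c (γ * δ) = symAct (δ : SL(2, ℤ)) (c γ) + c δ}
  add_mem' {a b} ha hb γ δ := by
    simp only [Pi.add_apply, ha γ δ, hb γ δ, symAct_add]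
    abel
  zero_mem' γ δ := by
    ext i
    simp [symAct_apply]
  smul_mem' m a ha γ δ := by
    simp only [Pi.smul_apply, ha γ δ, symAct_smul, smul_add]

variable {n M A}

lemma mem_cocycles {c : Gamma M → Fin (n + 1) → A} :
    c ∈ cocycles n M A ↔ ∀ γ δ, c (γ * δ) = symAct (δ : SL(2, ℤ)) (c γ) + c δ := Iff.rfl

lemma cocycle_one {c : Gamma M → Fin (n + 1) → A} (hc : c ∈ cocycles n M A) : c 1 = 0 := by
  have h := hc 1 1
  rw [mul_one, OneMemClass.coe_one, Matrix.SpecialLinearGroup.coe_one, symAct_one] at h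
  simpa using h

/-- A cocycle whose values on generators have coordinates in a subgroup has all its values there. -/
lemma cocycle_mem {c : Gamma M → Fin (n + 1) → A} (hc : c ∈ cocycles n M A)
    {S : Set (Gamma M)} (hS : Subgroup.closure S = ⊤) (B : AddSubgroup A)
    (h : ∀ s ∈ S, ∀ i, c s i ∈ B) (γ : Gamma M) (i : Fin (n + 1)) : c γ i ∈ B := by
  have hact : ∀ (g : Matrix (Fin 2) (Fin 2) ℤ) (P : Fin (n + 1) → A), (∀ i, P i ∈ B) →
      ∀ i, symAct g P i ∈ B := fun g P hP i ↦
    AddSubgroup.sum_mem _ fun j _ ↦ AddSubgroup.zsmul_mem _ (hP j) _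
  have hγ : γ ∈ Subgroup.closure S := hS ▸ Subgroup.mem_top γ
  induction hγ using Subgroup.closure_induction generalizing i with
  | mem x hx => exact h x hx i
  | one => simp [cocycle_one hc]
  | mul x y _ _ hx hy =>
    rw [hc x y]
    exact B.add_mem (hact _ _ hx i) (hy i)
  | inv x _ hx =>
    have h1 := hc x x⁻¹
    rw [mul_inv_cancel, cocycle_one hc] at h1
    rw [← neg_eq_of_add_eq_zero_right h1.symm]
    exact B.neg_mem (hact _ _ hx i)

lemma cocycle_map {B : Type*} [AddCommGroup B] (f : A →+ B) {c : Gamma M → Fin (n + 1) → A}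
    (hc : c ∈ cocycles n M A) : (fun γ i ↦ f (c γ i)) ∈ cocycles n M B := by
  intro γ δ
  ext i
  beta_reduce
  rw [hc γ δ, Pi.add_apply, Pi.add_apply, map_add, symAct_map]

instance finite_cocycles [NeZero M] : Module.Finite ℤ (cocycles n M ℤ) := by
  have : Group.FG (Gamma M) := inferInstance
  obtain ⟨S, hS⟩ := this.out
  let f : cocycles n M ℤ →ₗ[ℤ] (S → Fin (n + 1) → ℤ) :=
    { toFun := fun c s ↦ c.1 s
      map_add' := fun _ _ ↦ rfl
      map_smul' := fun _ _ ↦ rfl }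
  refine Module.Finite.of_injective f ((injective_iff_map_eq_zero f).2 fun c hc ↦ ?_)
  ext γ i
  have := cocycle_mem c.2 hS ⊥ (fun s hs i ↦ congr_fun (congr_fun hc ⟨s, hs⟩) i) γ i
  simpa using this

variable {N ℓ : ℕ} (H : HeckePrime N ℓ) (hM : M ∣ N) [NeZero ℓ]

/-- The factor, as an element of `Γ(M)`. -/
def HeckePrime.factorGamma (γ : Gamma M) (i : Option (ZMod ℓ)) : Gamma M :=
  ⟨H.factor γ i, H.factor_mem_Gamma hM γ.2 i⟩

/-- The Hecke operator on cocycles. -/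
def HeckePrime.heckeCocycle (n : ℕ) (A : Type*) [AddCommGroup A] :
    Module.End ℤ (Gamma M → Fin (n + 1) → A) where
  toFun c γ := ∑ i, symAct (heckeRep N ℓ (H.idx γ i)) (c (H.factorGamma hM γ i))
  map_add' c d := by
    ext γ : 1
    simp only [Pi.add_apply, symAct_add, Finset.sum_add_distrib]
  map_smul' m c := by
    ext γ : 1
    simp only [Pi.smul_apply, symAct_smul, Finset.smul_sum, RingHom.id_apply]

lemma HeckePrime.heckeCocycle_apply (c : Gamma M → Fin (n + 1) → A) (γ : Gamma M) :
    H.heckeCocycle hM n A c γ =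
      ∑ i, symAct (heckeRep N ℓ (H.idx γ i)) (c (H.factorGamma hM γ i)) := rfl

lemma HeckePrime.heckeCocycle_mem {c : Gamma M → Fin (n + 1) → A} (hc : c ∈ cocycles n M A) :
    H.heckeCocycle hM n A c ∈ cocycles n M A := by
  intro γ δ
  simp only [heckeCocycle_apply]
  rw [symAct_sum, ← H.idx_perm_sum γ
    (fun i ↦ symAct (heckeRep N ℓ (H.idx δ i)) (c (H.factorGamma hM δ i))),
    ← Finset.sum_add_distrib]
  refine Finset.sum_congr rfl fun i _ ↦ ?_
  have h1 : H.factorGamma hM (γ * δ) i =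
      H.factorGamma hM γ i * H.factorGamma hM δ (H.idx γ i) :=
    Subtype.ext (H.factor_mul γ δ i).2
  have h2 : H.idx ((γ * δ : Gamma M) : SL(2, ℤ)) i = H.idx δ (H.idx γ i) :=
    (H.factor_mul γ δ i).1
  rw [h1, h2, hc, symAct_add, ← symAct_mul, ← symAct_mul]
  congr 2
  exact (H.rep_mul δ (H.idx γ i)).symm

lemma HeckePrime.heckeCocycle_map {B : Type*} [AddCommGroup B] (f : A →+ B)
    (c : Gamma M → Fin (n + 1) → A) (γ : Gamma M) (i : Fin (n + 1)) :
    H.heckeCocycle hM n B (fun γ i ↦ f (c γ i)) γ i = f (H.heckeCocycle hM n A c γ i) := by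
  simp only [heckeCocycle_apply, Finset.sum_apply, map_sum, symAct_map]

open Classical in
/-- The reduction of a coordinate of an integral cocycle, extended by zero. -/
def cocycleReduction (p : ℕ) (c : Gamma M → Fin (n + 1) → ℤ) (j : Fin (n + 1)) (γ : SL(2, ℤ)) :
    ZMod p :=
  if h : γ ∈ Gamma M then (c ⟨γ, h⟩ j : ZMod p) else 0

lemma cocycleReduction_apply (p : ℕ) (c : Gamma M → Fin (n + 1) → ℤ) (j : Fin (n + 1))
    (γ : Gamma M) : cocycleReduction p c j γ = (c γ j : ZMod p) := by
  simp [cocycleReduction]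

lemma symAct_cast_of_map {p : ℕ} {g : Matrix (Fin 2) (Fin 2) ℤ} {u : ℤ}
    (hg : g.map (Int.cast : ℤ → ZMod p) = !![1, 0; 0, (u : ZMod p)]) (P : Fin (n + 1) → ℤ)
    (i : Fin (n + 1)) : ((symAct g P i : ℤ) : ZMod p) = (u : ZMod p) ^ (n - i) * P i := by
  simp only [symAct_apply, Int.cast_sum, smul_eq_mul, Int.cast_mul, symRep_cast n hg]
  simp

lemma map_cast_of_mem_Gamma {p : ℕ} (hp : p ∣ M) {γ : SL(2, ℤ)} (hγ : γ ∈ Gamma M) :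
    (γ : Matrix (Fin 2) (Fin 2) ℤ).map (Int.cast : ℤ → ZMod p) =
      !![1, 0; 0, ((1 : ℤ) : ZMod p)] := by
  have h := Gamma_mem.1 (Gamma_le_Gamma hp hγ)
  ext a b
  fin_cases a <;> fin_cases b <;> simp [h]

lemma addOnGamma_cocycleReduction {p : ℕ} (hp : p ∣ M) {c : Gamma M → Fin (n + 1) → ℤ}
    (hc : c ∈ cocycles n M ℤ) (j : Fin (n + 1)) : AddOnGamma M (cocycleReduction p c j) := by
  intro γ hγ δ hδ
  have h := congr_arg (Int.cast : ℤ → ZMod p) (congr_fun (hc ⟨γ, hγ⟩ ⟨δ, hδ⟩) j)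
  rw [Pi.add_apply, Int.cast_add, symAct_cast_of_map (map_cast_of_mem_Gamma hp hδ)] at h
  have h1 := cocycleReduction_apply p c j (⟨γ, hγ⟩ * ⟨δ, hδ⟩)
  have h2 := cocycleReduction_apply p c j ⟨γ, hγ⟩
  have h3 := cocycleReduction_apply p c j ⟨δ, hδ⟩
  simp only [Int.cast_one, one_pow, one_mul] at h
  rw [h, ← h2, ← h3] at h1
  exact h1

lemma HeckePrime.heckeCocycle_cast {p : ℕ} (hp : p ∣ N) (c : Gamma M → Fin (n + 1) → ℤ)
    (j : Fin (n + 1)) (γ : Gamma M) :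
    (H.heckeCocycle hM n ℤ c γ j : ZMod p) =
      (-1) ^ (n - j : ℕ) * H.heckeHom (cocycleReduction p c j) γ := by
  have h : ∀ i, (heckeRep N ℓ i).map (Int.cast : ℤ → ZMod p) =
      !![1, 0; 0, ((-1 : ℤ) : ZMod p)] := fun i ↦ by simpa using H.map_rep hp i
  rw [heckeCocycle_apply, Finset.sum_apply, Int.cast_sum, heckeHom, Finset.mul_sum]
  refine Finset.sum_congr rfl fun i _ ↦ ?_
  rw [symAct_cast_of_map (h _), ← cocycleReduction_apply]
  simp [factorGamma]

/-- The square of the Hecke operator maps integral cocycles to multiples of `p`. -/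
lemma HeckePrime.dvd_heckeCocycle_sq {p : ℕ} (hpM : p ∣ M) (hN : N = M * p)
    (hφ : ∀ φ : SL(2, ℤ) → ZMod p, AddOnGamma N φ → φ (ModularGroup.T ^ N) = 0 →
      H.heckeHom φ (ModularGroup.T ^ N) = 0 → ∀ γ ∈ Gamma N, H.heckeHom φ γ = 0)
    {c : Gamma M → Fin (n + 1) → ℤ} (hc : c ∈ cocycles n M ℤ) (γ : Gamma M) (j : Fin (n + 1)) :
    (p : ℤ) ∣ H.heckeCocycle hM n ℤ (H.heckeCocycle hM n ℤ c) γ j := by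
  have hpN : p ∣ N := hpM.trans hM
  rw [← ZMod.intCast_zmod_eq_zero_iff_dvd, H.heckeCocycle_cast hM hpN]
  have hred : ∀ δ : Gamma M, cocycleReduction p (H.heckeCocycle hM n ℤ c) j δ =
      (-1) ^ (n - j : ℕ) * H.heckeHom (cocycleReduction p c j) δ := fun δ ↦ by
    rw [cocycleReduction_apply, H.heckeCocycle_cast hM hpN]
  have hadd := addOnGamma_cocycleReduction hpM hc j
  have hT : ∀ φ : SL(2, ℤ) → ZMod p, AddOnGamma M φ → φ (ModularGroup.T ^ N) = 0 := by
    intro φ hφ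
    have := hφ.map_pow (T_pow_mem_Gamma M) p
    rw [← pow_mul, ← hN] at this
    simp [this]
  have hvan : ∀ δ ∈ Gamma N, H.heckeHom (cocycleReduction p c j) δ = 0 :=
    hφ _ (fun a ha b hb ↦ hadd a (Gamma_le_Gamma hM ha) b (Gamma_le_Gamma hM hb))
      (hT _ hadd) (hT _ (H.addOnGamma_heckeHom hM hadd))
  rw [H.heckeHom_eq_zero_of_vanish hpN hM (fun a ↦ by simp)
    (addOnGamma_cocycleReduction hpM (H.heckeCocycle_mem hM hc) j)
    (fun δ hδ ↦ by rw [hred ⟨δ, Gamma_le_Gamma hM hδ⟩, hvan δ hδ, mul_zero]) γ.2, mul_zero]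

/-- A polynomial congruent to a power of `X` modulo `p` annihilates the integral cocycles. -/
lemma HeckePrime.exists_annihilator [NeZero M] {p : ℕ} (hp0 : p ≠ 0) (hpM : p ∣ M) (hN : N = M * p)
    (hφ : ∀ φ : SL(2, ℤ) → ZMod p, AddOnGamma N φ → φ (ModularGroup.T ^ N) = 0 →
      H.heckeHom φ (ModularGroup.T ^ N) = 0 → ∀ γ ∈ Gamma N, H.heckeHom φ γ = 0) (n : ℕ) :
    ∃ (d : ℕ) (R : ℤ[X]), ∀ c ∈ cocycles n M ℤ,
      aeval (H.heckeCocycle hM n ℤ) (X ^ d + C (p : ℤ) * R) c = 0 := by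
  let T := H.heckeCocycle hM n ℤ
  let T' : Module.End ℤ (cocycles n M ℤ) := T.restrict fun c hc ↦ H.heckeCocycle_mem hM hc
  have hrange : LinearMap.range (T' ^ 2) ≤ Ideal.span {(p : ℤ)} • ⊤ := by
    rintro _ ⟨c, rfl⟩
    have hdvd := H.dvd_heckeCocycle_sq hM hpM hN hφ c.2
    choose b hb using hdvd
    have hbeq : ((T' ^ 2) c : Gamma M → Fin (n + 1) → ℤ) = (p : ℤ) • b := by
      ext γ j
      rw [pow_two]
      exact hb γ j
    have hbmem : b ∈ cocycles n M ℤ := by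
      have h1 : (p : ℤ) • b ∈ cocycles n M ℤ := hbeq ▸ ((T' ^ 2) c).2
      intro γ δ
      have h2 := h1 γ δ
      simp only [Pi.smul_apply, symAct_smul, ← smul_add] at h2
      exact smul_right_injective _ (by exact_mod_cast hp0 : (p : ℤ) ≠ 0) h2
    have : (T' ^ 2) c = (p : ℤ) • ⟨b, hbmem⟩ := Subtype.ext hbeq
    rw [this]
    exact Submodule.smul_mem_smul (Ideal.mem_span_singleton_self _) trivial
  obtain ⟨P, hmon, -, hcoeff, hP⟩ :=
    LinearMap.exists_monic_and_natDegree_eq_and_coeff_mem_pow_and_aeval_eq_zero ℤ (T' ^ 2)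
      (Ideal.span {(p : ℤ)}) hrange
  have hdvd : C (p : ℤ) ∣ P - X ^ P.natDegree := by
    rw [C_dvd_iff_dvd_coeff]
    intro k
    rw [coeff_sub, coeff_X_pow]
    rcases lt_trichotomy k P.natDegree with h | h | h
    · rw [if_neg h.ne, sub_zero, ← Ideal.mem_span_singleton]
      exact Ideal.pow_le_self (by omega) (hcoeff k)
    · simp [h, hmon]
    · simp [h.ne', coeff_eq_zero_of_natDegree_lt h]
  obtain ⟨R, hR⟩ := hdvd
  refine ⟨2 * P.natDegree, expand ℤ 2 R, fun c hc ↦ ?_⟩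
  have h1 : X ^ (2 * P.natDegree) + C (p : ℤ) * expand ℤ 2 R = expand ℤ 2 P := by
    have h2 := congr_arg (expand ℤ 2) (eq_add_of_sub_eq hR)
    rw [h2, map_add, map_mul, expand_C, map_pow, expand_X, ← pow_mul, add_comm]
  rw [h1]
  have h2 := aeval_apply_of_intertwine T' T (cocycles n M ℤ).subtype (fun _ ↦ rfl)
    (expand ℤ 2 P) ⟨c, hc⟩
  rw [expand_aeval, hP] at h2
  simpa using h2.symm

/-- Annihilation passes from integral to complex cocycles. -/
lemma HeckePrime.aeval_heckeCocycle_complex [NeZero M] {Q : ℤ[X]}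
    (hQ : ∀ c ∈ cocycles n M ℤ, aeval (H.heckeCocycle hM n ℤ) Q c = 0)
    {c : Gamma M → Fin (n + 1) → ℂ} (hc : c ∈ cocycles n M ℂ) :
    aeval (H.heckeCocycle hM n ℂ) Q c = 0 := by
  have : Group.FG (Gamma M) := inferInstance
  obtain ⟨S, hS⟩ := this.out
  let B : Submodule ℤ ℂ :=
    Submodule.span ℤ (Set.range fun x : S × Fin (n + 1) ↦ c x.1 x.2)
  have hB : ∀ γ i, c γ i ∈ B := cocycle_mem hc hS B.toAddSubgroup fun s hs i ↦
    Submodule.subset_span ⟨(⟨s, hs⟩, i), rfl⟩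
  have : Module.Finite ℤ B := Module.Finite.span_of_finite ℤ (Set.finite_range _)
  have : Module.IsTorsionFree ℤ B := inferInstance
  let b := Module.finBasis ℤ B
  let cB : Gamma M → Fin (n + 1) → B := fun γ i ↦ ⟨c γ i, hB γ i⟩
  have hcB : cB ∈ cocycles n M B := by
    intro γ δ
    ext i
    have h := congr_fun (hc γ δ) i
    rw [Pi.add_apply] at h ⊢
    refine h.trans ?_
    rw [Submodule.coe_add]
    congr 1
    exact (symAct_map (B.subtype.toAddMonoidHom) (δ : SL(2, ℤ)) (cB γ) i).symm
  let co : ∀ k, B →+ ℤ := fun k ↦ (b.coord k).toAddMonoidHom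
  let mu : ∀ k, ℤ →+ ℂ := fun k ↦ (zmultiplesHom ℂ) (b k : ℂ)
  have hsum : c = ∑ k, fun γ i ↦ mu k (co k (cB γ i)) := by
    ext γ i
    have h := congr_arg (Subtype.val) (b.sum_repr (cB γ i))
    rw [Submodule.coe_sum] at h
    simpa [mu, co, Finset.sum_apply] using h.symm
  rw [hsum, map_sum]
  refine Finset.sum_eq_zero fun k _ ↦ ?_
  let L : (Gamma M → Fin (n + 1) → ℤ) →ₗ[ℤ] (Gamma M → Fin (n + 1) → ℂ) :=
    { toFun := fun c γ i ↦ mu k (c γ i)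
      map_add' := fun _ _ ↦ by ext; simp
      map_smul' := fun _ _ ↦ by ext; simp [mu, mul_assoc] }
  have := aeval_apply_of_intertwine (H.heckeCocycle hM n ℤ) (H.heckeCocycle hM n ℂ) L
    (fun v ↦ by ext γ i; exact (H.heckeCocycle_map hM (mu k) v γ i).symm) Q
    (fun γ i ↦ co k (cB γ i))
  rw [hQ _ (cocycle_map (co k) hcB), map_zero] at this
  exact this.symm

end Cocycle

end

end

section

noncomputable section

open UpperHalfPlane hiding I
open Function PowerSeries Complex
open scoped Manifold ModularForm MatrixGroups

/-- Termwise primitive of a `q`-expansion without constant term. -/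
def qPrimitive (N : ℕ) (f : ℂ⟦X⟧) : ℂ⟦X⟧ :=
  .mk fun m ↦ coeff m f * (N / (2 * Real.pi * I * m))

lemma coeff_qPrimitive (N m : ℕ) (f : ℂ⟦X⟧) :
    coeff m (qPrimitive N f) = coeff m f * (N / (2 * Real.pi * I * m)) := coeff_mk _ _

lemma HasQExp.exists_primitive {N : ℕ} {f : ℂ⟦X⟧} {F : ℍ → ℂ} (hN : 0 < N) (hf : HasQExp N f F)
    (h0 : coeff 0 f = 0) : ∃ G : ℍ → ℂ, HasQExp N (qPrimitive N f) G ∧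
      ∀ z : ℍ, HasDerivAt (fun w ↦ G (ofComplex w)) (F z) z := by
  have hN' : (0 : ℝ) < N := by exact_mod_cast hN
  have hNC : (N : ℂ) ≠ 0 := by exact_mod_cast hN.ne'
  let u : ℍ → ℕ → ℝ := fun z m ↦ ‖coeff m f * Periodic.qParam N z ^ m‖ * N
  have hu : ∀ z, Summable (u z) := fun z ↦ (hf z).summable.norm.mul_right _
  have hc : ∀ m : ℕ, ‖(N / (2 * Real.pi * I * m) : ℂ)‖ ≤ N := by
    intro m
    rcases Nat.eq_zero_or_pos m with rfl | hm
    · simp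
    rw [norm_div, Complex.norm_natCast]
    refine div_le_self hN'.le ?_
    have h1 : (1 : ℝ) ≤ m := by exact_mod_cast hm
    have h2 := Real.pi_gt_three
    simp [abs_of_pos Real.pi_pos]
    nlinarith
  let t : ℕ → ℂ → ℂ := fun m w ↦ coeff m (qPrimitive N f) * Periodic.qParam N w ^ m
  have hle : ∀ (z : ℍ) (m : ℕ) (w : ℂ), z.im < w.im → ‖t m w‖ ≤ u z m := by
    intro z m w hw
    simp only [t, u, coeff_qPrimitive, norm_mul, norm_pow]
    rw [mul_right_comm]
    refine mul_le_mul (mul_le_mul_of_nonneg_left ?_ (norm_nonneg _)) (hc m) (norm_nonneg _)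
      (by positivity)
    refine pow_le_pow_left₀ (norm_nonneg _) ?_ m
    rw [Periodic.norm_qParam, Periodic.norm_qParam]
    refine Real.exp_le_exp.2 (div_le_div_of_nonneg_right ?_ hN'.le)
    have := Real.pi_pos
    have h3 : z.im ≤ w.im := hw.le
    rw [coe_im]
    nlinarith
  have hlow : ∀ z : ℍ, ∃ z' : ℍ, z'.im < z.im := fun z ↦
    ⟨⟨z.im / 2 * I, by simpa using z.im_pos⟩, by
      have : (z.im / 2 * I : ℂ).im = z.im / 2 := by simp
      rw [← coe_im, UpperHalfPlane.coe_mk, this]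
      linarith [z.im_pos]⟩
  have hderiv : ∀ (m : ℕ) (w : ℂ),
      HasDerivAt (t m) (coeff m f * Periodic.qParam N w ^ m) w := by
    intro m w
    rcases Nat.eq_zero_or_pos m with rfl | hm
    · simpa [t, h0, coeff_qPrimitive] using hasDerivAt_const w (0 : ℂ)
    have h1 : HasDerivAt (fun w ↦ Periodic.qParam N w ^ m)
        (Periodic.qParam N w ^ m * (2 * Real.pi * I / N * m)) w := by
      have h2 : ∀ w, Periodic.qParam N w ^ m = exp (2 * Real.pi * I / N * m * w) := fun w ↦ by
        rw [Periodic.qParam, ← exp_nat_mul]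
        congr 1
        push_cast
        ring
      simp only [h2]
      have h3 := ((hasDerivAt_id w).const_mul (2 * Real.pi * I / N * m : ℂ)).cexp
      simpa using h3
    convert! h1.const_mul (coeff m (qPrimitive N f)) using 1
    have h2 : (m : ℂ) ≠ 0 := by exact_mod_cast hm.ne'
    have h3 : (Real.pi : ℂ) ≠ 0 := by exact_mod_cast Real.pi_ne_zero
    rw [coeff_qPrimitive]
    field_simp [I_ne_zero]
  have hsum : ∀ z : ℍ, Summable fun m ↦ t m z := fun z ↦ by
    obtain ⟨z', hz'⟩ := hlow z
    exact Summable.of_norm_bounded (hu z') fun m ↦ hle z' m z hz'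
  refine ⟨fun z ↦ ∑' m, t m z, fun z ↦ (hsum z).hasSum, fun z ↦ ?_⟩
  obtain ⟨z', hz'⟩ := hlow z
  have hopen : IsOpen {w : ℂ | z'.im < w.im} := isOpen_lt continuous_const continuous_im
  have hdiff : ∀ m, DifferentiableOn ℂ (t m) {w : ℂ | z'.im < w.im} := fun m w _ ↦
    (hderiv m w).differentiableAt.differentiableWithinAt
  have h1 := hasSum_deriv_of_summable_norm (hu z') hdiff hopen (hle z') (z := (z : ℂ)) hz'
  have h2 := (differentiableOn_tsum_of_summable_norm (hu z') hdiff hopen (hle z')).differentiableAt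
    (hopen.mem_nhds (show (z : ℂ) ∈ {w : ℂ | z'.im < w.im} from hz'))
  simp only [(hderiv _ _).deriv] at h1
  have h3 := h2.hasDerivAt
  rw [h1.unique (hf z)] at h3
  refine h3.congr_of_eventuallyEq ?_
  filter_upwards [hopen.mem_nhds (show (z : ℂ) ∈ {w : ℂ | z'.im < w.im} from hz')] with w hw
  rw [ofComplex_apply_of_im_pos (z'.im_pos.trans hw)]

section IsForm

/-- Functions of two variables given by binary forms of degree `n`. -/
def IsForm (n : ℕ) (Φ : (Fin 2 → ℂ) → ℂ) : Prop := ∃ P : Fin (n + 1) → ℂ, ∀ v, Φ v = formEval P v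

variable {n : ℕ} {Φ Ψ : (Fin 2 → ℂ) → ℂ}

lemma IsForm.add (hΦ : IsForm n Φ) (hΨ : IsForm n Ψ) : IsForm n fun v ↦ Φ v + Ψ v := by
  obtain ⟨P, hP⟩ := hΦ
  obtain ⟨Q, hQ⟩ := hΨ
  exact ⟨P + Q, fun v ↦ by simp [hP, hQ, formEval, add_mul, Finset.sum_add_distrib]⟩

lemma IsForm.smul (a : ℂ) (hΦ : IsForm n Φ) : IsForm n fun v ↦ a * Φ v := by
  obtain ⟨P, hP⟩ := hΦ
  exact ⟨a • P, fun v ↦ by simp [hP, formEval, Finset.mul_sum, mul_assoc]⟩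

lemma IsForm.sub (hΦ : IsForm n Φ) (hΨ : IsForm n Ψ) : IsForm n fun v ↦ Φ v - Ψ v := by
  simpa [sub_eq_add_neg] using hΦ.add (hΨ.smul (-1))

lemma IsForm.const (a : ℂ) : IsForm 0 fun _ ↦ a := ⟨fun _ ↦ a, fun v ↦ by simp [formEval]⟩

lemma IsForm.mul_fst (hΦ : IsForm n Φ) : IsForm (n + 1) fun v ↦ v 0 * Φ v := by
  obtain ⟨P, hP⟩ := hΦ
  refine ⟨Fin.cons 0 P, fun v ↦ ?_⟩
  beta_reduce
  rw [hP, formEval, formEval, Finset.mul_sum, Fin.sum_univ_succ (n := n + 1)]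
  simp [pow_succ]
  exact Finset.sum_congr rfl fun i _ ↦ by ring

lemma IsForm.mul_snd (hΦ : IsForm n Φ) : IsForm (n + 1) fun v ↦ v 1 * Φ v := by
  obtain ⟨P, hP⟩ := hΦ
  refine ⟨Fin.snoc P 0, fun v ↦ ?_⟩
  beta_reduce
  rw [hP, formEval, formEval, Finset.mul_sum, Fin.sum_univ_castSucc (n := n + 1)]
  simp
  refine Finset.sum_congr rfl fun i _ ↦ ?_
  rw [Nat.sub_add_comm (by omega : (i : ℕ) ≤ n), pow_succ]
  ring

lemma IsForm.linear_pow (z : ℂ) (n : ℕ) : IsForm n fun v ↦ (v 0 - z * v 1) ^ n := by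
  induction n with
  | zero => simpa using IsForm.const 1
  | succ n ih =>
    convert ih.mul_fst.sub (ih.mul_snd.smul z) using 2 with v
    ring

lemma IsForm.comp_mulVec (hΦ : IsForm n Φ) (g : Matrix (Fin 2) (Fin 2) ℤ) :
    IsForm n fun v ↦ Φ ((g.map (Int.cast : ℤ → ℂ)).mulVec v) := by
  obtain ⟨P, hP⟩ := hΦ
  exact ⟨symAct g P, fun v ↦ by beta_reduce; rw [formEval_symAct, hP]⟩

lemma IsForm.homogeneous (hΦ : IsForm n Φ) (a : ℂ) (v : Fin 2 → ℂ) :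
    Φ (a • v) = a ^ n * Φ v := by
  obtain ⟨P, hP⟩ := hΦ
  rw [hP, hP, formEval, formEval, Finset.mul_sum]
  refine Finset.sum_congr rfl fun i _ ↦ ?_
  have : a ^ n = a ^ (i : ℕ) * a ^ (n - i) := by rw [← pow_add]; congr 1; omega
  simp only [Pi.smul_apply, smul_eq_mul, mul_pow, this]
  ring

end IsForm

/-- Eichler integrals of a function `F` of weight `n + 2`, with values in binary forms. -/
structure IsEichler (n : ℕ) (F : ℍ → ℂ) (E : ℍ → (Fin 2 → ℂ) → ℂ) : Prop where
  deriv : ∀ (z : ℍ) (v : Fin 2 → ℂ),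
    HasDerivAt (fun w ↦ E (ofComplex w) v) (F z * (v 0 - z * v 1) ^ n) z
  isForm : ∀ z, IsForm n (E z)

namespace IsEichler

variable {n : ℕ} {F F' : ℍ → ℂ} {E E' : ℍ → (Fin 2 → ℂ) → ℂ}

lemma add (h : IsEichler n F E) (h' : IsEichler n F' E') : IsEichler n (F + F') (E + E') where
  deriv z v := by
    simpa [add_mul] using! (h.deriv z v).add (h'.deriv z v)
  isForm z := (h.isForm z).add (h'.isForm z)

lemma smul (a : ℤ) (h : IsEichler n F E) : IsEichler n (a • F) (a • E) where
  deriv z v := by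
    simpa [mul_assoc] using! (h.deriv z v).const_mul (a : ℂ)
  isForm z := by simpa using! (h.isForm z).smul a

lemma zero : IsEichler n 0 0 where
  deriv z v := by simpa using! hasDerivAt_const (z : ℂ) (0 : ℂ)
  isForm z := ⟨0, fun v ↦ by simp [formEval]⟩

lemma sum {ι : Type*} (s : Finset ι) {F : ι → ℍ → ℂ} {E : ι → ℍ → (Fin 2 → ℂ) → ℂ}
    (h : ∀ i, IsEichler n (F i) (E i)) : IsEichler n (∑ i ∈ s, F i) (∑ i ∈ s, E i) := by
  classical
  induction s using Finset.induction_on with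
  | empty => simpa using zero
  | insert i s hi ih => rw [Finset.sum_insert hi, Finset.sum_insert hi]; exact (h i).add ih

lemma unique (h : IsEichler n F E) (h' : IsEichler n F E') :
    ∃ P : Fin (n + 1) → ℂ, ∀ z v, E z v - E' z v = formEval P v := by
  obtain ⟨P, hP⟩ := (h.isForm UpperHalfPlane.I).sub (h'.isForm UpperHalfPlane.I)
  refine ⟨P, fun z v ↦ ?_⟩
  rw [← hP]
  have hd : ∀ w ∈ {w : ℂ | 0 < w.im},
      HasDerivAt (fun w ↦ E (ofComplex w) v - E' (ofComplex w) v) 0 w := fun w hw ↦ by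
    simpa using! ((h.deriv ⟨w, hw⟩ v).sub (h'.deriv ⟨w, hw⟩ v))
  have := (isOpen_lt continuous_const continuous_im :
      IsOpen {w : ℂ | 0 < w.im}).is_const_of_deriv_eq_zero
    (convex_halfSpace_im_gt 0).isPreconnected (fun w hw ↦
      (hd w hw).differentiableAt.differentiableWithinAt)
    (fun w hw ↦ (hd w hw).deriv) z.im_pos UpperHalfPlane.I.im_pos
  simp only [ofComplex_apply] at this
  exact this.trans (by rw [← ofComplex_apply UpperHalfPlane.I])

lemma slash (h : IsEichler n F E) {A : Matrix (Fin 2) (Fin 2) ℤ} (hA : 0 < A.det) :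
    IsEichler n (F ∣[(n + 2 : ℤ)] intGL A)
      (fun z v ↦ E (intGL A • z) ((A.map (Int.cast : ℤ → ℂ)).mulVec v)) where
  deriv z v := by
    have hdet : ((intGL A).val.det : ℝ) = A.det := det_intGL hA.ne'
    have hpos : 0 < (intGL A).val.det := by rw [hdet]; exact_mod_cast hA
    have h1 := (hasStrictDerivAt_smul hpos z).hasDerivAt
    have h2 := h.deriv (intGL A • z) ((A.map (Int.cast : ℤ → ℂ)).mulVec v)
    have h3 := HasDerivAt.scomp (z : ℂ) (h := fun w ↦ ((intGL A • ofComplex w : ℍ) : ℂ))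
      (by rw [ofComplex_apply] at *; exact h2) h1
    have h4 : (fun w : ℂ ↦ E (intGL A • ofComplex w) ((A.map (Int.cast : ℤ → ℂ)).mulVec v)) =
      (fun w ↦ E (ofComplex w) ((A.map (Int.cast : ℤ → ℂ)).mulVec v)) ∘
        fun w ↦ ((intGL A • ofComplex w : ℍ) : ℂ) := by ext w; simp
    rw [h4]
    refine h3.congr_deriv ?_
    have hd := denom_ne_zero (intGL A) z
    have hv : ((A.map (Int.cast : ℤ → ℂ)).mulVec v) 0 - (intGL A • z : ℍ) *
        ((A.map (Int.cast : ℤ → ℂ)).mulVec v) 1 =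
        A.det * (v 0 - z * v 1) / denom (intGL A) z := by
      rw [coe_smul_of_det_pos hpos, eq_div_iff hd, sub_mul, mul_right_comm, div_mul_cancel₀ _ hd]
      simp [num, denom, intGL_apply hA.ne', Matrix.mulVec, dotProduct, Matrix.det_fin_two]
      ring
    rw [hv, ModularForm.slash_apply, hdet, UpperHalfPlane.σ, if_pos (by exact hpos)]
    have hab : ((|(intGL A).det.val| : ℝ) : ℂ) = A.det := by
      rw [det_intGL hA.ne', abs_of_pos (by exact_mod_cast hA)]; simp
    have e1 : ((n : ℤ) + 2 - 1) = ((n + 1 : ℕ) : ℤ) := by push_cast; ring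
    have e2 : (-((n : ℤ) + 2)) = -((n + 2 : ℕ) : ℤ) := by push_cast; ring
    rw [hab, e1, e2, zpow_natCast, zpow_neg, zpow_natCast]
    simp only [ContinuousAlgEquiv.refl_apply, smul_eq_mul, div_pow, mul_pow, pow_add, pow_one,
        pow_two]
    field_simp
    simp
    ring
  isForm z := (h.isForm _).comp_mulVec A

end IsEichler

lemma HasQExp.exists_eichler {N : ℕ} (hN : 0 < N) (n : ℕ) {f : ℂ⟦X⟧} {F : ℍ → ℂ}
    (hf : HasQExp N f F) (h0 : coeff 0 f = 0) :
    ∃ (E : ℍ → (Fin 2 → ℂ) → ℂ) (G : ℍ → ℂ), IsEichler n F E ∧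
      HasQExp N ((qPrimitive N)^[n + 1] f) G ∧ MDiff G ∧
      ∀ z : ℍ, E z ![z, 1] = n.factorial * G z := by
  induction n generalizing f F with
  | zero =>
    obtain ⟨G, hG, hd⟩ := hf.exists_primitive hN h0
    exact ⟨fun z _ ↦ G z, G, ⟨fun z v ↦ by simpa using hd z, fun z ↦ IsForm.const _⟩, hG,
      mdifferentiable_iff.2 fun w hw ↦
        (hd ⟨w, hw⟩).differentiableAt.differentiableWithinAt, fun z ↦ by simp⟩
  | succ n ih =>
    obtain ⟨F₁, hF₁, hd⟩ := hf.exists_primitive hN h0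
    obtain ⟨E, G, hE, hG, hGd, hEG⟩ := ih hF₁ (by simp [coeff_qPrimitive])
    refine ⟨fun z v ↦ F₁ z * (v 0 - z * v 1) ^ (n + 1) + (n + 1) * (v 1 * E z v), G,
      ⟨fun z v ↦ ?_, fun z ↦ ?_⟩, hG, hGd, fun z ↦ ?_⟩
    · have h1 := hd z
      have h2 : HasDerivAt (fun w ↦ (v 0 - (ofComplex w : ℂ) * v 1) ^ (n + 1))
          (((n + 1 : ℕ) : ℂ) * (v 0 - z * v 1) ^ n * (-v 1)) z := by
        have h3 : HasDerivAt (fun w : ℂ ↦ (v 0 - w * v 1) ^ (n + 1))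
            (((n + 1 : ℕ) : ℂ) * (v 0 - z * v 1) ^ n * (-v 1)) z := by
          have h4 := (((hasDerivAt_id (z : ℂ)).mul_const (v 1)).const_sub (v 0)).pow (n + 1)
          simpa using! h4
        refine h3.congr_of_eventuallyEq ?_
        filter_upwards [eventuallyEq_coe_comp_ofComplex z.im_pos] with w hw
        simp only [Function.comp_apply, id] at hw
        rw [hw]
      have h3 := (h1.mul h2).add (((hE.deriv z v).const_mul (v 1)).const_mul (n + 1 : ℂ))
      convert! h3 using 1
      simp
      ring
    · exact ((IsForm.linear_pow z (n + 1)).smul (F₁ z)).add ((hE.isForm z).mul_snd.smul _)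
    · simp [hEG, Nat.factorial_succ]
      ring

end

end

section

noncomputable section

open UpperHalfPlane hiding I
open Function PowerSeries CongruenceSubgroup
open scoped Manifold ModularForm MatrixGroups

/-- The action on `q`-expansions of the Hecke operator of weight `n + 2` at `ℓ`, with the sign
coming from matrices congruent to `diag(1, -1)`. -/
def heckeSeries (A : Type*) [CommRing A] (n ℓ : ℕ) : Module.End ℤ A⟦X⟧ where
  toFun f := .mk fun m ↦ coeff (ℓ * m) f +
    if ℓ ∣ m then (-1) ^ n * (ℓ : A) ^ (n + 1) * coeff (m / ℓ) f else 0
  map_add' f g := by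
    ext m
    simp only [map_add, coeff_mk]
    split_ifs <;> ring
  map_smul' a f := by
    ext m
    simp only [map_zsmul, coeff_mk, eq_intCast, Int.cast_id]
    split_ifs
    · simp only [zsmul_eq_mul]; ring
    · simp

lemma coeff_heckeSeries {A : Type*} [CommRing A] (n ℓ m : ℕ) (f : A⟦X⟧) :
    coeff m (heckeSeries A n ℓ f) = coeff (ℓ * m) f +
      if ℓ ∣ m then (-1) ^ n * (ℓ : A) ^ (n + 1) * coeff (m / ℓ) f else 0 := by
  exact coeff_mk m fun m ↦ coeff (ℓ * m) f +
    if ℓ ∣ m then (-1) ^ n * (ℓ : A) ^ (n + 1) * coeff (m / ℓ) f else 0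

lemma map_heckeSeries {A B : Type*} [CommRing A] [CommRing B] (φ : A →+* B) (n ℓ : ℕ) (f : A⟦X⟧) :
    (heckeSeries A n ℓ f).map φ = heckeSeries B n ℓ (f.map φ) := by
  ext m
  simp only [coeff_map, coeff_heckeSeries, map_add]
  split_ifs <;> simp

lemma HasQExp.sum {N : ℕ} {ι : Type*} (s : Finset ι) {f : ι → ℂ⟦X⟧} {F : ι → ℍ → ℂ}
    (h : ∀ i, HasQExp N (f i) (F i)) : HasQExp N (∑ i ∈ s, f i) (∑ i ∈ s, F i) := by
  classical
  induction s using Finset.induction_on with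
  | empty => simpa using HasQExp.zero
  | insert i s hi ih => rw [Finset.sum_insert hi, Finset.sum_insert hi]; exact (h i).add ih

lemma IsAutForm.sum {k : ℤ} {ι : Type*} (s : Finset ι) {F : ι → ℍ → ℂ}
    (h : ∀ i, IsAutForm k (F i)) : IsAutForm k (∑ i ∈ s, F i) := by
  classical
  induction s using Finset.induction_on with
  | empty => simpa using IsAutForm.zero
  | insert i s hi ih => rw [Finset.sum_insert hi]; exact (h i).add ih

lemma sum_exp_pow_val {ℓ : ℕ} [NeZero ℓ] (j : ℕ) :
    ∑ b : ZMod ℓ, (Complex.exp (2 * Real.pi * Complex.I / ℓ) ^ b.val) ^ j =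
      if ℓ ∣ j then (ℓ : ℂ) else 0 := by
  have h := Complex.isPrimitiveRoot_exp ℓ (NeZero.ne ℓ)
  set ζ := Complex.exp (2 * Real.pi * Complex.I / ℓ)
  have h1 : ∑ b : ZMod ℓ, (ζ ^ b.val) ^ j = ∑ b ∈ Finset.range ℓ, (ζ ^ j) ^ b := by
    refine Finset.sum_nbij (fun b ↦ b.val) (fun b _ ↦ by simpa using ZMod.val_lt b)
      (fun b _ b' _ hb ↦ ZMod.val_injective ℓ hb) (fun b hb ↦ ⟨(b : ZMod ℓ), by simp, ?_⟩)
      fun b _ ↦ by rw [← pow_mul, ← pow_mul, mul_comm]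
    exact ZMod.val_cast_of_lt (by simpa using hb)
  rw [h1]
  split_ifs with hj
  · simp [(h.pow_eq_one_iff_dvd j).2 hj]
  · have h2 : ζ ^ j ≠ 1 := fun h' ↦ hj ((h.pow_eq_one_iff_dvd j).1 h')
    rw [geom_sum_eq h2, ← pow_mul, mul_comm, pow_mul, h.pow_eq_one]
    simp

variable {N ℓ : ℕ} (H : HeckePrime N ℓ) [NeZero ℓ]

include H in
lemma HeckePrime.hasQExp_sum_slash {f : ℂ⟦X⟧} {F : ℍ → ℂ} (hf : HasQExp N f F) (n : ℕ) :
    HasQExp (N * ℓ) (expand ℓ H.prime.ne_zero (heckeSeries ℂ n ℓ f))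
      (∑ i, F ∣[(n + 2 : ℤ)] intGL (heckeRep N ℓ i)) := by
  have hℓ : (ℓ : ℂ) ≠ 0 := by exact_mod_cast H.prime.ne_zero
  rw [Fintype.sum_option]
  convert (H.hasQExp_slash_none hf (n + 2)).add
    (HasQExp.sum Finset.univ fun b ↦ H.hasQExp_slash_some hf (n + 2) b) using 1
  ext j
  have he : (n + 2 - 1 : ℤ) = ((n + 1 : ℕ) : ℤ) := by push_cast; ring
  have he' : (n + 2 : ℤ) = ((n + 2 : ℕ) : ℤ) := by push_cast; ring
  have hs : (-1 : ℂ) ^ (n + 2) = (-1) ^ n := by ring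
  rw [map_add, map_sum, he, he', zpow_natCast, zpow_natCast, hs]
  simp only [PowerSeries.coeff_smul, coeff_rescale, smul_eq_mul]
  rw [← Finset.mul_sum, ← Finset.sum_mul, sum_exp_pow_val]
  by_cases hj : ℓ ∣ j
  · obtain ⟨m, rfl⟩ := hj
    rw [coeff_expand_mul, coeff_heckeSeries, if_pos (dvd_mul_right ℓ m)]
    by_cases hm : ℓ ∣ m
    · obtain ⟨m, rfl⟩ := hm
      rw [if_pos (dvd_mul_right _ _), Nat.mul_div_cancel_left _ H.prime.pos,
        show ℓ * (ℓ * m) = ℓ ^ 2 * m by ring, coeff_expand_mul]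
      field_simp
      ring
    · rw [if_neg hm, coeff_expand_of_not_dvd]
      · field_simp
        ring
      · rw [pow_two]
        exact fun h ↦ hm (Nat.dvd_of_mul_dvd_mul_left H.prime.pos h)
  · rw [coeff_expand_of_not_dvd _ _ _ hj, if_neg hj, coeff_expand_of_not_dvd]
    · simp
    · exact fun h ↦ hj (dvd_trans (dvd_pow_self ℓ two_ne_zero) h)

/-- Cusp forms of weight `n + 2` for `Γ(M)`. -/
structure IsLevelCuspForm (n M : ℕ) (F : ℍ → ℂ) : Prop where
  aut : IsAutForm (n + 2) F
  inv : ∀ γ ∈ Gamma M, F ∣[(n + 2 : ℤ)] γ = F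
  cusp : ∀ γ : SL(2, ℤ), IsZeroAtImInfty (F ∣[(n + 2 : ℤ)] γ)

namespace IsLevelCuspForm

variable {n M : ℕ} {F F' : ℍ → ℂ}

lemma add (h : IsLevelCuspForm n M F) (h' : IsLevelCuspForm n M F') :
    IsLevelCuspForm n M (F + F') where
  aut := h.aut.add h'.aut
  inv γ hγ := by rw [SlashAction.add_slash, h.inv γ hγ, h'.inv γ hγ]
  cusp γ := by
    rw [SlashAction.add_slash]
    exact Filter.ZeroAtFilter.add (h.cusp γ) (h'.cusp γ)

lemma smul (a : ℂ) (h : IsLevelCuspForm n M F) : IsLevelCuspForm n M (a • F) where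
  aut := h.aut.smul a
  inv γ hγ := by rw [ModularForm.SL_smul_slash, h.inv γ hγ]
  cusp γ := by
    rw [ModularForm.SL_smul_slash]
    exact Filter.ZeroAtFilter.smul a (h.cusp γ)

lemma zero : IsLevelCuspForm n M 0 where
  aut := .zero
  inv γ _ := SlashAction.zero_slash _ _
  cusp γ := by
    rw [SlashAction.zero_slash]
    exact Filter.zero_zeroAtFilter _

lemma mono {M' : ℕ} (hM : M ∣ M') (h : IsLevelCuspForm n M F) : IsLevelCuspForm n M' F :=
  ⟨h.aut, fun γ hγ ↦ h.inv γ (Gamma_le_Gamma hM hγ), h.cusp⟩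

lemma slash_SL (h : IsLevelCuspForm n M F) (γ : SL(2, ℤ)) :
    IsLevelCuspForm n M (F ∣[(n + 2 : ℤ)] γ) where
  aut := h.aut.slash_SL γ
  inv δ hδ := by
    rw [← SlashAction.slash_mul, show γ * δ = (γ * δ * γ⁻¹) * γ by group, SlashAction.slash_mul,
      h.inv _ ((Gamma_normal M).conj_mem _ hδ γ)]
  cusp δ := by
    rw [← SlashAction.slash_mul]
    exact h.cusp _

lemma exists_hasQExp (hM : 0 < M) (h : IsLevelCuspForm n M F) :
    ∃ f, HasQExp M f F ∧ coeff 0 f = 0 := by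
  obtain ⟨f, hf⟩ := h.aut.exists_hasQExp hM (h.inv _ (T_pow_mem_Gamma M))
  have h0 := h.cusp 1
  rw [SlashAction.slash_one] at h0
  exact ⟨f, hf, tendsto_nhds_unique (hf.tendsto hM h.aut.mdiff) h0⟩

lemma coeff_zero (h : IsLevelCuspForm n M F) {N : ℕ} (hN : 0 < N) {f : ℂ⟦X⟧}
    (hf : HasQExp N f F) : coeff 0 f = 0 := by
  have h0 := h.cusp 1
  rw [SlashAction.slash_one] at h0
  exact tendsto_nhds_unique (hf.tendsto hN h.aut.mdiff) h0

include H in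
lemma hecke (hM : M ∣ N) (h : IsLevelCuspForm n M F) :
    IsLevelCuspForm n M (∑ i, F ∣[(n + 2 : ℤ)] intGL (heckeRep N ℓ i)) where
  aut := IsAutForm.sum _ fun i ↦ h.aut.slash (H.det_pos i).ne'
  inv γ hγ := by
    rw [SlashAction.sum_slash,
      ← H.idx_perm_sum γ fun i ↦ F ∣[(n + 2 : ℤ)] intGL (heckeRep N ℓ i)]
    refine Finset.sum_congr rfl fun i _ ↦ ?_
    rw [H.slash_rep_slash, h.inv _ (H.factor_mem_Gamma hM hγ i)]
  cusp γ := by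
    rw [SlashAction.sum_slash]
    refine Submodule.sum_mem (Filter.zeroAtFilterSubmodule ℂ atImInfty) fun i _ ↦ ?_
    rw [H.slash_rep_slash]
    refine IsZeroAtImInfty.slash _ (g := intGL (heckeRep N ℓ (H.idx γ i))) ?_ (h.cusp _)
    rw [intGL_apply (H.det_pos _).ne']
    cases H.idx γ i <;> simp [heckeRep]

include H in
lemma hasQExp_hecke (hM : M ∣ N) (h : IsLevelCuspForm n M F) {f : ℂ⟦X⟧} (hf : HasQExp N f F) :
    HasQExp N (heckeSeries ℂ n ℓ f) (∑ i, F ∣[(n + 2 : ℤ)] intGL (heckeRep N ℓ i)) := by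
  have hN : 0 < N := zero_lt_one.trans H.one_lt
  obtain ⟨g, hg, -⟩ := ((h.hecke H hM).mono hM).exists_hasQExp hN
  have h1 := (hg.expand H.prime.ne_zero).unique (Nat.mul_pos hN H.prime.pos)
    (H.hasQExp_sum_slash hf n)
  rwa [← PowerSeries.expand_injective H.prime.ne_zero h1]

end IsLevelCuspForm

end

end

section

noncomputable section

open UpperHalfPlane hiding I
open Function PowerSeries CongruenceSubgroup
open scoped Manifold ModularForm MatrixGroups

/-- The series `f` is the `q`-expansion of a cusp form whose Eichler integral has period
cocycle `c`. -/
def IsPeriodCocycle (n M N : ℕ) (f : ℂ⟦X⟧) (c : Gamma M → Fin (n + 1) → ℂ) : Prop :=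
  ∃ (F : ℍ → ℂ) (E : ℍ → (Fin 2 → ℂ) → ℂ), IsLevelCuspForm n M F ∧ HasQExp N f F ∧
    IsEichler n F E ∧ ∀ (γ : Gamma M) (z : ℍ) (v : Fin 2 → ℂ),
      E (intGL (γ : SL(2, ℤ)) • z)
        (((γ : SL(2, ℤ)) : Matrix (Fin 2) (Fin 2) ℤ).map (Int.cast : ℤ → ℂ) |>.mulVec v) =
      E z v + formEval (c γ) v

lemma formEval_injective {n : ℕ} {P Q : Fin (n + 1) → ℂ} (h : ∀ v, formEval P v = formEval Q v) :
    P = Q := by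
  let p : (Fin (n + 1) → ℂ) → Polynomial ℂ :=
      fun P ↦ ∑ i, Polynomial.C (P i) * Polynomial.X ^ (i : ℕ)
  have hc : ∀ P i, (p P).coeff (i : Fin (n + 1)) = P i := fun P i ↦ by
    simp [p, Polynomial.finsetSum_coeff, Polynomial.coeff_X_pow, Fin.val_inj]
  have hp : p P = p Q := Polynomial.funext fun x ↦ by
    simpa [p, Polynomial.eval_finsetSum, formEval] using h ![x, 1]
  ext i
  rw [← hc P, hp, hc]

lemma det_SL_ne_zero (γ : SL(2, ℤ)) : (γ : Matrix (Fin 2) (Fin 2) ℤ).det ≠ 0 := by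
  rw [γ.det_coe]; exact one_ne_zero

lemma map_mulVec_mul (A B : Matrix (Fin 2) (Fin 2) ℤ) (v : Fin 2 → ℂ) :
    ((A * B).map (Int.cast : ℤ → ℂ)).mulVec v =
      (A.map (Int.cast : ℤ → ℂ)).mulVec ((B.map (Int.cast : ℤ → ℂ)).mulVec v) := by
  rw [Matrix.mulVec_mulVec]
  congr 1
  exact Matrix.map_mul (f := Int.castRingHom ℂ)

namespace IsPeriodCocycle

variable {n M N ℓ : ℕ} {f g : ℂ⟦X⟧} {c d : Gamma M → Fin (n + 1) → ℂ}

lemma mem_cocycles (h : IsPeriodCocycle n M N f c) : c ∈ cocycles n M ℂ := by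
  obtain ⟨F, E, -, -, -, hE⟩ := h
  intro γ δ
  refine formEval_injective fun v ↦ ?_
  have h1 := hE (γ * δ) UpperHalfPlane.I v
  rw [Subgroup.coe_mul, Matrix.SpecialLinearGroup.coe_mul, intGL_mul (det_SL_ne_zero _)
    (det_SL_ne_zero _), map_mulVec_mul, mul_smul, hE γ, hE δ, add_assoc] at h1
  rw [← add_left_cancel h1, ← formEval_symAct, add_comm, formEval, formEval, formEval,
    ← Finset.sum_add_distrib]
  exact Finset.sum_congr rfl fun i _ ↦ (add_mul _ _ _).symm

lemma add (h : IsPeriodCocycle n M N f c) (h' : IsPeriodCocycle n M N g d) :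
    IsPeriodCocycle n M N (f + g) (c + d) := by
  obtain ⟨F, E, h1, h2, h3, h4⟩ := h
  obtain ⟨F', E', h1', h2', h3', h4'⟩ := h'
  refine ⟨F + F', E + E', h1.add h1', h2.add h2', h3.add h3', fun γ z v ↦ ?_⟩
  simp only [Pi.add_apply, h4 γ z v, h4' γ z v, formEval, add_mul, Finset.sum_add_distrib]
  ring

lemma smul (a : ℤ) (h : IsPeriodCocycle n M N f c) : IsPeriodCocycle n M N (a • f) (a • c) := by
  obtain ⟨F, E, h1, h2, h3, h4⟩ := h
  refine ⟨a • F, a • E, ?_, ?_, h3.smul a, fun γ z v ↦ ?_⟩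
  · rw [← Int.cast_smul_eq_zsmul ℂ]; exact h1.smul _
  · rw [← Int.cast_smul_eq_zsmul ℂ, ← Int.cast_smul_eq_zsmul ℂ a F]; exact h2.smul _
  · simp only [Pi.smul_apply, h4 γ z v, formEval, zsmul_eq_mul, mul_add, Finset.mul_sum, mul_assoc]

lemma hecke (H : HeckePrime N ℓ) [NeZero ℓ] (hM : M ∣ N) (h : IsPeriodCocycle n M N f c) :
    IsPeriodCocycle n M N (heckeSeries ℂ n ℓ f) (H.heckeCocycle hM n ℂ c) := by
  obtain ⟨F, E, h1, h2, h3, h4⟩ := h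
  let e : Option (ZMod ℓ) → ℍ → (Fin 2 → ℂ) → ℂ := fun i z v ↦
    E (intGL (heckeRep N ℓ i) • z) (((heckeRep N ℓ i).map (Int.cast : ℤ → ℂ)).mulVec v)
  refine ⟨_, ∑ i, e i, h1.hecke H hM, h1.hasQExp_hecke H hM h2,
    IsEichler.sum _ fun i ↦ h3.slash (H.det_pos i), fun γ z v ↦ ?_⟩
  have h5 : ∀ i, e i (intGL (γ : SL(2, ℤ)) • z)
      (((γ : SL(2, ℤ)) : Matrix (Fin 2) (Fin 2) ℤ).map (Int.cast : ℤ → ℂ) |>.mulVec v) =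
      e (H.idx γ i) z v +
        formEval (symAct (heckeRep N ℓ (H.idx γ i)) (c (H.factorGamma hM γ i))) v := by
    intro i
    simp only [e]
    rw [← mul_smul, ← map_mulVec_mul, ← intGL_mul (H.det_pos i).ne' (det_SL_ne_zero _),
      H.rep_mul, intGL_mul (det_SL_ne_zero _) (H.det_pos _).ne', mul_smul, map_mulVec_mul,
      formEval_symAct]
    exact h4 (H.factorGamma hM γ i) _ _
  simp only [Finset.sum_apply]
  rw [Finset.sum_congr rfl fun i _ ↦ h5 i, Finset.sum_add_distrib,
    H.idx_perm_sum γ fun i ↦ e i z v, H.heckeCocycle_apply]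
  simp only [formEval, Finset.sum_apply, Finset.sum_mul]
  rw [Finset.sum_comm]

lemma aeval (H : HeckePrime N ℓ) [NeZero ℓ] (hM : M ∣ N) (Q : Polynomial ℤ)
    (h : IsPeriodCocycle n M N f c) :
    IsPeriodCocycle n M N (Polynomial.aeval (heckeSeries ℂ n ℓ) Q f)
      (Polynomial.aeval (H.heckeCocycle hM n ℂ) Q c) := by
  induction Q using Polynomial.induction_on with
  | C a => simpa using! h.smul a
  | add p q hp hq => simpa using hp.add hq
  | monomial k a ih =>
    rw [pow_succ', mul_left_comm, map_mul (Polynomial.aeval (heckeSeries ℂ n ℓ)) Polynomial.X,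
      map_mul (Polynomial.aeval (H.heckeCocycle hM n ℂ)) Polynomial.X, Module.End.mul_apply,
      Module.End.mul_apply, Polynomial.aeval_X, Polynomial.aeval_X]
    exact ih.hecke H hM

lemma exists_of_hasQExp {F : ℍ → ℂ} (hN : 0 < N) (hF : IsLevelCuspForm n M F)
    (hf : HasQExp N f F) : ∃ c, IsPeriodCocycle n M N f c := by
  obtain ⟨E, G, hE, -⟩ := hf.exists_eichler hN n (hF.coeff_zero hN hf)
  have h : ∀ γ : Gamma M, ∃ P : Fin (n + 1) → ℂ, ∀ (z : ℍ) (v : Fin 2 → ℂ),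
      E (intGL (γ : SL(2, ℤ)) • z)
        (((γ : SL(2, ℤ)) : Matrix (Fin 2) (Fin 2) ℤ).map (Int.cast : ℤ → ℂ) |>.mulVec v) =
      E z v + formEval P v := by
    intro γ
    have h1 := hE.slash (A := (γ : SL(2, ℤ)))
      (by rw [Matrix.SpecialLinearGroup.det_coe]; exact one_pos)
    have h2 : F ∣[(n + 2 : ℤ)] intGL (γ : SL(2, ℤ)) = F := by
      rw [intGL_coe]; exact hF.inv γ γ.2
    rw [h2] at h1
    obtain ⟨P, hP⟩ := h1.unique hE
    exact ⟨P, fun z v ↦ by rw [← hP z v]; ring⟩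
  choose c hc using h
  exact ⟨c, F, E, hF, hf, hE, hc⟩

end IsPeriodCocycle

lemma coeff_iterate_qPrimitive_eq_zero {N : ℕ} (hN : 0 < N) {f : ℂ⟦X⟧} {m : ℕ} (hm : m ≠ 0) (k : ℕ)
    (h : coeff m ((qPrimitive N)^[k] f) = 0) : coeff m f = 0 := by
  induction k with
  | zero => exact h
  | succ k ih =>
    rw [iterate_succ_apply', coeff_qPrimitive, mul_eq_zero] at h
    refine ih (h.resolve_right (div_ne_zero (by exact_mod_cast hN.ne') ?_))
    exact mul_ne_zero Complex.two_pi_I_ne_zero (by exact_mod_cast hm)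

/-- A form of nonpositive weight for `Γ(M)` is constant. -/
lemma IsAutForm.exists_eq_const {M n : ℕ} (hM : 0 < M) {h : ℍ → ℂ} (hh : IsAutForm (-n) h)
    (hinv : ∀ γ ∈ Gamma M, h ∣[(-n : ℤ)] γ = h) : ∃ a, h = fun _ ↦ a := by
  have : NeZero M := ⟨hM.ne'⟩
  let 𝒢 : Subgroup (GL (Fin 2) ℝ) := (Gamma M).map (Matrix.SpecialLinearGroup.mapGL ℝ)
  let g : ModularForm 𝒢 (-n) :=
    { toFun := h
      slash_action_eq' := by
        rintro _ ⟨γ, hγ, rfl⟩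
        exact hinv γ hγ
      holo' := hh.mdiff
      bdd_at_cusps' := fun hc ↦
        hh.2 _ ((Subgroup.IsArithmetic.isCusp_iff_isCusp_SL2Z 𝒢).1 hc) }
  rcases Nat.eq_zero_or_pos n with rfl | hn
  · obtain ⟨a, ha⟩ := ModularForm.eq_const_of_weight_zero
      (show ModularForm 𝒢 0 from { g with
        slash_action_eq' := by simpa using g.slash_action_eq'
        bdd_at_cusps' := by simpa using @g.bdd_at_cusps' })
    exact ⟨a, ha⟩
  · refine ⟨0, ?_⟩
    have h0 := ModularForm.isZero_of_neg_weight (by omega) g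
    exact congr_arg (fun x : ModularForm 𝒢 (-n) ↦ (x : ℍ → ℂ)) h0


lemma vadd_eq_intGL_smul (N : ℕ) (z : ℍ) :
    ((N : ℝ) +ᵥ z) = intGL ((ModularGroup.T ^ N : SL(2, ℤ)) : Matrix (Fin 2) (Fin 2) ℤ) • z := by
  have h1 := modular_T_zpow_smul z N
  rw [zpow_natCast, Int.cast_natCast] at h1
  rw [intGL_coe]
  exact h1.symm

lemma coe_T_pow_eq (N : ℕ) :
    ((ModularGroup.T ^ N : SL(2, ℤ)) : Matrix (Fin 2) (Fin 2) ℤ) = !![1, (N : ℤ); 0, 1] := by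
  have h1 := ModularGroup.coe_T_zpow N
  rwa [zpow_natCast] at h1

lemma formEval_eq_of_periodic {n N : ℕ} (hN : 0 < N) {P : Fin (n + 1) → ℂ}
    (h : ∀ z : ℍ, formEval P ![((N : ℝ) +ᵥ z : ℍ), 1] = formEval P ![(z : ℂ), 1]) (z : ℍ) :
    formEval P ![(z : ℂ), 1] = formEval P ![UpperHalfPlane.I, 1] := by
  let p : Polynomial ℂ := ∑ i, Polynomial.C (P i) * Polynomial.X ^ (i : ℕ)
  have hp : ∀ x, formEval P ![x, 1] = p.eval x := fun x ↦ by
    simp [p, Polynomial.eval_finsetSum, formEval]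
  have h1 : ∀ k : ℕ, p.eval ((UpperHalfPlane.I : ℂ) + k * N) = p.eval (UpperHalfPlane.I : ℂ) := by
    intro k
    induction k with
    | zero => simp
    | succ k ih =>
      have h2 := h (((k * N : ℕ) : ℝ) +ᵥ UpperHalfPlane.I)
      rw [hp, hp, coe_vadd, coe_vadd] at h2
      rw [← ih]
      convert h2 using 2 <;> push_cast <;> ring
  have h2 : p = Polynomial.C (p.eval (UpperHalfPlane.I : ℂ)) := by
    refine Polynomial.eq_of_infinite_eval_eq _ _ (Set.Infinite.mono ?_
      (Set.infinite_range_of_injective (f := fun k : ℕ ↦ (UpperHalfPlane.I : ℂ) + k * N) ?_))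
    · rintro _ ⟨k, rfl⟩
      simpa using h1 k
    · intro k k' hk
      have hN' : (N : ℂ) ≠ 0 := by exact_mod_cast hN.ne'
      exact_mod_cast mul_right_cancel₀ hN' (add_left_cancel hk)
  rw [hp, hp, h2]
  simp

/-- A cusp form whose period cocycle vanishes is zero. -/
theorem IsPeriodCocycle.eq_zero {n M N : ℕ} (hN : 0 < N) (hM : M ∣ N) {f : ℂ⟦X⟧}
    (h : IsPeriodCocycle n M N f 0) : f = 0 := by
  obtain ⟨F, E, hF, hf, hE, hc⟩ := h
  have hM0 : 0 < M := Nat.pos_of_dvd_of_pos hM hN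
  have hc' : ∀ γ ∈ Gamma M, ∀ (z : ℍ) (v : Fin 2 → ℂ), E (intGL γ • z)
      ((γ : Matrix (Fin 2) (Fin 2) ℤ).map (Int.cast : ℤ → ℂ) |>.mulVec v) = E z v :=
    fun γ hγ z v ↦ by rw [hc ⟨γ, hγ⟩ z v]; simp [formEval]
  -- the twisted integrals at all cusps
  let e : SL(2, ℤ) → ℍ → ℂ := fun δ z ↦ E (intGL δ • z)
    ((δ : Matrix (Fin 2) (Fin 2) ℤ).map (Int.cast : ℤ → ℂ) |>.mulVec ![(z : ℂ), 1])
  have hvec : ∀ (δ : SL(2, ℤ)) (z : ℍ),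
      ((δ : Matrix (Fin 2) (Fin 2) ℤ).map (Int.cast : ℤ → ℂ)).mulVec ![(z : ℂ), 1] =
        denom (intGL δ) z • ![((intGL δ • z : ℍ) : ℂ), 1] := by
    intro δ z
    have hd := denom_ne_zero (intGL δ) z
    have h1 : (0 : ℝ) < (intGL δ).det.val := by
      rw [det_intGL (det_SL_ne_zero δ), δ.det_coe]; simp
    rw [coe_smul_of_det_pos h1]
    ext i
    fin_cases i
    · simp [Matrix.mulVec, dotProduct, Fin.sum_univ_two, num, mul_div_cancel₀ _ hd,
        intGL_apply (det_SL_ne_zero δ)]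
    · simp [Matrix.mulVec, dotProduct, Fin.sum_univ_two, denom, intGL_apply (det_SL_ne_zero δ)]
  have he : ∀ δ, e 1 ∣[(-n : ℤ)] δ = e δ := by
    intro δ
    ext z
    rw [ModularForm.SL_slash_apply, neg_neg, zpow_natCast]
    simp only [e]
    rw [hvec δ z, (hE.isForm _).homogeneous, mul_comm, intGL_coe δ]
    congr 1
    rw [intGL_coe, map_one, one_smul]
    simp
    rfl
  have key : ∀ δ : SL(2, ℤ), MDiff (e δ) ∧ ∃ (g : ℂ⟦X⟧) (a : ℂ), HasQExp N g (F ∣[(n + 2 : ℤ)] δ) ∧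
      HasQExp N ((n.factorial : ℂ) • (qPrimitive N)^[n + 1] g + C a) (e δ) := by
    intro δ
    obtain ⟨g, hg, hg0⟩ := ((hF.slash_SL δ).mono hM).exists_hasQExp hN
    obtain ⟨E', G, hE', hG, hGd, hEG⟩ := hg.exists_eichler hN n hg0
    have h1 := hE.slash (A := δ) (by rw [δ.det_coe]; exact one_pos)
    have h2 : F ∣[(n + 2 : ℤ)] intGL δ = F ∣[(n + 2 : ℤ)] δ := by rw [intGL_coe]; rfl
    rw [h2] at h1
    obtain ⟨P, hP⟩ := h1.unique hE'
    have h3 : ∀ z : ℍ, e δ z = n.factorial * G z + formEval P ![(z : ℂ), 1] := fun z ↦ by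
      rw [← hEG, ← hP z]
      simp only [e]
      ring
    have h4 : ∀ z : ℍ, e δ ((N : ℝ) +ᵥ z) = e δ z := by
      intro z
      have hmem : δ * ModularGroup.T ^ N * δ⁻¹ ∈ Gamma M :=
        (Gamma_normal M).conj_mem _ (Gamma_le_Gamma hM (T_pow_mem_Gamma N)) δ
      have h5 : ![(((N : ℝ) +ᵥ z : ℍ) : ℂ), 1] = (((ModularGroup.T ^ N : SL(2, ℤ)) :
          Matrix (Fin 2) (Fin 2) ℤ).map (Int.cast : ℤ → ℂ)).mulVec ![(z : ℂ), 1] := by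
        rw [coe_T_pow_eq, coe_vadd]
        ext i
        fin_cases i
        · simp [Matrix.mulVec, dotProduct, Fin.sum_univ_two, add_comm]
        · simp [Matrix.mulVec, dotProduct, Fin.sum_univ_two]
      have h6 := hc' _ hmem (intGL δ • z)
        ((δ : Matrix (Fin 2) (Fin 2) ℤ).map (Int.cast : ℤ → ℂ) |>.mulVec ![(z : ℂ), 1])
      rw [← mul_smul, ← map_mulVec_mul, ← intGL_mul (det_SL_ne_zero _) (det_SL_ne_zero _),
        ← Matrix.SpecialLinearGroup.coe_mul, inv_mul_cancel_right] at h6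
      simp only [e]
      rw [← h6, h5, vadd_eq_intGL_smul, ← mul_smul, ← map_mulVec_mul,
        ← intGL_mul (det_SL_ne_zero _) (det_SL_ne_zero _), ← Matrix.SpecialLinearGroup.coe_mul]
    have h5 : ∀ z : ℍ, formEval P ![(z : ℂ), 1] = formEval P ![UpperHalfPlane.I, 1] :=
      formEval_eq_of_periodic hN fun z ↦ by
        have := h4 z
        rwa [h3, h3, hG.vadd hN, add_right_inj] at this
    have h6 : e δ = (n.factorial : ℂ) • G + fun _ ↦ formEval P ![(UpperHalfPlane.I : ℂ), 1] := by
      ext z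
      rw [h3, h5]
      simp
    refine ⟨?_, g, formEval P ![(UpperHalfPlane.I : ℂ), 1], hg, ?_⟩
    · rw [h6]
      exact (hGd.const_smul _).add mdifferentiable_const
    · rw [h6]
      exact (hG.smul _).add (HasQExp.const _)
  have haut : IsAutForm (-n) (e 1) := IsAutForm.of_slash (key 1).1 fun γ ↦ by
    rw [he]
    obtain ⟨g, a, -, h1⟩ := (key γ).2
    exact h1.bdd hN
  obtain ⟨b, hb⟩ := haut.exists_eq_const hM0 fun γ hγ ↦ by
    rw [he]
    ext z
    simp only [e]
    rw [hc' γ hγ, intGL_coe, map_one, one_smul]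
    simp
  obtain ⟨g, a, hg, hga⟩ := (key 1).2
  rw [SlashAction.slash_one] at hg
  obtain rfl := hg.unique hN hf
  rw [hb] at hga
  have h1 := hga.unique hN (HasQExp.const b)
  ext m
  rcases eq_or_ne m 0 with rfl | hm
  · exact hF.coeff_zero hN hf
  · refine coeff_iterate_qPrimitive_eq_zero hN hm (n + 1) ?_
    have h2 := congr_arg (coeff m) h1
    rw [map_add, coeff_C, coeff_C, if_neg hm, if_neg hm, add_zero, PowerSeries.coeff_smul,
      smul_eq_mul] at h2
    exact (mul_eq_zero.1 h2).resolve_left (by exact_mod_cast n.factorial_ne_zero)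

/-- Some power of the Hecke operator annihilates the reduction modulo `p` of every cusp form of
level `M` with integral coefficients. -/
theorem HeckePrime.exists_pow_heckeSeries_dvd {M N ℓ p : ℕ} (H : HeckePrime N ℓ) [NeZero ℓ]
    [NeZero M] (hp0 : p ≠ 0) (hpM : p ∣ M) (hN : N = M * p)
    (hφ : ∀ φ : SL(2, ℤ) → ZMod p, AddOnGamma N φ → φ (ModularGroup.T ^ N) = 0 →
      H.heckeHom φ (ModularGroup.T ^ N) = 0 → ∀ γ ∈ Gamma N, H.heckeHom φ γ = 0) (n : ℕ) :
    ∃ d : ℕ, ∀ (F : ℍ → ℂ) (f : ℤ⟦X⟧), IsLevelCuspForm n M F →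
      HasQExp N (f.map (Int.castRingHom ℂ)) F →
      ∀ m, (p : ℤ) ∣ coeff m ((heckeSeries ℤ n ℓ ^ d) f) := by
  have hM : M ∣ N := hN ▸ dvd_mul_right M p
  obtain ⟨d, R, hR⟩ := H.exists_annihilator hM hp0 hpM hN hφ n
  refine ⟨d, fun F f hF hf m ↦ ?_⟩
  have hN0 : 0 < N := zero_lt_one.trans H.one_lt
  set Q := Polynomial.X ^ d + Polynomial.C (p : ℤ) * R with hQ
  obtain ⟨c, hc⟩ := IsPeriodCocycle.exists_of_hasQExp hN0 hF hf
  have h1 := hc.aeval H hM Q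
  rw [H.aeval_heckeCocycle_complex hM hR hc.mem_cocycles] at h1
  have h2 := h1.eq_zero hN0 hM
  let L : ℤ⟦X⟧ →ₗ[ℤ] ℂ⟦X⟧ := (PowerSeries.map (Int.castRingHom ℂ)).toAddMonoidHom.toIntLinearMap
  have h3 := Polynomial.aeval_apply_of_intertwine (heckeSeries ℤ n ℓ) (heckeSeries ℂ n ℓ) L
    (fun v ↦ map_heckeSeries (Int.castRingHom ℂ) n ℓ v) Q f
  have h4 : Polynomial.aeval (heckeSeries ℤ n ℓ) Q f = 0 := by
    refine PowerSeries.map_injective (Int.castRingHom ℂ) Int.cast_injective ?_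
    rw [map_zero]
    exact h3.trans h2
  rw [hQ, map_add, map_pow, map_mul, Polynomial.aeval_X, Polynomial.aeval_C,
      LinearMap.add_apply] at h4
  have h5 := congr_arg (coeff m) (eq_neg_of_add_eq_zero_left h4)
  exact ⟨-(coeff m (Polynomial.aeval (heckeSeries ℤ n ℓ) R f)), by
    rw [h5, Module.End.mul_apply, Module.algebraMap_end_apply, map_neg, map_zsmul]; simp⟩

end

end

section

noncomputable section

open UpperHalfPlane hiding I
open Function PowerSeries CongruenceSubgroup
open scoped Manifold ModularForm MatrixGroups

/-- A long enough product of commuting operators, each nilpotent on a finite module, vanishes. -/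
lemma foldl_apply_eq_zero_of_nilpotent {E : Type*} [AddCommGroup E] (L : List (Module.End ℤ E)) :
    ∀ (W : Submodule ℤ E) [Finite W], Nat.card W ≤ L.length + 1 →
      (∀ T ∈ L, ∀ w ∈ W, T w ∈ W) → (∀ T ∈ L, ∃ d, ∀ w ∈ W, (T ^ d) w = 0) →
      (∀ S ∈ L, ∀ T ∈ L, ∀ v, S (T v) = T (S v)) →
      ∀ w ∈ W, L.foldl (fun v T ↦ T v) w = 0 := by
  induction L with
  | nil =>
    intro W _ hW _ _ _ w hw
    have h1 : Subsingleton W := (Finite.card_le_one_iff_subsingleton).1 (by simpa using hW)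
    exact congr_arg Subtype.val (Subsingleton.elim (⟨w, hw⟩ : W) 0)
  | cons T L ih =>
    intro W _ hW hpres hnil hcomm w hw
    have hT := List.mem_cons_self (a := T) (l := L)
    have hle : W.map T ≤ W := by
      rintro _ ⟨v, hv, rfl⟩
      exact hpres T hT v hv
    have hfin : Finite (W.map T) := Finite.of_injective _ (Submodule.inclusion_injective hle)
    refine ih (W.map T) ?_ ?_ ?_ ?_ (T w) (Submodule.mem_map_of_mem hw)
    · by_cases h : W.map T = W
      · have h1 : ∀ d, W.map (T ^ d) = W := fun d ↦ by
          induction d with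
          | zero => simp [Module.End.one_eq_id]
          | succ d ihd => rw [pow_succ, Module.End.mul_eq_comp, Submodule.map_comp, h, ihd]
        obtain ⟨d, hd⟩ := hnil T hT
        have h2 : W = ⊥ := by
          rw [← h1 d, eq_bot_iff]
          rintro _ ⟨v, hv, rfl⟩
          rw [hd v hv]
          exact zero_mem _
        rw [h, h2]
        simp
      · have h1 : (W.map T : Set E) ⊂ W := lt_of_le_of_ne hle fun h' ↦ h (SetLike.coe_injective h')
        have h2 := Set.ncard_lt_ncard h1 (Set.toFinite _)
        rw [← Nat.card_coe_set_eq, ← Nat.card_coe_set_eq] at h2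
        rw [List.length_cons] at hW
        have h3 : Nat.card (W.map T) < Nat.card W := h2
        omega
    · rintro S hS _ ⟨v, hv, rfl⟩
      rw [hcomm S (List.mem_cons_of_mem _ hS) T hT]
      exact Submodule.mem_map_of_mem (hpres S (List.mem_cons_of_mem _ hS) v hv)
    · intro S hS
      obtain ⟨d, hd⟩ := hnil S (List.mem_cons_of_mem _ hS)
      exact ⟨d, fun v hv ↦ hd v (hle hv)⟩
    · exact fun S hS S' hS' ↦ hcomm S (List.mem_cons_of_mem _ hS) S' (List.mem_cons_of_mem _ hS')

section

variable {A : Type*} [CommRing A] (n : ℕ)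

lemma heckeSeries_comm {ℓ q : ℕ} (hℓ : ℓ.Prime) (hq : q.Prime) (f : A⟦X⟧) :
    heckeSeries A n ℓ (heckeSeries A n q f) = heckeSeries A n q (heckeSeries A n ℓ f) := by
  rcases eq_or_ne ℓ q with rfl | hne
  · rfl
  have hc : ℓ.Coprime q := (Nat.coprime_primes hℓ hq).2 hne
  ext m
  simp only [coeff_heckeSeries]
  rw [show q * (ℓ * m) = ℓ * (q * m) by ring]
  simp only [hc.symm.dvd_mul_left, hc.dvd_mul_left]
  have h1 : ∀ x y : ℕ, y ∣ m → x * m / y = x * (m / y) := fun x y h ↦ Nat.mul_div_assoc x h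
  by_cases h2 : ℓ ∣ m <;> by_cases h3 : q ∣ m
  · obtain ⟨m, rfl⟩ := hc.mul_dvd_of_dvd_of_dvd h2 h3
    have e1 : ℓ * q * m / ℓ = q * m := by rw [mul_assoc, Nat.mul_div_cancel_left _ hℓ.pos]
    have e2 : ℓ * q * m / q = ℓ * m := by
      rw [mul_comm ℓ q, mul_assoc, Nat.mul_div_cancel_left _ hq.pos]
    simp only [if_pos h2, if_pos h3, h1 _ _ h2, h1 _ _ h3, e1, e2, dvd_mul_right, if_true,
      Nat.mul_div_cancel_left _ hq.pos, Nat.mul_div_cancel_left _ hℓ.pos]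
    ring
  · have h4 : ¬ q ∣ m / ℓ := fun h ↦ h3 (h.trans (Nat.div_dvd_of_dvd h2))
    simp [h2, h3, h4, h1 _ _ h2]
  · have h4 : ¬ ℓ ∣ m / q := fun h ↦ h2 (h.trans (Nat.div_dvd_of_dvd h3))
    simp [h2, h3, h4, h1 _ _ h3]
  · simp [h2, h3]

lemma coeff_foldl_heckeSeries (L : List ℕ) (hL : L.Nodup) (hp : ∀ ℓ ∈ L, ℓ.Prime) {m : ℕ}
    (hm : ∀ ℓ ∈ L, ¬ ℓ ∣ m) (f : A⟦X⟧) :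
    coeff m ((L.map fun ℓ ↦ heckeSeries A n ℓ).foldl (fun v T ↦ T v) f) =
      coeff (m * L.prod) f := by
  induction L generalizing f with
  | nil => simp
  | cons ℓ L ih =>
    rw [List.nodup_cons] at hL
    simp only [List.map_cons, List.foldl_cons]
    have hℓ := hp ℓ List.mem_cons_self
    rw [ih hL.2 (fun q hq ↦ hp q (List.mem_cons_of_mem _ hq))
      (fun q hq ↦ hm q (List.mem_cons_of_mem _ hq)), coeff_heckeSeries, if_neg, add_zero,
      List.prod_cons]
    · congr 2
      ring
    · intro h
      rcases (Nat.Prime.dvd_mul hℓ).1 h with h | h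
      · exact hm ℓ List.mem_cons_self h
      · obtain ⟨q, hq, hd⟩ := (Prime.dvd_prod_iff hℓ.prime).1 h
        have := (Nat.prime_dvd_prime_iff_eq hℓ (hp q (List.mem_cons_of_mem _ hq))).1 hd
        exact hL.1 (this ▸ hq)

lemma map_heckeSeries_pow {B : Type*} [CommRing B] (φ : A →+* B) (ℓ d : ℕ) (f : A⟦X⟧) :
    ((heckeSeries A n ℓ ^ d) f).map φ = (heckeSeries B n ℓ ^ d) (f.map φ) := by
  induction d with
  | zero => rfl
  | succ d ih => rw [pow_succ', pow_succ', Module.End.mul_apply, Module.End.mul_apply,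
      map_heckeSeries, ih]

end

lemma pow_slash_SL (k : ℤ) (F : ℍ → ℂ) (γ : SL(2, ℤ)) (m : ℕ) :
    (F ^ m) ∣[k * (m : ℕ)] γ = (F ∣[k] γ) ^ m := by
  induction m with
  | zero => simpa using ModularForm.is_invariant_const γ 1
  | succ m ih =>
    rw [pow_succ, pow_succ, ← ih, ← ModularForm.mul_slash_SL2]
    congr 1
    push_cast
    ring

/-- Integral `q`-expansions of cusp forms of level `M`. -/
def integralCuspForms (n M N : ℕ) : Submodule ℤ ℤ⟦X⟧ where
  carrier := {f | ∃ F, IsLevelCuspForm n M F ∧ HasQExp N (f.map (Int.castRingHom ℂ)) F}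
  add_mem' := by
    rintro f g ⟨F, hF, hf⟩ ⟨G, hG, hg⟩
    exact ⟨F + G, hF.add hG, by rw [map_add]; exact hf.add hg⟩
  zero_mem' := ⟨0, .zero, by rw [map_zero]; exact .zero⟩
  smul_mem' := by
    rintro a f ⟨F, hF, hf⟩
    refine ⟨(a : ℂ) • F, hF.smul a, ?_⟩
    rw [map_zsmul, ← Int.cast_smul_eq_zsmul ℂ]
    exact hf.smul a

lemma finite_integralCuspForms (n : ℕ) {M N : ℕ} (hN : 0 < N) (hM : M ∣ N) :
    Module.Finite ℤ (integralCuspForms n M N) := by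
  obtain ⟨α, hα⟩ := exists_sturm_bound N hN
  set B := α * (n + 2)
  let L : integralCuspForms n M N →ₗ[ℤ] (Fin (B + 1) → ℤ) :=
    { toFun f i := coeff i (f : ℤ⟦X⟧)
      map_add' f g := by ext i; simp
      map_smul' a f := by ext i; exact map_zsmul (coeff (R := ℤ) i) a (f : ℤ⟦X⟧) }
  refine Module.Finite.of_injective L ((injective_iff_map_eq_zero L).2 ?_)
  rintro ⟨f, F, hF, hf⟩ h
  have h0 : ∀ i ≤ B, coeff i f = 0 := fun i hi ↦
    congr_fun h (⟨i, Nat.lt_succ_of_le hi⟩ : Fin (B + 1))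
  have hF' := hF.mono hM
  have hw : ((n : ℤ) + 2) * (12 : ℕ) = 12 * ((n + 2 : ℕ) : ℤ) := by push_cast; ring
  have h1 : (f.map (Int.castRingHom ℂ)) ^ 12 = 0 := by
    refine hα (n + 2) (F ^ 12) _ ?_ (fun γ hγ ↦ ?_) (hf.pow 12) fun i hi ↦ ?_
    · rw [← hw]; exact hF.aut.pow 12
    · rw [← hw, pow_slash_SL, hF'.inv γ hγ]
    · refine coeff_of_lt_order _ (lt_of_lt_of_le (b := ((B + 1 : ℕ) : ℕ∞)) ?_ ?_)
      · exact_mod_cast Nat.lt_succ_of_le hi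
      · refine le_trans ?_ (le_order_pow _ 12)
        have : ((B + 1 : ℕ) : ℕ∞) ≤ (f.map (Int.castRingHom ℂ)).order :=
          nat_le_order _ _ fun i hi ↦ by simp [h0 i (Nat.lt_succ_iff.1 hi)]
        refine this.trans (le_self_nsmul zero_le (by norm_num))
  have h2 : f.map (Int.castRingHom ℂ) = 0 := pow_eq_zero_iff (by norm_num) |>.1 h1
  refine Subtype.ext (PowerSeries.map_injective (Int.castRingHom ℂ) Int.cast_injective ?_)
  rw [h2]
  simp

/-- Coefficients at indices exactly divisible by many of the primes in `𝓛` vanish modulo `p`. -/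
theorem exists_dvd_coeff_of_exactly_dvd (n : ℕ) {M N p : ℕ} [NeZero M] (hp0 : p ≠ 0) (hpM : p ∣ M)
    (hN : N = M * p) {𝓛 : Set ℕ} (h𝓛 : ∀ ℓ ∈ 𝓛, HeckePrime N ℓ)
    (hφ : ∀ (ℓ : ℕ) (_ : ℓ ∈ 𝓛) (H : HeckePrime N ℓ) [NeZero ℓ] (φ : SL(2, ℤ) → ZMod p),
      AddOnGamma N φ → φ (ModularGroup.T ^ N) = 0 → H.heckeHom φ (ModularGroup.T ^ N) = 0 →
      ∀ γ ∈ Gamma N, H.heckeHom φ γ = 0) :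
    ∃ D : ℕ, ∀ (F : ℍ → ℂ) (f : ℤ⟦X⟧), IsLevelCuspForm n M F →
      HasQExp N (f.map (Int.castRingHom ℂ)) F → ∀ (s : Finset ℕ) (m : ℕ), ↑s ⊆ 𝓛 → D ≤ s.card →
      (∀ ℓ ∈ s, ℓ ∣ m ∧ ¬ ℓ ^ 2 ∣ m) → (p : ℤ) ∣ coeff m f := by
  have hM : M ∣ N := hN ▸ dvd_mul_right M p
  have hN0 : 0 < N := hN ▸ Nat.mul_pos (Nat.pos_of_neZero M) (Nat.pos_of_ne_zero hp0)
  let φ := Int.castRingHom (ZMod p)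
  let red : ℤ⟦X⟧ →ₗ[ℤ] (ZMod p)⟦X⟧ := (PowerSeries.map φ).toAddMonoidHom.toIntLinearMap
  have hred : ∀ f, red f = f.map φ := fun _ ↦ rfl
  let W := (integralCuspForms n M N).map red
  have := finite_integralCuspForms n hN0 hM
  have hWfg : Module.Finite ℤ W := Module.Finite.map _ _
  have hWp : ∀ w ∈ W, (p : ℤ) • w = 0 := fun w _ ↦ by
    ext i
    rw [map_zsmul]
    simp
  have hWfin : Finite W := Module.finite_of_fg_torsion _ fun w ↦
    ⟨⟨p, mem_nonZeroDivisors_of_ne_zero (by exact_mod_cast hp0)⟩, Subtype.ext (hWp w w.2)⟩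
  refine ⟨Nat.card W, fun F f hF hf s m hs hcard hm ↦ ?_⟩
  have hpr : ∀ ℓ ∈ s, ℓ.Prime := fun ℓ hℓ ↦ (h𝓛 ℓ (hs hℓ)).prime
  have hdvd : s.toList.prod ∣ m := by
    rw [Finset.prod_toList]
    exact Finset.prod_primes_dvd m (fun ℓ hℓ ↦ (hpr ℓ hℓ).prime) fun ℓ hℓ ↦ (hm ℓ hℓ).1
  obtain ⟨m', rfl⟩ := hdvd
  have hm' : ∀ ℓ ∈ s.toList, ¬ ℓ ∣ m' := fun ℓ hℓ h ↦ (hm ℓ (by simpa using hℓ)).2 <| by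
    rw [pow_two]
    exact mul_dvd_mul (List.dvd_prod hℓ) h
  have h1 : (s.toList.map fun ℓ ↦ heckeSeries (ZMod p) n ℓ).foldl (fun v T ↦ T v) (red f) = 0 := by
    refine foldl_apply_eq_zero_of_nilpotent _ W (by simp; omega) ?_ ?_ ?_ _ ⟨f, ⟨F, hF, hf⟩, rfl⟩
    · intro T hT w hw
      simp only [List.mem_map, Finset.mem_toList] at hT
      obtain ⟨ℓ, hℓ, rfl⟩ := hT
      obtain ⟨g, ⟨G, hG, hg⟩, rfl⟩ := hw
      have H := h𝓛 ℓ (hs hℓ)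
      have : NeZero ℓ := ⟨H.prime.ne_zero⟩
      refine ⟨heckeSeries ℤ n ℓ g, ⟨_, hG.hecke H hM, ?_⟩, map_heckeSeries φ n ℓ g⟩
      rw [map_heckeSeries]
      exact hG.hasQExp_hecke H hM hg
    · intro T hT
      simp only [List.mem_map, Finset.mem_toList] at hT
      obtain ⟨ℓ, hℓ, rfl⟩ := hT
      have H := h𝓛 ℓ (hs hℓ)
      have : NeZero ℓ := ⟨H.prime.ne_zero⟩
      obtain ⟨d, hd⟩ := H.exists_pow_heckeSeries_dvd hp0 hpM hN (hφ ℓ (hs hℓ) H) n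
      refine ⟨d, ?_⟩
      rintro _ ⟨g, ⟨G, hG, hg⟩, rfl⟩
      rw [hred, ← map_heckeSeries_pow]
      ext i
      rw [coeff_map, map_zero]
      exact (ZMod.intCast_zmod_eq_zero_iff_dvd _ p).2 (hd G g hG hg i)
    · intro S hS T hT v
      simp only [List.mem_map, Finset.mem_toList] at hS hT
      obtain ⟨ℓ, hℓ, rfl⟩ := hS
      obtain ⟨q, hq, rfl⟩ := hT
      exact heckeSeries_comm n (hpr ℓ hℓ) (hpr q hq) v
  have h2 := congr_arg (coeff m') h1
  rw [coeff_foldl_heckeSeries n _ s.nodup_toList (by simpa using hpr) hm', hred, coeff_map,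
    map_zero, mul_comm] at h2
  exact (ZMod.intCast_zmod_eq_zero_iff_dvd _ p).1 h2

end

end

section

open Filter Topology

section TripleProduct

/-- The finite `q`-Pochhammer product `(Q; Q)_k`. -/
noncomputable def qPoch (Q : ℂ) (k : ℕ) : ℂ := ∏ i ∈ Finset.range k, (1 - Q ^ (i + 1))

lemma qPoch_succ (Q : ℂ) (k : ℕ) : qPoch Q (k + 1) = qPoch Q k * (1 - Q ^ (k + 1)) :=
  Finset.prod_range_succ _ _

lemma one_sub_pow_ne_zero {Q : ℂ} (hQ : ‖Q‖ < 1) (i : ℕ) : 1 - Q ^ (i + 1) ≠ 0 := by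
  intro h
  have h1 : Q ^ (i + 1) = 1 := (sub_eq_zero.mp h).symm
  have h2 : ‖Q‖ ^ (i + 1) = 1 := by rw [← norm_pow, h1, norm_one]
  have h3 := pow_lt_one₀ (norm_nonneg Q) hQ (Nat.succ_ne_zero i)
  exact h3.ne h2

lemma qPoch_ne_zero {Q : ℂ} (hQ : ‖Q‖ < 1) (k : ℕ) : qPoch Q k ≠ 0 :=
  Finset.prod_ne_zero_iff.mpr fun i _ ↦ one_sub_pow_ne_zero hQ i

lemma prod_one_add_mul_pow_eq_sum {Q : ℂ} (hQ : ‖Q‖ < 1) (y : ℂ) (N : ℕ) :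
    ∏ j ∈ Finset.range N, (1 + y * Q ^ j) =
      ∑ k ∈ Finset.range (N + 1),
        qPoch Q N / (qPoch Q k * qPoch Q (N - k)) * Q ^ (k.choose 2) * y ^ k := by
  induction N with
  | zero => simp [qPoch]
  | succ N ih =>
    rw [Finset.prod_range_succ, ih, mul_one_add]
    have hp := qPoch_ne_zero hQ
    rw [Finset.sum_range_succ' _ (N + 1)]
    nth_rewrite 1 [Finset.sum_range_succ' _ N]
    rw [Finset.sum_range_succ _ N, Finset.sum_range_succ _ N, add_mul, Finset.sum_mul]
    have h0 : ∀ M,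
        qPoch Q M / (qPoch Q 0 * qPoch Q (M - 0)) * Q ^ (Nat.choose 0 2) * y ^ 0 = 1 := by
      intro M
      have := hp M
      have e0 : qPoch Q 0 = 1 := by simp [qPoch]
      rw [e0]
      simp [div_self this]
    have h1 : qPoch Q N / (qPoch Q N * qPoch Q (N - N)) * Q ^ (N.choose 2) * y ^ N * (y * Q ^ N) =
        qPoch Q (N + 1) / (qPoch Q (N + 1) * qPoch Q (N + 1 - (N + 1))) *
          Q ^ ((N + 1).choose 2) * y ^ (N + 1) := by
      have hc : (N + 1).choose 2 = N + N.choose 2 := by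
        simp [Nat.choose_succ_succ' N 1]
      have e0 : qPoch Q 0 = 1 := by simp [qPoch]
      rw [hc, Nat.sub_self, Nat.sub_self, e0]
      have := hp N
      have := hp (N + 1)
      field_simp
      ring
    have h2 : ∀ k ∈ Finset.range N,
        qPoch Q (N + 1) / (qPoch Q (k + 1) * qPoch Q (N + 1 - (k + 1))) *
          Q ^ ((k + 1).choose 2) * y ^ (k + 1) =
        qPoch Q N / (qPoch Q (k + 1) * qPoch Q (N - (k + 1))) *
          Q ^ ((k + 1).choose 2) * y ^ (k + 1) +
        qPoch Q N / (qPoch Q k * qPoch Q (N - k)) * Q ^ (k.choose 2) * y ^ k * (y * Q ^ N) := by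
      intro k hk
      obtain ⟨j, rfl⟩ : ∃ j, N = k + 1 + j :=
        Nat.exists_eq_add_of_le (Nat.succ_le_of_lt (Finset.mem_range.mp hk))
      have hc : (k + 1).choose 2 = k + k.choose 2 := by
        simp [Nat.choose_succ_succ' k 1]
      have e1 : k + 1 + j + 1 - (k + 1) = j + 1 := by omega
      have e2 : k + 1 + j - (k + 1) = j := by omega
      have e3 : k + 1 + j - k = j + 1 := by omega
      rw [hc, e1, e2, e3, qPoch_succ Q (k + 1 + j), qPoch_succ Q k, qPoch_succ Q j]
      have := hp k
      have := hp j
      have := hp (k + 1 + j)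
      have := one_sub_pow_ne_zero hQ k
      have := one_sub_pow_ne_zero hQ j
      field_simp
      ring
    rw [Finset.sum_congr rfl h2, Finset.sum_add_distrib, h0, h0, h1]
    ring

/-- The symmetric Gaussian binomial coefficient, extended by zero. -/
noncomputable def gaussCoeff (Q : ℂ) (n : ℕ) (j : ℤ) : ℂ :=
  if j.natAbs ≤ n then qPoch Q (2 * n) / (qPoch Q (n + j).toNat * qPoch Q (n - j).toNat) else 0

lemma prod_mul_prod_eq_tsum {Q w : ℂ} (hQ : ‖Q‖ < 1) (hQ0 : Q ≠ 0) (hw : w ≠ 0) (n : ℕ) :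
    (∏ i ∈ Finset.range n, (1 - w * Q ^ (i + 1))) * ∏ i ∈ Finset.range n, (1 - w⁻¹ * Q ^ i) =
      ∑' j : ℤ, gaussCoeff Q n j * ((-w) ^ j * Q ^ (j * (j + 1) / 2)) := by
  have key := prod_one_add_mul_pow_eq_sum hQ (-w * Q ^ (1 - n : ℤ)) (2 * n)
  have hL : ∏ j ∈ Finset.range (2 * n), (1 + -w * Q ^ (1 - n : ℤ) * Q ^ j) =
      ((-w) ^ n * Q ^ (-(n.choose 2 : ℤ))) *
        ((∏ i ∈ Finset.range n, (1 - w * Q ^ (i + 1))) *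
          ∏ i ∈ Finset.range n, (1 - w⁻¹ * Q ^ i)) := by
    rw [two_mul, Finset.prod_range_add, ← Finset.prod_range_reflect]
    have a1 : ∀ j ∈ Finset.range n, 1 + -w * Q ^ (1 - n : ℤ) * Q ^ (n - 1 - j) =
        (-w * Q ^ (-(j : ℤ))) * (1 - w⁻¹ * Q ^ j) := by
      intro j hj
      have hj := Finset.mem_range.mp hj
      rw [← zpow_natCast Q (n - 1 - j), mul_assoc, ← zpow_add₀ hQ0]
      have : (1 - n : ℤ) + (n - 1 - j : ℕ) = -j := by omega
      rw [this, zpow_neg, zpow_natCast]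
      field_simp
      ring
    have a2 : ∀ j ∈ Finset.range n, 1 + -w * Q ^ (1 - n : ℤ) * Q ^ (n + j) =
        1 - w * Q ^ (j + 1) := by
      intro j _
      rw [← zpow_natCast Q (n + j), mul_assoc, ← zpow_add₀ hQ0]
      have : (1 - n : ℤ) + (n + j : ℕ) = (j + 1 : ℕ) := by push_cast; ring
      rw [this, zpow_natCast]
      ring
    have a3 : ∏ j ∈ Finset.range n, (-w * Q ^ (-(j : ℤ))) =
        (-w) ^ n * Q ^ (-(n.choose 2 : ℤ)) := by
      rw [Finset.prod_mul_distrib, Finset.prod_const, Finset.card_range]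
      congr 1
      simp only [zpow_neg, zpow_natCast]
      rw [Finset.prod_inv_distrib, Finset.prod_pow_eq_pow_sum, Finset.sum_range_id,
        Nat.choose_two_right]
    rw [Finset.prod_congr rfl a1, Finset.prod_congr rfl a2, Finset.prod_mul_distrib, a3]
    ring
  have hR : ∑ k ∈ Finset.range (2 * n + 1),
        qPoch Q (2 * n) / (qPoch Q k * qPoch Q (2 * n - k)) * Q ^ (k.choose 2) *
          (-w * Q ^ (1 - n : ℤ)) ^ k =
      ((-w) ^ n * Q ^ (-(n.choose 2 : ℤ))) *
        ∑' j : ℤ, gaussCoeff Q n j * ((-w) ^ j * Q ^ (j * (j + 1) / 2)) := by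
    rw [← (Equiv.subRight (n : ℤ)).tsum_eq, tsum_eq_sum (s := (Finset.range (2 * n + 1)).map
      Nat.castEmbedding), Finset.sum_map, Finset.mul_sum]
    · refine Finset.sum_congr rfl fun k hk ↦ ?_
      have hk := Finset.mem_range.mp hk
      have b1 : ((k : ℤ) - n).natAbs ≤ n := by omega
      have b2 : ((n : ℤ) + (k - n)).toNat = k := by omega
      have b3 : ((n : ℤ) - (k - n)).toNat = 2 * n - k := by omega
      simp only [Nat.castEmbedding_apply, Equiv.subRight_apply]
      rw [gaussCoeff, if_pos b1, b2, b3, mul_pow, ← zpow_natCast Q (k.choose 2),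
        ← zpow_natCast (Q ^ (1 - n : ℤ)) k, ← zpow_mul, ← zpow_natCast (-w) k,
        ← zpow_natCast (-w) n]
      have hw' : -w ≠ 0 := neg_ne_zero.mpr hw
      have c1 : (-w) ^ (k : ℤ) = (-w) ^ (n : ℤ) * (-w) ^ ((k : ℤ) - n) := by
        rw [← zpow_add₀ hw']; congr 1; ring
      have c2 : Q ^ (k.choose 2 : ℤ) * Q ^ ((1 - n : ℤ) * k) =
          Q ^ (-(n.choose 2 : ℤ)) * Q ^ (((k : ℤ) - n) * ((k : ℤ) - n + 1) / 2) := by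
        rw [← zpow_add₀ hQ0, ← zpow_add₀ hQ0]
        congr 1
        have d1 : (k.choose 2 : ℤ) * 2 = k * (k - 1) := by
          have := Nat.choose_two_right k
          have h2 := Nat.div_mul_cancel (even_iff_two_dvd.mp (Nat.even_mul_pred_self k))
          rw [← this] at h2
          rcases k with _ | k
          · simp
          · push_cast [← Nat.cast_inj (R := ℤ)] at h2 ⊢
            simpa using h2
        have d2 : (n.choose 2 : ℤ) * 2 = n * (n - 1) := by
          have := Nat.choose_two_right n
          have h2 := Nat.div_mul_cancel (even_iff_two_dvd.mp (Nat.even_mul_pred_self n))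
          rw [← this] at h2
          rcases n with _ | n
          · simp
          · push_cast [← Nat.cast_inj (R := ℤ)] at h2 ⊢
            simpa using h2
        have d3 := Int.ediv_mul_cancel
          (even_iff_two_dvd.mp (Int.even_mul_succ_self ((k : ℤ) - n)))
        nlinarith
      rw [c1]
      linear_combination (qPoch Q (2 * n) / (qPoch Q k * qPoch Q (2 * n - k)) *
        (-w) ^ (n : ℤ) * (-w) ^ ((k : ℤ) - n)) * c2
    · intro j hj
      rw [gaussCoeff, if_neg, zero_mul]
      intro h
      apply hj
      simp only [Finset.mem_map, Finset.mem_range, Nat.castEmbedding_apply]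
      simp only [Equiv.subRight_apply] at h
      exact ⟨j.toNat, by omega, by omega⟩
  rw [hL, hR] at key
  exact mul_left_cancel₀ (mul_ne_zero (pow_ne_zero _ (neg_ne_zero.mpr hw))
    (zpow_ne_zero _ hQ0)) key

lemma multipliable_one_sub_mul_pow {Q : ℂ} (hQ : ‖Q‖ < 1) (a : ℂ) :
    Multipliable fun i : ℕ ↦ 1 - a * Q ^ i := by
  simp only [sub_eq_add_neg]
  apply multipliable_one_add_of_summable
  simpa using (summable_geometric_of_lt_one (norm_nonneg _) hQ).mul_left ‖a‖

lemma tprod_one_sub_pow_ne_zero {Q : ℂ} (hQ : ‖Q‖ < 1) : ∏' i : ℕ, (1 - Q ^ (i + 1)) ≠ 0 := by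
  simp only [sub_eq_add_neg]
  refine tprod_one_add_ne_zero_of_summable (fun i ↦ ?_) ?_
  · rw [← sub_eq_add_neg]
    exact one_sub_pow_ne_zero hQ i
  · simpa using (summable_nat_add_iff 1).mpr (summable_geometric_of_lt_one (norm_nonneg _) hQ)

lemma tendsto_qPoch {Q : ℂ} (hQ : ‖Q‖ < 1) :
    Tendsto (qPoch Q) atTop (𝓝 (∏' i : ℕ, (1 - Q ^ (i + 1)))) :=
  (ModularForm.multipliable_one_sub_pow hQ).hasProd.tendsto_prod_nat

lemma exists_norm_gaussCoeff_le {Q : ℂ} (hQ : ‖Q‖ < 1) :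
    ∃ K : ℝ, ∀ n j, ‖gaussCoeff Q n j‖ ≤ K := by
  obtain ⟨C, hC⟩ := (Metric.isBounded_range_of_tendsto _ (tendsto_qPoch hQ)).exists_norm_le
  obtain ⟨D, hD⟩ := (Metric.isBounded_range_of_tendsto _
    ((tendsto_qPoch hQ).inv₀ (tprod_one_sub_pow_ne_zero hQ))).exists_norm_le
  have hC0 : 0 ≤ C := (norm_nonneg _).trans (hC _ ⟨0, rfl⟩)
  have hD0 : 0 ≤ D := (norm_nonneg _).trans (hD _ ⟨0, rfl⟩)
  refine ⟨C * (D * D), fun n j ↦ ?_⟩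
  rw [gaussCoeff]
  split_ifs
  · rw [div_eq_mul_inv, mul_inv, norm_mul, norm_mul]
    gcongr
    exacts [hC _ ⟨_, rfl⟩, hD _ ⟨_, rfl⟩, hD _ ⟨_, rfl⟩]
  · rw [norm_zero]; positivity

lemma tendsto_gaussCoeff {Q : ℂ} (hQ : ‖Q‖ < 1) (j : ℤ) :
    Tendsto (fun n ↦ gaussCoeff Q n j) atTop (𝓝 (∏' i : ℕ, (1 - Q ^ (i + 1)))⁻¹) := by
  set E := ∏' i : ℕ, (1 - Q ^ (i + 1)) with hE
  have hE0 : E ≠ 0 := tprod_one_sub_pow_ne_zero hQ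
  have h1 : Tendsto (fun n : ℕ ↦ 2 * n) atTop atTop :=
    tendsto_id.const_mul_atTop' (by norm_num)
  have h2 : Tendsto (fun n : ℕ ↦ ((n : ℤ) + j).toNat) atTop atTop :=
    tendsto_atTop.mpr fun b ↦ by
      filter_upwards [eventually_ge_atTop (b + j.natAbs)] with n hn
      omega
  have h3 : Tendsto (fun n : ℕ ↦ ((n : ℤ) - j).toNat) atTop atTop :=
    tendsto_atTop.mpr fun b ↦ by
      filter_upwards [eventually_ge_atTop (b + j.natAbs)] with n hn
      omega
  have h4 := ((tendsto_qPoch hQ).comp h1).div (((tendsto_qPoch hQ).comp h2).mul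
    ((tendsto_qPoch hQ).comp h3)) (mul_ne_zero hE0 hE0)
  rw [← hE, show E / (E * E) = E⁻¹ by field_simp] at h4
  refine h4.congr' ?_
  filter_upwards [eventually_ge_atTop j.natAbs] with n hn
  simp [gaussCoeff, hn]

/-- The Jacobi triple product. -/
theorem tripleProduct {Q w : ℂ} (hQ : ‖Q‖ < 1) (hQ0 : Q ≠ 0) (hw : w ≠ 0)
    (hs : Summable fun j : ℤ ↦ (-w) ^ j * Q ^ (j * (j + 1) / 2)) :
    ∑' j : ℤ, (-w) ^ j * Q ^ (j * (j + 1) / 2) =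
      (∏' i : ℕ, (1 - Q ^ (i + 1))) * ((∏' i : ℕ, (1 - w * Q ^ (i + 1))) *
        ∏' i : ℕ, (1 - w⁻¹ * Q ^ i)) := by
  set E := ∏' i : ℕ, (1 - Q ^ (i + 1)) with hE
  have hE0 : E ≠ 0 := tprod_one_sub_pow_ne_zero hQ
  obtain ⟨K, hK⟩ := exists_norm_gaussCoeff_le hQ
  have h1 : Tendsto (fun n : ℕ ↦ ∑' j : ℤ, gaussCoeff Q n j *
      ((-w) ^ j * Q ^ (j * (j + 1) / 2))) atTop
      (𝓝 (∑' j : ℤ, E⁻¹ * ((-w) ^ j * Q ^ (j * (j + 1) / 2)))) := by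
    refine tendsto_tsum_of_dominated_convergence (hs.norm.mul_left K)
      (fun j ↦ (tendsto_gaussCoeff hQ j).mul_const _) (.of_forall fun n j ↦ ?_)
    rw [norm_mul]
    gcongr
    exact hK n j
  have m1 : Multipliable fun i : ℕ ↦ 1 - w * Q ^ (i + 1) := by
    simpa [pow_succ', mul_assoc] using multipliable_one_sub_mul_pow hQ (w * Q)
  have h2 := m1.hasProd.tendsto_prod_nat.mul
    (multipliable_one_sub_mul_pow hQ w⁻¹).hasProd.tendsto_prod_nat
  simp only [prod_mul_prod_eq_tsum hQ hQ0 hw] at h2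
  have h3 := tendsto_nhds_unique h1 h2
  rw [tsum_mul_left] at h3
  rw [← h3, mul_inv_cancel_left₀ hE0]

end TripleProduct

end

section

open Complex Real ModularForm
open UpperHalfPlane hiding I
open scoped MatrixGroups

section SiegelFunction

/-- The odd Jacobi theta function, in terms of `jacobiTheta₂`. -/
noncomputable def oddTheta (u τ : ℂ) : ℂ :=
  cexp (π * I * (τ / 4 + u)) * jacobiTheta₂ (u + 1 / 2 + τ / 2) τ

lemma oddTheta_add_one (u τ : ℂ) : oddTheta (u + 1) τ = -oddTheta u τ := by
  have h : jacobiTheta₂ (u + 1 + 1 / 2 + τ / 2) τ = jacobiTheta₂ (u + 1 / 2 + τ / 2) τ := by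
    rw [← jacobiTheta₂_add_left (u + 1 / 2 + τ / 2)]; congr 1; ring
  rw [oddTheta, oddTheta, h, show π * I * (τ / 4 + (u + 1)) = π * I * (τ / 4 + u) + π * I by ring,
    Complex.exp_add, Complex.exp_pi_mul_I]
  ring

lemma oddTheta_add_tau (u τ : ℂ) :
    oddTheta (u + τ) τ = -cexp (-(π * I * (τ + 2 * u))) * oddTheta u τ := by
  rw [oddTheta, oddTheta, show u + τ + 1 / 2 + τ / 2 = u + 1 / 2 + τ / 2 + τ by ring,
    jacobiTheta₂_add_left', ← mul_assoc, ← mul_assoc, ← Complex.exp_add, neg_mul (cexp _),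
    ← Complex.exp_add]
  congr 1
  have h : ∀ x : ℂ, -cexp x = cexp (π * I + x) := fun x ↦ by
    rw [Complex.exp_add, Complex.exp_pi_mul_I, neg_one_mul]
  rw [h, Complex.exp_eq_exp_iff_exists_int]
  exact ⟨-1, by push_cast; ring⟩

lemma jacobiTheta₂_add_half_add_one (z τ : ℂ) :
    jacobiTheta₂ (z + 1 / 2) (τ + 1) = jacobiTheta₂ z τ := by
  refine tsum_congr fun n ↦ ?_
  rw [jacobiTheta₂_term, jacobiTheta₂_term, Complex.exp_eq_exp_iff_exists_int]
  refine ⟨n * (n + 1) / 2, ?_⟩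
  have h := Int.ediv_mul_cancel (even_iff_two_dvd.mp (Int.even_mul_succ_self n))
  have h2 : ((n * (n + 1) / 2 : ℤ) : ℂ) * 2 = n * (n + 1) := by exact_mod_cast h
  linear_combination (-(π * I : ℂ)) * h2

lemma oddTheta_tau_add_one (u τ : ℂ) :
    oddTheta u (τ + 1) = cexp (π * I / 4) * oddTheta u τ := by
  rw [oddTheta, oddTheta, show u + 1 / 2 + (τ + 1) / 2 = u + 1 / 2 + τ / 2 + 1 / 2 by ring,
    jacobiTheta₂_add_half_add_one, ← mul_assoc, ← Complex.exp_add]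
  congr 2; ring

lemma oddTheta_S (u : ℂ) {τ : ℂ} (hτ : 0 < τ.im) :
    oddTheta (u / τ) (-1 / τ) =
      -I * (-I * τ) ^ (1 / 2 : ℂ) * cexp (π * I * u ^ 2 / τ) * oddTheta u τ := by
  have h0 : τ ≠ 0 := by rintro rfl; simp at hτ
  have hs : (-I * τ) ^ (1 / 2 : ℂ) ≠ 0 := by
    rw [Ne, Complex.cpow_eq_zero_iff]; simp [h0]
  have h := jacobiTheta₂_functional_equation (u - 1 / 2 + τ / 2) τ
  have h1 : jacobiTheta₂ (u + 1 / 2 + τ / 2) τ = jacobiTheta₂ (u - 1 / 2 + τ / 2) τ := by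
    rw [← jacobiTheta₂_add_left (u - 1 / 2 + τ / 2)]; congr 1; ring
  rw [oddTheta, oddTheta, h1, h,
    show (u - 1 / 2 + τ / 2) / τ = u / τ + 1 / 2 + -1 / τ / 2 by field_simp; ring]
  have h2 : cexp (π * I * (-1 / τ / 4 + u / τ)) =
      -I * cexp (π * I * u ^ 2 / τ) * cexp (π * I * (τ / 4 + u)) *
        cexp (-π * I * (u - 1 / 2 + τ / 2) ^ 2 / τ) := by
    rw [show -I = cexp (-(π / 2 * I)) by rw [Complex.exp_neg, Complex.exp_pi_div_two_mul_I]; simp,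
      ← Complex.exp_add, ← Complex.exp_add, ← Complex.exp_add]
    congr 1
    field_simp
    ring
  rw [h2]
  field_simp

lemma eta_add_one (z : ℂ) : η (z + 1) = cexp (π * I / 12) * η z := by
  have h : ∀ n, eta_q n (z + 1) = eta_q n z := fun n ↦ by
    rw [eta_q_eq_pow, eta_q_eq_pow, mul_add, Complex.exp_add]; simp
  simp only [ModularForm.eta, h, Function.Periodic.qParam]
  rw [← mul_assoc, ← Complex.exp_add]
  congr 2
  push_cast
  ring

/-- The Siegel function with characteristics `(x, y)`. -/
noncomputable def siegel (x y : ℝ) (τ : ℍ) : ℂ :=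
  cexp (π * I * x * (x * τ + y)) * oddTheta (x * τ + y) τ / η τ

lemma siegel_T (x y : ℝ) (τ : ℍ) :
    siegel x y (ModularGroup.T • τ) = cexp (π * I / 6) * siegel x (x + y) τ := by
  have hT : ((ModularGroup.T • τ : ℍ) : ℂ) = τ + 1 := by
    rw [modular_T_smul, coe_vadd, add_comm]; simp
  rw [siegel, siegel, hT, eta_add_one, oddTheta_tau_add_one]
  have h0 := eta_ne_zero τ.2
  have h1 : cexp (π * I / 4) = cexp (π * I / 6) * cexp (π * I / 12) := by
    rw [← Complex.exp_add]; congr 1; ring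
  rw [h1]
  push_cast
  rw [show (x : ℂ) * (τ + 1) + y = x * τ + (x + y) by ring]
  have := Complex.exp_ne_zero (π * I / 12)
  field_simp

lemma siegel_S (x y : ℝ) (τ : ℍ) :
    siegel x y (ModularGroup.S • τ) = -I * siegel y (-x) τ := by
  have hI : sqrt I ≠ 0 := by simp [_root_.sqrt_eq_exp Complex.I_ne_zero]
  have hc : cexp (log (-I) / 2) * sqrt I = 1 := by
    rw [_root_.sqrt_eq_exp Complex.I_ne_zero, Complex.log_neg_I, Complex.log_I,
      ← Complex.exp_add, ← Complex.exp_zero]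
    congr 1; ring
  have h0 : (τ : ℂ) ≠ 0 := ne_zero τ
  have hS : ((ModularGroup.S • τ : ℍ) : ℂ) = -1 / τ := by
    rw [UpperHalfPlane.modular_S_smul]; simp [neg_div, inv_neg]
  have hη : η (-1 / (τ : ℂ)) = (sqrt I)⁻¹ * (sqrt τ * η τ) := by
    simpa using eta_comp_eq_csqrt_I_inv τ.2
  have hlog : log (-I * τ) = log (-I) + log τ := by
    refine Complex.log_mul (by simp) h0 ?_
    rw [Complex.arg_neg_I]
    have h1 : 0 ≤ arg (τ : ℂ) := Complex.arg_nonneg_iff.mpr τ.2.le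
    have h2 := Complex.arg_le_pi (τ : ℂ)
    constructor <;> linarith [Real.pi_pos]
  have hsq : (-I * τ) ^ (1 / 2 : ℂ) = cexp (log (-I) / 2) * sqrt (τ : ℂ) := by
    rw [Complex.cpow_def_of_ne_zero (by simp [h0]), hlog, _root_.sqrt_eq_exp h0,
      ← Complex.exp_add]
    congr 1; ring
  have hu : (x : ℂ) * (-1 / τ) + y = (y * τ - x) / τ := by field_simp; ring
  rw [siegel, siegel, hS, hη, hu, oddTheta_S _ τ.2, hsq]
  have h3 := eta_ne_zero τ.2
  have h4 : sqrt (τ : ℂ) ≠ 0 := by simp [_root_.sqrt_eq_exp h0]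
  push_cast
  rw [← sub_eq_add_neg]
  have h5 : cexp (π * I * y * (y * τ - x)) = cexp (π * I * x * ((y * τ - x) / τ)) *
      cexp (π * I * (y * τ - x) ^ 2 / τ) := by
    rw [← Complex.exp_add]; congr 1; field_simp; ring
  rw [h5]
  field_simp
  linear_combination (-oddTheta (y * τ - x) τ) * hc

lemma siegel_add_one_snd (x y : ℝ) (τ : ℍ) :
    siegel x (y + 1) τ = -cexp (π * I * x) * siegel x y τ := by
  rw [siegel, siegel]
  push_cast
  rw [← add_assoc, oddTheta_add_one, mul_add, Complex.exp_add, mul_one]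
  ring

lemma siegel_add_one_fst (x y : ℝ) (τ : ℍ) :
    siegel (x + 1) y τ = -cexp (-(π * I * y)) * siegel x y τ := by
  rw [siegel, siegel]
  push_cast
  rw [show ((x : ℂ) + 1) * τ + y = x * τ + y + τ by ring, oddTheta_add_tau]
  have : cexp (-(π * I * y)) * cexp (π * I * x * (x * τ + y)) =
    cexp (π * I * (x + 1) * (x * τ + y + τ)) * cexp (-(π * I * (τ + 2 * (x * τ + y)))) := by
    rw [← Complex.exp_add, ← Complex.exp_add]; congr 1; ring
  linear_combination (-oddTheta (x * τ + y) τ / η τ) * (-this)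

end SiegelFunction

end

section

open Complex Real ModularForm
open UpperHalfPlane hiding I
open scoped MatrixGroups

section EtaCharacter

/-- The exponent of the character of `SL(2, ℤ)` attached to the square of the eta function. -/
def etaExp (γ : SL(2, ℤ)) : ZMod 12 :=
  (1 - (γ 1 0 : ZMod 12) ^ 2) * (γ 0 1 * γ 1 1 + 3 * (γ 1 0 - 1) * γ 1 1 + γ 1 0 + 3) +
    γ 1 0 * (γ 0 0 + γ 1 1 - 3)

lemma ZMod.twelve_ext (x y : ZMod 12)
    (h3 : ZMod.castHom (show 3 ∣ 12 by norm_num) (ZMod 3) x =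
      ZMod.castHom (show 3 ∣ 12 by norm_num) (ZMod 3) y)
    (h4 : ZMod.castHom (show 4 ∣ 12 by norm_num) (ZMod 4) x =
      ZMod.castHom (show 4 ∣ 12 by norm_num) (ZMod 4) y) : x = y := by
  revert x y
  decide

lemma etaExp_mul_T (γ : SL(2, ℤ)) : etaExp (γ * ModularGroup.T) = etaExp γ + 1 := by
  have hdet : γ 0 0 * γ 1 1 - γ 0 1 * γ 1 0 = 1 := by
    rw [← Matrix.det_fin_two]; exact γ.det_coe
  have h3 : ∀ a b c d : ZMod 3, a * d - b * c = 1 →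
    (1 - c ^ 2) * ((a + b) * (c + d) + 3 * (c - 1) * (c + d) + c + 3) + c * (a + (c + d) - 3) =
    (1 - c ^ 2) * (b * d + 3 * (c - 1) * d + c + 3) + c * (a + d - 3) + 1 := by decide
  have h4 : ∀ a b c d : ZMod 4, a * d - b * c = 1 →
    (1 - c ^ 2) * ((a + b) * (c + d) + 3 * (c - 1) * (c + d) + c + 3) + c * (a + (c + d) - 3) =
    (1 - c ^ 2) * (b * d + 3 * (c - 1) * d + c + 3) + c * (a + d - 3) + 1 := by decide
  have e00 : (γ * ModularGroup.T) 0 0 = γ 0 0 := by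
    simp only [Matrix.SpecialLinearGroup.coe_mul, Matrix.mul_apply, Fin.sum_univ_two]
    simp [ModularGroup.T]
  have e01 : (γ * ModularGroup.T) 0 1 = γ 0 0 + γ 0 1 := by
    simp only [Matrix.SpecialLinearGroup.coe_mul, Matrix.mul_apply, Fin.sum_univ_two]
    simp [ModularGroup.T]
  have e10 : (γ * ModularGroup.T) 1 0 = γ 1 0 := by
    simp only [Matrix.SpecialLinearGroup.coe_mul, Matrix.mul_apply, Fin.sum_univ_two]
    simp [ModularGroup.T]
  have e11 : (γ * ModularGroup.T) 1 1 = γ 1 0 + γ 1 1 := by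
    simp only [Matrix.SpecialLinearGroup.coe_mul, Matrix.mul_apply, Fin.sum_univ_two]
    simp [ModularGroup.T]
  rw [etaExp, etaExp, e00, e01, e10, e11]
  apply ZMod.twelve_ext
  · simpa only [Int.cast_add, Int.cast_neg, map_add, map_sub, map_mul, map_pow, map_neg, map_one,
      map_ofNat, map_intCast] using
      h3 (γ 0 0) (γ 0 1) (γ 1 0) (γ 1 1) (by exact_mod_cast congrArg _ hdet)
  · simpa only [Int.cast_add, Int.cast_neg, map_add, map_sub, map_mul, map_pow, map_neg, map_one,
      map_ofNat, map_intCast] using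
      h4 (γ 0 0) (γ 0 1) (γ 1 0) (γ 1 1) (by exact_mod_cast congrArg _ hdet)

lemma etaExp_mul_S (γ : SL(2, ℤ)) : etaExp (γ * ModularGroup.S) = etaExp γ - 3 := by
  have hdet : γ 0 0 * γ 1 1 - γ 0 1 * γ 1 0 = 1 := by
    rw [← Matrix.det_fin_two]; exact γ.det_coe
  have h3 : ∀ a b c d : ZMod 3, a * d - b * c = 1 →
    (1 - d ^ 2) * (-a * -c + 3 * (d - 1) * -c + d + 3) + d * (b + -c - 3) =
    (1 - c ^ 2) * (b * d + 3 * (c - 1) * d + c + 3) + c * (a + d - 3) - 3 := by decide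
  have h4 : ∀ a b c d : ZMod 4, a * d - b * c = 1 →
    (1 - d ^ 2) * (-a * -c + 3 * (d - 1) * -c + d + 3) + d * (b + -c - 3) =
    (1 - c ^ 2) * (b * d + 3 * (c - 1) * d + c + 3) + c * (a + d - 3) - 3 := by decide
  have e00 : (γ * ModularGroup.S) 0 0 = γ 0 1 := by
    simp only [Matrix.SpecialLinearGroup.coe_mul, Matrix.mul_apply, Fin.sum_univ_two]
    simp [ModularGroup.S]
  have e01 : (γ * ModularGroup.S) 0 1 = -γ 0 0 := by
    simp only [Matrix.SpecialLinearGroup.coe_mul, Matrix.mul_apply, Fin.sum_univ_two]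
    simp [ModularGroup.S]
  have e10 : (γ * ModularGroup.S) 1 0 = γ 1 1 := by
    simp only [Matrix.SpecialLinearGroup.coe_mul, Matrix.mul_apply, Fin.sum_univ_two]
    simp [ModularGroup.S]
  have e11 : (γ * ModularGroup.S) 1 1 = -γ 1 0 := by
    simp only [Matrix.SpecialLinearGroup.coe_mul, Matrix.mul_apply, Fin.sum_univ_two]
    simp [ModularGroup.S]
  rw [etaExp, etaExp, e00, e01, e10, e11]
  apply ZMod.twelve_ext
  · simpa only [Int.cast_add, Int.cast_neg, map_add, map_sub, map_mul, map_pow, map_neg, map_one,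
      map_ofNat, map_intCast] using
      h3 (γ 0 0) (γ 0 1) (γ 1 0) (γ 1 1) (by exact_mod_cast congrArg _ hdet)
  · simpa only [Int.cast_add, Int.cast_neg, map_add, map_sub, map_mul, map_pow, map_neg, map_one,
      map_ofNat, map_intCast] using
      h4 (γ 0 0) (γ 0 1) (γ 1 0) (γ 1 1) (by exact_mod_cast congrArg _ hdet)

lemma etaExp_one : etaExp 1 = 0 := by
  rw [etaExp]; simp

lemma etaExp_T : etaExp ModularGroup.T = 1 := by
  simpa [etaExp_one] using etaExp_mul_T 1

lemma etaExp_S : etaExp ModularGroup.S = -3 := by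
  simpa [etaExp_one] using etaExp_mul_S 1

lemma etaExp_mul (γ δ : SL(2, ℤ)) : etaExp (γ * δ) = etaExp γ + etaExp δ := by
  have hδ : δ ∈ Subgroup.closure {ModularGroup.S, ModularGroup.T} := by
    rw [SpecialLinearGroup.SL2Z_generators]; trivial
  induction hδ using Subgroup.closure_induction generalizing γ with
  | mem x hx =>
    rcases hx with rfl | rfl
    · rw [etaExp_mul_S, etaExp_S, sub_eq_add_neg]
    · rw [etaExp_mul_T, etaExp_T]
  | one => simp [etaExp_one]
  | mul x y _ _ hx hy => rw [← mul_assoc, hy, hx, hy x, add_assoc]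
  | inv x _ hx =>
    have h1 := hx (γ * x⁻¹)
    have h2 := hx x⁻¹
    rw [inv_mul_cancel_right] at h1
    rw [inv_mul_cancel, etaExp_one] at h2
    linear_combination h2 - h1

lemma etaExp_eq_zero {M : ℕ} (hM : 12 ∣ M) {γ : SL(2, ℤ)} (hγ : γ ∈ CongruenceSubgroup.Gamma M) :
    etaExp γ = 0 := by
  have h := Gamma_le_Gamma hM hγ
  rw [CongruenceSubgroup.Gamma_mem] at h
  obtain ⟨h1, h2, h3, h4⟩ := h
  rw [etaExp, h1, h2, h3, h4]
  decide

/-- The character of `SL(2, ℤ)` attached to the square of the eta function. -/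
noncomputable def etaChar (γ : SL(2, ℤ)) : ℂ := ZMod.stdAddChar (etaExp γ)

lemma etaChar_mul (γ δ : SL(2, ℤ)) : etaChar (γ * δ) = etaChar γ * etaChar δ := by
  rw [etaChar, etaExp_mul, AddChar.map_add_eq_mul]; rfl

lemma etaChar_one : etaChar 1 = 1 := by
  rw [etaChar, etaExp_one, AddChar.map_zero_eq_one]

lemma etaChar_T : etaChar ModularGroup.T = cexp (π * I / 6) := by
  have := ZMod.stdAddChar_coe (N := 12) 1
  rw [etaChar, etaExp_T]
  simp only [Int.cast_one] at this
  rw [this]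
  congr 1
  push_cast
  ring

lemma etaChar_S : etaChar ModularGroup.S = -I := by
  have := ZMod.stdAddChar_coe (N := 12) (-3)
  rw [etaChar, etaExp_S]
  push_cast at this
  rw [this, show -I = cexp (-(π / 2 * I)) by
      rw [Complex.exp_neg, Complex.exp_pi_div_two_mul_I]; simp]
  congr 1
  ring

lemma etaChar_eq_one {M : ℕ} (hM : 12 ∣ M) {γ : SL(2, ℤ)}
    (hγ : γ ∈ CongruenceSubgroup.Gamma M) : etaChar γ = 1 := by
  rw [etaChar, etaExp_eq_zero hM hγ, AddChar.map_zero_eq_one]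

lemma siegel_smul (γ : SL(2, ℤ)) (x y : ℝ) (τ : ℍ) :
    siegel x y (γ • τ) =
      etaChar γ * siegel (x * γ 0 0 + y * γ 1 0) (x * γ 0 1 + y * γ 1 1) τ := by
  have hγ : γ ∈ Subgroup.closure {ModularGroup.S, ModularGroup.T} := by
    rw [SpecialLinearGroup.SL2Z_generators]; trivial
  induction hγ using Subgroup.closure_induction generalizing x y τ with
  | mem γ hγ =>
    rcases hγ with rfl | rfl
    · rw [siegel_S, etaChar_S]; simp [ModularGroup.S]
    · rw [siegel_T, etaChar_T]; simp [ModularGroup.T]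
  | one => simp [etaChar_one]
  | mul γ δ _ _ hγ hδ =>
    rw [mul_smul, hγ, hδ, etaChar_mul, ← mul_assoc]
    simp only [Matrix.SpecialLinearGroup.coe_mul, Matrix.mul_apply, Fin.sum_univ_two]
    push_cast
    congr 2 <;> ring
  | inv γ _ h =>
    have hdet : (γ 0 0 * γ 1 1 - γ 0 1 * γ 1 0 : ℝ) = 1 := by
      have : γ 0 0 * γ 1 1 - γ 0 1 * γ 1 0 = 1 := by
        rw [← Matrix.det_fin_two]; exact γ.det_coe
      exact_mod_cast this
    have h1 := h (x * γ⁻¹ 0 0 + y * γ⁻¹ 1 0) (x * γ⁻¹ 0 1 + y * γ⁻¹ 1 1) (γ⁻¹ • τ)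
    have h2 : etaChar γ * etaChar γ⁻¹ = 1 := by rw [← etaChar_mul, mul_inv_cancel, etaChar_one]
    rw [smul_inv_smul] at h1
    rw [h1, ← mul_assoc, mul_comm (etaChar _), h2, one_mul]
    simp only [Matrix.SpecialLinearGroup.SL2_inv_expl]
    simp
    congr 1
    · linear_combination (-x) * hdet
    · linear_combination (-y) * hdet

lemma eta_sq_slash (γ : SL(2, ℤ)) :
    (fun z : ℍ ↦ η z ^ 2) ∣[(1 : ℤ)] γ = etaChar γ • fun z : ℍ ↦ η z ^ 2 := by
  have hγ : γ ∈ Subgroup.closure {ModularGroup.S, ModularGroup.T} := by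
    rw [SpecialLinearGroup.SL2Z_generators]; trivial
  induction hγ using Subgroup.closure_induction with
  | mem γ hγ =>
    rcases hγ with rfl | rfl
    · ext τ
      have hη : η (-1 / (τ : ℂ)) = (sqrt I)⁻¹ * (sqrt τ * η τ) := by
        simpa using eta_comp_eq_csqrt_I_inv τ.2
      have hS : ((ModularGroup.S • τ : ℍ) : ℂ) = -1 / τ := by
        rw [UpperHalfPlane.modular_S_smul]; simp [neg_div, inv_neg]
      have hsq : ∀ z : ℂ, z ≠ 0 → sqrt z ^ 2 = z := fun z hz ↦ by
        rw [_root_.sqrt_eq_exp hz, ← Complex.exp_nat_mul]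
        push_cast
        rw [mul_div_cancel₀ _ two_ne_zero, Complex.exp_log hz]
      rw [ModularForm.SL_slash_apply, Pi.smul_apply, smul_eq_mul, hS, hη, etaChar_S,
        ModularGroup.denom_S, mul_pow, mul_pow, inv_pow, hsq _ I_ne_zero, hsq _ (ne_zero τ)]
      have := ne_zero τ
      simp
      field_simp
    · ext τ
      have hT : ((ModularGroup.T • τ : ℍ) : ℂ) = τ + 1 := by
        rw [modular_T_smul, coe_vadd, add_comm]; simp
      rw [ModularForm.SL_slash_apply, Pi.smul_apply, smul_eq_mul, hT, eta_add_one, etaChar_T,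
        mul_pow, ← Complex.exp_nat_mul]
      have hd : denom (ModularGroup.T : SL(2, ℤ)) τ = 1 := by
        rw [ModularGroup.denom_apply]; simp [ModularGroup.T]
      have he : cexp ((2 : ℕ) * (π * I / 12)) = cexp (π * I / 6) := by
        congr 1; push_cast; ring
      rw [hd, he]
      simp
  | one => simp [etaChar_one]
  | mul γ δ _ _ hγ hδ =>
    rw [SlashAction.slash_mul, hγ, SL_smul_slash, hδ, smul_smul, etaChar_mul]
  | inv γ _ h =>
    have h2 : etaChar γ⁻¹ * etaChar γ = 1 := by rw [← etaChar_mul, inv_mul_cancel, etaChar_one]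
    have h1 := congrArg (fun f ↦ etaChar γ⁻¹ • (f ∣[(1 : ℤ)] γ⁻¹)) h
    beta_reduce at h1
    rw [← SlashAction.slash_mul, mul_inv_cancel, SlashAction.slash_one, SL_smul_slash, smul_smul,
      h2, one_smul] at h1
    exact h1.symm

end EtaCharacter

end

section

open Complex Real ModularForm
open UpperHalfPlane hiding I
open scoped MatrixGroups

section SiegelProduct

/-- The infinite product `∏ (1 - w * Q ^ i)` over `i ≥ 1`. -/
noncomputable def tailProd (w Q : ℂ) : ℂ := ∏' i : ℕ, (1 - w * Q ^ (i + 1))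

lemma multipliable_one_sub_mul_pow_succ {Q : ℂ} (hQ : ‖Q‖ < 1) (w : ℂ) :
    Multipliable fun i : ℕ ↦ 1 - w * Q ^ (i + 1) := by
  simpa [pow_succ', mul_assoc] using multipliable_one_sub_mul_pow hQ (w * Q)

lemma norm_exp_two_pi_I_mul_lt_one (τ : ℍ) : ‖cexp (2 * π * I * τ)‖ < 1 := by
  exact_mod_cast norm_exp_two_pi_I_lt_one τ

lemma eta_eq_tailProd (τ : ℂ) :
    η τ = cexp (π * I * τ / 12) * tailProd 1 (cexp (2 * π * I * τ)) := by
  rw [ModularForm.eta, tailProd, Function.Periodic.qParam]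
  congr 2
  · push_cast; ring
  · ext i
    rw [eta_q_eq_pow, one_mul]

lemma oddTheta_eq_tailProd (u : ℂ) (τ : ℍ) :
    oddTheta u τ = cexp (π * I * (τ / 4 + u)) * (tailProd 1 (cexp (2 * π * I * τ)) *
      (tailProd (cexp (2 * π * I * u)) (cexp (2 * π * I * τ)) * ((1 - cexp (-(2 * π * I * u))) *
        tailProd (cexp (-(2 * π * I * u))) (cexp (2 * π * I * τ))))) := by
  have hQ := norm_exp_two_pi_I_mul_lt_one τ
  rw [Complex.exp_neg]
  obtain ⟨Q, hQd⟩ : ∃ Q, Q = cexp (2 * π * I * τ) := ⟨_, rfl⟩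
  obtain ⟨w, hwd⟩ : ∃ w, w = cexp (2 * π * I * u) := ⟨_, rfl⟩
  have hQ0 : Q ≠ 0 := hQd ▸ Complex.exp_ne_zero _
  have hw0 : w ≠ 0 := hwd ▸ Complex.exp_ne_zero _
  rw [← hQd, ← hwd]
  rw [← hQd] at hQ
  have ht : ∀ j : ℤ, jacobiTheta₂_term j (u + 1 / 2 + τ / 2) τ =
      (-w) ^ j * Q ^ (j * (j + 1) / 2) := fun j ↦ by
    have h1 : -w = cexp (2 * π * I * u + π * I) := by
      rw [Complex.exp_add, Complex.exp_pi_mul_I, mul_neg_one, hwd]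
    rw [h1, ← Complex.exp_int_mul, hQd, ← Complex.exp_int_mul, ← Complex.exp_add,
      jacobiTheta₂_term]
    congr 1
    have h := Int.ediv_mul_cancel (even_iff_two_dvd.mp (Int.even_mul_succ_self j))
    have h2 : ((j * (j + 1) / 2 : ℤ) : ℂ) * 2 = j * (j + 1) := by exact_mod_cast h
    linear_combination (-(π * I * τ : ℂ)) * h2
  have hs := (summable_jacobiTheta₂_term_iff (u + 1 / 2 + τ / 2) τ).mpr τ.2
  rw [oddTheta, jacobiTheta₂]
  simp only [ht] at hs ⊢
  have hz : ∏' i : ℕ, (1 - w⁻¹ * Q ^ i) = (1 - w⁻¹) * tailProd w⁻¹ Q := by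
    rw [tprod_eq_zero_mul' (f := fun i ↦ 1 - w⁻¹ * Q ^ i)
      (multipliable_one_sub_mul_pow_succ hQ w⁻¹), pow_zero, mul_one, tailProd]
  rw [tripleProduct hQ hQ0 hw0 hs, hz, tailProd, tailProd, tailProd]
  simp only [one_mul]

lemma siegel_zero_eq_tailProd (y : ℝ) (τ : ℍ) :
    siegel 0 y τ = cexp (π * I * y) * (1 - cexp (-(2 * π * I * y))) * cexp (π * I * τ / 6) *
      (tailProd (cexp (2 * π * I * y)) (cexp (2 * π * I * τ)) *
        tailProd (cexp (-(2 * π * I * y))) (cexp (2 * π * I * τ))) := by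
  have h0 : tailProd 1 (cexp (2 * π * I * τ)) ≠ 0 := by
    have := tprod_one_sub_pow_ne_zero (norm_exp_two_pi_I_mul_lt_one τ)
    simpa [tailProd] using this
  have h1 : cexp (π * I * (τ / 4 + y)) =
      cexp (π * I * y) * cexp (π * I * τ / 6) * cexp (π * I * τ / 12) := by
    rw [← Complex.exp_add, ← Complex.exp_add]; congr 1; ring
  rw [siegel, eta_eq_tailProd]
  simp only [ofReal_zero, mul_zero, zero_mul, zero_add, Complex.exp_zero, one_mul]
  rw [oddTheta_eq_tailProd, h1, mul_div_mul_comm, mul_div_assoc, div_self (Complex.exp_ne_zero _),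
    mul_div_cancel_left₀ _ h0]
  ring

lemma IsPrimitiveRoot.prod_range_one_sub_pow_mul {m : ℕ} (hm : 0 < m) {ζ : ℂ}
    (hζ : IsPrimitiveRoot ζ m) (x : ℂ) : ∏ r ∈ Finset.range m, (1 - ζ ^ r * x) = 1 - x ^ m := by
  have h := hζ.pow_sub_pow_eq_prod_sub_mul 1 x hm
  rw [one_pow] at h
  rw [h]
  refine Finset.prod_bij (fun r _ ↦ ζ ^ r) (fun r _ ↦ ?_) (fun r hr s hs h ↦ ?_)
    (fun z hz ↦ ?_) (fun r _ ↦ rfl)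
  · rw [Polynomial.mem_nthRootsFinset hm, ← pow_mul, mul_comm, pow_mul, hζ.pow_eq_one, one_pow]
  · exact hζ.pow_inj (Finset.mem_range.mp hr) (Finset.mem_range.mp hs) h
  · rw [Polynomial.mem_nthRootsFinset hm] at hz
    have : NeZero m := ⟨hm.ne'⟩
    obtain ⟨i, hi, rfl⟩ := hζ.eq_pow_of_pow_eq_one hz
    exact ⟨i, Finset.mem_range.mpr hi, rfl⟩

lemma IsPrimitiveRoot.prod_tailProd {m : ℕ} (hm : 0 < m) {ζ : ℂ}
    (hζ : IsPrimitiveRoot ζ m) {Q : ℂ} (hQ : ‖Q‖ < 1) :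
    ∏ r ∈ Finset.range m, tailProd (ζ ^ r) Q = tailProd 1 (Q ^ m) := by
  simp only [tailProd]
  rw [← Multipliable.tprod_finsetProd fun r _ ↦ multipliable_one_sub_mul_pow_succ hQ _]
  refine tprod_congr fun i ↦ ?_
  rw [hζ.prod_range_one_sub_pow_mul hm, one_mul, ← pow_mul, ← pow_mul, mul_comm]

lemma Finset.prod_range_two_mul_add_one {α : Type*} [CommMonoid α] (f : ℕ → α) (h : ℕ) :
    ∏ r ∈ range (2 * h + 1), f r = f 0 * ∏ k ∈ range h, (f (k + 1) * f (2 * h - k)) := by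
  rw [prod_range_succ', mul_comm, prod_mul_distrib, two_mul, prod_range_add]
  congr 2
  rw [← prod_range_reflect]
  refine prod_congr rfl fun k hk ↦ ?_
  rw [mem_range] at hk
  congr 1
  omega

/-- For odd `m`, the product of the Siegel functions over half of the nontrivial `m`-torsion is a
constant multiple of an eta quotient. -/
lemma exists_prod_siegel_eq (h : ℕ) : ∃ c : ℂ, c ≠ 0 ∧ ∀ τ : ℍ,
    ∏ k ∈ Finset.range h, siegel 0 ((k + 1 : ℕ) / (2 * h + 1 : ℕ)) τ =
      c * (η ((2 * h + 1 : ℕ) * τ) / η τ) := by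
  set m := 2 * h + 1 with hm
  have hm0 : m ≠ 0 := by omega
  have hmC : (m : ℂ) ≠ 0 := by exact_mod_cast hm0
  have hζ := Complex.isPrimitiveRoot_exp m hm0
  set ζ := cexp (2 * π * I / m) with hζd
  have hp : ∀ k : ℕ, cexp (2 * π * I * ((k + 1 : ℕ) / m : ℝ)) = ζ ^ (k + 1) := fun k ↦ by
    rw [hζd, ← Complex.exp_nat_mul]; congr 1; push_cast; ring
  have hn : ∀ k ∈ Finset.range h,
      cexp (-(2 * π * I * ((k + 1 : ℕ) / m : ℝ))) = ζ ^ (2 * h - k) := fun k hk ↦ by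
    rw [Finset.mem_range] at hk
    rw [Complex.exp_neg, hp, inv_eq_iff_eq_inv, eq_comm, inv_eq_iff_eq_inv, ← mul_eq_one_iff_eq_inv₀
      (pow_ne_zero _ (Complex.exp_ne_zero _)), ← pow_add,
      show 2 * h - k + (k + 1) = m by omega, hζ.pow_eq_one]
  refine ⟨∏ k ∈ Finset.range h, (cexp (π * I * ((k + 1 : ℕ) / m : ℝ)) * (1 - ζ ^ (2 * h - k))),
    Finset.prod_ne_zero_iff.mpr fun k hk ↦ mul_ne_zero (Complex.exp_ne_zero _) ?_, fun τ ↦ ?_⟩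
  · rw [Finset.mem_range] at hk
    exact sub_ne_zero.mpr (hζ.pow_ne_one_of_pos_of_lt (by omega) (by omega)).symm
  · have h0 : tailProd 1 (cexp (2 * π * I * τ)) ≠ 0 := by
      have := tprod_one_sub_pow_ne_zero (norm_exp_two_pi_I_mul_lt_one τ)
      simpa [tailProd] using this
    have h1 := hζ.prod_tailProd (Nat.pos_of_ne_zero hm0) (norm_exp_two_pi_I_mul_lt_one τ)
    rw [hm, Finset.prod_range_two_mul_add_one, pow_zero, ← hm, ← Complex.exp_nat_mul] at h1
    have h2 : ∀ k ∈ Finset.range h, siegel 0 ((k + 1 : ℕ) / m) τ =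
        (cexp (π * I * ((k + 1 : ℕ) / m : ℝ)) * (1 - ζ ^ (2 * h - k))) * cexp (π * I * τ / 6) *
          (tailProd (ζ ^ (k + 1)) (cexp (2 * π * I * τ)) *
            tailProd (ζ ^ (2 * h - k)) (cexp (2 * π * I * τ))) := fun k hk ↦ by
      rw [siegel_zero_eq_tailProd, hp, hn k hk]
    rw [Finset.prod_congr rfl h2, Finset.prod_mul_distrib, Finset.prod_mul_distrib,
      Finset.prod_const, Finset.card_range, eta_eq_tailProd, eta_eq_tailProd,
      show 2 * π * I * (m * τ) = m * (2 * π * I * τ) by ring, ← h1, ← Complex.exp_nat_mul,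
      mul_assoc]
    congr 1
    rw [mul_div_mul_comm, mul_div_cancel_left₀ _ h0, ← Complex.exp_sub]
    congr 2
    rw [hm]
    push_cast
    ring

end SiegelProduct

end

section

open Real ModularForm Filter Topology
open UpperHalfPlane hiding I
open Complex (I)
open scoped MatrixGroups Manifold

section EtaQuotient

lemma siegel_add_natCast_fst (x y : ℝ) (τ : ℍ) (n : ℕ) :
    siegel (x + n) y τ = (-Complex.exp (-(π * I * y))) ^ n * siegel x y τ := by
  induction n with
  | zero => simp
  | succ n ih =>
    rw [Nat.cast_succ, ← add_assoc, siegel_add_one_fst, ih, pow_succ]; ring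

lemma siegel_add_int_mul_fst {m : ℕ} {y : ℝ} {r : ℤ} (hy : m * y = r) (x : ℝ) (τ : ℍ) (n : ℤ) :
    siegel (x + n * (2 * m : ℕ)) y τ = siegel x y τ := by
  have h : Function.Periodic (fun x ↦ siegel x y τ) ((2 * m : ℕ) : ℝ) := fun x ↦ by
    beta_reduce
    rw [siegel_add_natCast_fst, pow_mul, neg_sq, ← Complex.exp_nat_mul, ← Complex.exp_nat_mul,
      show (m : ℂ) * ((2 : ℕ) * -(π * I * y)) = (-r : ℤ) * (2 * π * I) by
        have : (m : ℂ) * y = r := by exact_mod_cast hy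
        push_cast
        linear_combination (-2 * π * I : ℂ) * this,
      Complex.exp_int_mul_two_pi_mul_I, one_mul]
  exact h.int_mul n x

lemma siegel_zero_add_two_mul_snd (y : ℝ) (τ : ℍ) (n : ℤ) :
    siegel 0 (y + n * 2) τ = siegel 0 y τ := by
  have h : Function.Periodic (fun y ↦ siegel 0 y τ) 2 := fun y ↦ by
    beta_reduce
    rw [← one_add_one_eq_two, ← add_assoc, siegel_add_one_snd, siegel_add_one_snd]
    simp
  exact h.int_mul n y

lemma siegel_zero_smul_of_mem_Gamma {m M : ℕ} (hm : m ≠ 0) (h12 : 12 ∣ M) (hmM : 2 * m ^ 2 ∣ M)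
    {γ : SL(2, ℤ)} (hγ : γ ∈ CongruenceSubgroup.Gamma M) (r : ℕ) (τ : ℍ) :
    siegel 0 (r / m) (γ • τ) = siegel 0 (r / m) τ := by
  have hmR : (m : ℝ) ≠ 0 := by exact_mod_cast hm
  have hγ2 := Gamma_le_Gamma hmM hγ
  rw [CongruenceSubgroup.Gamma_mem] at hγ2
  obtain ⟨-, -, hc, hd⟩ := hγ2
  obtain ⟨c, hc⟩ := (ZMod.intCast_zmod_eq_zero_iff_dvd _ _).mp hc
  have hd' : ((γ 1 1 - 1 : ℤ) : ZMod (2 * m ^ 2)) = 0 := by push_cast; rw [hd, sub_self]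
  obtain ⟨d, hd⟩ := (ZMod.intCast_zmod_eq_zero_iff_dvd _ _).mp hd'
  have hc' : ((γ 1 0 : ℤ) : ℝ) = 2 * m ^ 2 * c := by rw [hc]; push_cast; ring
  have hd2 : ((γ 1 1 : ℤ) : ℝ) = 1 + 2 * m ^ 2 * d := by
    rw [show γ 1 1 = 1 + (γ 1 1 - 1) by ring, hd]; push_cast; ring
  rw [siegel_smul, etaChar_eq_one h12 hγ, one_mul, hc', hd2,
    show (0 : ℝ) * γ 0 0 + r / m * (2 * m ^ 2 * c) = 0 + (r * c : ℤ) * (2 * m : ℕ) by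
      push_cast; field_simp; ring,
    show (0 : ℝ) * γ 0 1 + r / m * (1 + 2 * m ^ 2 * d) = r / m + (r * m * d : ℤ) * 2 by
      push_cast; field_simp; ring,
    siegel_add_int_mul_fst (r := r + 2 * m * (r * m * d)), siegel_zero_add_two_mul_snd]
  push_cast
  field_simp

/-- The quotient of eta functions at `m * z` and `z`. -/
noncomputable def etaQuot (m : ℕ) (z : ℍ) : ℂ := η (m * z) / η z

lemma etaQuot_smul {m M : ℕ} (hm : Odd m) (h12 : 12 ∣ M) (hmM : 2 * m ^ 2 ∣ M)
    {γ : SL(2, ℤ)} (hγ : γ ∈ CongruenceSubgroup.Gamma M) (τ : ℍ) :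
    etaQuot m (γ • τ) = etaQuot m τ := by
  obtain ⟨h, rfl⟩ := hm
  obtain ⟨c, hc, hτ⟩ := exists_prod_siegel_eq h
  refine mul_left_cancel₀ hc ?_
  rw [etaQuot, etaQuot, ← hτ, ← hτ]
  exact Finset.prod_congr rfl fun k _ ↦
    siegel_zero_smul_of_mem_Gamma (by omega) h12 hmM hγ (k + 1) τ

/-- The eta quotient of weight `s` given by `η z ^ (2 * s - 1) * η (m * z)`. -/
noncomputable def etaForm (s m : ℕ) : ℍ → ℂ := (fun z : ℍ ↦ η z ^ 2) ^ s * etaQuot m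

lemma etaForm_slash {s m M : ℕ} (hm : Odd m) (h12 : 12 ∣ M) (hmM : 2 * m ^ 2 ∣ M)
    {γ : SL(2, ℤ)} (hγ : γ ∈ CongruenceSubgroup.Gamma M) :
    etaForm s m ∣[(s : ℤ)] γ = etaForm s m := by
  have h1 := pow_slash_SL 1 (fun z : ℍ ↦ η z ^ 2) γ s
  rw [eta_sq_slash, etaChar_eq_one h12 hγ, one_smul, one_mul] at h1
  have h2 : etaQuot m ∣[(0 : ℤ)] γ = etaQuot m := by
    ext τ
    rw [ModularForm.SL_slash_apply, etaQuot_smul hm h12 hmM hγ]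
    simp
  have h3 := ModularForm.mul_slash_SL2 (s : ℤ) 0 γ ((fun z : ℍ ↦ η z ^ 2) ^ s) (etaQuot m)
  rwa [add_zero, h1, h2] at h3

/-- The discriminant at `m * z`. -/
noncomputable def discriminantMul (m : ℕ) (z : ℍ) : ℂ := η (m * z) ^ 24

lemma isAutForm_discriminantMul {m : ℕ} (hm : m ≠ 0) : IsAutForm 12 (discriminantMul m) := by
  have hmC : (m : ℂ) ≠ 0 := by exact_mod_cast hm
  set A : Matrix (Fin 2) (Fin 2) ℤ := !![m, 0; 0, 1] with hA
  have hdet : A.det = m := by simp [hA, Matrix.det_fin_two]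
  have hd0 : A.det ≠ 0 := by rw [hdet]; exact_mod_cast hm
  have hR : (0 : ℝ) < (intGL A).det.val := by
    rw [det_intGL hd0, hdet]; exact_mod_cast Nat.pos_of_ne_zero hm
  have h : discriminantMul m =
      ((m : ℂ) ^ 11)⁻¹ • (ModularForm.discriminant ∣[(12 : ℤ)] intGL A) := by
    ext z
    have hσ : ∀ x, σ (intGL A) x = x := fun x ↦ by
      simp [σ, hR, -Matrix.GeneralLinearGroup.val_det_apply]
    have hd : ((|(intGL A).det.val| : ℝ) : ℂ) = m := by
      rw [abs_of_pos hR, det_intGL hd0, hdet]; simp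
    have hden : denom (intGL A) z = 1 := by
      rw [denom]
      simp only [intGL_apply hd0]; simp [hA]
    have hz : ((intGL A • z : ℍ) : ℂ) = m * z := by
      rw [coe_smul_of_det_pos hR, num, denom]
      simp only [intGL_apply hd0]; simp [hA]
    rw [Pi.smul_apply, ModularForm.slash_apply, hσ, hd, hden, ModularForm.discriminant, hz,
      discriminantMul]
    norm_num
    field_simp
  rw [h]
  exact (isAutForm_discriminant.slash hd0).smul _

lemma etaForm_pow (n m : ℕ) :
    etaForm (n + 2) m ^ 24 = ModularForm.discriminant ^ (2 * n + 3) * discriminantMul m := by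
  ext z
  have := ModularForm.eta_ne_zero z.2
  simp only [etaForm, etaQuot, Pi.pow_apply, Pi.mul_apply, ModularForm.discriminant,
    discriminantMul]
  field_simp
  ring

lemma mdiff_etaForm (s : ℕ) {m : ℕ} (hm : m ≠ 0) : MDiff (etaForm s m) := by
  rw [UpperHalfPlane.mdifferentiable_iff]
  have hm0 : (0 : ℝ) < m := by exact_mod_cast Nat.pos_of_ne_zero hm
  have h : DifferentiableOn ℂ (fun z ↦ (η z ^ 2) ^ s * (η (m * z) / η z)) {z | 0 < z.im} := by
    intro z hz
    have h1 := ModularForm.differentiableAt_eta_of_mem_upperHalfPlaneSet hz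
    have h2 : DifferentiableAt ℂ (fun z ↦ η (m * z)) z := by
      refine DifferentiableAt.comp (g := ModularForm.eta) z ?_ (by fun_prop)
      refine ModularForm.differentiableAt_eta_of_mem_upperHalfPlaneSet ?_
      simpa [upperHalfPlaneSet] using mul_pos hm0 hz
    exact (((h1.pow 2).pow s).mul (h2.div h1 (ModularForm.eta_ne_zero hz))).differentiableWithinAt
  refine h.congr fun z hz ↦ ?_
  simp [etaForm, etaQuot, ofComplex_apply_of_im_pos hz]

lemma isZeroAtImInfty_of_pow {f : ℍ → ℂ} {k : ℕ} (h : IsZeroAtImInfty (f ^ k)) :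
    IsZeroAtImInfty f := by
  have h' : Tendsto (f ^ k) atImInfty (𝓝 0) := h
  rw [Metric.tendsto_nhds] at h'
  refine Metric.tendsto_nhds.mpr fun ε hε ↦ ?_
  filter_upwards [h' (ε ^ k) (pow_pos hε k)] with z hz
  rw [dist_zero_right] at hz ⊢
  rw [Pi.pow_apply, norm_pow] at hz
  exact lt_of_pow_lt_pow_left₀ k hε.le hz

theorem isLevelCuspForm_etaForm (n : ℕ) {m M : ℕ} (hm : Odd m) (h12 : 12 ∣ M)
    (hmM : 2 * m ^ 2 ∣ M) : IsLevelCuspForm n M (etaForm (n + 2) m) := by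
  have hm0 : m ≠ 0 := hm.pos.ne'
  have hcusp : ∀ γ : SL(2, ℤ), IsZeroAtImInfty (etaForm (n + 2) m ∣[(n + 2 : ℤ)] γ) := fun γ ↦ by
    refine isZeroAtImInfty_of_pow (k := 24) ?_
    have h1 := pow_slash_SL 12 ModularForm.discriminant γ (2 * n + 3)
    rw [discriminant_slash] at h1
    rw [← pow_slash_SL, etaForm_pow,
      show ((n : ℤ) + 2) * (24 : ℕ) = 12 * (2 * n + 3 : ℕ) + 12 by push_cast; ring,
      ModularForm.mul_slash_SL2, h1]
    have h2 : Tendsto (ModularForm.discriminant ^ (2 * n + 3)) atImInfty (𝓝 0) := by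
      have h0 : Tendsto ModularForm.discriminant atImInfty (𝓝 0) :=
        ModularForm.discriminant_isZeroAtImInfty
      have := h0.pow (2 * n + 3)
      rw [zero_pow (by omega)] at this
      exact this
    have h3 := (isAutForm_discriminantMul hm0).bdd_slash γ
    have h4 := ((Asymptotics.isLittleO_one_iff ℝ).mpr h2).mul_isBigO h3
    have h5 := (Asymptotics.isLittleO_one_iff ℝ).mp (h4.trans_isBigO
      (Asymptotics.isBigO_of_le _ fun _ ↦ by simp))
    exact h5
  exact ⟨IsAutForm.of_slash (mdiff_etaForm _ hm0) fun γ ↦ (hcusp γ).isBoundedAtImInfty,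
    fun γ hγ ↦ by exact_mod_cast etaForm_slash hm h12 hmM hγ, hcusp⟩

end EtaQuotient

end

section

open Real ModularForm Filter Topology PowerSeries
open UpperHalfPlane hiding I
open Complex (I)
open Function (Periodic.qParam)

section EulerSeries

lemma prod_range_three_mul {α : Type*} [CommMonoid α] (f : ℕ → α) (n : ℕ) :
    ∏ i ∈ Finset.range (3 * n), f i = (∏ i ∈ Finset.range n, f (3 * i + 2)) *
      ((∏ i ∈ Finset.range n, f (3 * i + 1)) * ∏ i ∈ Finset.range n, f (3 * i)) := by
  induction n with
  | zero => simp
  | succ n ih =>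
    rw [Finset.prod_range_succ, Finset.prod_range_succ, Finset.prod_range_succ,
      show 3 * (n + 1) = 3 * n + 1 + 1 + 1 by ring, Finset.prod_range_succ,
      Finset.prod_range_succ, Finset.prod_range_succ, ih]
    ac_rfl

lemma tprod_mod_three {Q : ℂ} (hQ : ‖Q‖ < 1) :
    (∏' i : ℕ, (1 - (Q ^ 3) ^ (i + 1))) * ((∏' i : ℕ, (1 - Q⁻¹ * (Q ^ 3) ^ (i + 1))) *
      ∏' i : ℕ, (1 - Q⁻¹⁻¹ * (Q ^ 3) ^ i)) = tailProd 1 Q := by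
  rcases eq_or_ne Q 0 with rfl | hQ0
  · simp [tailProd]
  have hQ3 : ‖Q ^ 3‖ < 1 := by
    rw [norm_pow]; exact pow_lt_one₀ (norm_nonneg _) hQ (by norm_num)
  have h := ((multipliable_one_sub_mul_pow_succ hQ3 1).hasProd.tendsto_prod_nat).mul
    ((multipliable_one_sub_mul_pow_succ hQ3 Q⁻¹).hasProd.tendsto_prod_nat.mul
      (multipliable_one_sub_mul_pow hQ3 Q⁻¹⁻¹).hasProd.tendsto_prod_nat)
  have h2 := (multipliable_one_sub_mul_pow_succ hQ 1).hasProd.tendsto_prod_nat.comp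
    (tendsto_id.const_mul_atTop' (r := 3) (by norm_num) : Tendsto (fun n : ℕ ↦ 3 * n) atTop atTop)
  simp only [one_mul] at h
  refine tendsto_nhds_unique h ?_
  rw [tailProd]
  refine h2.congr fun n ↦ ?_
  rw [Function.comp_apply, prod_range_three_mul]
  congr 1
  · exact Finset.prod_congr rfl fun i _ ↦ by ring
  · congr 1
    · refine Finset.prod_congr rfl fun i _ ↦ ?_
      field_simp
      ring
    · refine Finset.prod_congr rfl fun i _ ↦ ?_
      rw [inv_inv]; ring

lemma hasSum_pentagonalSeries_eval {Q : ℂ} (hQ : ‖Q‖ < 1) (hQ0 : Q ≠ 0) :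
    HasSum (fun n ↦ coeff n (pentagonalSeries ℂ) * Q ^ n) (tailProd 1 Q) := by
  have hQ3 : ‖Q ^ 3‖ < 1 := by
    rw [norm_pow]; exact pow_lt_one₀ (norm_nonneg _) hQ (by norm_num)
  have ht : ∀ j : ℤ, (-Q⁻¹) ^ j * (Q ^ 3) ^ (j * (j + 1) / 2) =
      coeff (pentagonal (-j)) (pentagonalSeries ℂ) * Q ^ pentagonal (-j) := fun j ↦ by
    have h2 := two_mul_natCast_pentagonal_neg j
    have h3 := Int.ediv_mul_cancel (even_iff_two_dvd.mp (Int.even_mul_succ_self j))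
    rw [coeff_pentagonalSeries_pentagonal, neg_eq_neg_one_mul, mul_zpow, mul_assoc, inv_zpow',
      ← zpow_natCast, ← zpow_mul, ← zpow_add₀ hQ0, ← zpow_natCast Q,
      show -j + ((3 : ℕ) : ℤ) * (j * (j + 1) / 2) = (pentagonal (-j) : ℤ) by
        push_cast; linarith]
    congr 1
    rw [Int.negOnePow_neg, Int.coe_negOnePow]
    rcases Int.even_or_odd j with h | h
    · rw [h.neg_one_zpow, (Int.natAbs_even.mpr h).neg_one_pow]
    · rw [h.neg_one_zpow, (Int.natAbs_odd.mpr h).neg_one_pow]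
  have hinj : Function.Injective fun j : ℤ ↦ pentagonal (-j) :=
    pentagonal_injective.comp neg_injective
  have hs : Summable fun j : ℤ ↦ (-Q⁻¹) ^ j * (Q ^ 3) ^ (j * (j + 1) / 2) := by
    refine Summable.of_norm ?_
    refine ((summable_geometric_of_lt_one (norm_nonneg _) hQ).comp_injective hinj).congr fun j ↦ ?_
    rw [ht, coeff_pentagonalSeries_pentagonal]
    rcases Int.units_eq_one_or (Int.negOnePow (-j)) with h | h <;> simp [h]
  have h := hs.hasSum
  rw [tripleProduct hQ3 (pow_ne_zero _ hQ0) (inv_ne_zero hQ0) hs, tprod_mod_three hQ] at h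
  simp only [ht] at h
  refine (hinj.hasSum_iff fun n hn ↦ ?_).mp h
  rw [coeff_pentagonalSeries_eq_zero, zero_mul]
  rintro ⟨k, rfl⟩
  exact hn ⟨-k, by simp⟩

lemma hasQExp_pentagonalSeries :
    HasQExp 1 (pentagonalSeries ℂ) fun z ↦ tailProd 1 (Complex.exp (2 * π * I * z)) := fun z ↦ by
  have := hasSum_pentagonalSeries_eval (norm_exp_two_pi_I_mul_lt_one z) (Complex.exp_ne_zero _)
  simpa [Periodic.qParam] using this

lemma hasQExp_pentagonalSeries_expand {m : ℕ} (hm : m ≠ 0) :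
    HasQExp 1 (PowerSeries.expand m hm (pentagonalSeries ℂ))
      fun z ↦ tailProd 1 (Complex.exp (2 * π * I * (m * z))) := fun z ↦ by
  have hq : Complex.exp (2 * π * I * (m * z)) = Complex.exp (2 * π * I * z) ^ m := by
    rw [← Complex.exp_nat_mul]; congr 1; ring
  have h1 := norm_exp_two_pi_I_mul_lt_one z
  have h2 := hasSum_pentagonalSeries_eval (Q := Complex.exp (2 * π * I * z) ^ m)
    (by rw [norm_pow]; exact pow_lt_one₀ (norm_nonneg _) h1 hm)
    (pow_ne_zero _ (Complex.exp_ne_zero _))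
  beta_reduce
  rw [hq]
  have hinj : Function.Injective fun n : ℕ ↦ m * n := fun a b h ↦ by simpa [hm] using h
  refine (hinj.hasSum_iff ?_).1 ?_
  · intro x hx
    rw [coeff_expand_of_not_dvd _ _ _ (fun ⟨c, hc⟩ ↦ hx ⟨c, hc.symm⟩), zero_mul]
  · convert h2 using 2 with n
    simp [coeff_expand_mul, pow_mul, Periodic.qParam]

lemma pentagonalSeries_map {R S : Type*} [CommRing R] [CommRing S] (φ : R →+* S) :
    (pentagonalSeries R).map φ = pentagonalSeries S := by
  ext n
  rw [coeff_map]
  by_cases hn : n ∈ Set.range pentagonal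
  · obtain ⟨k, rfl⟩ := hn
    rcases Int.units_eq_one_or (Int.negOnePow k) with h | h <;> simp [h]
  · rw [coeff_pentagonalSeries_eq_zero _ hn, coeff_pentagonalSeries_eq_zero _ hn, map_zero]

/-- The power series `∏ (1 - X ^ i) ^ a * (1 - X ^ (m * i))`. -/
noncomputable def eulerQuot (a m : ℕ) (hm : m ≠ 0) : ℤ⟦X⟧ :=
  pentagonalSeries ℤ ^ a * PowerSeries.expand m hm (pentagonalSeries ℤ)

lemma HasQExp.X_pow_mul {N : ℕ} {f : ℂ⟦X⟧} {F : ℍ → ℂ} (hf : HasQExp N f F) (k : ℕ) :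
    HasQExp N (X ^ k * f) fun z ↦ Periodic.qParam N z ^ k * F z := fun z ↦ by
  have hinj : Function.Injective fun n : ℕ ↦ n + k := add_left_injective k
  refine (hinj.hasSum_iff ?_).1 ?_
  · intro x hx
    rw [coeff_X_pow_mul', if_neg fun h ↦ hx ⟨x - k, Nat.sub_add_cancel h⟩, zero_mul]
  · refine ((hf z).mul_left (Periodic.qParam N z ^ k)).congr_fun fun n ↦ ?_
    rw [Function.comp_apply, coeff_X_pow_mul, pow_add]
    ring

lemma etaForm_hasQExp (n : ℕ) {m : ℕ} (hm : m ≠ 0) {K : ℕ} (hK : K ≠ 0) :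
    HasQExp (24 * K) ((X ^ (K * (2 * n + 3 + m)) * PowerSeries.expand (24 * K)
      (mul_ne_zero (by norm_num) hK) (eulerQuot (2 * n + 3) m hm)).map (Int.castRingHom ℂ))
      (etaForm (n + 2) m) := by
  have h1 := ((hasQExp_pentagonalSeries.pow (2 * n + 3)).mul
    (hasQExp_pentagonalSeries_expand hm)).expand (l := 24 * K) (mul_ne_zero (by norm_num) hK)
  rw [one_mul] at h1
  have h2 := h1.X_pow_mul (K * (2 * n + 3 + m))
  have hKC : (K : ℂ) ≠ 0 := by exact_mod_cast hK
  convert h2 using 1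
  · rw [map_mul, map_pow, map_X, PowerSeries.map_expand, eulerQuot, map_mul, map_pow,
      PowerSeries.map_expand, pentagonalSeries_map]
  · ext z
    have hz := ModularForm.eta_ne_zero z.2
    have hq : Periodic.qParam (24 * K : ℕ) z ^ (K * (2 * n + 3 + m)) =
        Complex.exp (π * I * z / 12) ^ (2 * n + 3) * Complex.exp (π * I * (m * z) / 12) := by
      rw [Periodic.qParam, ← Complex.exp_nat_mul, ← Complex.exp_nat_mul, ← Complex.exp_add]
      congr 1
      push_cast
      field_simp
      ring
    rw [hq]
    simp only [etaForm, etaQuot, Pi.pow_apply, Pi.mul_apply]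
    rw [← mul_div_assoc, ← pow_mul, show 2 * (n + 2) = 2 * n + 3 + 1 by ring, pow_succ,
      mul_right_comm, mul_div_assoc, div_self hz, mul_one, eta_eq_tailProd, eta_eq_tailProd]
    ring

end EulerSeries

end

section

open Filter Topology PowerSeries PowerSeries.WithPiTopology

section GeneratingFunction

/-- The generating function of `t`-regular partitions. -/
noncomputable def regularSeries (t : ℕ) : ℤ⟦X⟧ :=
  PowerSeries.mk fun n ↦ (regularPartitionCount t n : ℤ)

lemma regularPartitionCount_eq_card (t n : ℕ) :
    regularPartitionCount t n = (Nat.Partition.restricted n fun i ↦ ¬ t ∣ i).card := by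
  rw [regularPartitionCount, Nat.card_eq_fintype_card, Fintype.card_subtype,
    Nat.Partition.restricted]

lemma hasProd_expand_pentagonalSeries {t : ℕ} (ht : t ≠ 0) :
    HasProd (fun i : ℕ ↦ if t ∣ i + 1 then (1 - X ^ (i + 1) : ℤ⟦X⟧) else 1)
      (PowerSeries.expand t ht (pentagonalSeries ℤ)) := by
  have hc : Continuous (PowerSeries.expand t ht : ℤ⟦X⟧ →ₐ[ℤ] ℤ⟦X⟧) := by
    refine continuous_iff_continuousAt.mpr fun f ↦ ?_
    rw [ContinuousAt, tendsto_iff_coeff_tendsto]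
    intro d
    simp only [coeff_expand]
    split_ifs
    · exact (continuous_coeff ℤ _).tendsto f
    · exact tendsto_const_nhds
  have h := (hasProd_one_sub_X_pow ℤ).map (PowerSeries.expand t ht : ℤ⟦X⟧ →ₐ[ℤ] ℤ⟦X⟧) hc
  have hinj : Function.Injective fun i : ℕ ↦ t * (i + 1) - 1 := fun a b hab ↦ by
    have ha : 0 < t * (a + 1) := by positivity
    have hb : 0 < t * (b + 1) := by positivity
    have : t * (a + 1) = t * (b + 1) := by simp only at hab; omega
    simpa using Nat.eq_of_mul_eq_mul_left (Nat.pos_of_ne_zero ht) this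
  refine (hinj.hasProd_iff fun i hi ↦ if_neg ?_).mp ?_
  · rintro ⟨c, hc⟩
    refine hi ⟨c - 1, ?_⟩
    have : c ≠ 0 := by rintro rfl; simp at hc
    simp only
    rw [Nat.sub_add_cancel (Nat.pos_of_ne_zero this), ← hc, Nat.add_sub_cancel]
  · refine h.congr_fun fun i ↦ ?_
    have : 0 < t * (i + 1) := by positivity
    simp only [Function.comp_apply]
    rw [Nat.sub_add_cancel this, if_pos (dvd_mul_right _ _), map_sub, map_one, map_pow, expand_X,
      pow_mul]

lemma regularSeries_mul_pentagonalSeries {t : ℕ} (ht : t ≠ 0) :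
    regularSeries t * pentagonalSeries ℤ = PowerSeries.expand t ht (pentagonalSeries ℤ) := by
  have h1 := Nat.Partition.hasProd_powerSeriesMk_card_restricted ℤ fun i ↦ ¬ t ∣ i
  simp only [← regularPartitionCount_eq_card] at h1
  refine (h1.mul (hasProd_one_sub_X_pow ℤ)).unique
    ((hasProd_expand_pentagonalSeries ht).congr_fun fun i ↦ ?_)
  by_cases h : t ∣ i + 1
  · simp [h]
  · simp only [h, not_false_eq_true, if_true, if_false]
    have h2 := tsum_pow_mul_one_sub_of_constantCoeff_eq_zero (R := ℤ) (f := X ^ (i + 1)) (by simp)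
    simpa only [← pow_mul] using h2

lemma coeff_regularSeries_mul (u v n : ℕ) :
    coeff n (regularSeries u * regularSeries v) = (B u v n : ℤ) := by
  rw [coeff_mul, Finset.Nat.sum_antidiagonal_eq_sum_range_succ_mk, B]
  simp [regularSeries]

lemma pentagonalSeries_ne_zero (R : Type*) [CommRing R] [Nontrivial R] :
    pentagonalSeries R ≠ 0 := fun h ↦ by
  have h1 := coeff_pentagonalSeries_pentagonal R 0
  rw [h] at h1
  simp at h1

lemma expand_zmod {p : ℕ} [Fact p.Prime] (hp : p ≠ 0) (f : (ZMod p)⟦X⟧) :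
    PowerSeries.expand p hp f = f ^ p := by
  have := MvPowerSeries.map_frobenius_expand p hp (f := f)
  rw [ZMod.frobenius_zmod] at this
  simpa using! this

theorem dvd_B_sub_coeff_eulerQuot {p m : ℕ} (hp : p.Prime) (hm : m ≠ 0) (n : ℕ) :
    (p : ℤ) ∣ B p m n - coeff n (eulerQuot (p - 2) m hm) := by
  have : Fact p.Prime := ⟨hp⟩
  have key : (regularSeries p * regularSeries m).map (Int.castRingHom (ZMod p)) =
      (eulerQuot (p - 2) m hm).map (Int.castRingHom (ZMod p)) := by
    refine mul_right_cancel₀ (pow_ne_zero 2 (pentagonalSeries_ne_zero (ZMod p))) ?_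
    have h1 : regularSeries p * regularSeries m * pentagonalSeries ℤ ^ 2 =
        PowerSeries.expand p hp.ne_zero (pentagonalSeries ℤ) *
          PowerSeries.expand m hm (pentagonalSeries ℤ) := by
      rw [← regularSeries_mul_pentagonalSeries hp.ne_zero,
        ← regularSeries_mul_pentagonalSeries hm]
      ring
    have h2 := congrArg (PowerSeries.map (Int.castRingHom (ZMod p))) h1
    rw [map_mul, map_pow, map_mul (PowerSeries.map _) (PowerSeries.expand p _ _),
      PowerSeries.map_expand, PowerSeries.map_expand, pentagonalSeries_map, expand_zmod] at h2
    rw [h2, eulerQuot, map_mul, map_pow, PowerSeries.map_expand, pentagonalSeries_map,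
        mul_right_comm, ← pow_add,
      Nat.sub_add_cancel hp.two_le]
  have h := congrArg (coeff n) key
  rw [coeff_map, coeff_map, coeff_regularSeries_mul, ← sub_eq_zero, ← map_sub] at h
  exact (ZMod.intCast_zmod_eq_zero_iff_dvd _ _).mp (by simpa using h)

end GeneratingFunction

end

section

open Filter Topology Finset

section ExactDivisors

lemma le_card_filter_exactly_dvd {ℓ u : ℕ} (hℓ : ℓ.Prime) (hu : u.Coprime ℓ) (v : ℕ) :
    ℓ - 1 ≤ #{j ∈ range (ℓ ^ 2) | ℓ ∣ u * j + v ∧ ¬ ℓ ^ 2 ∣ u * j + v} := by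
  have h0 : 0 < ℓ ^ 2 := pow_pos hℓ.pos 2
  set f : ℕ → ℕ := fun j ↦ (u * j + v) % ℓ ^ 2 with hf
  have hinj : Set.InjOn f (range (ℓ ^ 2)) := fun a ha b hb hab ↦ by
    have h1 : u * a ≡ u * b [MOD ℓ ^ 2] := Nat.ModEq.add_right_cancel' v hab
    have h2 : a ≡ b [MOD ℓ ^ 2] :=
      Nat.ModEq.cancel_left_of_coprime (Nat.Coprime.pow_left 2 hu.symm) h1
    simp only [coe_range, Set.mem_Iio] at ha hb
    exact Nat.ModEq.eq_of_lt_of_lt h2 ha hb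
  have hmaps : Set.MapsTo f (range (ℓ ^ 2)) (range (ℓ ^ 2)) := fun a _ ↦ by
    simpa [hf] using Nat.mod_lt _ h0
  have hsurj := surjOn_of_injOn_of_card_le f hmaps hinj le_rfl
  have hsub : (Ico 1 ℓ).image (ℓ * ·) ⊆
      {j ∈ range (ℓ ^ 2) | ℓ ∣ u * j + v ∧ ¬ ℓ ^ 2 ∣ u * j + v}.image f := by
    intro y hy
    obtain ⟨t, ht, rfl⟩ := mem_image.mp hy
    rw [mem_Ico] at ht
    have hlt : ℓ * t < ℓ ^ 2 := by rw [sq]; exact Nat.mul_lt_mul_of_pos_left ht.2 hℓ.pos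
    obtain ⟨j, hj, hjt⟩ := hsurj (mem_coe.mpr (mem_range.mpr hlt))
    refine mem_image.mpr ⟨j, mem_filter.mpr ⟨hj, ?_, fun h ↦ ?_⟩, hjt⟩
    · rw [← Nat.dvd_mod_iff (dvd_pow_self ℓ two_ne_zero)]
      exact ⟨t, hjt⟩
    · have h3 : ℓ * t = 0 := hjt.symm.trans (Nat.mod_eq_zero_of_dvd h)
      rcases Nat.mul_eq_zero.mp h3 with h | h
      · exact hℓ.ne_zero h
      · omega
  calc ℓ - 1 = #((Ico 1 ℓ).image (ℓ * ·)) := by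
        rw [card_image_of_injective _ (mul_right_injective₀ hℓ.ne_zero), Nat.card_Ico]
    _ ≤ _ := card_le_card hsub
    _ ≤ _ := card_image_le

lemma card_filter_not_exactly_dvd_le {ℓ u : ℕ} (hℓ : ℓ.Prime) (hu : u.Coprime ℓ) (v : ℕ) :
    (#{j ∈ range (ℓ ^ 2) | ¬ (ℓ ∣ u * j + v ∧ ¬ ℓ ^ 2 ∣ u * j + v)} : ℝ) ≤
      (ℓ ^ 2 : ℕ) * Real.exp (-(1 / 2) * (1 / ℓ)) := by
  have h1 := card_filter_add_card_filter_not (s := range (ℓ ^ 2))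
    (fun j ↦ ℓ ∣ u * j + v ∧ ¬ ℓ ^ 2 ∣ u * j + v)
  have h2 := le_card_filter_exactly_dvd hℓ hu v
  rw [card_range] at h1
  have h3 : (#{j ∈ range (ℓ ^ 2) | ¬ (ℓ ∣ u * j + v ∧ ¬ ℓ ^ 2 ∣ u * j + v)} : ℝ) ≤
      ℓ ^ 2 - ((ℓ : ℝ) - 1) := by
    have h4 : #{j ∈ range (ℓ ^ 2) | ¬ (ℓ ∣ u * j + v ∧ ¬ ℓ ^ 2 ∣ u * j + v)} + ℓ ≤
        ℓ ^ 2 + 1 := by have := hℓ.pos; omega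
    have h5 : ((#{j ∈ range (ℓ ^ 2) | ¬ (ℓ ∣ u * j + v ∧ ¬ ℓ ^ 2 ∣ u * j + v)} : ℕ) : ℝ) + ℓ ≤
        ℓ ^ 2 + 1 := by exact_mod_cast h4
    linarith
  refine h3.trans ?_
  have hℓ2 : (2 : ℝ) ≤ ℓ := by exact_mod_cast hℓ.two_le
  have h6 := Real.add_one_le_exp (-(1 / 2) * (1 / (ℓ : ℝ)))
  calc (ℓ : ℝ) ^ 2 - ((ℓ : ℝ) - 1) ≤ (ℓ : ℝ) ^ 2 * (-(1 / 2) * (1 / (ℓ : ℝ)) + 1) := by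
        have : (ℓ : ℝ) ^ 2 * (-(1 / 2) * (1 / (ℓ : ℝ)) + 1) = ℓ ^ 2 - ℓ / 2 := by
          field_simp; ring
        rw [this]; linarith
    _ ≤ _ := by push_cast; gcongr

/-- The integers `n` for which no prime in `S` exactly divides `K * n + r`. -/
def NoExactDivisor (K r : ℕ) (S : Finset ℕ) (n : ℕ) : Prop :=
  ∀ ℓ ∈ S, ¬ (ℓ ∣ K * n + r ∧ ¬ ℓ ^ 2 ∣ K * n + r)

instance (K r : ℕ) (S : Finset ℕ) : DecidablePred (NoExactDivisor K r S) := fun _ ↦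
  inferInstanceAs (Decidable (∀ ℓ ∈ S, _))

lemma noExactDivisor_mod (K r : ℕ) (S : Finset ℕ) (n : ℕ) :
    NoExactDivisor K r S (n % ∏ ℓ ∈ S, ℓ ^ 2) ↔ NoExactDivisor K r S n := by
  refine forall₂_congr fun ℓ hℓ ↦ ?_
  have h2 : ℓ ^ 2 ∣ ∏ ℓ ∈ S, ℓ ^ 2 := dvd_prod_of_mem _ hℓ
  have h : K * (n % ∏ ℓ ∈ S, ℓ ^ 2) + r ≡ K * n + r [MOD ∏ ℓ ∈ S, ℓ ^ 2] :=
    ((Nat.mod_modEq n _).mul_left K).add_right r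
  rw [(h.of_dvd h2).dvd_iff dvd_rfl,
    (h.of_dvd ((dvd_pow_self ℓ two_ne_zero).trans h2)).dvd_iff dvd_rfl]

lemma card_noExactDivisor_le (K r : ℕ) (S : Finset ℕ) (hS : ∀ ℓ ∈ S, ℓ.Prime ∧ K.Coprime ℓ) :
    (#{n ∈ range (∏ ℓ ∈ S, ℓ ^ 2) | NoExactDivisor K r S n} : ℝ) ≤
      (∏ ℓ ∈ S, ℓ ^ 2 : ℕ) * Real.exp (-(1 / 2) * ∑ ℓ ∈ S, (1 / ℓ : ℝ)) := by
  induction S using Finset.induction with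
  | empty =>
    have := card_filter_le (range (∏ ℓ ∈ (∅ : Finset ℕ), ℓ ^ 2)) (NoExactDivisor K r ∅)
    simpa only [prod_empty, sum_empty, mul_zero, Real.exp_zero, mul_one, Nat.cast_le, card_range]
      using this
  | insert ℓ S hℓS ih =>
    have ih := ih fun q hq ↦ hS q (mem_insert_of_mem hq)
    obtain ⟨hℓ, hKℓ⟩ := hS ℓ (mem_insert_self _ _)
    have hQ0 : 0 < ∏ q ∈ S, q ^ 2 :=
      prod_pos fun q hq ↦ pow_pos (hS q (mem_insert_of_mem hq)).1.pos 2
    have hQℓ : (∏ q ∈ S, q ^ 2).Coprime ℓ := Nat.Coprime.prod_left fun q hq ↦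
      Nat.Coprime.pow_left 2 ((Nat.coprime_primes (hS q (mem_insert_of_mem hq)).1 hℓ).mpr
        (by rintro rfl; exact hℓS hq))
    have hmod := noExactDivisor_mod K r S
    rw [prod_insert hℓS, sum_insert hℓS]
    set Q := ∏ q ∈ S, q ^ 2 with hQ
    have h1 : #{n ∈ range (ℓ ^ 2 * Q) | NoExactDivisor K r (insert ℓ S) n} ≤
        ∑ a ∈ {a ∈ range Q | NoExactDivisor K r S a}, #{j ∈ range (ℓ ^ 2) |
          ¬ (ℓ ∣ K * Q * j + (K * a + r) ∧ ¬ ℓ ^ 2 ∣ K * Q * j + (K * a + r))} := by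
      rw [← card_sigma]
      refine card_le_card_of_injOn (fun n ↦ ⟨n % Q, n / Q⟩) (fun n hn ↦ ?_)
        (fun a _ b _ hab ↦ ?_)
      · simp only [coe_filter, Set.mem_ofPred_eq, mem_range] at hn
        obtain ⟨hn, hn'⟩ := hn
        have he : K * Q * (n / Q) + (K * (n % Q) + r) = K * n + r := by
          conv_rhs => rw [← Nat.div_add_mod n Q]
          ring
        simp only [coe_sigma, Set.mem_sigma_iff, coe_filter, Set.mem_ofPred_eq, mem_range, he]
        refine ⟨⟨Nat.mod_lt _ hQ0, (hmod n).mpr fun q hq ↦ hn' q (mem_insert_of_mem hq)⟩,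
          ?_, hn' ℓ (mem_insert_self _ _)⟩
        exact Nat.div_lt_of_lt_mul (by rwa [mul_comm])
      · simp only [Sigma.mk.injEq, heq_eq_eq] at hab
        rw [← Nat.div_add_mod a Q, ← Nat.div_add_mod b Q, hab.1, hab.2]
    have h2 : (#{n ∈ range (ℓ ^ 2 * Q) | NoExactDivisor K r (insert ℓ S) n} : ℝ) ≤
        #{a ∈ range Q | NoExactDivisor K r S a} *
          ((ℓ ^ 2 : ℕ) * Real.exp (-(1 / 2) * (1 / ℓ))) := by
      refine (Nat.cast_le.mpr h1).trans ?_
      rw [Nat.cast_sum, ← nsmul_eq_mul]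
      exact sum_le_card_nsmul _ _ _ fun a _ ↦
        card_filter_not_exactly_dvd_le hℓ (hKℓ.mul_left hQℓ) _
    refine h2.trans ?_
    rw [mul_add, Real.exp_add, Nat.cast_mul]
    calc _ ≤ (Q : ℝ) * Real.exp (-(1 / 2) * ∑ ℓ ∈ S, (1 / ℓ : ℝ)) *
          ((ℓ ^ 2 : ℕ) * Real.exp (-(1 / 2) * (1 / ℓ))) := by gcongr
      _ = _ := by ring

lemma card_filter_range_le_of_mod (Q : ℕ) (hQ : 0 < Q) (P : ℕ → Prop) [DecidablePred P]
    (hP : ∀ n, P (n % Q) ↔ P n) (Y : ℕ) :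
    #{n ∈ range Y | P n} ≤ (Y / Q + 1) * #{n ∈ range Q | P n} := by
  rw [← card_range (Y / Q + 1), ← card_product]
  refine card_le_card_of_injOn (fun n ↦ (n / Q, n % Q)) (fun n hn ↦ ?_) (fun a _ b _ hab ↦ ?_)
  · simp only [coe_filter, Set.mem_ofPred_eq, mem_range] at hn
    simp only [coe_product, Set.mem_prod, coe_filter, Set.mem_ofPred_eq, mem_range, coe_range,
      Set.mem_Iio]
    exact ⟨Nat.lt_succ_of_le (Nat.div_le_div_right hn.1.le), Nat.mod_lt _ hQ, (hP n).mpr hn.2⟩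
  · simp only [Prod.mk.injEq] at hab
    rw [← Nat.div_add_mod a Q, ← Nat.div_add_mod b Q, hab.1, hab.2]

lemma eventually_card_noExactDivisor_le (K r : ℕ) (S : Finset ℕ)
    (hS : ∀ ℓ ∈ S, ℓ.Prime ∧ K.Coprime ℓ) : ∀ᶠ Y : ℕ in atTop,
    (#{n ∈ range Y | NoExactDivisor K r S n} : ℝ) ≤
      2 * Real.exp (-(1 / 2) * ∑ ℓ ∈ S, (1 / ℓ : ℝ)) * Y := by
  have hQ0 : 0 < ∏ q ∈ S, q ^ 2 := prod_pos fun q hq ↦ pow_pos (hS q hq).1.pos 2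
  have h1 := card_noExactDivisor_le K r S hS
  have h2 := noExactDivisor_mod K r S
  set Q := ∏ q ∈ S, q ^ 2
  filter_upwards [eventually_ge_atTop Q] with Y hY
  have h3 : (#{n ∈ range Y | NoExactDivisor K r S n} : ℝ) ≤
      ((Y / Q + 1 : ℕ) : ℝ) * #{n ∈ range Q | NoExactDivisor K r S n} := by
    exact_mod_cast card_filter_range_le_of_mod Q hQ0 _ h2 Y
  have h4 : ((Y / Q + 1 : ℕ) : ℝ) * Q ≤ 2 * Y := by
    have : (Y / Q + 1) * Q ≤ 2 * Y := by
      have := Nat.div_mul_le_self Y Q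
      linarith [add_mul (Y / Q) 1 Q]
    exact_mod_cast this
  calc _ ≤ _ := h3
    _ ≤ ((Y / Q + 1 : ℕ) : ℝ) * (Q * Real.exp (-(1 / 2) * ∑ ℓ ∈ S, (1 / ℓ : ℝ))) := by gcongr
    _ = ((Y / Q + 1 : ℕ) : ℝ) * Q * Real.exp (-(1 / 2) * ∑ ℓ ∈ S, (1 / ℓ : ℝ)) := by ring
    _ ≤ 2 * Y * Real.exp (-(1 / 2) * ∑ ℓ ∈ S, (1 / ℓ : ℝ)) := by gcongr
    _ = _ := by ring

lemma exists_finset_lt_sum {𝓛 : Set ℕ} (h𝓛 : ¬ Summable fun ℓ : 𝓛 ↦ (1 / (ℓ : ℕ) : ℝ))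
    (T : Finset ℕ) (C : ℝ) :
    ∃ S : Finset ℕ, ↑S ⊆ 𝓛 ∧ Disjoint S T ∧ C < ∑ ℓ ∈ S, (1 / ℓ : ℝ) := by
  classical
  have h1 : ¬ Summable (𝓛.indicator fun ℓ : ℕ ↦ (1 / ℓ : ℝ)) := fun h ↦
    h𝓛 (summable_subtype_iff_indicator.mpr h)
  rw [not_summable_iff_tendsto_nat_atTop_of_nonneg
    fun n ↦ Set.indicator_nonneg (fun _ _ ↦ by positivity) n] at h1
  obtain ⟨n, hn⟩ := (h1.eventually_gt_atTop (C + ∑ ℓ ∈ T, (1 / ℓ : ℝ))).exists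
  refine ⟨{ℓ ∈ range n | ℓ ∈ 𝓛} \ T, fun ℓ hℓ ↦ ?_, sdiff_disjoint, ?_⟩
  · simp only [coe_sdiff, coe_filter, Set.mem_sdiff, Set.mem_ofPred_eq] at hℓ
    exact hℓ.1.2
  · have h2 : ∑ i ∈ range n, 𝓛.indicator (fun ℓ : ℕ ↦ (1 / ℓ : ℝ)) i =
        ∑ ℓ ∈ {ℓ ∈ range n | ℓ ∈ 𝓛}, (1 / ℓ : ℝ) := by
      rw [sum_filter]
      exact sum_congr rfl fun i _ ↦ by rw [Set.indicator_apply]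
    have h3 : ∑ ℓ ∈ {ℓ ∈ range n | ℓ ∈ 𝓛}, (1 / ℓ : ℝ) ≤
        ∑ ℓ ∈ {ℓ ∈ range n | ℓ ∈ 𝓛} \ T, (1 / ℓ : ℝ) + ∑ ℓ ∈ T, (1 / ℓ : ℝ) := by
      rw [← sum_union sdiff_disjoint]
      refine sum_le_sum_of_subset_of_nonneg (fun x hx ↦ ?_) fun _ _ _ ↦ by positivity
      by_cases hT : x ∈ T
      · exact mem_union_right _ hT
      · exact mem_union_left _ (mem_sdiff.mpr ⟨hx, hT⟩)
    linarith

open Classical in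
/-- Almost all values `K * n + r` are exactly divisible by many primes from a set of primes with
divergent sum of reciprocals. -/
theorem eventually_card_few_exact_divisors_le {𝓛 : Set ℕ}
    (h𝓛 : ¬ Summable fun ℓ : 𝓛 ↦ (1 / (ℓ : ℕ) : ℝ)) {K : ℕ} (r : ℕ)
    (hK : ∀ ℓ ∈ 𝓛, ℓ.Prime ∧ K.Coprime ℓ) (D : ℕ) (T : Finset ℕ) {ε : ℝ} (hε : 0 < ε) :
    ∀ᶠ Y : ℕ in atTop, (#{n ∈ range Y | ¬ ∃ s : Finset ℕ, ↑s ⊆ 𝓛 ∧ Disjoint s T ∧ #s = D ∧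
      ∀ ℓ ∈ s, ℓ ∣ K * n + r ∧ ¬ ℓ ^ 2 ∣ K * n + r} : ℝ) ≤ ε * Y := by
  induction D generalizing T ε with
  | zero =>
    refine .of_forall fun Y ↦ ?_
    rw [filter_false_of_mem fun n _ ↦ not_not.mpr ⟨∅, by simp⟩, card_empty, Nat.cast_zero]
    positivity
  | succ D ih =>
    obtain ⟨S, hS, hST, hsum⟩ := exists_finset_lt_sum h𝓛 T (-2 * Real.log (ε / 4))
    have h1 : 2 * Real.exp (-(1 / 2) * ∑ ℓ ∈ S, (1 / ℓ : ℝ)) ≤ ε / 2 := by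
      have : Real.exp (-(1 / 2) * ∑ ℓ ∈ S, (1 / ℓ : ℝ)) ≤ ε / 4 := by
        rw [← Real.exp_log (show 0 < ε / 4 by positivity)]
        exact Real.exp_le_exp.mpr (by linarith)
      linarith
    filter_upwards [ih (T ∪ S) (half_pos hε),
      eventually_card_noExactDivisor_le K r S fun ℓ hℓ ↦ hK ℓ (hS hℓ)] with Y hY1 hY2
    have hsub : {n ∈ range Y | ¬ ∃ s : Finset ℕ, ↑s ⊆ 𝓛 ∧ Disjoint s T ∧ #s = D + 1 ∧
        ∀ ℓ ∈ s, ℓ ∣ K * n + r ∧ ¬ ℓ ^ 2 ∣ K * n + r} ⊆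
        {n ∈ range Y | ¬ ∃ s : Finset ℕ, ↑s ⊆ 𝓛 ∧ Disjoint s (T ∪ S) ∧ #s = D ∧
          ∀ ℓ ∈ s, ℓ ∣ K * n + r ∧ ¬ ℓ ^ 2 ∣ K * n + r} ∪
        {n ∈ range Y | NoExactDivisor K r S n} := by
      intro n hn
      rw [mem_filter] at hn
      rw [mem_union, mem_filter, mem_filter]
      by_contra hcon
      push Not at hcon
      obtain ⟨s, hs1, hs2, hs3, hs4⟩ := hcon.1 hn.1
      have h5 := hcon.2 hn.1
      rw [NoExactDivisor] at h5
      push Not at h5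
      obtain ⟨ℓ, hℓ, hℓ'⟩ := h5
      rw [disjoint_union_right] at hs2
      have hℓs : ℓ ∉ s := fun h ↦ disjoint_left.mp hs2.2 h hℓ
      refine hn.2 ⟨insert ℓ s, ?_, ?_, ?_, ?_⟩
      · rw [coe_insert]
        exact Set.insert_subset (hS hℓ) hs1
      · rw [disjoint_insert_left]
        exact ⟨disjoint_left.mp hST hℓ, hs2.1⟩
      · rw [card_insert_of_notMem hℓs, hs3]
      · exact forall_mem_insert _ _ _ |>.mpr ⟨hℓ', hs4⟩
    have h6 := Nat.cast_le (α := ℝ).mpr ((card_le_card hsub).trans (card_union_le _ _))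
    rw [Nat.cast_add] at h6
    have h7 := mul_le_mul_of_nonneg_right h1 (Nat.cast_nonneg (α := ℝ) Y)
    linarith

end ExactDivisors

end

section

open Filter Topology Finset PowerSeries

section Density

/-- For primes `p ≥ 5`, the coefficients of `eulerQuot (p - 2) m` divisible by `p` contain those at
indices `n` for which `N * n + r` is exactly divisible by many primes of a suitable set. -/
lemma exists_primes_forall_dvd_coeff_eulerQuot {p m : ℕ} (hp : p.Prime) (hp5 : 5 ≤ p)
    (hm : Odd m) : ∃ (N r D : ℕ) (𝓛 : Set ℕ), (¬ Summable fun ℓ : 𝓛 ↦ (1 / (ℓ : ℕ) : ℝ)) ∧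
      (∀ ℓ ∈ 𝓛, ℓ.Prime ∧ N.Coprime ℓ) ∧ ∀ (n : ℕ) (s : Finset ℕ), ↑s ⊆ 𝓛 → #s = D →
        (∀ ℓ ∈ s, ℓ ∣ N * n + r ∧ ¬ ℓ ^ 2 ∣ N * n + r) →
          (p : ℤ) ∣ coeff n (eulerQuot (p - 2) m hm.pos.ne') := by
  have hm0 : m ≠ 0 := hm.pos.ne'
  obtain ⟨n, hn⟩ : ∃ n, p = 2 * n + 5 := by
    obtain ⟨k, hk⟩ := hp.odd_of_ne_two (by omega)
    exact ⟨k - 2, by omega⟩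
  have hp0 : p ≠ 0 := hp.ne_zero
  have : NeZero p := ⟨hp0⟩
  have hK0 : m ^ 2 * p ^ 2 ≠ 0 := by positivity
  have hM0 : 24 * (m ^ 2 * p) ≠ 0 := by positivity
  set K := m ^ 2 * p ^ 2 with hK
  set M := 24 * (m ^ 2 * p) with hM
  have : NeZero M := ⟨hM0⟩
  have hN : 24 * K = M * p := by rw [hK, hM]; ring
  have hpM : p ∣ M := ⟨24 * m ^ 2, by rw [hM]; ring⟩
  have h12 : 12 ∣ M := ⟨2 * (m ^ 2 * p), by rw [hM]; ring⟩
  have hmM : 2 * m ^ 2 ∣ M := ⟨12 * p, by rw [hM]; ring⟩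
  have hN3 : 3 ≤ 24 * K := by have := Nat.pos_of_ne_zero hK0; omega
  obtain ⟨S, hS⟩ := exists_heckeHom_eq_zero (p := p) hN3 (hN ▸ dvd_mul_left p M)
  obtain ⟨R, hSR, hstar, hsum⟩ := exists_frobConj_primes S (24 * K) (by omega)
  set 𝓛 : Set ℕ := {ℓ | ℓ.Prime ∧ 24 * K ∣ ℓ + 1 ∧ FrobConj R ℓ} with h𝓛
  have hHecke : ∀ ℓ ∈ 𝓛, HeckePrime (24 * K) ℓ := fun ℓ hℓ ↦ ⟨hℓ.1, hℓ.2.1, by omega⟩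
  obtain ⟨D, hD⟩ := exists_dvd_coeff_of_exactly_dvd n hp0 hpM hN hHecke
    fun ℓ hℓ H _ ↦ hS ℓ H R hSR hstar hℓ.2.2
  refine ⟨24 * K, K * (2 * n + 3 + m), D, 𝓛, hsum, fun ℓ hℓ ↦ ⟨hℓ.1, ?_⟩,
    fun j s hs hcard hdvd ↦ ?_⟩
  · refine Nat.Coprime.of_dvd_left hℓ.2.1 ?_
    simp
  · have h := hD _ _ (isLevelCuspForm_etaForm n hm h12 hmM) (etaForm_hasQExp n hm0 hK0) s _ hs
      hcard.ge hdvd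
    rw [coeff_X_pow_mul, coeff_expand_mul] at h
    have h2 : 2 * n + 3 = p - 2 := by omega
    rwa [h2] at h

lemma tendsto_card_div_of_eventually_le {P : ℕ → Prop} [DecidablePred P]
    (h : ∀ ε : ℝ, 0 < ε → ∀ᶠ Y : ℕ in atTop, (#{n ∈ range Y | ¬ P n} : ℝ) ≤ ε * Y) :
    Tendsto (fun X : ℕ ↦ (#{n ∈ range (X + 1) | P n} : ℝ) / X) atTop (𝓝 1) := by
  have hbad : Tendsto (fun Y : ℕ ↦ (#{n ∈ range Y | ¬ P n} : ℝ) / Y) atTop (𝓝 0) := by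
    rw [Metric.tendsto_atTop']
    intro ε hε
    obtain ⟨Y₀, hY₀⟩ := eventually_atTop.mp (h (ε / 2) (half_pos hε))
    refine ⟨Y₀, fun Y hY ↦ ?_⟩
    have hY0 : (0 : ℝ) < Y := by exact_mod_cast (Nat.zero_le _).trans_lt hY
    rw [Real.dist_eq, sub_zero, abs_of_nonneg (by positivity), div_lt_iff₀ hY0]
    refine (hY₀ Y hY.le).trans_lt ?_
    nlinarith
  have h1 : Tendsto (fun X : ℕ ↦ 1 + 1 / (X : ℝ)) atTop (𝓝 1) := by
    simpa using tendsto_const_nhds.add (tendsto_one_div_atTop_nhds_zero_nat (𝕜 := ℝ))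
  have h2 := h1.mul ((hbad.comp (tendsto_add_atTop_nat 1)).const_sub 1)
  rw [sub_zero, mul_one] at h2
  refine h2.congr' ?_
  filter_upwards [eventually_gt_atTop 0] with X hX
  have hX0 : (X : ℝ) ≠ 0 := by positivity
  have hX1 : (X : ℝ) + 1 ≠ 0 := by positivity
  have h3 := card_filter_add_card_filter_not (s := range (X + 1)) P
  rw [card_range] at h3
  have h4 : (#{n ∈ range (X + 1) | P n} : ℝ) + #{n ∈ range (X + 1) | ¬ P n} = X + 1 := by
    exact_mod_cast h3
  simp only [Function.comp_apply, Nat.cast_add, Nat.cast_one]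
  rw [← eq_sub_iff_add_eq] at h4
  rw [h4]
  field_simp

end Density

end

/-- Theorem 1.1 (Meher): for a prime `p ≥ 5` and `m` a positive integer all of whose
prime divisors are `≥ 5`, with `gcd(p, m) = 1`, the set of `n` with
`B p m n ≡ 0 (mod p)` has arithmetic density one. -/
theorem B_p_m_density_one (p m : ℕ) (hp : p.Prime) (hp5 : 5 ≤ p) (hm : 0 < m)
    (hmprimes : ∀ q : ℕ, q.Prime → q ∣ m → 5 ≤ q) (hcop : Nat.gcd p m = 1) :
    Filter.Tendsto
      (fun X : ℕ =>
        (((Finset.range (X + 1)).filter (fun n => p ∣ B p m n)).card : ℝ) / (X : ℝ))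
      Filter.atTop (nhds 1) := by
  have hodd : Odd m := by
    rw [← Nat.not_even_iff_odd]
    intro he
    have := hmprimes 2 Nat.prime_two he.two_dvd
    omega
  obtain ⟨N, r, D, 𝓛, hsum, h𝓛, hdvd⟩ := exists_primes_forall_dvd_coeff_eulerQuot hp hp5 hodd
  classical
  refine tendsto_card_div_of_eventually_le fun ε hε ↦ ?_
  filter_upwards [eventually_card_few_exact_divisors_le hsum r h𝓛 D ∅ hε] with Y hY
  refine le_trans (Nat.cast_le.mpr (Finset.card_le_card fun n hn ↦ ?_)) hY
  rw [Finset.mem_filter] at hn ⊢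
  refine ⟨hn.1, fun ⟨s, hs, _, hcard, hs'⟩ ↦ hn.2 ?_⟩
  have h1 := dvd_B_sub_coeff_eulerQuot (m := m) hp hodd.pos.ne' n
  exact_mod_cast (Int.dvd_iff_dvd_of_dvd_sub h1).mpr (hdvd n s hs hcard hs')
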